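/- Let Δ ∈ ℕ, let p be a polynomial, and let 0 < a₁ ≤ a₂ be constants. Let (G_n) be a sequence of finite connected vertex-transitive graphs of degree Δ with |V_n| even, |V_n| → ∞, and such that every ball of radius r in every G_n has at most p(r) vertices. Let ε_n ∈ (0,1) satisfy ε_n ≤ |V_n|^{−a_n} for some a_n ∈ [a₁, a₂]. Then, with η_n a uniformly random perfect matching of V_n: (i) there exists θ ∈ (0,1) such that P(t_mix^{G_n*}(θ) ≥ 2·t_mix^{G_n*}(1−θ)) → 1 as n → ∞ (so with high probability the random walks on (G_n*) do not exhibit cutoff); and (ii) if in addition ε_n·diam(G_n)² → ∞, then there exist constants 0 < c ≤ C with P(c/ε_n ≤ t_mix^{G_n*}(1/4) ≤ C/ε_n) → 1 as n → ∞. -/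

import Mathlib

open Filter

noncomputable section

/-- A perfect matching of a vertex set: a fixed-point-free involution. -/
def IsPerfectMatchingFn {V : Type*} (η : V → V) : Prop :=
  Function.Involutive η ∧ ∀ x, η x ≠ x

/-- Probability that a uniformly random perfect matching satisfies the event `E`. -/
noncomputable def matchingProb (V : Type*) (E : (V → V) → Prop) : ℝ :=
  (Nat.card {η : V → V // IsPerfectMatchingFn η ∧ E η} : ℝ) /
    (Nat.card {η : V → V // IsPerfectMatchingFn η} : ℝ)

/-- Transition matrix of the simple random walk on a finite graph. -/
noncomputable def srwMatrix {V : Type*} [Fintype V] (G : SimpleGraph V) [DecidableRel G.Adj] :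
    Matrix V V ℝ :=
  fun x y => if G.Adj x y then ((G.degree x : ℝ))⁻¹ else 0

/-- Stationary distribution of the simple random walk: `deg x / (2|E|)`. -/
noncomputable def srwPi {V : Type*} [Fintype V] [DecidableEq V] (G : SimpleGraph V)
    [DecidableRel G.Adj] : V → ℝ :=
  fun x => (G.degree x : ℝ) / (2 * G.edgeFinset.card)

/-- The lazy version `(I + P)/2` of a transition matrix `P`. -/
noncomputable def lazyMatrix {V : Type*} [Fintype V] [DecidableEq V] (P : Matrix V V ℝ) :
    Matrix V V ℝ :=
  (2 : ℝ)⁻¹ • (1 + P)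

/-- Transition matrix of the random walk on the weighted graph `G*` obtained from `G`
by adding the matching edges `{x, η x}` with weight `ε`. -/
noncomputable def starMatrix {V : Type*} [Fintype V] [DecidableEq V] (G : SimpleGraph V)
    [DecidableRel G.Adj] (η : V → V) (ε : ℝ) : Matrix V V ℝ :=
  fun x y => ((if G.Adj x y then (1 : ℝ) else 0) + ε * (if η x = y then 1 else 0)) /
    ((G.degree x : ℝ) + ε)

/-- Stationary distribution of the random walk on `G*`. -/
noncomputable def starPi {V : Type*} [Fintype V] [DecidableEq V] (G : SimpleGraph V)
    [DecidableRel G.Adj] (ε : ℝ) : V → ℝ :=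
  fun x => ((G.degree x : ℝ) + ε) / (2 * G.edgeFinset.card + ε * Fintype.card V)

/-- The chain with transition matrix `P` and stationary distribution `stat` is mixed within
total variation distance `θ` from every starting state at time `t`. -/
def mixedAt {V : Type*} [Fintype V] [DecidableEq V] (P : Matrix V V ℝ) (stat : V → ℝ)
    (θ : ℝ) (t : ℕ) : Prop :=
  ∀ x, (2 : ℝ)⁻¹ * ∑ y, |(P ^ t) x y - stat y| ≤ θ

/-- Total variation mixing time (`sInf` over `ℕ`, so `0` if the chain never mixes). -/
noncomputable def tmix {V : Type*} [Fintype V] [DecidableEq V] (P : Matrix V V ℝ)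
    (stat : V → ℝ) (θ : ℝ) : ℕ :=
  sInf {t | mixedAt P stat θ t}

/-- Entropy of a probability vector. -/
noncomputable def entropy {V : Type*} [Fintype V] (p : V → ℝ) : ℝ :=
  ∑ y, Real.negMulLog (p y)

/-- A family of Markov chains indexed by `n`, with mixing-time function `tm n θ`,
exhibits cutoff. -/
def hasCutoff (tm : ℕ → ℝ → ℕ) : Prop :=
  ∃ t s : ℕ → ℝ, (∀ n, 0 < t n) ∧ (∀ n, 0 ≤ s n) ∧
    Tendsto (fun n => s n / t n) atTop (nhds 0) ∧
    ∀ θ ∈ Set.Ioo (0 : ℝ) 1, ∃ c : ℝ,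
      ∀ n, t n - c * s n ≤ (tm n θ : ℝ) ∧ (tm n θ : ℝ) ≤ t n + c * s n

/-- Number of vertices within graph distance `s` of `o`. -/
noncomputable def ballCard {V : Type*} (G : SimpleGraph V) (o : V) (s : ℝ) : ℕ :=
  Nat.card {y : V | (G.dist o y : ℝ) ≤ s}

/-- A vertex-transitive graph. -/
def IsVertexTransitive {V : Type*} (G : SimpleGraph V) : Prop :=
  ∀ x y : V, ∃ φ : G ≃g G, φ x = y

namespace TransGrowth
set_option linter.unusedSectionVars false
open Finset Pointwise commutatorElement

section
open Subgroup QuotientGroup Module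
open scoped IsMulCommutative

/-! ### Groups all of whose subgroups are finitely generated -/

def SubgroupsFG (G : Type*) [Group G] : Prop := ∀ L : Subgroup G, L.FG

lemma fg_map {G G' : Type*} [Group G] [Group G'] (f : G →* G') {L : Subgroup G} (h : L.FG) :
    (L.map f).FG := by
  classical
  obtain ⟨A, hA⟩ := h
  exact ⟨A.image f, by rw [← hA, MonoidHom.map_closure, Finset.coe_image]⟩

lemma SubgroupsFG.of_surjective {G G' : Type*} [Group G] [Group G'] (h : SubgroupsFG G)
    (f : G →* G') (hf : Function.Surjective f) : SubgroupsFG G' := fun L => by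
  rw [← map_comap_eq_self_of_surjective hf L]
  exact fg_map f (h _)

lemma SubgroupsFG.of_ker_of_codomain {G G' : Type*} [Group G] [Group G'] (f : G →* G')
    (hk : ∀ L : Subgroup G, L ≤ f.ker → L.FG) (h' : SubgroupsFG G') : SubgroupsFG G := fun L => by
  classical
  obtain ⟨A, hA⟩ := hk (L ⊓ f.ker) inf_le_right
  obtain ⟨B, hB⟩ := h' (L.map f)
  have hBL : ∀ b ∈ B, ∃ a ∈ L, f a = b := fun b hb => by
    have : b ∈ L.map f := hB ▸ Subgroup.subset_closure hb
    simpa using this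
  choose! g hg hfg using hBL
  refine ⟨A ∪ B.image g, le_antisymm ?_ fun x hx => ?_⟩
  · rw [closure_le]
    intro x hx
    simp only [Finset.coe_union, Finset.coe_image, Set.mem_union, Set.mem_image,
      Finset.mem_coe] at hx
    rcases hx with hx | ⟨b, hb, rfl⟩
    · have : x ∈ L ⊓ f.ker := hA ▸ Subgroup.subset_closure hx
      exact this.1
    · exact hg b hb
  · have h1 : f x ∈ (Subgroup.closure (B.image g : Set G)).map f := by
      rw [MonoidHom.map_closure]
      have h2 : f x ∈ Subgroup.closure (B : Set G') := hB ▸ mem_map_of_mem f hx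
      refine Subgroup.closure_mono ?_ h2
      intro b hb
      exact ⟨g b, by simpa using ⟨b, hb, rfl⟩, hfg b hb⟩
    obtain ⟨y, hy, hyx⟩ := h1
    have hyL : y ∈ L := by
      refine (closure_le L).2 ?_ hy
      intro z hz
      obtain ⟨b, hb, rfl⟩ := by simpa using hz
      exact hg b hb
    have h3 : x * y⁻¹ ∈ Subgroup.closure (A : Set G) := by
      rw [hA]
      exact ⟨L.mul_mem hx (L.inv_mem hyL), by simp [hyx]⟩
    have h4 : x = x * y⁻¹ * y := by group
    rw [h4]
    refine Subgroup.mul_mem _ (Subgroup.closure_mono ?_ h3) (Subgroup.closure_mono ?_ hy) <;> simp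

lemma fg_of_map_subtype {G : Type*} [Group G] {N : Subgroup G} {L : Subgroup N}
    (h : (L.map N.subtype).FG) : L.FG := by
  rw [← Group.fg_iff_subgroup_fg] at h ⊢
  exact Group.fg_of_surjective
    (f := (L.equivMapOfInjective N.subtype N.subtype_injective).symm.toMonoidHom)
    (L.equivMapOfInjective N.subtype N.subtype_injective).symm.surjective

lemma SubgroupsFG.subgroup {G : Type*} [Group G] (h : SubgroupsFG G) (N : Subgroup G) :
    SubgroupsFG N := fun _ => fg_of_map_subtype (h _)

lemma SubgroupsFG.le_fg {G : Type*} [Group G] {N : Subgroup G} (h : SubgroupsFG N)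
    (L : Subgroup G) (hL : L ≤ N) : L.FG := by
  have := fg_map N.subtype (h (L.subgroupOf N))
  rwa [subgroupOf_map_subtype, inf_eq_left.2 hL] at this

lemma subgroupsFG_of_finite (G : Type*) [Group G] [Finite G] : SubgroupsFG G := fun L => by
  rw [← Group.fg_iff_subgroup_fg]; infer_instance

lemma subgroupsFG_of_isCyclic (G : Type*) [Group G] [IsCyclic G] : SubgroupsFG G := fun L => by
  obtain ⟨g, hg⟩ := (inferInstance : IsCyclic L).exists_generator
  rw [← Group.fg_iff_subgroup_fg]
  exact ⟨⟨{g}, by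
    rw [Finset.coe_singleton, ← zpowers_eq_closure]; exact (eq_top_iff' _).2 hg⟩⟩

lemma SubgroupsFG.of_finiteIndex {G : Type*} [Group G] (N : Subgroup G) [N.FiniteIndex]
    (h : SubgroupsFG N) : SubgroupsFG G := by
  refine SubgroupsFG.of_ker_of_codomain (mk' N.normalCore) (fun L hL => ?_)
    (subgroupsFG_of_finite _)
  rw [ker_mk'] at hL
  exact h.le_fg L (hL.trans N.normalCore_le)

/-! ### Nilpotency from commutators of generators -/

lemma mem_ucs_succ_of_generators {G : Type*} [Group G] {T : Set G}
    (hT : Subgroup.closure T = ⊤) {n : ℕ} {y : G}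
    (h : ∀ x ∈ T, ⁅y, x⁆ ∈ Subgroup.upperCentralSeries G n) :
    y ∈ Subgroup.upperCentralSeries G (n + 1) := by
  rw [Subgroup.mem_upperCentralSeries_succ_iff]
  have key : ∀ x, ⁅y, x⁆ ∈ Subgroup.upperCentralSeries G n ↔
      mk' (Subgroup.upperCentralSeries G n) x ∈
        centralizer {mk' (Subgroup.upperCentralSeries G n) y} := fun x => by
    rw [mem_centralizer_singleton_iff, eq_comm, ← commutatorElement_eq_one_iff_mul_comm,
      ← map_commutatorElement, mk'_apply, eq_one_iff]
  have : Subgroup.closure T ≤ (centralizer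
      {mk' (Subgroup.upperCentralSeries G n) y}).comap
        (mk' (Subgroup.upperCentralSeries G n)) := by
    rw [closure_le]
    exact fun x hx => (key x).1 (h x hx)
  intro x
  exact (key x).2 (this (hT ▸ Subgroup.mem_top x))

/-- Left-normed commutators of weight `n + 1` in the elements of `T`. -/
def leftComm {G : Type*} [Group G] (T : Set G) : ℕ → Set G
  | 0 => T
  | n + 1 => {z | ∃ y ∈ leftComm T n, ∃ x ∈ T, z = ⁅y, x⁆}

lemma leftComm_subset_ucs {G : Type*} [Group G] {T : Set G} (hT : Subgroup.closure T = ⊤)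
    {n : ℕ} (h : leftComm T n ⊆ {1}) (i j : ℕ) (hij : i + j = n) :
    leftComm T j ⊆ Subgroup.upperCentralSeries G i := by
  induction i generalizing j with
  | zero =>
    obtain rfl : j = n := by omega
    intro x hx
    rw [h hx]; exact Subgroup.one_mem _
  | succ i ih =>
    intro y hy
    exact mem_ucs_succ_of_generators hT fun x hx => ih (j + 1) (by omega) ⟨y, hy, x, hx, rfl⟩

lemma ucs_eq_top_of_leftComm {G : Type*} [Group G] {T : Set G} (hT : Subgroup.closure T = ⊤)
    {n : ℕ} (h : leftComm T n ⊆ {1}) : Subgroup.upperCentralSeries G n = ⊤ := by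
  rw [eq_top_iff, ← hT, closure_le]
  exact leftComm_subset_ucs hT h n 0 rfl

lemma leftComm_image {G G' : Type*} [Group G] [Group G'] (f : G →* G') (T : Set G) (n : ℕ) :
    leftComm (f '' T) n = f '' leftComm T n := by
  induction n with
  | zero => rfl
  | succ n ih =>
    ext z
    simp only [leftComm, ih, Set.mem_ofPred_eq, Set.mem_image]
    constructor
    · rintro ⟨_, ⟨y, hy, rfl⟩, _, ⟨x, hx, rfl⟩, rfl⟩
      exact ⟨_, ⟨y, hy, x, hx, rfl⟩, map_commutatorElement f y x⟩
    · rintro ⟨_, ⟨y, hy, x, hx, rfl⟩, rfl⟩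
      exact ⟨_, ⟨y, hy, rfl⟩, _, ⟨x, hx, rfl⟩, map_commutatorElement f y x⟩

lemma isNilpotent_of_ker_le_ucs {G G' : Type*} [Group G] [Group G'] (f : G →* G')
    (N : Subgroup G') (hN : Group.IsNilpotent N) (hf : f.range ≤ N) {m : ℕ}
    (hZ : f.ker ≤ Subgroup.upperCentralSeries G m) : Group.IsNilpotent G := by
  obtain ⟨n, hn⟩ := (isNilpotent_iff_lowerCentralSeries N).1 hN
  have h1 : (⊤ : Subgroup G).lowerCentralSeries n ≤ f.ker := by
    rw [← Subgroup.map_eq_bot_iff, map_lowerCentralSeries, ← le_bot_iff, ← hn]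
    refine lowerCentralSeries_mono n ?_
    rwa [← MonoidHom.range_eq_map]
  have h2 : ∀ i ≤ n, (⊤ : Subgroup G).lowerCentralSeries (n - i) ≤
      Subgroup.upperCentralSeries G (m + i) := by
    intro i hi
    induction i with
    | zero => exact h1.trans hZ
    | succ i ih =>
      intro y hy
      refine mem_ucs_succ_of_generators (T := Set.univ) Subgroup.closure_univ fun x _ => ?_
      refine ih (by omega) ?_
      have : n - i = n - (i + 1) + 1 := by omega
      rw [this]
      exact commutator_mem_commutator hy (Subgroup.mem_top x)
  refine ⟨m + n, eq_top_iff.2 ?_⟩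
  simpa using h2 n le_rfl

/-! ### Polynomial growth of groups -/

/-- Polynomial growth: the number of elements which are products of `r` elements of a finite set
is at most polynomial in `r`. -/
def PolyGrowth (G : Type*) [Group G] (d : ℕ) : Prop :=
  ∀ S : Set G, S.Finite → ∃ C : ℕ, ∀ r : ℕ, ∀ F : Finset G, (F : Set G) ⊆ S ^ r →
    F.card ≤ C * (r + 1) ^ d

lemma PolyGrowth.of_surjective {G G' : Type*} [Group G] [Group G'] {d : ℕ} (h : PolyGrowth G d)
    (f : G →* G') (hf : Function.Surjective f) : PolyGrowth G' d := fun S hS => by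
  classical
  choose g hg using hf
  obtain ⟨C, hC⟩ := h (g '' S) (hS.image g)
  refine ⟨C, fun r F hF => ?_⟩
  have h1 : S ^ r = f '' ((g '' S) ^ r) := by rw [Set.image_pow, Set.image_image]; simp [hg]
  rw [h1] at hF
  obtain ⟨F', hF', rfl⟩ := Finset.subset_set_image_iff.1 hF
  exact Finset.card_image_le.trans (hC r F' hF')

/-! ### Automorphisms of finitely generated abelian groups -/

lemma exists_pow_sub_one_pow_eq_zero_matrix {n : ℕ} (M : Matrix (Fin n) (Fin n) ℤ)
    (h : ∀ z ∈ (M.map (Int.castRingHom ℂ)).charpoly.roots, z ≠ 0 ∧ ‖z‖ ≤ 1) :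
    ∃ q, 0 < q ∧ ∃ m, (M ^ q - 1) ^ m = 0 := by
  set f := (M.map (Int.castRingHom ℂ)).charpoly with hf
  have hfM : f = M.charpoly.map (Int.castRingHom ℂ) := Matrix.charpoly_map _ _
  have hmonic : f.Monic := Matrix.charpoly_monic _
  have hmah : (M.charpoly.map (Int.castRingHom ℂ)).mahlerMeasure = 1 := by
    rw [← hfM, Polynomial.mahlerMeasure_eq_leadingCoeff_mul_prod_roots, hmonic.leadingCoeff]
    have : f.roots.map (fun a => max 1 ‖a‖) = f.roots.map (fun _ => (1 : ℝ)) :=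
      Multiset.map_congr rfl fun a ha => max_eq_left (h a ha).2
    rw [this]; simp
  have hroot : ∀ z ∈ f.roots, ∃ k, 0 < k ∧ z ^ k = 1 := fun z hz =>
    Polynomial.pow_eq_one_of_mahlerMeasure_eq_one hmah (h z hz).1 (by
      rw [Polynomial.aroots]; rw [hfM] at hz; exact hz)
  choose! k hk0 hk using hroot
  set q := ∏ z ∈ f.roots.toFinset, k z with hq
  have hq0 : 0 < q := prod_pos fun z hz => hk0 z (Multiset.mem_toFinset.1 hz)
  have hzq : ∀ z ∈ f.roots, z ^ q = 1 := fun z hz => by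
    obtain ⟨c, hc⟩ := dvd_prod_of_mem k (Multiset.mem_toFinset.2 hz)
    rw [hq, hc, pow_mul, hk z hz, one_pow]
  have hdvd : f ∣ (Polynomial.X ^ q - 1) ^ (Multiset.card f.roots) := by
    conv_lhs => rw [(IsAlgClosed.splits f).eq_prod_roots_of_monic hmonic]
    rw [← Multiset.prod_replicate, ← Multiset.map_const']
    refine Multiset.prod_dvd_prod_of_dvd _ _ fun z hz => ?_
    rw [Polynomial.dvd_iff_isRoot]
    simp [hzq z hz]
  refine ⟨q, hq0, Multiset.card f.roots, ?_⟩
  obtain ⟨g, hg⟩ := hdvd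
  have h2 := congrArg (Polynomial.aeval (M.map (Int.castRingHom ℂ))) hg
  rw [map_mul, hf, Matrix.aeval_self_charpoly, zero_mul] at h2
  simp only [map_pow, map_sub, Polynomial.aeval_X, map_one] at h2
  have hinj : Function.Injective ((Int.castRingHom ℂ).mapMatrix (m := Fin n)) :=
    Matrix.map_injective (RingHom.injective_int _)
  apply hinj
  rw [map_pow, map_sub, map_pow, map_one, map_zero]
  exact h2

lemma coeff_eq_zero_of_sum_pow_eq_zero {μ : ℂ} (hμ : 2 ≤ ‖μ‖) (c : ℕ → ℂ)
    (hc : ∀ i, c i = 0 ∨ ‖c i‖ = 1) (n : ℕ) (h : ∑ i ∈ range n, c i * μ ^ i = 0) :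
    ∀ i < n, c i = 0 := by
  have hb : ∀ n : ℕ, ‖∑ i ∈ range n, c i * μ ^ i‖ ≤ ‖μ‖ ^ n - 1 := fun n => by
    induction n with
    | zero => simp
    | succ n ih =>
      rw [sum_range_succ, pow_succ]
      refine (norm_add_le _ _).trans ?_
      have h1 : ‖c n * μ ^ n‖ ≤ ‖μ‖ ^ n := by
        rw [norm_mul, norm_pow]
        rcases hc n with h | h <;> rw [h] <;> simp
      nlinarith [pow_nonneg (norm_nonneg μ) n]
  induction n with
  | zero => simp
  | succ n ih =>
    rw [sum_range_succ] at h
    have hn : c n = 0 := by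
      refine (hc n).resolve_right fun h1 => ?_
      have h2 : c n * μ ^ n = -∑ i ∈ range n, c i * μ ^ i := by linear_combination h
      have h3 := congrArg norm h2
      rw [norm_mul, norm_pow, h1, norm_neg, one_mul] at h3
      linarith [hb n]
    rw [hn, zero_mul, add_zero] at h
    intro i hi
    rcases Nat.lt_succ_iff_lt_or_eq.1 hi with h' | rfl
    · exact ih h i h'
    · exact hn

lemma eq_of_sum_pow_eq {μ : ℂ} (hμ : 2 ≤ ‖μ‖) {n : ℕ} {I J : Finset ℕ} (hI : I ⊆ range n)
    (hJ : J ⊆ range n) (h : ∑ i ∈ I, μ ^ i = ∑ i ∈ J, μ ^ i) : I = J := by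
  classical
  have hs : ∀ I ⊆ range n, ∑ i ∈ I, μ ^ i =
      ∑ i ∈ range n, (if i ∈ I then 1 else 0) * μ ^ i := fun I hI => by
    simp only [ite_mul, one_mul, zero_mul, sum_ite_mem, inter_eq_right.2 hI]
  rw [hs I hI, hs J hJ, ← sub_eq_zero, ← sum_sub_distrib] at h
  simp only [← sub_mul] at h
  have h0 := coeff_eq_zero_of_sum_pow_eq_zero hμ _ (fun i => by
    by_cases h1 : i ∈ I <;> by_cases h2 : i ∈ J <;> simp [h1, h2]) n h
  ext i
  by_cases hi : i < n
  · have := h0 i hi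
    by_cases h1 : i ∈ I <;> by_cases h2 : i ∈ J <;> simp [h1, h2] at this ⊢
  · exact ⟨fun h => absurd (mem_range.1 (hI h)) hi,
      fun h => absurd (mem_range.1 (hJ h)) hi⟩

/-- An automorphism of a finitely generated abelian group with no exponentially many distinct
sums along orbits has a power which is unipotent. -/
lemma exists_pow_sub_one_pow_eq_zero {A : Type*} [AddCommGroup A] [Module.Finite ℤ A]
    (τ : (End ℤ A)ˣ)
    (h : ∀ (j : ℕ) (a : A), ∃ n, ∃ I ⊆ range n, ∃ J ⊆ range n, I ≠ J ∧
      ∑ i ∈ I, ((τ : End ℤ A) ^ j) ^ i • a = ∑ i ∈ J, ((τ : End ℤ A) ^ j) ^ i • a) :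
    ∃ q, 0 < q ∧ ∃ m, ((τ : End ℤ A) ^ q - 1) ^ m = 0 := by
  classical
  set T := Submodule.torsion ℤ A with hT
  have hmap : ∀ σ : End ℤ A, T ≤ T.comap σ := fun σ a ha => by
    obtain ⟨c, hc⟩ := ha
    exact ⟨c, by rw [Submonoid.smul_def, ← map_smul]; rw [Submonoid.smul_def] at hc; rw [hc, map_zero]⟩
  let b := finBasis ℤ (A ⧸ T)
  let Q : End ℤ A →+* End ℤ (A ⧸ T) :=
    { toFun := fun σ => T.mapQ T σ (hmap σ)
      map_one' := by ext; simp
      map_mul' := fun _ _ => by ext; simp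
      map_zero' := by ext; simp
      map_add' := fun _ _ => by ext; simp }
  have hQ : ∀ σ a, Q σ (T.mkQ a) = T.mkQ (σ a) := fun σ a => by simp [Q]
  set M := LinearMap.toMatrixAlgEquiv b (Q τ) with hM
  obtain ⟨q, hq, m, hm⟩ := exists_pow_sub_one_pow_eq_zero_matrix M (fun z hz => by
    rw [Polynomial.mem_roots (Matrix.charpoly_monic _).ne_zero, Polynomial.IsRoot.def,
      Matrix.eval_charpoly, ← Matrix.exists_vecMul_eq_zero_iff] at hz
    obtain ⟨w, hw0, hw⟩ := hz
    let φ : A →ₗ[ℤ] ℂ := (b.constr ℤ w).comp T.mkQ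
    have hφτ : ∀ a, φ ((τ : End ℤ A) a) = z * φ a := by
      have h1 : ∀ x, b.constr ℤ w (Q τ x) = z * b.constr ℤ w x := by
        have : (b.constr ℤ w).comp (Q τ) = (LinearMap.mulLeft ℤ z).comp (b.constr ℤ w) := by
          refine b.ext fun i => ?_
          have h2 := congrFun hw i
          rw [Matrix.vecMul_sub, Pi.sub_apply, Pi.zero_apply, sub_eq_zero, Matrix.scalar_apply,
            Matrix.vecMul_diagonal] at h2
          rw [LinearMap.comp_apply, LinearMap.comp_apply, LinearMap.mulLeft_apply,
            Basis.constr_basis, mul_comm z, h2, Basis.constr_apply_fintype]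
          simp only [Matrix.vecMul, dotProduct, Matrix.map_apply, hM,
            LinearMap.toMatrixAlgEquiv_apply, Basis.equivFun_apply]
          refine sum_congr rfl fun j _ => ?_
          rw [zsmul_eq_mul, mul_comm]; rfl
        exact fun x => LinearMap.congr_fun this x
      intro a
      have h2 := h1 (T.mkQ a)
      rwa [hQ] at h2
    obtain ⟨a, ha⟩ : ∃ a, φ a ≠ 0 := by
      by_contra! hcon
      apply hw0
      ext i
      obtain ⟨a, ha⟩ := T.mkQ_surjective (b i)
      have := hcon a
      simpa [φ, ha] using this
    have hz0 : z ≠ 0 := by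
      rintro rfl
      apply ha
      have := hφτ ((↑τ⁻¹ : End ℤ A) a)
      rwa [← End.mul_apply, Units.mul_inv, End.one_apply, zero_mul] at this
    refine ⟨hz0, ?_⟩
    by_contra! hlt
    obtain ⟨j, hj⟩ := pow_unbounded_of_one_lt 2 hlt
    obtain ⟨n, I, hI, J, hJ, hne, hsum⟩ := h j a
    apply hne
    have hpow : ∀ i : ℕ, φ (((τ : End ℤ A) ^ j) ^ i • a) = (z ^ j) ^ i * φ a := by
      have h1 : ∀ k : ℕ, φ (((τ : End ℤ A) ^ k) a) = z ^ k * φ a := fun k => by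
        induction k with
        | zero => simp
        | succ k ih => rw [pow_succ', End.mul_apply, hφτ, ih, pow_succ']; ring
      intro i
      rw [← pow_mul, ← pow_mul, End.smul_def, h1]
    refine eq_of_sum_pow_eq (μ := z ^ j) (by rw [norm_pow]; exact hj.le) hI hJ ?_
    have h2 := congrArg φ hsum
    simp only [map_sum, hpow, ← sum_mul] at h2
    exact mul_right_cancel₀ ha h2)
  have hmT : ∀ a, (((τ : End ℤ A) ^ q - 1) ^ m) a ∈ T := fun a => by
    have h1 : Q (((τ : End ℤ A) ^ q - 1) ^ m) = 0 := by
      apply (LinearMap.toMatrixAlgEquiv b).injective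
      rw [map_pow, map_sub, map_pow, map_one, map_zero, map_pow, map_sub, map_pow, map_one]
      exact hm
    have h2 := hQ (((τ : End ℤ A) ^ q - 1) ^ m) a
    rw [h1, LinearMap.zero_apply] at h2
    rwa [eq_comm, Submodule.mkQ_apply, Submodule.Quotient.mk_eq_zero] at h2
  have hfin : Finite T := finite_of_fg_torsion T (Submodule.torsion_isTorsion)
  have hper : ∃ p, 0 < p ∧ ∀ x ∈ T, ((τ : End ℤ A) ^ p) x = x := by
    obtain ⟨k, l, hkl, heq⟩ := Finite.exists_ne_map_eq_of_infinite
      (fun k : ℕ => fun x : T => (⟨((τ : End ℤ A) ^ k) x, hmap _ x.2⟩ : T))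
    wlog hlt : k < l generalizing k l
    · exact this l k hkl.symm heq.symm (by omega)
    refine ⟨l - k, by omega, fun x hx => ?_⟩
    have h1 := congrArg Subtype.val (congrFun heq ⟨x, hx⟩)
    have h2 : (((τ ^ k)⁻¹ : (End ℤ A)ˣ) : End ℤ A) (((τ : End ℤ A) ^ k) x) =
        x := by
      rw [← Units.val_pow_eq_pow_val, ← End.mul_apply, Units.inv_mul, End.one_apply]
    have h3 : ((τ : End ℤ A) ^ l) = ((τ : End ℤ A) ^ k) * (τ : End ℤ A) ^ (l - k) := by
      rw [← pow_add]; congr 1; omega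
    simp only [h3] at h1
    have h4 := congrArg (((τ ^ k)⁻¹ : (End ℤ A)ˣ) : End ℤ A) h1
    rw [h2, ← End.mul_apply, ← mul_assoc, ← Units.val_pow_eq_pow_val, Units.inv_mul,
      one_mul] at h4
    exact h4.symm
  obtain ⟨p, hp, hpT⟩ := hper
  refine ⟨q * p, Nat.mul_pos hq hp, m + 1, LinearMap.ext fun a => ?_⟩
  set x := (τ : End ℤ A) ^ q with hx
  have h1 : x ^ p - 1 = (∑ i ∈ range p, x ^ i) * (x - 1) := (geom_sum_mul x p).symm
  have h2 : Commute (∑ i ∈ range p, x ^ i) (x - 1) := by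
    rw [Commute, SemiconjBy, geom_sum_mul, mul_geom_sum]
  have hT0 : ∀ y ∈ T, (x ^ p - 1) y = 0 := fun y hy => by
    have h3 : ∀ k : ℕ, (((τ : End ℤ A) ^ p) ^ k) y = y := fun k => by
      induction k with
      | zero => rfl
      | succ k ih => rw [pow_succ, End.mul_apply, hpT y hy, ih]
    rw [LinearMap.sub_apply, hx, ← pow_mul, mul_comm, pow_mul, h3, End.one_apply, sub_self]
  rw [pow_mul, pow_succ', h1, h2.mul_pow, ← h1, End.mul_apply, End.mul_apply]
  exact hT0 _ (hmap _ (hmT a))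

lemma exists_mul_pow_lt_pow (C k d : ℕ) {A : ℝ} (hA : 1 < A) :
    ∃ n : ℕ, (C : ℝ) * (k * n + 1) ^ d < A ^ n := by
  have h := tendsto_pow_const_div_const_pow_of_one_lt d hA
  have h2 : Tendsto (fun n : ℕ => (C : ℝ) * (k + 1) ^ d * ((n : ℝ) ^ d / A ^ n)) atTop (nhds 0) := by
    simpa using h.const_mul ((C : ℝ) * (k + 1) ^ d)
  obtain ⟨n, hn, hn1⟩ := ((h2.eventually_lt_const (zero_lt_one)).and (eventually_ge_atTop 1)).exists
  refine ⟨n, ?_⟩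
  have hA' : 0 < A ^ n := by positivity
  rw [← mul_div_assoc, div_lt_one hA', mul_assoc, ← mul_pow] at hn
  refine lt_of_le_of_lt ?_ hn
  have : (1 : ℝ) ≤ n := by exact_mod_cast hn1
  gcongr
  nlinarith

/-! ### Conjugation on a commutative normal subgroup -/

/-- The action by conjugation on a commutative normal subgroup, written additively. -/
def conjEnd {G : Type*} [Group G] (Z : Subgroup G) [Z.Normal] [IsMulCommutative Z] :
    G →* Module.End ℤ (Additive Z) where
  toFun g := (MonoidHom.toAdditive (MulAut.conjNormal g : Z ≃* Z).toMonoidHom).toIntLinearMap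
  map_one' := by ext; simp
  map_mul' _ _ := by ext; simp

lemma coe_conjEnd {G : Type*} [Group G] (Z : Subgroup G) [Z.Normal] [IsMulCommutative Z]
    (g : G) (a : Additive Z) : ((conjEnd Z g a).toMul : G) = g * (a.toMul : G) * g⁻¹ := by
  simp [conjEnd]

lemma PolyGrowth.exists_sum_conj_eq {G : Type*} [Group G] {d : ℕ} (hG : PolyGrowth G d)
    (Z : Subgroup G) [Z.Normal] [IsMulCommutative Z] (s : G) (a : Additive Z) :
    ∃ n, ∃ I ⊆ range n, ∃ J ⊆ range n, I ≠ J ∧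
      ∑ i ∈ I, conjEnd Z s ^ i • a = ∑ i ∈ J, conjEnd Z s ^ i • a := by
  classical
  obtain ⟨C, hC⟩ := hG {1, (a.toMul : G), s} (by simp)
  obtain ⟨n, hn⟩ := exists_mul_pow_lt_pow C 2 d one_lt_two
  have h1' : (1 : G) ∈ ({1, (a.toMul : G), s} : Set G) := by simp
  have ha' : (a.toMul : G) ∈ ({1, (a.toMul : G), s} : Set G) := by simp
  have hs' : s ∈ ({1, (a.toMul : G), s} : Set G) := by simp
  let u : Finset ℕ → G := fun I => ((∑ i ∈ I, conjEnd Z s ^ i • a).toMul : G) * s ^ n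
  have hu : ∀ n : ℕ, ∀ I ⊆ range n, ((∑ i ∈ I, conjEnd Z s ^ i • a).toMul : G) * s ^ n ∈
        ({1, (a.toMul : G), s} : Set G) ^ (2 * n) := by
    intro n
    induction n with
    | zero => intro I hI; simp at hI; simp [hI]
    | succ n ih =>
      intro I hI
      have h1 : I.erase n ⊆ range n := fun i hi => by
        have := mem_range.1 (hI (mem_of_mem_erase hi))
        have := ne_of_mem_erase hi
        rw [mem_range]; omega
      have h2 := ih _ h1
      rw [show 2 * (n + 1) = 2 * n + 1 + 1 by ring, pow_succ _ (2 * n + 1), pow_succ _ (2 * n)]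
      by_cases hn : n ∈ I
      · have h := Set.mul_mem_mul (Set.mul_mem_mul h2 ha') hs'
        convert h using 1
        rw [← add_sum_erase I _ hn, add_comm, toMul_add, Subgroup.coe_mul,
          ← map_pow, Module.End.smul_def, coe_conjEnd, pow_succ]
        group
      · have h := Set.mul_mem_mul (Set.mul_mem_mul h2 h1') hs'
        convert h using 1
        rw [erase_eq_of_notMem hn, pow_succ]
        group
  by_contra! hcon
  have hinj : Set.InjOn u (range n).powerset := by
    intro I hI J hJ hIJ
    by_contra hne
    refine hcon n I (mem_powerset.1 hI) J (mem_powerset.1 hJ) hne ?_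
    have h3 := mul_right_cancel hIJ
    exact Additive.toMul.injective (Subtype.ext h3)
  have := hC (2 * n) ((range n).powerset.image u) (by
    intro g hg
    obtain ⟨I, hI, rfl⟩ := by simpa using hg
    exact hu n I (by intro i hi; simpa using hI hi))
  rw [card_image_of_injOn hinj, card_powerset, card_range] at this
  have h4 : (2 : ℝ) ^ n ≤ C * (2 * n + 1) ^ d := by exact_mod_cast this
  push_cast at hn
  linarith

lemma PolyGrowth.exists_unipotent_conj {G : Type*} [Group G] {d : ℕ} (hG : PolyGrowth G d)
    (Z : Subgroup G) [Z.Normal] [IsMulCommutative Z] (hZ : Z.FG) (t : G) :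
    ∃ q, 0 < q ∧ ∃ m, (conjEnd Z (t ^ q) - 1) ^ m = 0 := by
  have : Group.FG Z := (Group.fg_iff_subgroup_fg Z).2 hZ
  have : Module.Finite ℤ (Additive Z) := Module.Finite.iff_addGroup_fg.2 inferInstance
  have := exists_pow_sub_one_pow_eq_zero (Units.map (conjEnd Z) (toUnits t)) (fun j a => by
    have := hG.exists_sum_conj_eq Z (t ^ j) a
    simpa using this)
  simpa using this

/-! ### Nilpotent-by-cyclic groups of polynomial growth -/

lemma PolyGrowth.exists_nilpotent_sup_zpowers (c : ℕ) : ∀ {G : Type*} [Group G] {d : ℕ}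
    (_ : PolyGrowth G d) (L : Subgroup G) [L.Normal] (_ : SubgroupsFG L)
    (_ : L.lowerCentralSeries c = ⊥) (t : G),
    ∃ q, 0 < q ∧ Group.IsNilpotent (L ⊔ zpowers (t ^ q) : Subgroup G) := by
  induction c with
  | zero =>
    intro G _ d _ L _ _ hc t
    rw [Subgroup.lowerCentralSeries_zero] at hc
    refine ⟨1, one_pos, ?_⟩
    rw [hc, bot_sup_eq]
    infer_instance
  | succ c ih =>
    intro G _ d hG L _ hL hc t
    set Z := L.lowerCentralSeries c with hZ
    have hZL : Z ≤ L := lowerCentralSeries_le_self L c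
    have : Z.Normal := by rw [hZ]; infer_instance
    have hcent : ∀ z ∈ Z, ∀ x ∈ L, ⁅z, x⁆ = 1 := fun z hz x hx => by
      have : ⁅z, x⁆ ∈ L.lowerCentralSeries (c + 1) := commutator_mem_commutator hz hx
      rwa [hc, Subgroup.mem_bot] at this
    have : IsMulCommutative Z := ⟨⟨fun a b => Subtype.ext
      (commutatorElement_eq_one_iff_mul_comm.1 (hcent a a.2 b (hZL b.2)))⟩⟩
    obtain ⟨q₁, hq₁, hn⟩ := ih (hG.of_surjective _ (mk'_surjective Z))
      (L.map (mk' Z))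
      (hL.of_surjective _ ((mk' Z).subgroupMap_surjective L)) (by
        rw [← map_lowerCentralSeries, Subgroup.map_eq_bot_iff, ker_mk'])
      (mk' Z t)
    obtain ⟨q₂, hq₂, m, hm⟩ := hG.exists_unipotent_conj Z (hL.le_fg Z hZL) (t ^ q₁)
    refine ⟨q₁ * q₂, Nat.mul_pos hq₁ hq₂, ?_⟩
    set s := t ^ (q₁ * q₂) with hs
    rw [← pow_mul, ← hs] at hm
    set K := L ⊔ zpowers s with hK
    refine isNilpotent_of_ker_le_ucs ((mk' Z).comp K.subtype) _ hn ?_ (m := m) ?_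
    · rw [MonoidHom.range_comp, range_subtype, hK, Subgroup.map_sup, MonoidHom.map_zpowers]
      refine sup_le_sup le_rfl ?_
      rw [zpowers_le, hs, pow_mul, map_pow, map_pow]
      exact Subgroup.pow_mem _ (mem_zpowers _) _
    have hgen : Subgroup.closure {x : K | (x : G) ∈ L ∨ (x : G) = s} = ⊤ := by
      refine Subgroup.map_injective K.subtype_injective ?_
      rw [← MonoidHom.range_eq_map, range_subtype]
      refine le_antisymm (map_subtype_le _) (sup_le (fun x hx => ?_) ?_)
      · exact ⟨⟨x, mem_sup_left hx⟩, Subgroup.subset_closure (Or.inl hx), rfl⟩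
      · rw [zpowers_le]
        exact ⟨⟨s, mem_sup_right (mem_zpowers s)⟩,
          Subgroup.subset_closure (Or.inr rfl), rfl⟩
    have key : ∀ j, ∀ a : Additive Z, ((conjEnd Z s - 1) ^ j) a = 0 → ∀ k : K,
        (k : G) = a.toMul → k ∈ Subgroup.upperCentralSeries K j := by
      intro j
      induction j with
      | zero =>
        intro a ha k hk
        simp only [pow_zero, Module.End.one_apply] at ha
        have : k = 1 := Subtype.ext (by rw [hk, ha]; rfl)
        rw [this]; exact Subgroup.one_mem _
      | succ j ihj =>
        intro a ha k hk
        refine mem_ucs_succ_of_generators hgen fun x hx => ?_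
        rcases hx with hx | hx
        · have : ⁅k, x⁆ = 1 := Subtype.ext (by
            simpa [hk, commutatorElement_def] using hcent _ a.toMul.2 _ hx)
          rw [this]; exact Subgroup.one_mem _
        · refine ihj (-((conjEnd Z s - 1) a)) ?_ _ ?_
          · rw [map_neg, ← Module.End.mul_apply, ← pow_succ, ha, neg_zero]
          · have h5 : ((conjEnd Z s a).toMul : G) = s * (a.toMul : G) * s⁻¹ := coe_conjEnd Z s a
            have h6 : ((-((conjEnd Z s - 1) a)).toMul : G) =
                (((conjEnd Z s a).toMul : G) * (a.toMul : G)⁻¹)⁻¹ := by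
              simp [div_eq_mul_inv]
            rw [h6, h5]
            simp [commutatorElement_def, hk, hx, mul_assoc]
    intro k hk
    have hkZ : (k : G) ∈ Z := by simpa using hk
    exact key m (Additive.ofMul ⟨k, hkZ⟩) (by rw [hm]; rfl) k rfl

lemma finite_monoidHom_of_fg {G F : Type*} [Group G] [Group.FG G] [Group F] [Finite F] :
    Finite (G →* F) := by
  obtain ⟨S, hS⟩ := Group.FG.out (G := G)
  refine Finite.of_injective (fun (φ : G →* F) (x : S) => φ x) fun φ ψ h => ?_
  refine MonoidHom.eq_of_eqOn_dense hS fun x hx => ?_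
  exact congrFun h ⟨x, hx⟩

lemma exists_characteristic_le {L : Type*} [Group L] [Group.FG L] (N : Subgroup L)
    [N.FiniteIndex] : ∃ M ≤ N, M.Characteristic ∧ M.FiniteIndex := by
  have : Finite (L →* Equiv.Perm (L ⧸ N)) := finite_monoidHom_of_fg
  refine ⟨⨅ φ : L →* Equiv.Perm (L ⧸ N), φ.ker, ?_, ?_, ?_⟩
  · refine (iInf_le _ (MulAction.toPermHom L (L ⧸ N))).trans ?_
    rw [← normalCore_eq_ker]
    exact N.normalCore_le
  · rw [characteristic_iff_le_comap]
    intro α x hx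
    simp only [Subgroup.mem_comap, Subgroup.mem_iInf, MonoidHom.mem_ker] at hx ⊢
    exact fun φ => hx (φ.comp α.toMonoidHom)
  · exact finiteIndex_iInf fun φ => inferInstance

lemma PolyGrowth.isVirtuallyNilpotent_of_sup_zpowers {G : Type*} [Group G] {d : ℕ}
    (hG : PolyGrowth G d) (L : Subgroup G) [L.Normal] (hL : SubgroupsFG L)
    (hv : Group.IsVirtuallyNilpotent L) (t : G) (ht : L ⊔ zpowers t = ⊤) :
    Group.IsVirtuallyNilpotent G := by
  obtain ⟨N, hN, hNi⟩ := hv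
  have : Group.FG L := Group.fg_def.2 (hL ⊤)
  obtain ⟨M, hMN, hM, hMi⟩ := exists_characteristic_le N
  set M' := M.map L.subtype with hM'
  have hM'n : M'.Normal := by rw [hM']; infer_instance
  obtain ⟨c, hc⟩ := (isNilpotent_iff_lowerCentralSeries N).1 hN
  replace hc : M'.lowerCentralSeries c = ⊥ := by
    have h1 : M.lowerCentralSeries c ≤ N.lowerCentralSeries c :=
      lowerCentralSeries_mono c hMN
    rw [hc] at h1
    rw [hM', ← map_lowerCentralSeries, Subgroup.map_eq_bot_iff]
    exact h1.trans bot_le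
  obtain ⟨q, hq, hK⟩ := hG.exists_nilpotent_sup_zpowers c M'
    ((hL.subgroup M).of_surjective _ (L.subtype.subgroupMap_surjective M)) hc t
  refine ⟨_, hK, ?_⟩
  set K := M' ⊔ zpowers (t ^ q) with hKdef
  have : NeZero q := ⟨hq.ne'⟩
  refine finiteIndex_iff_finite_quotient.2 ?_
  refine Finite.of_surjective (α := (L ⧸ M) × Fin q)
    (fun p => ((((p.1.out : L) : G) * t ^ (p.2 : ℕ) : G) : G ⧸ K)) fun g => ?_
  obtain ⟨g, rfl⟩ := mk_surjective g
  obtain ⟨l, hl, s, ⟨m, rfl⟩, rfl⟩ := mem_sup_of_normal_left.1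
    (show g ∈ L ⊔ zpowers t by rw [ht]; trivial)
  have hm0 : 0 ≤ m % q := Int.emod_nonneg _ (by exact_mod_cast hq.ne')
  have hm1 : m % q < q := Int.emod_lt_of_pos _ (by exact_mod_cast hq)
  refine ⟨(QuotientGroup.mk (⟨l, hl⟩ : L), ⟨(m % q).toNat, by omega⟩), ?_⟩
  obtain ⟨h, hh⟩ := mk_out_eq_mul M (⟨l, hl⟩ : L)
  rw [QuotientGroup.eq]
  simp only [hh]
  have e1 : t ^ ((m % q).toNat) = t ^ (m % q) := by rw [← zpow_natCast, Int.toNat_of_nonneg hm0]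
  have e2 : t ^ m = t ^ (m % q) * (t ^ q) ^ (m / q) := by
    rw [← zpow_natCast t q, ← zpow_mul, ← zpow_add, Int.emod_add_mul_ediv]
  have h3 : (t ^ (m % q))⁻¹ * (((h : L) : G))⁻¹ * ((t ^ (m % q))⁻¹)⁻¹ ∈ M' :=
    hM'n.conj_mem _ (M'.inv_mem ⟨h, h.2, rfl⟩) _
  have h4 := K.mul_mem (mem_sup_left h3)
    (mem_sup_right (Subgroup.zpow_mem _ (mem_zpowers (t ^ q)) (m / q)))
  convert h4 using 1
  simp only [e1]
  rw [e2]
  push_cast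
  group

end

section
open Real

/-! ### Random walk on a regular graph with loops -/

/-- A regular locally finite graph with a loop at every vertex. -/
structure WalkGraph (X : Type*) where
  /-- neighbours of a vertex, the vertex itself included -/
  nb : X → Finset X
  /-- the common number of neighbours -/
  deg : ℕ
  symm : ∀ {x y}, y ∈ nb x → x ∈ nb y
  refl : ∀ x, x ∈ nb x
  card_nb : ∀ x, (nb x).card = deg

namespace WalkGraph

variable {X : Type*} (Γ : WalkGraph X)

open scoped Classical in
def ball (x : X) : ℕ → Finset X
  | 0 => {x}
  | r + 1 => (ball x r).biUnion Γ.nb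

lemma mem_ball_succ {x y : X} {r : ℕ} : y ∈ Γ.ball x (r + 1) ↔ ∃ z ∈ Γ.ball x r, y ∈ Γ.nb z := by
  simp [ball]

lemma ball_subset_succ (x : X) (r : ℕ) : Γ.ball x r ⊆ Γ.ball x (r + 1) := fun y hy =>
  Γ.mem_ball_succ.2 ⟨y, hy, Γ.refl y⟩

lemma mem_ball_self (x : X) (r : ℕ) : x ∈ Γ.ball x r := by
  induction r with
  | zero => simp [ball]
  | succ r ih => exact Γ.ball_subset_succ x r ih

lemma deg_pos [Nonempty X] : 0 < Γ.deg := by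
  rw [← Γ.card_nb (Classical.arbitrary X)]
  exact card_pos.2 ⟨_, Γ.refl _⟩

def BallLE (o : X) (C d : ℕ) : Prop := ∀ r, (Γ.ball o r).card ≤ C * (r + 1) ^ d

lemma cast_deg_pos [Nonempty X] : (0 : ℝ) < Γ.deg := Nat.cast_pos.2 Γ.deg_pos

def Connected : Prop := ∀ x y, ∃ r, y ∈ Γ.ball x r

lemma succ_le_card_ball [Infinite X] (hc : Γ.Connected) (x : X) (r : ℕ) :
    r + 1 ≤ (Γ.ball x r).card := by
  induction r with
  | zero => simp [ball]
  | succ r ih =>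
    refine lt_of_le_of_lt ih (card_lt_card ⟨Γ.ball_subset_succ x r, fun h => ?_⟩)
    have h2 : ∀ k, Γ.ball x k ⊆ Γ.ball x r := by
      intro k
      induction k with
      | zero => intro y hy; simp [ball] at hy; rw [hy]; exact Γ.mem_ball_self x r
      | succ k ihk =>
        intro y hy
        obtain ⟨z, hz, hy⟩ := Γ.mem_ball_succ.1 hy
        exact h (Γ.mem_ball_succ.2 ⟨z, ihk hz, hy⟩)
    exact (Γ.ball x r).finite_toSet.not_infinite (by
      convert Set.infinite_univ (α := X)
      ext y
      obtain ⟨k, hk⟩ := hc x y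
      simpa using h2 k hk)

section avg
variable {E : Type*} [AddCommGroup E] [Module ℝ E]

def avg : (X → E) →ₗ[ℝ] (X → E) where
  toFun f x := (Γ.deg : ℝ)⁻¹ • ∑ y ∈ Γ.nb x, f y
  map_add' f g := by ext x; simp [sum_add_distrib]
  map_smul' c f := by
    ext x
    simp only [Pi.smul_apply, ← smul_sum, RingHom.id_apply]
    rw [smul_comm]

lemma avg_apply (f : X → E) (x : X) : Γ.avg f x = (Γ.deg : ℝ)⁻¹ • ∑ y ∈ Γ.nb x, f y := rfl

def step : (X →₀ ℝ) →ₗ[ℝ] (X →₀ ℝ) :=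
  Finsupp.linearCombination ℝ fun x => (Γ.deg : ℝ)⁻¹ • ∑ y ∈ Γ.nb x, Finsupp.single y 1

/-- Integration of a function against a finitely supported measure. -/
abbrev integ (g : X → E) : (X →₀ ℝ) →ₗ[ℝ] E := Finsupp.linearCombination ℝ g

lemma step_single (x : X) :
    Γ.step (Finsupp.single x 1) = (Γ.deg : ℝ)⁻¹ • ∑ y ∈ Γ.nb x, Finsupp.single y 1 := by
  simp [step]

lemma integ_step (g : X → E) (f : X →₀ ℝ) : integ g (Γ.step f) = integ (Γ.avg g) f := by
  suffices (integ g).comp Γ.step = integ (Γ.avg g) from LinearMap.congr_fun this f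
  ext x
  simp [step_single, avg_apply]

lemma step_apply (f : X →₀ ℝ) (z : X) : Γ.step f z = Γ.avg f z := by
  classical
  suffices (Finsupp.lapply z).comp Γ.step =
      ((LinearMap.proj z).comp Γ.avg).comp (Finsupp.lcoeFun : (X →₀ ℝ) →ₗ[ℝ] X → ℝ) from
    LinearMap.congr_fun this f
  ext x
  simp only [LinearMap.comp_apply, Finsupp.lsingle_apply, step_single, Finsupp.lapply_apply,
    Finsupp.smul_apply, Finsupp.finsetSum_apply, Finsupp.lcoeFun_apply, LinearMap.proj_apply,
    avg_apply, Finsupp.single_apply, sum_ite_eq, sum_ite_eq']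
  have : z ∈ Γ.nb x ↔ x ∈ Γ.nb z := ⟨Γ.symm, Γ.symm⟩
  simp [this]

lemma integ_step_pow (t : ℕ) (g : X → E) (f : X →₀ ℝ) :
    integ g ((Γ.step ^ t) f) = integ ((Γ.avg ^ t) g) f := by
  induction t generalizing f with
  | zero => simp
  | succ t ih => rw [pow_succ, Module.End.mul_apply, ih, integ_step, ← Module.End.mul_apply,
      ← pow_succ']

lemma avg_const [Nonempty X] (c : E) : Γ.avg (fun _ => c) = fun _ => c := by
  ext x
  have := Γ.cast_deg_pos.ne'
  rw [avg_apply, sum_const, Γ.card_nb, ← Nat.cast_smul_eq_nsmul ℝ, smul_smul,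
    inv_mul_cancel₀ this, one_smul]

end avg

def kernel (t : ℕ) (x : X) : X →₀ ℝ := (Γ.step ^ t) (Finsupp.single x 1)

lemma kernel_zero (x : X) : Γ.kernel 0 x = Finsupp.single x 1 := rfl

lemma kernel_succ (t : ℕ) (x : X) : Γ.kernel (t + 1) x = Γ.step (Γ.kernel t x) := by
  rw [kernel, pow_succ', Module.End.mul_apply, kernel]

lemma kernel_succ' (t : ℕ) (x : X) :
    Γ.kernel (t + 1) x = (Γ.deg : ℝ)⁻¹ • ∑ y ∈ Γ.nb x, Γ.kernel t y := by
  rw [kernel, pow_succ, Module.End.mul_apply, step_single, map_smul, map_sum]; rfl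

lemma integ_kernel {E : Type*} [AddCommGroup E] [Module ℝ E] (t : ℕ) (x : X) (g : X → E) :
    integ g (Γ.kernel t x) = (Γ.avg ^ t) g x := by
  rw [kernel, integ_step_pow]; simp

lemma avg_nonneg {f : X → ℝ} (hf : ∀ x, 0 ≤ f x) (x : X) : 0 ≤ Γ.avg f x := by
  rw [avg_apply]; exact smul_nonneg (by positivity) (sum_nonneg fun y _ => hf y)

lemma kernel_nonneg (t : ℕ) (x y : X) : 0 ≤ Γ.kernel t x y := by
  classical
  induction t generalizing y with
  | zero => rw [kernel_zero, Finsupp.single_apply]; split_ifs <;> norm_num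
  | succ t ih => rw [kernel_succ, step_apply]; exact Γ.avg_nonneg ih y

lemma support_kernel_subset (t : ℕ) (x : X) : (Γ.kernel t x).support ⊆ Γ.ball x t := by
  classical
  induction t with
  | zero => rw [kernel_zero]; exact Finsupp.support_single_subset
  | succ t ih =>
    intro y hy
    rw [Finsupp.mem_support_iff, kernel_succ, step_apply, avg_apply] at hy
    obtain ⟨z, hz, hz0⟩ := exists_ne_zero_of_sum_ne_zero (right_ne_zero_of_smul hy)
    exact Γ.mem_ball_succ.2 ⟨z, ih (Finsupp.mem_support_iff.2 hz0), Γ.symm hz⟩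

abbrev mass : (X →₀ ℝ) →ₗ[ℝ] ℝ := integ fun _ => (1 : ℝ)

lemma mass_apply (f : X →₀ ℝ) : mass f = ∑ x ∈ f.support, f x := by
  simp [mass, integ, Finsupp.linearCombination_apply, Finsupp.sum]

lemma mass_nonneg {f : X →₀ ℝ} (hf : ∀ x, 0 ≤ f x) : 0 ≤ mass f := by
  rw [mass_apply]; exact sum_nonneg fun x _ => hf x

lemma mass_eq_sum {f : X →₀ ℝ} {s : Finset X} (h : f.support ⊆ s) : mass f = ∑ x ∈ s, f x := by
  rw [mass_apply]
  exact sum_subset h fun x _ hx => by simpa using hx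

lemma mass_step [Nonempty X] (f : X →₀ ℝ) : mass (Γ.step f) = mass f := by
  rw [mass, integ_step, avg_const]

lemma mass_kernel (t : ℕ) (x : X) : mass (Γ.kernel t x) = 1 := by
  have : Nonempty X := ⟨x⟩
  induction t with
  | zero => simp [kernel_zero, mass]
  | succ t ih => rw [kernel_succ, mass_step, ih]

def ip (f g : X →₀ ℝ) : ℝ := mass (f * g)

lemma ip_comm (f g : X →₀ ℝ) : ip f g = ip g f := by rw [ip, ip, mul_comm]
lemma ip_add_left (f g h : X →₀ ℝ) : ip (f + g) h = ip f h + ip g h := by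
  rw [ip, add_mul, map_add]; rfl
lemma ip_smul_left (c : ℝ) (f h : X →₀ ℝ) : ip (c • f) h = c * ip f h := by
  have : c • f * h = c • (f * h) := by ext; simp [mul_assoc]
  rw [ip, ip, this, map_smul, smul_eq_mul]
lemma ip_sub_left (f g h : X →₀ ℝ) : ip (f - g) h = ip f h - ip g h := by
  rw [ip, sub_mul, map_sub]; rfl
lemma ip_add_right (f g h : X →₀ ℝ) : ip h (f + g) = ip h f + ip h g := by
  rw [ip, mul_add, map_add]; rfl
lemma ip_sub_right (f g h : X →₀ ℝ) : ip h (f - g) = ip h f - ip h g := by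
  rw [ip, mul_sub, map_sub]; rfl
lemma ip_smul_right (c : ℝ) (f h : X →₀ ℝ) : ip h (c • f) = c * ip h f := by
  rw [ip_comm, ip_smul_left, ip_comm]
lemma ip_sum_left {ι : Type*} (s : Finset ι) (f : ι → X →₀ ℝ) (h : X →₀ ℝ) :
    ip (∑ i ∈ s, f i) h = ∑ i ∈ s, ip (f i) h := by
  rw [ip, sum_mul, map_sum]; rfl

lemma ip_eq_integ (f g : X →₀ ℝ) : ip f g = integ g f := by
  rw [ip, mass_eq_sum (s := f.support) (fun x hx => by simp at hx ⊢; exact hx.1)]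
  simp [integ, Finsupp.linearCombination_apply, Finsupp.sum]

lemma ip_self_nonneg (f : X →₀ ℝ) : 0 ≤ ip f f :=
  mass_nonneg fun x => by simpa using mul_self_nonneg _

lemma ip_step (f g : X →₀ ℝ) : ip (Γ.step f) g = ip f (Γ.step g) := by
  rw [ip_eq_integ, integ_step, ip_eq_integ]; congr 1
  ext x; simp [step_apply]

lemma two_mul_ip_le (f g : X →₀ ℝ) (r : ℝ) : 2 * r * ip f g ≤ ip f f + r ^ 2 * ip g g := by
  have := ip_self_nonneg (f - r • g)
  simp only [ip_sub_left, ip_sub_right, ip_smul_left, ip_smul_right, ip_comm g f] at this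
  linarith

lemma ip_sq_le (f g : X →₀ ℝ) : ip f g ^ 2 ≤ ip f f * ip g g := by
  rcases (ip_self_nonneg g).eq_or_lt with h | h
  · have h1 := two_mul_ip_le f g
    rw [← h] at h1 ⊢
    by_contra! hc
    have hne : ip f g ≠ 0 := by rintro h0; simp [h0] at hc
    have := h1 ((ip f f + 1) / (2 * ip f g))
    rw [show 2 * ((ip f f + 1) / (2 * ip f g)) * ip f g = ip f f + 1 by field_simp] at this
    linarith
  · have := two_mul_ip_le f g (ip f g / ip g g)
    field_simp at this
    nlinarith

lemma kernel_apply_eq_ip (k : ℕ) (x y : X) :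
    Γ.kernel (2 * k) x y = ip (Γ.kernel k x) (Γ.kernel k y) := by
  have h : ∀ (j : ℕ) (f g : X →₀ ℝ), ip ((Γ.step ^ j) f) g = ip f ((Γ.step ^ j) g) := by
    intro j
    induction j with
    | zero => intros; rfl
    | succ j ih => intro f g; rw [pow_succ, Module.End.mul_apply, ih, ip_step,
        ← Module.End.mul_apply, ← pow_succ', ← pow_succ]
  simp only [kernel]
  rw [← h, ← Module.End.mul_apply, ← pow_add, ← two_mul, ip_comm, ip_eq_integ]
  simp

lemma ip_add_step_ge [Nonempty X] (g : X →₀ ℝ) :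
    2 / (Γ.deg : ℝ) * ip g g ≤ ip g g + ip g (Γ.step g) := by
  have hm := Γ.cast_deg_pos
  have h : 0 ≤ mass (g * g + (2 : ℝ) • (g * Γ.step g) + Γ.step (g * g) -
      (4 / (Γ.deg : ℝ)) • (g * g)) := by
    refine mass_nonneg fun x => ?_
    have h1 : (Γ.deg : ℝ)⁻¹ * ∑ y ∈ Γ.nb x, (g x + g y) ^ 2 =
        g x * g x + 2 * (g x * Γ.avg g x) + Γ.avg (g * g : X →₀ ℝ) x := by
      simp only [avg_apply, add_sq, sum_add_distrib, sum_const, Γ.card_nb,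
        smul_eq_mul, nsmul_eq_mul, Finsupp.mul_apply, ← mul_sum]
      field_simp
    have h2 : (g x + g x) ^ 2 ≤ ∑ y ∈ Γ.nb x, (g x + g y) ^ 2 :=
      single_le_sum (f := fun y => (g x + g y) ^ 2) (fun y _ => sq_nonneg _) (Γ.refl x)
    simp only [Finsupp.sub_apply, Finsupp.add_apply, Finsupp.smul_apply, Finsupp.mul_apply,
      smul_eq_mul, step_apply]
    rw [← h1, sub_nonneg, div_eq_inv_mul, mul_assoc]
    gcongr
    linarith
  simp only [map_add, map_sub, map_smul, mass_step, smul_eq_mul] at h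
  change 0 ≤ ip g g + 2 * ip g (Γ.step g) + ip g g - 4 / (Γ.deg : ℝ) * ip g g at h
  have : 2 / (Γ.deg : ℝ) * ip g g = (4 / (Γ.deg : ℝ) * ip g g) / 2 := by ring
  linarith

def Invariant (H : Type*) [Group H] [MulAction H X] : Prop :=
  ∀ (h : H) (x y : X), y ∈ Γ.nb x → h • y ∈ Γ.nb (h • x)

lemma norm_sub_le_of_mem_ball {E : Type*} [SeminormedAddCommGroup E] {u : X → E} {c : ℝ}
    (hu : ∀ x, ∀ y ∈ Γ.nb x, ‖u y - u x‖ ≤ c) (o : X) (r : ℕ) :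
    ∀ x ∈ Γ.ball o r, ‖u x - u o‖ ≤ c * r := by
  induction r with
  | zero => intro x hx; simp [ball] at hx; simp [hx]
  | succ r ih =>
    intro x hx
    obtain ⟨z, hz, hx⟩ := Γ.mem_ball_succ.1 hx
    calc ‖u x - u o‖ = ‖(u x - u z) + (u z - u o)‖ := by congr 1; abel
      _ ≤ c + c * r := (norm_add_le _ _).trans (add_le_add (hu z x hx) (ih z hz))
      _ = _ := by push_cast; ring

def hdist (k : ℕ) (x y : X) : ℝ := ip (Γ.kernel k x - Γ.kernel k y) (Γ.kernel k x - Γ.kernel k y)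

def energy (f : X →₀ ℝ) : ℝ := ip f (f - Γ.step f)

lemma hdist_le_of_mem_ball (k : ℕ) (o : X) (r : ℕ) {M : ℝ}
    (hM : ∀ x, ∀ y ∈ Γ.nb x, Γ.hdist k y x ≤ M) :
    ∀ x ∈ Γ.ball o r, Γ.hdist k x o ≤ r ^ 2 * M := by
  induction r with
  | zero => intro x hx; simp [ball] at hx; simp [hx, hdist, ip]
  | succ r ih =>
    intro x hx
    obtain ⟨z, hz, hx⟩ := Γ.mem_ball_succ.1 hx
    have h1 := ih z hz
    have h2 := hM z x hx
    have e : Γ.kernel k x - Γ.kernel k o =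
      (Γ.kernel k z - Γ.kernel k o) + (Γ.kernel k x - Γ.kernel k z) := by abel
    rw [hdist] at h1 h2 ⊢
    rw [e]
    generalize Γ.kernel k z - Γ.kernel k o = f at *
    generalize Γ.kernel k x - Γ.kernel k z = g at *
    have h3 := two_mul_ip_le f g r
    rw [ip_add_left, ip_add_right, ip_add_right, ip_comm g f]
    rcases Nat.eq_zero_or_pos r with rfl | hr
    · have h4 : ip f f = 0 := le_antisymm (by simpa using h1) (ip_self_nonneg f)
      have h5 := ip_sq_le f g
      rw [h4, zero_mul] at h5
      have h6 : ip f g = 0 := by nlinarith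
      rw [h4, h6]; simpa using h2
    · have hr' : (1 : ℝ) ≤ r := by exact_mod_cast hr
      push_cast
      have h7 : 2 * r * ip f g ≤ 2 * r * (r * M) := by nlinarith
      have h8 : ip f g ≤ r * M := le_of_mul_le_mul_left h7 (by positivity)
      nlinarith

lemma energy_sub_energy_step [Nonempty X] (f : X →₀ ℝ) :
    2 / (Γ.deg : ℝ) * ip (f - Γ.step f) (f - Γ.step f) ≤ Γ.energy f - Γ.energy (Γ.step f) := by
  refine (Γ.ip_add_step_ge (f - Γ.step f)).trans (le_of_eq ?_)
  simp only [energy, ip_sub_left, ip_sub_right, map_sub, ip_step]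
  ring

lemma one_le_card_mul_ip (k : ℕ) (o : X) :
    1 ≤ (Γ.ball o k).card * ip (Γ.kernel k o) (Γ.kernel k o) := by
  have h := sq_sum_le_card_mul_sum_sq (s := Γ.ball o k) (f := Γ.kernel k o)
  rw [← mass_eq_sum (Γ.support_kernel_subset k o), mass_kernel, one_pow] at h
  refine h.trans (le_of_eq ?_)
  rw [ip, mass_eq_sum (s := Γ.ball o k)]
  · simp [pow_two]
  · intro x hx
    refine Γ.support_kernel_subset k o ?_
    simp at hx ⊢; exact hx

section invariant
variable {Γ} {H : Type*} [Group H] [MulAction H X] (hinv : Γ.Invariant H)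
include hinv

lemma Invariant.avg_smul {E : Type*} [AddCommGroup E] [Module ℝ E] (f : X → E) (h : H) (x : X) :
    Γ.avg f (h • x) = Γ.avg (fun y => f (h • y)) x := by
  rw [avg_apply, avg_apply]
  congr 1
  refine (sum_nbij' (fun y => h • y) (fun y => h⁻¹ • y) (fun y hy => hinv h x y hy)
    (fun y hy => ?_) (fun y _ => inv_smul_smul h y) (fun y _ => smul_inv_smul h y)
    (fun y _ => rfl)).symm
  simpa using hinv h⁻¹ _ _ hy

lemma Invariant.avg_pow_smul {E : Type*} [AddCommGroup E] [Module ℝ E] (f : X → E) (h : H)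
    (x : X) (t : ℕ) : (Γ.avg ^ t) f (h • x) = (Γ.avg ^ t) (fun y => f (h • y)) x := by
  induction t generalizing x with
  | zero => rfl
  | succ t ih =>
    rw [pow_succ', Module.End.mul_apply, Module.End.mul_apply, hinv.avg_smul]
    simp only [ih]

lemma Invariant.kernel_smul (t : ℕ) (h : H) (x y : X) :
    Γ.kernel t (h • x) (h • y) = Γ.kernel t x y := by
  classical
  induction t generalizing y with
  | zero => simp [kernel_zero, Finsupp.single_apply]
  | succ t ih =>
    rw [kernel_succ, kernel_succ, step_apply, step_apply, hinv.avg_smul]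
    simp only [ih]

lemma Invariant.ip_kernel_smul (k : ℕ) (h : H) (x y : X) :
    ip (Γ.kernel k (h • x)) (Γ.kernel k (h • y)) = ip (Γ.kernel k x) (Γ.kernel k y) := by
  rw [← kernel_apply_eq_ip, ← kernel_apply_eq_ip, hinv.kernel_smul]

variable [MulAction.IsPretransitive H X]

lemma Invariant.ip_kernel_self (k : ℕ) (x y : X) :
    ip (Γ.kernel k x) (Γ.kernel k x) = ip (Γ.kernel k y) (Γ.kernel k y) := by
  obtain ⟨h, rfl⟩ := MulAction.exists_smul_eq H x y
  rw [hinv.ip_kernel_smul]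

lemma Invariant.sum_hdist (k : ℕ) (o : X) :
    ∑ y ∈ Γ.nb o, hdist Γ k y o = 2 * Γ.deg * energy Γ (Γ.kernel k o) := by
  have : Nonempty X := ⟨o⟩
  have hm := Γ.cast_deg_pos.ne'
  have h1 : ip (Γ.kernel k o) (Γ.step (Γ.kernel k o)) =
      (Γ.deg : ℝ)⁻¹ * ∑ y ∈ Γ.nb o, ip (Γ.kernel k y) (Γ.kernel k o) := by
    rw [← kernel_succ, kernel_succ', ip_smul_right, ip_comm, ip_sum_left]
  simp only [hdist, energy, ip_sub_left, ip_sub_right, h1, hinv.ip_kernel_self k _ o,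
    sum_sub_distrib, sum_const, Γ.card_nb, nsmul_eq_mul]
  simp only [ip_comm (Γ.kernel k o)]
  field_simp
  ring

lemma Invariant.hdist_nb_le (k : ℕ) (o : X) : ∀ x, ∀ y ∈ Γ.nb x,
    ∃ z ∈ Γ.nb o, hdist Γ k y x = hdist Γ k z o := by
  intro x y hy
  obtain ⟨h, rfl⟩ := MulAction.exists_smul_eq H o x
  refine ⟨h⁻¹ • y, by simpa using hinv h⁻¹ _ _ hy, ?_⟩
  obtain ⟨z, rfl⟩ : ∃ z, y = h • z := ⟨h⁻¹ • y, by simp⟩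
  simp only [hdist, ip_sub_left, ip_sub_right, inv_smul_smul, hinv.ip_kernel_smul]

lemma Invariant.hdist_nb_le_energy (k : ℕ) (o : X) : ∀ x, ∀ y ∈ Γ.nb x,
    hdist Γ k y x ≤ 2 * Γ.deg * energy Γ (Γ.kernel k o) := by
  intro x y hy
  obtain ⟨z, hz, h⟩ := hinv.hdist_nb_le k o x y hy
  rw [h, ← hinv.sum_hdist]
  exact single_le_sum (f := fun z => hdist Γ k z o) (fun i _ => ip_self_nonneg _) hz

lemma Invariant.ip_kernel_le (k : ℕ) (o : X) (r : ℕ) :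
    (Γ.ball o r).card * ip (Γ.kernel k o) (Γ.kernel k o) ≤
      1 + (Γ.ball o r).card * (r ^ 2 * Γ.deg * energy Γ (Γ.kernel k o)) := by
  have h1 : ∑ y ∈ Γ.ball o r, Γ.kernel (2 * k) o y ≤ 1 := by
    classical
    rw [← Γ.mass_kernel (2 * k) o, mass_eq_sum (subset_union_left (s₂ := Γ.ball o r))]
    exact sum_le_sum_of_subset_of_nonneg subset_union_right fun y _ _ => Γ.kernel_nonneg _ _ _
  have h2 : ∀ y ∈ Γ.ball o r, ip (Γ.kernel k o) (Γ.kernel k o) -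
      r ^ 2 * Γ.deg * energy Γ (Γ.kernel k o) ≤ Γ.kernel (2 * k) o y := by
    intro y hy
    have h3 := Γ.hdist_le_of_mem_ball k o r (hinv.hdist_nb_le_energy k o) y hy
    rw [kernel_apply_eq_ip]
    simp only [hdist, ip_sub_left, ip_sub_right, hinv.ip_kernel_self k y o,
      ip_comm (Γ.kernel k y)] at h3
    linarith
  have h3 := (sum_le_sum h2).trans h1
  rw [sum_const, nsmul_eq_mul] at h3
  linarith

end invariant

lemma exists_tendsto_ultrafilter {s : ℕ → ℝ} {c : ℝ} (hs : ∀ n, |s n| ≤ c) (U : Ultrafilter ℕ) :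
    ∃ l, Tendsto s U (nhds l) := by
  obtain ⟨l, _, hl⟩ := (isCompact_Icc (a := -c) (b := c)).ultrafilter_le_nhds (U.map s) (by
      rw [Ultrafilter.coe_map, le_principal_iff, Filter.mem_map]
      exact univ_mem' fun n => abs_le.1 (hs n))
  exact ⟨l, hl⟩

variable {Γ}
variable {H : Type*} [Group H] [MulAction H X] [MulAction.IsPretransitive H X]

lemma Invariant.le_energy [Infinite X] (hinv : Γ.Invariant H) (hc : Γ.Connected) (o : X) {C d : ℕ}
    (hg : Γ.BallLE o C d) (k : ℕ) :
    1 ≤ 8 * Γ.deg * ((C : ℝ) * (k + 1) ^ d) ^ 3 * Γ.energy (Γ.kernel k o) := by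
  set g : ℕ := C * (k + 1) ^ d with hgdef
  have h1 := Γ.one_le_card_mul_ip k o
  have h2 := hinv.ip_kernel_le k o (2 * g)
  have h3 := Γ.succ_le_card_ball hc o (2 * g)
  have h4 : ((Γ.ball o k).card : ℝ) ≤ g := by exact_mod_cast hg k
  have h5 : (2 * g + 1 : ℝ) ≤ (Γ.ball o (2 * g)).card := by exact_mod_cast h3
  have hb := ip_self_nonneg (Γ.kernel k o)
  set b := ip (Γ.kernel k o) (Γ.kernel k o)
  set e := Γ.energy (Γ.kernel k o)
  set n : ℝ := ((Γ.ball o (2 * g)).card : ℝ)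
  have h6 : 1 ≤ g * b := h1.trans (by gcongr)
  have hg0 : (0 : ℝ) ≤ g := by positivity
  have hn : 0 < n := by linarith
  have h7 : b - (↑(2 * g)) ^ 2 * Γ.deg * e ≤ 1 / n := by rw [le_div_iff₀ hn]; linarith
  have h8 : (g : ℝ) * (1 / n) ≤ 1 / 2 := by rw [mul_one_div, div_le_iff₀ hn]; linarith
  have h9 := (mul_le_mul_of_nonneg_left h7 hg0).trans h8
  push_cast at h9
  have : (g : ℝ) = C * (k + 1) ^ d := by rw [hgdef]; push_cast; ring
  rw [← this]
  nlinarith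

lemma Invariant.exists_almost_harmonic [Infinite X] (hinv : Γ.Invariant H) (hc : Γ.Connected)
    (o : X) {C d : ℕ} (hg : Γ.BallLE o C d) {η : ℝ} (hη : 0 < η) :
    ∃ k, ip (Γ.kernel k o - Γ.kernel (k + 1) o) (Γ.kernel k o - Γ.kernel (k + 1) o) ≤
      η * Γ.energy (Γ.kernel k o) := by
  by_contra! hcon
  have hm := Γ.cast_deg_pos
  set e : ℕ → ℝ := fun k => Γ.energy (Γ.kernel k o) with he
  have hlow : ∀ k, 1 ≤ 8 * Γ.deg * ((C : ℝ) * (k + 1) ^ d) ^ 3 * e k := hinv.le_energy hc o hg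
  have hpos : ∀ k, 0 < e k := fun k => by
    by_contra! h
    have := hlow k
    have h2 : 0 ≤ 8 * Γ.deg * ((C : ℝ) * (k + 1) ^ d) ^ 3 := by positivity
    nlinarith
  set ρ := 1 - 2 / Γ.deg * η with hρ
  have hdec : ∀ k, e (k + 1) ≤ ρ * e k := fun k => by
    have h1 := Γ.energy_sub_energy_step (Γ.kernel k o)
    rw [← kernel_succ] at h1
    have h2 := mul_le_mul_of_nonneg_left (hcon k).le (show 0 ≤ 2 / (Γ.deg : ℝ) by positivity)
    simp only [he, hρ]
    linarith
  have hρ0 : 0 < ρ := pos_of_mul_pos_left ((hpos 1).trans_le (hdec 0)) (hpos 0).le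
  have hρ1 : ρ < 1 := by rw [hρ]; have : 0 < 2 / (Γ.deg : ℝ) * η := by positivity
                         linarith
  have hk : ∀ k, e k ≤ ρ ^ k * e 0 := by
    intro k
    induction k with
    | zero => simp
    | succ k ih => calc e (k + 1) ≤ ρ * e k := hdec k
        _ ≤ ρ * (ρ ^ k * e 0) := by gcongr
        _ = _ := by ring
  obtain ⟨n, hn⟩ := exists_mul_pow_lt_pow ⌈8 * Γ.deg * (C : ℝ) ^ 3 * e 0⌉₊ 1 (3 * d)
    ((one_lt_inv₀ hρ0).2 hρ1)
  have h1 := hlow n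
  have h2 := Nat.le_ceil (8 * Γ.deg * (C : ℝ) ^ 3 * e 0)
  have h3 : (1 : ℝ) ≤ 8 * Γ.deg * (C : ℝ) ^ 3 * e 0 * (n + 1) ^ (3 * d) * ρ ^ n := by
    calc (1 : ℝ) ≤ 8 * Γ.deg * ((C : ℝ) * (n + 1) ^ d) ^ 3 * (ρ ^ n * e 0) :=
          h1.trans (mul_le_mul_of_nonneg_left (hk n) (by positivity))
      _ = _ := by ring
  have h4 := mul_lt_mul_of_pos_right hn (pow_pos hρ0 n)
  rw [← mul_pow, inv_mul_cancel₀ hρ0.ne', one_pow] at h4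
  push_cast at h4
  rw [one_mul] at h4
  have h5 : 8 * Γ.deg * (C : ℝ) ^ 3 * e 0 * (n + 1) ^ (3 * d) * ρ ^ n ≤
      ⌈8 * Γ.deg * (C : ℝ) ^ 3 * e 0⌉₊ * ((n : ℝ) + 1) ^ (3 * d) * ρ ^ n := by gcongr
  linarith

theorem Invariant.exists_harmonic [Infinite X] (hinv : Γ.Invariant H) (hc : Γ.Connected)
    (o : X) {C d : ℕ} (hg : Γ.BallLE o C d) :
    ∃ u : X → ℝ, Γ.avg u = u ∧ (∀ x, ∀ y ∈ Γ.nb x, |u y - u x| ≤ 1) ∧ u o = 0 ∧ ∃ z, u z ≠ 0 := by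
  have hm := Γ.cast_deg_pos
  have hstep : ∀ j : ℕ, ∃ v : X → ℝ, (∀ x, (Γ.avg v x - v x) ^ 2 ≤ 1 / ((j : ℝ) + 1)) ∧
      (∀ x, ∀ y ∈ Γ.nb x, |v y - v x| ≤ 1) ∧ v o = 0 ∧ 1 ≤ ∑ z ∈ Γ.nb o, v z ^ 2 := by
    intro j
    obtain ⟨k, hk⟩ := hinv.exists_almost_harmonic hc o hg (show (0 : ℝ) < 1 / (j + 1) by positivity)
    have he : 0 < Γ.energy (Γ.kernel k o) := by
      by_contra! h
      have := hinv.le_energy hc o hg k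
      have h2 : 0 ≤ 8 * Γ.deg * ((C : ℝ) * (k + 1) ^ d) ^ 3 := by positivity
      nlinarith
    obtain ⟨z, hz, hmax⟩ := exists_max_image (Γ.nb o) (fun y => Γ.hdist k y o) ⟨o, Γ.refl o⟩
    set M := Γ.hdist k z o with hM
    have hMe : 2 * Γ.energy (Γ.kernel k o) ≤ M := by
      have h1 := sum_le_card_nsmul (Γ.nb o) _ M hmax
      rw [hinv.sum_hdist, Γ.card_nb, nsmul_eq_mul] at h1
      refine le_of_mul_le_mul_left ?_ hm
      linarith
    have hM0 : 0 < M := by linarith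
    have hMx : ∀ x, ∀ y ∈ Γ.nb x, Γ.hdist k y x ≤ M := fun x y hy => by
      obtain ⟨w, hw, h⟩ := hinv.hdist_nb_le k o x y hy
      rw [h]; exact hmax w hw
    set f := Γ.kernel k z - Γ.kernel k o with hf
    have hMf : ip f f = M := rfl
    refine ⟨fun x => ip (Γ.kernel k x - Γ.kernel k o) f / M, fun x => ?_, fun x y hy => ?_, ?_, ?_⟩
    · have h1 : Γ.avg (fun x => ip (Γ.kernel k x - Γ.kernel k o) f / M) x -
          ip (Γ.kernel k x - Γ.kernel k o) f / M =
          -(ip (Γ.kernel k x - Γ.kernel (k + 1) x) f) / M := by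
        rw [avg_apply, kernel_succ', smul_eq_mul, ← sum_div]
        simp only [ip_sub_left, ip_smul_left, ip_sum_left, sum_sub_distrib,
          sum_const, Γ.card_nb, nsmul_eq_mul]
        field_simp
        ring
      have h2 := ip_sq_le (Γ.kernel k x - Γ.kernel (k + 1) x) f
      have h3 : ip (Γ.kernel k x - Γ.kernel (k + 1) x) (Γ.kernel k x - Γ.kernel (k + 1) x) =
          ip (Γ.kernel k o - Γ.kernel (k + 1) o) (Γ.kernel k o - Γ.kernel (k + 1) o) := by
        obtain ⟨h, rfl⟩ := MulAction.exists_smul_eq H o x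
        have h4 : ∀ i j, ip (Γ.kernel i (h • o)) (Γ.kernel j (h • o)) =
            ip (Γ.kernel i o) (Γ.kernel j o) := by
          intro i j
          rw [ip_eq_integ, integ_kernel, ip_eq_integ, integ_kernel, hinv.avg_pow_smul]
          simp only [hinv.kernel_smul]
        simp only [ip_sub_left, ip_sub_right, h4]
      rw [h1, div_pow, neg_sq, div_le_iff₀ (by positivity)]
      rw [h3, hMf] at h2
      refine h2.trans ?_
      have : 0 < (1 / ((j : ℝ) + 1)) := by positivity
      rw [pow_two, ← mul_assoc]
      gcongr
      refine hk.trans ?_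
      gcongr
      linarith
    · have h1 : ip (Γ.kernel k y - Γ.kernel k o) f / M - ip (Γ.kernel k x - Γ.kernel k o) f / M =
          ip (Γ.kernel k y - Γ.kernel k x) f / M := by
        simp only [ip_sub_left]; ring
      rw [h1, abs_div, abs_of_pos hM0, div_le_one hM0]
      refine abs_le_of_sq_le_sq ?_ hM0.le
      refine (ip_sq_le _ _).trans ?_
      rw [hMf, pow_two]
      gcongr
      exact hMx x y hy
    · simp [ip]
    · refine le_trans (le_of_eq ?_) (single_le_sum (fun y _ => sq_nonneg _) hz)
      rw [← hf, hMf, div_self hM0.ne', one_pow]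
  choose v hv1 hv2 hv3 hv4 using hstep
  have hlim : ∀ x, ∃ l, Tendsto (fun j => v j x) (hyperfilter ℕ) (nhds l) := fun x => by
    obtain ⟨r, hr⟩ := hc o x
    refine exists_tendsto_ultrafilter (c := 1 * r) (fun j => ?_) _
    have := Γ.norm_sub_le_of_mem_ball (u := v j) (c := 1) (hv2 j) o r x hr
    simpa [hv3 j] using this
  choose u hu using hlim
  refine ⟨u, ?_, ?_, ?_, ?_⟩
  · ext x
    have h1 : Tendsto (fun j => (Γ.avg (v j) x - v j x) ^ 2) (hyperfilter ℕ)
        (nhds ((Γ.avg u x - u x) ^ 2)) := by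
      simp only [avg_apply]
      exact (((tendsto_finsetSum _ fun y _ => hu y).const_smul _).sub (hu x)).pow 2
    have h2 : Tendsto (fun j : ℕ => 1 / ((j : ℝ) + 1)) (hyperfilter ℕ) (nhds 0) :=
      tendsto_one_div_add_atTop_nhds_zero_nat.mono_left (Nat.hyperfilter_le_atTop)
    have h3 := le_of_tendsto_of_tendsto' h1 h2 fun j => hv1 j x
    have : Γ.avg u x - u x = 0 := by nlinarith
    linarith
  · intro x y hy
    exact le_of_tendsto' ((hu y).sub (hu x)).abs fun j => hv2 j x y hy
  · exact tendsto_nhds_unique (hu o) (by simp [hv3])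
  · by_contra! h
    have h1 := ge_of_tendsto' (tendsto_finsetSum (Γ.nb o) fun z _ => (hu z).pow 2) hv4
    simp [h] at h1
    linarith

lemma sq_sqrt_sub_sqrt_le {p q : ℝ} (hp : 0 ≤ p) (hq : 0 < q) :
    (√p - √q) ^ 2 ≤ p * (log p - log q) - p + q := by
  rcases hp.eq_or_lt with rfl | hp
  · simp [sq_sqrt hq.le]
  have hsp := sqrt_pos.2 hp
  have hsq := sqrt_pos.2 hq
  have h1 := log_le_sub_one_of_pos (div_pos hsq hsp)
  rw [log_div hsq.ne' hsp.ne', log_sqrt hp.le, log_sqrt hq.le] at h1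
  have h2 := sq_sqrt hp.le
  have h3 := sq_sqrt hq.le
  have h4 : √q / √p * p = √q * √p := by field_simp; rw [h2]
  have h5 : p * (log q / 2 - log p / 2) ≤ √q * √p - p := by
    have := mul_le_mul_of_nonneg_left h1 hp.le
    linarith
  nlinarith

variable (Γ)

lemma integ_eq_sum {F : Type*} [AddCommGroup F] [Module ℝ F] (g : X → F) (f : X →₀ ℝ)
    {S : Finset X} (hf : f.support ⊆ S) : integ g f = ∑ y ∈ S, f y • g y := by
  rw [integ, Finsupp.linearCombination_apply, Finsupp.sum_of_support_subset _ hf _ (by simp)]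

def ent (t : ℕ) (x : X) : ℝ := ∑ y ∈ (Γ.kernel t x).support, negMulLog (Γ.kernel t x y)

lemma sum_negMulLog_eq_ent {t : ℕ} {x : X} {S : Finset X} (hS : (Γ.kernel t x).support ⊆ S) :
    ∑ y ∈ S, negMulLog (Γ.kernel t x y) = Γ.ent t x :=
  (sum_subset hS fun y _ hy => by rw [Finsupp.notMem_support_iff] at hy; simp [hy]).symm

lemma ent_le_log_card (t : ℕ) (x : X) : Γ.ent t x ≤ log (Γ.ball x t).card := by
  rw [← Γ.sum_negMulLog_eq_ent (Γ.support_kernel_subset t x)]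
  have hn : (0 : ℝ) < (Γ.ball x t).card := by exact_mod_cast card_pos.2 ⟨x, Γ.mem_ball_self x t⟩
  set n : ℝ := ((Γ.ball x t).card : ℝ) with hndef
  have h1 : ∀ y ∈ Γ.ball x t, negMulLog (Γ.kernel t x y) ≤
      Γ.kernel t x y * log n + n⁻¹ - Γ.kernel t x y := by
    intro y _
    rcases (Γ.kernel_nonneg t x y).eq_or_lt with h | h
    · rw [← h]; simp [hn.le]
    · have h2 := log_le_sub_one_of_pos (inv_pos.2 (mul_pos h hn))
      rw [log_inv, log_mul h.ne' hn.ne'] at h2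
      have h3 := mul_le_mul_of_nonneg_left h2 h.le
      rw [mul_sub, mul_inv, ← mul_assoc, mul_inv_cancel₀ h.ne'] at h3
      rw [negMulLog]
      linarith
  refine (sum_le_sum h1).trans (le_of_eq ?_)
  rw [sum_sub_distrib, sum_add_distrib, ← sum_mul,
    ← mass_eq_sum (Γ.support_kernel_subset t x), mass_kernel, sum_const, nsmul_eq_mul,
    ← hndef, mul_inv_cancel₀ hn.ne']
  ring

/-- Relative entropy of the kernels at neighbouring starting points. -/
def relEnt (t : ℕ) (x z : X) : ℝ := ∑ y ∈ (Γ.kernel (t + 1) x).support,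
    Γ.kernel t z y * (log (Γ.kernel t z y) - log (Γ.kernel (t + 1) x y))

lemma support_kernel_subset_of_nb {t : ℕ} {x z : X} (hz : z ∈ Γ.nb x) :
    (Γ.kernel t z).support ⊆ (Γ.kernel (t + 1) x).support := by
  have : Nonempty X := ⟨x⟩
  have hm := Γ.cast_deg_pos
  intro y hy
  rw [Finsupp.mem_support_iff] at hy ⊢
  have h1 : 0 < Γ.kernel t z y := lt_of_le_of_ne (Γ.kernel_nonneg _ _ _) (Ne.symm hy)
  rw [kernel_succ']
  simp only [Finsupp.smul_apply, Finsupp.finsetSum_apply, smul_eq_mul]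
  have h2 := single_le_sum (f := fun z => Γ.kernel t z y) (fun w _ => Γ.kernel_nonneg t w y) hz
  have : 0 < ∑ z ∈ Γ.nb x, Γ.kernel t z y := h1.trans_le h2
  positivity

lemma Invariant.ent_smul {Γ : WalkGraph X} (hinv : Γ.Invariant H) (t : ℕ) (h : H) (x : X) : Γ.ent t (h • x) = Γ.ent t x := by
  refine (sum_nbij' (fun y => h • y) (fun y => h⁻¹ • y) (fun y hy => ?_)
    (fun y hy => ?_) (fun y _ => inv_smul_smul h y) (fun y _ => smul_inv_smul h y)
    (fun y _ => ?_)).symm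
  · rw [Finsupp.mem_support_iff] at hy ⊢
    rwa [hinv.kernel_smul]
  · rw [Finsupp.mem_support_iff] at hy ⊢
    rwa [← hinv.kernel_smul t h, smul_inv_smul]
  · rw [hinv.kernel_smul]

lemma Invariant.sum_relEnt {Γ : WalkGraph X} (hinv : Γ.Invariant H) (t : ℕ) (x : X) :
    ∑ z ∈ Γ.nb x, Γ.relEnt t x z = Γ.deg * (Γ.ent (t + 1) x - Γ.ent t x) := by
  have : Nonempty X := ⟨x⟩
  have hm := Γ.cast_deg_pos.ne'
  have h1 : ∀ y, ∑ z ∈ Γ.nb x, Γ.kernel t z y = Γ.deg * Γ.kernel (t + 1) x y := fun y => by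
    rw [kernel_succ']
    simp only [Finsupp.smul_apply, Finsupp.finsetSum_apply, smul_eq_mul]
    rw [mul_inv_cancel_left₀ hm]
  have h2 : ∀ z ∈ Γ.nb x, Γ.relEnt t x z = - Γ.ent t x -
      ∑ y ∈ (Γ.kernel (t + 1) x).support, Γ.kernel t z y * log (Γ.kernel (t + 1) x y) := by
    intro z hz
    obtain ⟨h, rfl⟩ := MulAction.exists_smul_eq H x z
    rw [← hinv.ent_smul t h x, ← Γ.sum_negMulLog_eq_ent (Γ.support_kernel_subset_of_nb hz), relEnt,
      ← sum_neg_distrib, ← sum_sub_distrib]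
    refine sum_congr rfl fun y _ => ?_
    rw [negMulLog]; ring
  rw [sum_congr rfl h2, sum_sub_distrib, sum_comm]
  simp only [← sum_mul, h1, sum_const, Γ.card_nb, nsmul_eq_mul]
  have h3 : ∑ y ∈ (Γ.kernel (t + 1) x).support,
      Γ.deg * Γ.kernel (t + 1) x y * log (Γ.kernel (t + 1) x y) =
      - (Γ.deg * Γ.ent (t + 1) x) := by
    rw [ent, mul_sum, ← sum_neg_distrib]
    exact sum_congr rfl fun y _ => by rw [negMulLog]; ring
  rw [h3]
  ring

lemma relEnt_ge {t : ℕ} {x z : X} (hz : z ∈ Γ.nb x) :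
    ∑ y ∈ (Γ.kernel (t + 1) x).support, (√(Γ.kernel t z y) - √(Γ.kernel (t + 1) x y)) ^ 2 ≤
      Γ.relEnt t x z := by
  have h1 : ∀ y ∈ (Γ.kernel (t + 1) x).support, (√(Γ.kernel t z y) - √(Γ.kernel (t + 1) x y)) ^ 2 ≤
      Γ.kernel t z y * (log (Γ.kernel t z y) - log (Γ.kernel (t + 1) x y))
        - Γ.kernel t z y + Γ.kernel (t + 1) x y := fun y hy =>
    sq_sqrt_sub_sqrt_le (Γ.kernel_nonneg _ _ _) (lt_of_le_of_ne (Γ.kernel_nonneg _ _ _)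
      (Ne.symm (Finsupp.mem_support_iff.1 hy)))
  refine (sum_le_sum h1).trans (le_of_eq ?_)
  rw [sum_add_distrib, sum_sub_distrib, ← mass_eq_sum subset_rfl,
    ← mass_eq_sum (Γ.support_kernel_subset_of_nb hz), mass_kernel, mass_kernel]
  simp [relEnt]

section harmonic
variable {E : Type*} [NormedAddCommGroup E]

def grad2 (u : X → E) (x : X) : ℝ := (Γ.deg : ℝ)⁻¹ * ∑ y ∈ Γ.nb x, ‖u y - u x‖ ^ 2

lemma grad2_nonneg (u : X → E) (x : X) : 0 ≤ Γ.grad2 u x := by unfold grad2; positivity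

lemma norm_sq_le_grad2 (u : X → E) {x y : X} (hy : y ∈ Γ.nb x) :
    ‖u y - u x‖ ^ 2 ≤ Γ.deg * Γ.grad2 u x := by
  have : Nonempty X := ⟨x⟩
  have hm := Γ.cast_deg_pos.ne'
  rw [grad2, mul_inv_cancel_left₀ hm]
  exact single_le_sum (f := fun y => ‖u y - u x‖ ^ 2) (fun _ _ => by positivity) hy

variable [InnerProductSpace ℝ E]

lemma avg_norm_sq {u : X → E} (hu : Γ.avg u = u) (c : E) :
    Γ.avg (fun y => ‖u y - c‖ ^ 2) = (fun x => ‖u x - c‖ ^ 2) + Γ.grad2 u := by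
  ext x
  have : Nonempty X := ⟨x⟩
  have hm := Γ.cast_deg_pos.ne'
  have h0 : ∑ y ∈ Γ.nb x, (u y - u x) = 0 := by
    have h := congrFun hu x
    rw [avg_apply, inv_smul_eq_iff₀ hm] at h
    rw [sum_sub_distrib, h, sum_const, Γ.card_nb, Nat.cast_smul_eq_nsmul, sub_self]
  have h1 : ∀ y, ‖u y - c‖ ^ 2 = ‖u y - u x‖ ^ 2 + 2 * inner ℝ (u y - u x) (u x - c) +
      ‖u x - c‖ ^ 2 := fun y => by
    rw [← norm_add_sq_real]; congr 2; abel
  rw [avg_apply, Pi.add_apply, grad2, sum_congr rfl fun y _ => h1 y]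
  simp only [sum_add_distrib, ← mul_sum, ← sum_inner, h0, inner_zero_left,
    sum_const, Γ.card_nb, nsmul_eq_mul, smul_eq_mul]
  field_simp
  ring

lemma avg_pow_norm_sq {u : X → E} (hu : Γ.avg u = u) (c : E) (t : ℕ) :
    (Γ.avg ^ t) (fun y => ‖u y - c‖ ^ 2) = (fun x => ‖u x - c‖ ^ 2) +
      ∑ k ∈ range t, (Γ.avg ^ k) (Γ.grad2 u) := by
  induction t with
  | zero => simp
  | succ t ih =>
    rw [pow_succ, Module.End.mul_apply, avg_norm_sq Γ hu, map_add, ih, sum_range_succ, add_assoc]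

lemma avg_pow_nonneg {f : X → ℝ} (hf : ∀ x, 0 ≤ f x) (t : ℕ) (x : X) : 0 ≤ (Γ.avg ^ t) f x := by
  induction t generalizing x with
  | zero => exact hf x
  | succ t ih => rw [pow_succ', Module.End.mul_apply]; exact Γ.avg_nonneg ih x

lemma avg_pow_harmonic {u : X → E} (hu : Γ.avg u = u) (t : ℕ) : (Γ.avg ^ t) u = u := by
  induction t with
  | zero => rfl
  | succ t ih => rw [pow_succ, Module.End.mul_apply, hu, ih]

lemma norm_sq_le_relEnt {u : X → E} (hu : Γ.avg u = u) {x z : X} (hz : z ∈ Γ.nb x) (t : ℕ) :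
    ‖u z - u x‖ ^ 2 ≤ Γ.relEnt t x z * (2 * ((Γ.avg ^ t) (fun y => ‖u y - u x‖ ^ 2) z +
      (Γ.avg ^ (t + 1)) (fun y => ‖u y - u x‖ ^ 2) x)) := by
  have : Nonempty X := ⟨x⟩
  set S := (Γ.kernel (t + 1) x).support
  have hS := Γ.support_kernel_subset_of_nb (t := t) hz
  have hc : Γ.avg (fun y => u y - u x) = fun y => u y - u x := by
    have : (fun y => u y - u x) = u - fun _ => u x := rfl
    rw [this, map_sub, hu, avg_const]
  have e1 : u z - u x = ∑ y ∈ S, (Γ.kernel t z y - Γ.kernel (t + 1) x y) • (u y - u x) := by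
    have h1 := Γ.integ_kernel t z (fun y => u y - u x)
    have h2 := Γ.integ_kernel (t + 1) x (fun y => u y - u x)
    rw [Γ.avg_pow_harmonic hc, integ_eq_sum _ _ hS] at h1
    rw [Γ.avg_pow_harmonic hc, integ_eq_sum _ _ subset_rfl] at h2
    simp only [sub_smul _ _ (_ : E), sum_sub_distrib]
    refine (?_ : _ = (u z - u x) - (u x - u x)).trans (congrArg₂ _ h1.symm h2.symm)
    rw [sub_self, sub_zero]
  have e2 : (Γ.avg ^ t) (fun y => ‖u y - u x‖ ^ 2) z =
      ∑ y ∈ S, Γ.kernel t z y • ‖u y - u x‖ ^ 2 := by rw [← integ_kernel, integ_eq_sum _ _ hS]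
  have e3 : (Γ.avg ^ (t + 1)) (fun y => ‖u y - u x‖ ^ 2) x =
      ∑ y ∈ S, Γ.kernel (t + 1) x y • ‖u y - u x‖ ^ 2 := by
    rw [← integ_kernel, integ_eq_sum _ _ subset_rfl]
  have h1 : ‖u z - u x‖ ≤ ∑ y ∈ S, |√(Γ.kernel t z y) - √(Γ.kernel (t + 1) x y)| *
      ((√(Γ.kernel t z y) + √(Γ.kernel (t + 1) x y)) * ‖u y - u x‖) := by
    rw [e1]
    refine (norm_sum_le _ _).trans (sum_le_sum fun y _ => le_of_eq ?_)
    rw [norm_smul, ← mul_assoc]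
    congr 1
    rw [norm_eq_abs, ← abs_of_nonneg (add_nonneg (sqrt_nonneg (Γ.kernel t z y))
      (sqrt_nonneg (Γ.kernel (t + 1) x y))), ← abs_mul]
    congr 1
    rw [mul_comm, ← sq_sub_sq, sq_sqrt (Γ.kernel_nonneg _ _ _), sq_sqrt (Γ.kernel_nonneg _ _ _)]
  have h2 := sum_mul_sq_le_sq_mul_sq S (fun y => |√(Γ.kernel t z y) - √(Γ.kernel (t + 1) x y)|)
    (fun y => (√(Γ.kernel t z y) + √(Γ.kernel (t + 1) x y)) * ‖u y - u x‖)
  refine ((pow_le_pow_left₀ (norm_nonneg _) h1 2).trans h2).trans ?_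
  simp only [sq_abs]
  refine mul_le_mul (Γ.relEnt_ge hz) ?_ (sum_nonneg fun _ _ => sq_nonneg _)
    ((sum_nonneg fun _ _ => sq_nonneg _).trans (Γ.relEnt_ge hz))
  rw [e2, e3, ← sum_add_distrib, mul_sum]
  refine sum_le_sum fun y _ => ?_
  have ha := sq_sqrt (Γ.kernel_nonneg t z y)
  have hb := sq_sqrt (Γ.kernel_nonneg (t + 1) x y)
  rw [mul_pow, smul_eq_mul, smul_eq_mul, ← add_mul, ← mul_assoc]
  gcongr
  nlinarith [sq_nonneg (√(Γ.kernel t z y) - √(Γ.kernel (t + 1) x y))]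

lemma Invariant.grad2_le {Γ : WalkGraph X} (hinv : Γ.Invariant H) (o : X) {u : X → E} (hu : Γ.avg u = u)
    (t : ℕ) (x : X) : Γ.grad2 u x ≤ 2 * (Γ.deg + 1) * (Γ.ent (t + 1) o - Γ.ent t o) *
      ∑ k ∈ range (t + 1), (Γ.avg ^ k) (Γ.grad2 u) x := by
  have : Nonempty X := ⟨x⟩
  have hm := Γ.cast_deg_pos
  obtain ⟨h, rfl⟩ := MulAction.exists_smul_eq H x o
  rw [hinv.ent_smul, hinv.ent_smul]
  have hV : (Γ.avg ^ (t + 1)) (fun y => ‖u y - u x‖ ^ 2) x =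
      ∑ k ∈ range (t + 1), (Γ.avg ^ k) (Γ.grad2 u) x := by
    rw [Γ.avg_pow_norm_sq hu]; simp
  rw [← hV]
  set f : X → ℝ := fun y => ‖u y - u x‖ ^ 2
  have hf : ∀ z, 0 ≤ (Γ.avg ^ t) f z := Γ.avg_pow_nonneg (fun y => by positivity) t
  have h1 : ∀ z ∈ Γ.nb x, (Γ.avg ^ t) f z ≤ Γ.deg * (Γ.avg ^ (t + 1)) f x := by
    intro z hz
    rw [pow_succ', Module.End.mul_apply, avg_apply, smul_eq_mul, mul_inv_cancel_left₀ hm.ne']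
    exact single_le_sum (fun y _ => hf y) hz
  have h2 : ∀ z ∈ Γ.nb x, ‖u z - u x‖ ^ 2 ≤
      Γ.relEnt t x z * (2 * ((Γ.deg + 1) * (Γ.avg ^ (t + 1)) f x)) := by
    intro z hz
    refine (Γ.norm_sq_le_relEnt hu hz t).trans ?_
    have := h1 z hz
    have hr : 0 ≤ Γ.relEnt t x z := (sum_nonneg fun _ _ => sq_nonneg _).trans (Γ.relEnt_ge hz)
    gcongr
    linarith
  have h3 := sum_le_sum h2
  rw [← sum_mul, hinv.sum_relEnt] at h3
  rw [grad2, inv_mul_le_iff₀ hm]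
  exact h3.trans (le_of_eq (by ring))

end harmonic

/-- Polynomial growth bounds the increments of the entropy along a sequence of times. -/
lemma frequently_ent_sub_le (o : X) {C d : ℕ} (hg : Γ.BallLE o C d) :
    ∃ᶠ t in atTop, Γ.ent (t + 1) o - Γ.ent t o ≤ (d + 1) / ((t : ℝ) + 1) := by
  intro hcon
  simp only [not_le] at hcon
  obtain ⟨T, hT⟩ := eventually_atTop.1 hcon
  have hlog : ∀ t : ℕ, log ((t : ℝ) + 1 + 1) - log ((t : ℝ) + 1) ≤ 1 / ((t : ℝ) + 1) := by
    intro t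
    rw [← log_div (by positivity) (by positivity)]
    refine (log_le_sub_one_of_pos (by positivity)).trans (le_of_eq ?_)
    field_simp
    ring
  have hmono : ∀ t ≥ T, Γ.ent T o - (d + 1) * log ((T : ℝ) + 1) ≤
      Γ.ent t o - (d + 1) * log ((t : ℝ) + 1) := by
    intro t ht
    induction t, ht using Nat.le_induction with
    | base => exact le_rfl
    | succ t ht ih =>
      have h1 := hT t ht
      have h2 := mul_le_mul_of_nonneg_left (hlog t) (show (0 : ℝ) ≤ d + 1 by positivity)
      rw [mul_one_div] at h2
      push_cast
      linarith
  have hC : 0 < C := by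
    by_contra! h
    have h1 := hg 0
    rw [Nat.le_zero.1 h, zero_mul] at h1
    simp [ball] at h1
  have hup : ∀ t : ℕ, Γ.ent t o ≤ log C + d * log ((t : ℝ) + 1) := by
    intro t
    refine (Γ.ent_le_log_card t o).trans ?_
    rw [← log_pow, ← log_mul (by positivity) (by positivity)]
    refine log_le_log ?_ (by exact_mod_cast hg t)
    exact_mod_cast card_pos.2 ⟨o, Γ.mem_ball_self o t⟩
  have htend : Tendsto (fun t : ℕ => log ((t : ℝ) + 1)) atTop atTop :=
    tendsto_log_atTop.comp (tendsto_atTop_add_const_right _ _ tendsto_natCast_atTop_atTop)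
  obtain ⟨t, ht, htT⟩ := ((htend.eventually_gt_atTop
    (log C - (Γ.ent T o - (d + 1) * log ((T : ℝ) + 1)))).and
    (eventually_ge_atTop T)).exists
  have h1 := hmono t htT
  have h2 := hup t
  linarith


lemma avg_pow_const {E : Type*} [AddCommGroup E] [Module ℝ E] [Nonempty X] (c : E) (t : ℕ) :
    (Γ.avg ^ t) (fun _ => c) = fun _ => c := by
  induction t with
  | zero => rfl
  | succ t ih => rw [pow_succ, Module.End.mul_apply, avg_const, ih]

lemma avg_pow_le [Nonempty X] {f : X → ℝ} {c : ℝ} (hf : ∀ x, f x ≤ c) (t : ℕ) (x : X) :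
    (Γ.avg ^ t) f x ≤ c := by
  have h := Γ.avg_pow_nonneg (f := (fun _ => c) - f) (fun x => by simpa using hf x) t x
  rw [map_sub, avg_pow_const] at h
  simpa using h

lemma avg_pow_abs_le [Nonempty X] {f : X → ℝ} {c : ℝ} (hf : ∀ x, |f x| ≤ c) (t : ℕ) (x : X) :
    |(Γ.avg ^ t) f x| ≤ c := by
  rw [abs_le]
  refine ⟨?_, Γ.avg_pow_le (fun x => (abs_le.1 (hf x)).2) t x⟩
  have h := Γ.avg_pow_le (f := -f) (c := c) (fun x => by
    have := (abs_le.1 (hf x)).1; simp only [Pi.neg_apply]; linarith) t x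
  rw [map_neg, Pi.neg_apply] at h
  linarith

section
variable {E : Type*} [NormedAddCommGroup E]

lemma eq_of_grad2_eq_zero (hc : Γ.Connected) {u : X → E} (h : ∀ x, Γ.grad2 u x = 0) (x y : X) :
    u x = u y := by
  obtain ⟨r, hr⟩ := hc y x
  have := Γ.norm_sub_le_of_mem_ball (u := u) (c := 0) (fun x y hy => by
    have h1 := Γ.norm_sq_le_grad2 u hy
    rw [h, mul_zero] at h1
    nlinarith [norm_nonneg (u y - u x)]) y r x hr
  rw [zero_mul, norm_le_zero_iff, sub_eq_zero] at this
  exact this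

variable [InnerProductSpace ℝ E]

lemma Invariant.eq_of_bounded_harmonic {Γ : WalkGraph X} (hinv : Γ.Invariant H) (hc : Γ.Connected) {o : X} {C d : ℕ}
    (hg : Γ.BallLE o C d) {u : X → E} (hu : Γ.avg u = u) {c : ℝ}
    (hb : ∀ x, ‖u x‖ ≤ c) (x y : X) : u x = u y := by
  have : Nonempty X := ⟨o⟩
  refine Γ.eq_of_grad2_eq_zero hc (fun x => ?_) x y
  by_contra hne
  have hpos : 0 < Γ.grad2 u x := lt_of_le_of_ne (Γ.grad2_nonneg u x) (Ne.symm hne)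
  have hV : ∀ t, ∑ k ∈ range (t + 1), (Γ.avg ^ k) (Γ.grad2 u) x ≤ (2 * c) ^ 2 := by
    intro t
    have h1 : (Γ.avg ^ (t + 1)) (fun y => ‖u y - u x‖ ^ 2) x =
      ∑ k ∈ range (t + 1), (Γ.avg ^ k) (Γ.grad2 u) x := by
      rw [Γ.avg_pow_norm_sq hu]; simp
    rw [← h1]
    refine Γ.avg_pow_le (fun y => ?_) _ _
    have := (norm_sub_le (u y) (u x)).trans (add_le_add (hb y) (hb x))
    rw [two_mul]
    gcongr
  have hlim : Tendsto (fun t : ℕ => 2 * ((Γ.deg : ℝ) + 1) * ((d + 1) / ((t : ℝ) + 1)) * (2 * c) ^ 2)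
      atTop (nhds (2 * ((Γ.deg : ℝ) + 1) * 0 * (2 * c) ^ 2)) := by
    refine Tendsto.mul_const _ (Tendsto.const_mul _ ?_)
    exact tendsto_const_nhds.div_atTop
      (tendsto_atTop_add_const_right _ _ tendsto_natCast_atTop_atTop)
  rw [mul_zero, zero_mul] at hlim
  obtain ⟨t, h1, h2⟩ := ((Γ.frequently_ent_sub_le o hg).and_eventually
    (hlim.eventually (gt_mem_nhds hpos))).exists
  have h3 := hinv.grad2_le o hu t x
  have h4 : 0 ≤ ∑ k ∈ range (t + 1), (Γ.avg ^ k) (Γ.grad2 u) x := by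
    refine sum_nonneg fun k _ => Γ.avg_pow_nonneg (Γ.grad2_nonneg u) k x
  have h5 : 2 * ((Γ.deg : ℝ) + 1) * (Γ.ent (t + 1) o - Γ.ent t o) *
      ∑ k ∈ range (t + 1), (Γ.avg ^ k) (Γ.grad2 u) x ≤
      2 * ((Γ.deg : ℝ) + 1) * ((d + 1) / ((t : ℝ) + 1)) * (2 * c) ^ 2 := by
    refine (mul_le_mul_of_nonneg_right (mul_le_mul_of_nonneg_left h1 (by positivity)) h4).trans ?_
    exact mul_le_mul_of_nonneg_left (hV t) (by positivity)
  linarith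

end

/-- Lipschitz harmonic functions vanishing at the base point. -/
def lipHarm (o : X) : Submodule ℂ (X → ℂ) where
  carrier := {u | Γ.avg u = u ∧ u o = 0 ∧ ∃ c, ∀ x, ∀ y ∈ Γ.nb x, ‖u y - u x‖ ≤ c}
  add_mem' := by
    rintro u v ⟨h1, h2, c, h3⟩ ⟨h4, h5, c', h6⟩
    refine ⟨by rw [map_add, h1, h4], by simp [h2, h5], c + c', fun x y hy => ?_⟩
    calc ‖(u + v) y - (u + v) x‖ = ‖(u y - u x) + (v y - v x)‖ := by
          simp only [Pi.add_apply]; congr 1; ring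
      _ ≤ _ := (norm_add_le _ _).trans (add_le_add (h3 x y hy) (h6 x y hy))
  zero_mem' := ⟨map_zero _, rfl, 0, by simp⟩
  smul_mem' := by
    rintro a u ⟨h1, h2, c, h3⟩
    refine ⟨?_, by simp [h2], ‖a‖ * c, fun x y hy => ?_⟩
    · ext x
      have := congrFun h1 x
      rw [avg_apply] at this ⊢
      simp only [Pi.smul_apply]
      rw [← this, ← smul_sum, smul_comm]
    · simp only [Pi.smul_apply]
      rw [← smul_sub, norm_smul]
      exact mul_le_mul_of_nonneg_left (h3 x y hy) (norm_nonneg _)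

section form

def gradIp (u v : X → ℂ) (x : X) : ℝ :=
  (Γ.deg : ℝ)⁻¹ * ∑ y ∈ Γ.nb x, inner ℝ (u y - u x) (v y - v x)

lemma gradIp_self (u : X → ℂ) : Γ.gradIp u u = Γ.grad2 u := by ext x; simp [gradIp, grad2]

def cesaro (f : X → ℝ) (x : X) (t : ℕ) : ℝ := ((t : ℝ) + 1)⁻¹ * ∑ k ∈ range (t + 1), (Γ.avg ^ k) f x

lemma cesaro_abs_le [Nonempty X] {f : X → ℝ} {c : ℝ} (hf : ∀ x, |f x| ≤ c) (x : X) (t : ℕ) :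
    |Γ.cesaro f x t| ≤ c := by
  rw [cesaro, abs_mul, abs_of_nonneg (by positivity), inv_mul_le_iff₀ (by positivity)]
  refine (abs_sum_le_sum_abs _ _).trans ((sum_le_sum fun k _ => Γ.avg_pow_abs_le hf k x).trans ?_)
  simp

lemma gradIp_abs_le [Nonempty X] {u v : X → ℂ} {a b : ℝ}
    (hu : ∀ x, ∀ y ∈ Γ.nb x, ‖u y - u x‖ ≤ a) (hv : ∀ x, ∀ y ∈ Γ.nb x, ‖v y - v x‖ ≤ b) (x : X) :
    |Γ.gradIp u v x| ≤ a * b := by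
  have hm := Γ.cast_deg_pos
  rw [gradIp, abs_mul, abs_of_nonneg (by positivity), inv_mul_le_iff₀ hm]
  refine (abs_sum_le_sum_abs _ _).trans ((sum_le_sum fun y hy => ?_).trans
    (?_ : ∑ y ∈ Γ.nb x, a * b ≤ _))
  · exact (abs_real_inner_le_norm _ _).trans (mul_le_mul (hu x y hy) (hv x y hy) (norm_nonneg _)
      ((norm_nonneg _).trans (hu x y hy)))
  · rw [sum_const, Γ.card_nb, nsmul_eq_mul]

variable {Γ}

lemma lipHarm.gradIp_bdd [Nonempty X] {o : X} (u v : Γ.lipHarm o) :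
    ∃ c, ∀ x, |Γ.gradIp u v x| ≤ c := by
  obtain ⟨_, _, a, ha⟩ := u.2
  obtain ⟨_, _, b, hb⟩ := v.2
  exact ⟨_, Γ.gradIp_abs_le ha hb⟩

variable (U : Ultrafilter ℕ)

def limForm {o : X} (u v : Γ.lipHarm o) (x : X) : ℝ :=
  limUnder (U : Filter ℕ) (Γ.cesaro (Γ.gradIp u v) x)

lemma tendsto_limForm {o : X} (u v : Γ.lipHarm o) (x : X) :
    Tendsto (Γ.cesaro (Γ.gradIp u v) x) U (nhds (limForm U u v x)) := by
  have : Nonempty X := ⟨o⟩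
  obtain ⟨c, hc⟩ := lipHarm.gradIp_bdd u v
  obtain ⟨l, hl⟩ := exists_tendsto_ultrafilter (s := Γ.cesaro (Γ.gradIp u v) x) (c := c)
    (fun t => Γ.cesaro_abs_le hc x t) U
  exact tendsto_nhds_limUnder ⟨l, hl⟩

lemma cesaro_lin (f g : X → ℝ) (a : ℝ) (x : X) (t : ℕ) :
    Γ.cesaro (f + a • g) x t = Γ.cesaro f x t + a * Γ.cesaro g x t := by
  simp only [cesaro, map_add, map_smul, Pi.add_apply, Pi.smul_apply, sum_add_distrib,
    smul_eq_mul, ← mul_sum]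
  ring

lemma limForm_lin {o : X} (u v w : Γ.lipHarm o) (a : ℝ) (x : X) :
    limForm U (u + a • w) v x = limForm U u v x + a * limForm U w v x := by
  refine tendsto_nhds_unique (tendsto_limForm U _ v x) (((tendsto_limForm U u v x).add
    ((tendsto_limForm U w v x).const_mul a)).congr fun t => ?_)
  rw [← cesaro_lin]
  congr 1
  ext x
  simp only [gradIp, Pi.add_apply, Pi.smul_apply, smul_eq_mul]
  rw [mul_left_comm, ← mul_add, mul_sum, ← sum_add_distrib]
  congr 1
  refine sum_congr rfl fun y _ => ?_
  rw [← real_inner_smul_left, ← inner_add_left]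
  congr 1
  simp only [Submodule.coe_add, Submodule.coe_smul_of_tower, Pi.add_apply, Pi.smul_apply, smul_sub]
  ring

lemma limForm_symm {o : X} (u v : Γ.lipHarm o) (x : X) : limForm U u v x = limForm U v u x := by
  have : Γ.gradIp u v = Γ.gradIp v u := by
    ext x; simp only [gradIp]; congr 1
    exact sum_congr rfl fun y _ => real_inner_comm _ _
  rw [limForm, limForm, this]

variable (hU : (U : Filter ℕ) ≤ atTop)
include hU

lemma avg_limForm {o : X} (u v : Γ.lipHarm o) : Γ.avg (limForm U u v) = limForm U u v := by
  have : Nonempty X := ⟨o⟩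
  ext x
  have h1 : Tendsto (fun t => Γ.avg (fun y => Γ.cesaro (Γ.gradIp u v) y t) x) U
      (nhds (Γ.avg (limForm U u v) x)) := by
    simp only [avg_apply]
    exact (tendsto_finsetSum _ fun y _ => tendsto_limForm U u v y).const_smul _
  obtain ⟨c, hc⟩ := lipHarm.gradIp_bdd u v
  have h2 : ∀ t, Γ.avg (fun y => Γ.cesaro (Γ.gradIp u v) y t) x = Γ.cesaro (Γ.gradIp u v) x t +
      ((t : ℝ) + 1)⁻¹ * ((Γ.avg ^ (t + 1)) (Γ.gradIp u v) x - Γ.gradIp u v x) := by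
    intro t
    have e : (fun y => Γ.cesaro (Γ.gradIp u v) y t) = ((t : ℝ) + 1)⁻¹ •
        ∑ k ∈ range (t + 1), (Γ.avg ^ k) (Γ.gradIp u v) := by
      ext y; simp [cesaro]
    have e2 := sum_range_succ' (fun k => (Γ.avg ^ k) (Γ.gradIp u v) x) (t + 1)
    rw [sum_range_succ] at e2
    rw [e, map_smul, map_sum, cesaro, ← mul_add]
    simp only [Pi.smul_apply, Finset.sum_apply, smul_eq_mul]
    congr 1
    simp only [pow_zero, Module.End.one_apply, pow_succ' Γ.avg _, Module.End.mul_apply] at e2 ⊢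
    linarith
  have h3 : Tendsto (fun t : ℕ => ((t : ℝ) + 1)⁻¹ *
      ((Γ.avg ^ (t + 1)) (Γ.gradIp u v) x - Γ.gradIp u v x)) U (nhds 0) := by
    refine Tendsto.mono_left ?_ hU
    refine squeeze_zero_norm (a := fun t : ℕ => ((t : ℝ) + 1)⁻¹ * (c + c)) (fun t => ?_) ?_
    · rw [norm_eq_abs, abs_mul, abs_of_nonneg (by positivity)]
      gcongr
      exact (abs_sub _ _).trans (add_le_add (Γ.avg_pow_abs_le hc _ _) (hc x))
    · rw [← zero_mul (c + c)]
      exact (tendsto_inv_atTop_zero.comp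
        (tendsto_atTop_add_const_right _ _ tendsto_natCast_atTop_atTop)).mul_const _
  have h4 := (tendsto_limForm U u v x).add h3
  rw [add_zero] at h4
  exact tendsto_nhds_unique h1 (h4.congr fun t => (h2 t).symm)

variable {H : Type*} [Group H] [MulAction H X] [MulAction.IsPretransitive H X]
  (hinv : Γ.Invariant H) (hc : Γ.Connected) {o : X} {C d : ℕ}
  (hg : Γ.BallLE o C d)
include hinv hc hg

lemma limForm_const (u v : Γ.lipHarm o) (x y : X) : limForm U u v x = limForm U u v y := by
  have : Nonempty X := ⟨o⟩
  obtain ⟨c, hb⟩ := lipHarm.gradIp_bdd u v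
  refine hinv.eq_of_bounded_harmonic hc hg (avg_limForm U hU u v) (c := c) (fun x => ?_) x y
  exact le_of_tendsto (tendsto_limForm U u v x).norm
    (Eventually.of_forall fun t => Γ.cesaro_abs_le hb x t)

variable (hent : ∀ᶠ t in (U : Filter ℕ), Γ.ent (t + 1) o - Γ.ent t o ≤ (d + 1) / ((t : ℝ) + 1))
include hent

lemma grad2_le_limForm (u : Γ.lipHarm o) (x : X) :
    Γ.grad2 (u : X → ℂ) x ≤ 2 * (Γ.deg + 1) * (d + 1) * limForm U u u o := by
  rw [limForm_const U hU hinv hc hg u u o x]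
  refine ge_of_tendsto ((tendsto_limForm U u u x).const_mul _) (hent.mono fun t ht => ?_)
  have h3 := hinv.grad2_le o u.2.1 t x
  have h4 : 0 ≤ ∑ k ∈ range (t + 1), (Γ.avg ^ k) (Γ.grad2 (u : X → ℂ)) x := by
    refine sum_nonneg fun k _ => Γ.avg_pow_nonneg (Γ.grad2_nonneg _) k x
  refine h3.trans ((mul_le_mul_of_nonneg_right (mul_le_mul_of_nonneg_left ht
    (by positivity)) h4).trans (le_of_eq ?_))
  rw [gradIp_self, cesaro]
  ring

lemma limForm_pos {u : Γ.lipHarm o} (hu : u ≠ 0) : 0 < limForm U u u o := by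
  have : Nonempty X := ⟨o⟩
  by_contra! h
  refine hu (Subtype.ext ?_)
  ext x
  have h1 : ∀ x, Γ.grad2 (u : X → ℂ) x = 0 := fun x => le_antisymm
    ((grad2_le_limForm U hU hinv hc hg hent u x).trans
      (mul_nonpos_of_nonneg_of_nonpos (by positivity) h)) (Γ.grad2_nonneg _ x)
  rw [Γ.eq_of_grad2_eq_zero hc h1 x o, u.2.2.1]
  rfl

end form

variable {Γ}

def limBilin (U : Ultrafilter ℕ) (o : X) : LinearMap.BilinForm ℝ (Γ.lipHarm o) :=
  LinearMap.mk₂ ℝ (fun u v => limForm U u v o) (fun u v w => by simpa using limForm_lin U u w v 1 o)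
    (fun a u v => by
      have h0 := limForm_lin U 0 v 0 1 o
      have h := limForm_lin U 0 v u a o
      simp only [smul_zero, add_zero, one_mul, zero_add, left_eq_add] at h h0
      rw [h, h0, zero_add, smul_eq_mul])
    (fun u v w => by
      rw [limForm_symm, limForm_symm U u v, limForm_symm U u w]
      simpa using limForm_lin U v u w 1 o)
    (fun a u v => by
      rw [limForm_symm, limForm_symm U u v]
      have h0 := limForm_lin U 0 u 0 1 o
      have h := limForm_lin U 0 u v a o
      simp only [smul_zero, add_zero, one_mul, zero_add, left_eq_add] at h h0
      rw [h, h0, zero_add, smul_eq_mul])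

lemma limBilin_apply (U : Ultrafilter ℕ) (o : X) (u v : Γ.lipHarm o) :
    limBilin U o u v = limForm U u v o := rfl

/-- The span of an orthonormal family has dimension bounded by the trace of the gradient. -/
lemma card_le_of_orthonormal {U : Ultrafilter ℕ} {o : X} {K : ℝ}
    (hK0 : 0 ≤ K) (hK : ∀ (u : Γ.lipHarm o) (x : X), Γ.grad2 (u : X → ℂ) x ≤ K * limForm U u u o) {m : ℕ}
    (u : Fin m → Γ.lipHarm o) (h1 : ∀ i, limForm U (u i) (u i) o = 1)
    (h2 : ∀ i j, i ≠ j → limForm U (u i) (u j) o = 0) : (m : ℝ) ≤ 2 * (Γ.deg * K) := by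
  have : Nonempty X := ⟨o⟩
  have hm := Γ.cast_deg_pos
  have hQ : ∀ a : Fin m → ℝ, limForm U (∑ i, a i • u i) (∑ i, a i • u i) o = ∑ i, a i ^ 2 := by
    intro a
    rw [← limBilin_apply]
    simp only [map_sum, map_smul, LinearMap.sum_apply, LinearMap.smul_apply, smul_eq_mul,
      limBilin_apply]
    refine sum_congr rfl fun i _ => ?_
    rw [sum_eq_single i (fun j _ hj => by rw [h2 j i hj]; ring) (by simp), h1]
    ring
  have key : ∀ (ℓ : ℂ →ₗ[ℝ] ℝ), (∀ z, |ℓ z| ≤ ‖z‖) → ∀ x, ∀ y ∈ Γ.nb x,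
      ∑ i, ℓ ((u i : X → ℂ) y - (u i : X → ℂ) x) ^ 2 ≤ Γ.deg * K := by
    intro ℓ hℓ x y hy
    set a : Fin m → ℝ := fun i => ℓ ((u i : X → ℂ) y - (u i : X → ℂ) x) with ha
    set w : Γ.lipHarm o := ∑ i, a i • u i with hw
    have e : ℓ ((w : X → ℂ) y - (w : X → ℂ) x) = ∑ i, a i ^ 2 := by
      have : (w : X → ℂ) y - (w : X → ℂ) x = ∑ i, a i • ((u i : X → ℂ) y - (u i : X → ℂ) x) := by
        rw [hw]
        simp [mul_sub]
      rw [this, map_sum]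
      exact sum_congr rfl fun i _ => by rw [map_smul, smul_eq_mul, sq]
    have h3 := (Γ.norm_sq_le_grad2 (w : X → ℂ) hy).trans (mul_le_mul_of_nonneg_left (hK w x) hm.le)
    rw [hQ] at h3
    have h4 := hℓ ((w : X → ℂ) y - (w : X → ℂ) x)
    rw [e] at h4
    have h5 : 0 ≤ ∑ i, a i ^ 2 := sum_nonneg fun i _ => sq_nonneg _
    rw [abs_of_nonneg h5] at h4
    rcases h5.eq_or_lt with h6 | h6
    · rw [← h6]; positivity
    · have h7 : (∑ i, a i ^ 2) ^ 2 ≤ Γ.deg * (K * ∑ i, a i ^ 2) :=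
        (pow_le_pow_left₀ h5 h4 2).trans h3
      by_contra! hcon
      nlinarith
  have hsum : ∀ x, |∑ i, Γ.gradIp (u i) (u i) x| ≤ 2 * (Γ.deg * K) := by
    intro x
    simp only [gradIp_self]
    rw [abs_of_nonneg (sum_nonneg fun i _ => Γ.grad2_nonneg _ _)]
    simp only [grad2]
    rw [← mul_sum, inv_mul_le_iff₀ hm, sum_comm]
    refine (sum_le_sum (g := fun _ => 2 * (Γ.deg * K)) fun y hy => ?_).trans ?_
    · have e1 := key Complex.reLm Complex.abs_re_le_norm x y hy
      have e2 := key Complex.imLm Complex.abs_im_le_norm x y hy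
      rw [two_mul]
      refine le_trans (le_of_eq ?_) (add_le_add e1 e2)
      rw [← sum_add_distrib]
      refine sum_congr rfl fun i _ => ?_
      rw [Complex.sq_norm, Complex.normSq_apply, sq, sq]
      rfl
    · rw [sum_const, Γ.card_nb, nsmul_eq_mul]
  have hlim : Tendsto (fun t => ∑ i, Γ.cesaro (Γ.gradIp (u i) (u i)) o t) U
      (nhds (∑ i, limForm U (u i) (u i) o)) :=
    tendsto_finsetSum _ fun i _ => tendsto_limForm U (u i) (u i) o
  have h3 := le_of_tendsto hlim (b := 2 * (Γ.deg * K)) (Eventually.of_forall fun t => by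
    have e : ∑ i, Γ.cesaro (Γ.gradIp (u i) (u i)) o t =
        Γ.cesaro (fun x => ∑ i, Γ.gradIp (u i) (u i) x) o t := by
      simp only [cesaro]
      rw [← mul_sum, sum_comm]
      congr 1
      refine sum_congr rfl fun k _ => ?_
      have : (fun x => ∑ i, Γ.gradIp (u i) (u i) x) = ∑ i, Γ.gradIp (u i) (u i) := by ext x; simp
      rw [this, map_sum, Finset.sum_apply]
    rw [e]
    exact (abs_le.1 (Γ.cesaro_abs_le hsum o t)).2)
  simpa [h1] using h3

lemma Invariant.finite_lipHarm {H : Type*} [Group H] [MulAction H X] [MulAction.IsPretransitive H X]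
    (hinv : Γ.Invariant H) (hc : Γ.Connected) {o : X} {C d : ℕ}
    (hg : Γ.BallLE o C d) : Module.Finite ℂ (Γ.lipHarm o) := by
  have hfreq := Γ.frequently_ent_sub_le o hg
  have := frequently_iff_neBot.1 hfreq
  set U := Ultrafilter.of (atTop ⊓ 𝓟 {t : ℕ | Γ.ent (t + 1) o - Γ.ent t o ≤ (d + 1) / ((t : ℝ) + 1)})
  have hU1 : (U : Filter ℕ) ≤ atTop := (Ultrafilter.of_le _).trans inf_le_left
  have hU2 : ∀ᶠ t in (U : Filter ℕ), Γ.ent (t + 1) o - Γ.ent t o ≤ (d + 1) / ((t : ℝ) + 1) :=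
    (Ultrafilter.of_le _).trans inf_le_right (mem_principal_self _)
  set K : ℝ := 2 * (Γ.deg + 1) * (d + 1) with hKdef
  have hK := grad2_le_limForm U hU1 hinv hc hg hU2
  have hpos := fun {u} => limForm_pos (u := u) U hU1 hinv hc hg hU2
  have hrank : Module.rank ℝ (Γ.lipHarm o) ≤ (⌈2 * (Γ.deg * K)⌉₊ : ℕ) := by
    refine rank_le fun s hs => ?_
    set W := Submodule.span ℝ (Set.range fun i : s => (i : Γ.lipHarm o)) with hW
    have hfin : FiniteDimensional ℝ W := FiniteDimensional.span_of_finite ℝ (Set.finite_range _)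
    have hcard : Module.finrank ℝ W = s.card := by
      rw [hW, finrank_span_eq_card hs, Fintype.card_coe]
    set B : LinearMap.BilinForm ℝ W := (limBilin U o).restrict W with hB
    have hsymm : LinearMap.IsSymm B := ⟨fun u v => limForm_symm U _ _ o⟩
    have : Invertible (2 : ℝ) := invertibleOfNonzero two_ne_zero
    obtain ⟨v, hv⟩ := LinearMap.BilinForm.exists_orthogonal_basis (K := ℝ) (V := W) (B := B) hsymm
    have hvpos : ∀ i, 0 < limForm U (v i : Γ.lipHarm o) (v i) o := fun i => hpos fun h =>
      v.ne_zero i (Subtype.ext h)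
    have h := card_le_of_orthonormal (K := K) (by positivity) hK
      (fun i => (√(limForm U (v i : Γ.lipHarm o) (v i) o))⁻¹ • (v i : Γ.lipHarm o)) (fun i => by
        rw [← limBilin_apply, map_smul, map_smul, LinearMap.smul_apply, limBilin_apply, smul_eq_mul,
          smul_eq_mul, ← mul_assoc, ← mul_inv, mul_self_sqrt (hvpos i).le,
          inv_mul_cancel₀ (hvpos i).ne']) (fun i j hij => by
        have := hv hij
        change limForm U (v i : Γ.lipHarm o) (v j) o = 0 at this
        rw [← limBilin_apply, map_smul, map_smul, LinearMap.smul_apply, limBilin_apply, this]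
        simp)
    rw [hcard] at h
    exact_mod_cast h.trans (Nat.le_ceil _)
  have : Module.Finite ℝ (Γ.lipHarm o) :=
    Module.rank_lt_aleph0_iff.1 (hrank.trans_lt (Cardinal.natCast_lt_aleph0))
  exact Module.Finite.of_restrictScalars_finite ℝ ℂ _

end WalkGraph

end

section
open Subgroup Module

section isometric
variable {G : Type*} [Group G] {E : Type*} [NormedAddCommGroup E] [NormedSpace ℂ E]
  {ρ : G →* (E →L[ℂ] E)} (hρ : ∀ g, ‖ρ g‖ ≤ 1)
include hρ

lemma norm_map_sub_map_le (g x y : G) : ‖ρ (g * x) - ρ (g * y)‖ ≤ ‖ρ x - ρ y‖ := by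
  rw [map_mul, map_mul, ← mul_sub]
  refine (norm_mul_le _ _).trans ?_
  nlinarith [hρ g, norm_nonneg (ρ x - ρ y)]

lemma norm_map_inv_sub_one (g : G) : ‖ρ g⁻¹ - 1‖ ≤ ‖ρ g - 1‖ := by
  have := norm_map_sub_map_le hρ g⁻¹ 1 g
  rwa [mul_one, inv_mul_cancel, map_one, norm_sub_rev 1] at this

lemma norm_map_mul_sub_one (g h : G) : ‖ρ (g * h) - 1‖ ≤ ‖ρ g - 1‖ + ‖ρ h - 1‖ := by
  have h1 := norm_map_sub_map_le hρ g h 1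
  rw [mul_one, map_one] at h1
  calc ‖ρ (g * h) - 1‖ = ‖(ρ (g * h) - ρ g) + (ρ g - 1)‖ := by congr 1; abel
    _ ≤ _ := (norm_add_le _ _).trans (by linarith)

lemma norm_map_commutator_sub_one (g h : G) : ‖ρ ⁅g, h⁆ - 1‖ ≤ 2 * ‖ρ g - 1‖ * ‖ρ h - 1‖ := by
  have e : ρ ⁅g, h⁆ - 1 = ((ρ g - 1) * (ρ h - 1) - (ρ h - 1) * (ρ g - 1)) * ρ (g⁻¹ * h⁻¹) := by
    have h1 : (ρ g - 1) * (ρ h - 1) - (ρ h - 1) * (ρ g - 1) = ρ (g * h) - ρ (h * g) := by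
      rw [map_mul, map_mul]; noncomm_ring
    rw [h1, sub_mul, ← map_mul, ← map_mul]
    congr 1
    · rw [commutatorElement_def]; congr 1; group
    · rw [show h * g * (g⁻¹ * h⁻¹) = 1 by group, map_one]
  rw [e]
  refine (norm_mul_le _ _).trans ?_
  have h1 := norm_sub_le ((ρ g - 1) * (ρ h - 1)) ((ρ h - 1) * (ρ g - 1))
  have h2 := norm_mul_le (ρ g - 1) (ρ h - 1)
  have h3 := norm_mul_le (ρ h - 1) (ρ g - 1)
  have h4 := hρ (g⁻¹ * h⁻¹)
  have h5 := norm_nonneg ((ρ g - 1) * (ρ h - 1) - (ρ h - 1) * (ρ g - 1))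
  nlinarith

lemma norm_map_pow_sub_one_le (g : G) (k : ℕ) : ‖ρ (g ^ k) - 1‖ ≤ k * ‖ρ g - 1‖ := by
  induction k with
  | zero => simp
  | succ k ih =>
    rw [pow_succ]
    refine (norm_map_mul_sub_one hρ _ _).trans ?_
    push_cast; linarith

lemma norm_map_pow_sub_one_sub (g : G) (k : ℕ) :
    ‖ρ (g ^ k) - 1 - (k : ℂ) • (ρ g - 1)‖ ≤ k * (k * ‖ρ g - 1‖) * ‖ρ g - 1‖ := by
  induction k with
  | zero => simp
  | succ k ih =>
    have e : ρ (g ^ (k + 1)) - 1 - ((k + 1 : ℕ) : ℂ) • (ρ g - 1) =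
        (ρ (g ^ k) - 1 - (k : ℂ) • (ρ g - 1)) + (ρ (g ^ k) - 1) * (ρ g - 1) := by
      rw [pow_succ, map_mul]; push_cast
      rw [add_smul, one_smul]; noncomm_ring
    rw [e]
    refine (norm_add_le _ _).trans ?_
    have h1 := (norm_mul_le (ρ (g ^ k) - 1) (ρ g - 1))
    have h2 := mul_le_mul_of_nonneg_right (norm_map_pow_sub_one_le hρ g k) (norm_nonneg (ρ g - 1))
    have h3 : 0 ≤ ‖ρ g - 1‖ * ‖ρ g - 1‖ := by positivity
    have h4 : (0 : ℝ) ≤ k := by positivity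
    push_cast
    nlinarith [mul_nonneg h4 h3]

lemma le_norm_map_pow_sub_one (g : G) {k L : ℕ} (hk : 0 < k) (hkL : k ≤ L)
    (hL : L * ‖ρ g - 1‖ ≤ 1 / 2) : ‖ρ g - 1‖ / 2 ≤ ‖ρ (g ^ k) - 1‖ := by
  have h1 := norm_map_pow_sub_one_sub hρ g k
  have h2 := norm_sub_norm_le ((k : ℂ) • (ρ g - 1)) (ρ (g ^ k) - 1)
  rw [norm_smul, Complex.norm_natCast, norm_sub_rev _ (ρ (g ^ k) - 1)] at h2
  have hk1 : (1 : ℝ) ≤ k := by exact_mod_cast hk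
  have hkL' : (k : ℝ) ≤ L := by exact_mod_cast hkL
  have h3 : k * ‖ρ g - 1‖ ≤ 1 / 2 := (mul_le_mul_of_nonneg_right hkL' (norm_nonneg _)).trans hL
  have h4 : k * (k * ‖ρ g - 1‖) * ‖ρ g - 1‖ ≤ k * (1 / 2) * ‖ρ g - 1‖ := by gcongr
  nlinarith [norm_nonneg (ρ g - 1)]

/-- A rapidly contracting sequence of group elements generates exponentially many words. -/
lemma exists_words {S : Set G} {L : ℕ} (g : ℕ → G) (ℓ : ℕ → ℕ)
    (hS : ∀ i, ∀ k < L, g i ^ k ∈ S ^ (ℓ i)) (hpos : ∀ i, 0 < ‖ρ (g i) - 1‖)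
    (hsmall : ∀ i, L * ‖ρ (g i) - 1‖ ≤ 1 / 2)
    (hdec : ∀ i, (8 * L + 2) * ‖ρ (g (i + 1)) - 1‖ ≤ ‖ρ (g i) - 1‖) (m : ℕ) (i : ℕ) :
    ∃ F : Finset G, F.card = L ^ m ∧ (F : Set G) ⊆ S ^ (∑ j ∈ range m, ℓ (i + j)) ∧
      ∀ w ∈ F, ‖ρ w - 1‖ ≤ 2 * L * ‖ρ (g i) - 1‖ := by
  classical
  induction m generalizing i with
  | zero => exact ⟨{1}, by simp, by simp, by simp; positivity⟩
  | succ m ih =>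
    obtain ⟨F, hF1, hF2, hF3⟩ := ih (i + 1)
    refine ⟨(range L ×ˢ F).image fun p => g i ^ p.1 * p.2, ?_, ?_, ?_⟩
    · rw [card_image_of_injOn, card_product, card_range, hF1, pow_succ']
      have key : ∀ a b : ℕ, a < b → b < L → ∀ w ∈ F, ∀ w' ∈ F, g i ^ a * w ≠ g i ^ b * w' := by
        intro a b hab hb w hw w' hw' heq
        have e : g i ^ (b - a) = w * w'⁻¹ := by
          rw [eq_mul_inv_iff_mul_eq]
          refine mul_left_cancel (a := g i ^ a) ?_
          rw [← mul_assoc, ← pow_add, Nat.add_sub_cancel' hab.le, heq]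
        have h1 := le_norm_map_pow_sub_one hρ (g i) (k := b - a) (by omega) (by omega) (hsmall i)
        rw [e] at h1
        have h2 := norm_map_mul_sub_one hρ w w'⁻¹
        have h3 := norm_map_inv_sub_one hρ w'
        have h4 := hF3 w hw
        have h5 := hF3 w' hw'
        have h6 := hdec i
        have h7 := hpos (i + 1)
        nlinarith
      rintro ⟨a, w⟩ h1 ⟨b, w'⟩ h2 heq
      simp only [coe_product, Set.mem_prod, mem_coe, mem_range] at h1 h2 heq
      rcases lt_trichotomy a b with h | h | h
      · exact absurd heq (key a b h h2.1 w h1.2 w' h2.2)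
      · subst h; simpa using heq
      · exact absurd heq.symm (key b a h h1.1 w' h2.2 w h1.2)
    · intro x hx
      simp only [coe_image, Set.mem_image, coe_product, Set.mem_prod,
        mem_coe, mem_range] at hx
      obtain ⟨p, ⟨h1, h2⟩, rfl⟩ := hx
      rw [sum_range_succ', add_comm, pow_add, add_zero]
      refine Set.mul_mem_mul (hS i _ h1) ?_
      have := hF2 h2
      convert this using 3 with j
      congr 1; omega
    · intro x hx
      simp only [mem_image, mem_product, mem_range] at hx
      obtain ⟨p, ⟨h1, h2⟩, rfl⟩ := hx
      refine (norm_map_mul_sub_one hρ _ _).trans ?_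
      have h3 := norm_map_pow_sub_one_le hρ (g i) p.1
      have h4 := hF3 _ h2
      have h5 : (p.1 : ℝ) ≤ L := by exact_mod_cast h1.le
      have h6 := hdec i
      have h7 := hpos i
      have h8 := hpos (i + 1)
      have h9 : (p.1 : ℝ) * ‖ρ (g i) - 1‖ ≤ L * ‖ρ (g i) - 1‖ := by gcongr
      have hL : (1 : ℝ) ≤ L := by exact_mod_cast (by omega : 1 ≤ L)
      nlinarith

end isometric

lemma norm_eigenvalue_sub_one_le {G : Type*} [Group G] {E : Type*} [NormedAddCommGroup E]
    [NormedSpace ℂ E] {ρ : G →* (E →L[ℂ] E)} {g : G} {μ : ℂ}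
    (hμ : End.HasEigenvalue (ρ g : E →ₗ[ℂ] E) μ) : ‖μ - 1‖ ≤ ‖ρ g - 1‖ := by
  obtain ⟨v, hv⟩ := hμ.exists_hasEigenvector
  have h1 : (ρ g - 1) v = (μ - 1) • v := by
    have : ρ g v = μ • v := hv.apply_eq_smul
    rw [sub_apply, this, sub_smul, one_smul]; rfl
  have h2 := (ρ g - 1).le_opNorm v
  rw [h1, norm_smul] at h2
  exact le_of_mul_le_mul_right h2 (norm_pos_iff.2 hv.2)

section eigen
variable {G : Type*} [Group G] {E : Type*} [NormedAddCommGroup E] [NormedSpace ℂ E]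
  [FiniteDimensional ℂ E] {ρ : G →* (E →L[ℂ] E)} (hρ : ∀ g, ‖ρ g‖ ≤ 1)

/-- A central commutator acts on its eigenspaces by roots of unity. -/
lemma eigenvalue_pow_eq_one {a b : G} (ha : Commute ⁅a, b⁆ a) (hb : Commute ⁅a, b⁆ b) {μ : ℂ}
    (hμ : End.HasEigenvalue (ρ ⁅a, b⁆ : E →ₗ[ℂ] E) μ) :
    ∃ m, 0 < m ∧ m ≤ finrank ℂ E ∧ μ ^ m = 1 := by
  set f : E →ₗ[ℂ] E := (ρ ⁅a, b⁆ : E →ₗ[ℂ] E) with hf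
  set V := End.eigenspace f μ with hV
  have hpres : ∀ c : G, Commute ⁅a, b⁆ c → ∀ v ∈ V, ρ c v ∈ V := by
    intro c hc v hv
    rw [hV, End.mem_eigenspace_iff] at hv ⊢
    have : ρ ⁅a, b⁆ (ρ c v) = ρ c (ρ ⁅a, b⁆ v) := by
      rw [← mul_apply_eq_comp, ← map_mul, hc.eq, map_mul, mul_apply_eq_comp]
    change ρ ⁅a, b⁆ (ρ c v) = _
    rw [this]
    change ρ ⁅a, b⁆ v = _ at hv
    rw [hv, map_smul]
  let r : ∀ c : G, Commute ⁅a, b⁆ c → (V →ₗ[ℂ] V) := fun c hc =>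
    LinearMap.restrict (ρ c : E →ₗ[ℂ] E) (hpres c hc)
  have hinv : ∀ c (hc : Commute ⁅a, b⁆ c), LinearMap.det (r c hc) ≠ 0 := by
    intro c hc h0
    have h1 : r c⁻¹ hc.inv_right ∘ₗ r c hc = LinearMap.id := by
      ext v
      change ρ c⁻¹ (ρ c v) = v
      rw [← mul_apply_eq_comp, ← map_mul, inv_mul_cancel, map_one]; rfl
    have h2 := congrArg LinearMap.det h1
    rw [LinearMap.det_comp, h0, mul_zero, LinearMap.det_id] at h2
    exact zero_ne_one h2
  have h3 : (μ • (LinearMap.id : V →ₗ[ℂ] V)) ∘ₗ (r b hb ∘ₗ r a ha) = r a ha ∘ₗ r b hb := by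
    ext v
    change μ • (ρ b (ρ a v)) = ρ a (ρ b v)
    have h4 := hpres b hb _ (hpres a ha _ v.2)
    replace h4 := End.mem_eigenspace_iff.1 h4
    rw [← h4]
    change ρ ⁅a, b⁆ (ρ b (ρ a v)) = _
    rw [← mul_apply_eq_comp, ← mul_apply_eq_comp,
      ← mul_apply_eq_comp, ← map_mul, ← map_mul, ← map_mul, commutatorElement_def]
    congr 2; group
  have h4 := congrArg LinearMap.det h3
  rw [LinearMap.det_comp, LinearMap.det_comp, LinearMap.det_comp, LinearMap.det_smul,
    LinearMap.det_id, mul_one, mul_comm (LinearMap.det (r a ha))] at h4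
  have h5 := mul_right_cancel₀ (mul_ne_zero (hinv b hb) (hinv a ha)) (h4.trans (one_mul _).symm)
  refine ⟨finrank ℂ V, ?_, Submodule.finrank_le _, h5⟩
  have : Nontrivial V := Submodule.nontrivial_iff_ne_bot.2 hμ
  exact finrank_pos

include hρ in
lemma map_eq_one_of_eigenvalues {g : G}
    (h : ∀ μ, End.HasEigenvalue (ρ g : E →ₗ[ℂ] E) μ → μ = 1) : ρ g = 1 := by
  set f : E →ₗ[ℂ] E := (ρ g : E →ₗ[ℂ] E) with hf
  have h1 : ∀ v, (f - 1) ((f - 1) v) = 0 → (f - 1) v = 0 := by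
    intro v hv
    have hfix : f ((f - 1) v) = (f - 1) v := by rwa [LinearMap.sub_apply, sub_eq_zero] at hv
    have hpow : ∀ k : ℕ, ρ (g ^ k) v = v + (k : ℂ) • (f - 1) v := by
      intro k
      induction k with
      | zero => simp
      | succ k ih =>
        rw [pow_succ', map_mul, mul_apply_eq_comp, ih]
        change f _ = _
        rw [map_add, map_smul, hfix]
        push_cast
        rw [add_smul, one_smul, LinearMap.sub_apply, End.one_apply]
        abel
    by_contra hne
    have hp : 0 < ‖(f - 1) v‖ := norm_pos_iff.2 hne
    obtain ⟨k, hk⟩ := exists_nat_gt (2 * ‖v‖ / ‖(f - 1) v‖)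
    rw [div_lt_iff₀ hp] at hk
    have h2 : ‖(k : ℂ) • (f - 1) v‖ ≤ ‖ρ (g ^ k) v‖ + ‖v‖ := by
      rw [hpow k]
      calc ‖(k : ℂ) • (f - 1) v‖ = ‖(v + (k : ℂ) • (f - 1) v) - v‖ := by congr 1; abel
        _ ≤ _ := norm_sub_le _ _
    rw [norm_smul, Complex.norm_natCast] at h2
    have h3 := (ρ (g ^ k)).le_opNorm v
    have h4 := mul_le_mul_of_nonneg_right (hρ (g ^ k)) (norm_nonneg v)
    linarith
  have h2 : ∀ (k : ℕ) (v : E), ((f - 1) ^ (k + 1)) v = 0 → (f - 1) v = 0 := by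
    intro k
    induction k with
    | zero => intro v hv; simpa using hv
    | succ k ih =>
      intro v hv
      rw [pow_succ, End.mul_apply] at hv
      exact h1 v (ih _ hv)
  have htop := End.iSup_maxGenEigenspace_eq_top f
  have h3 : End.maxGenEigenspace f 1 = ⊤ := by
    rw [eq_top_iff, ← htop]
    refine iSup_le fun μ => ?_
    by_cases hμ : End.HasEigenvalue f μ
    · rw [h μ hμ]
    · have : End.maxGenEigenspace f μ = ⊥ := by
        by_contra hne
        refine hμ (End.hasEigenvalue_of_hasGenEigenvalue (k := finrank ℂ E) ?_)
        rw [End.maxGenEigenspace_eq_genEigenspace_finrank] at hne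
        exact hne
      rw [this]; exact bot_le
  ext v
  have hv : v ∈ End.maxGenEigenspace f 1 := h3 ▸ Submodule.mem_top
  rw [End.mem_maxGenEigenspace] at hv
  obtain ⟨k, hk⟩ := hv
  rw [one_smul] at hk
  have : (f - 1) v = 0 := h2 k v (by rw [pow_succ', End.mul_apply, hk, map_zero])
  rwa [LinearMap.sub_apply, sub_eq_zero] at this

end eigen

lemma exists_pos_forall_root_of_unity (n : ℕ) : ∃ δ > 0, ∀ (μ : ℂ) (m : ℕ), 0 < m → m ≤ n →
    μ ^ m = 1 → ‖μ - 1‖ < δ → μ = 1 := by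
  have hfin : {μ : ℂ | (∃ m, 0 < m ∧ m ≤ n ∧ μ ^ m = 1) ∧ μ ≠ 1}.Finite := by
    refine Set.Finite.subset (Set.Finite.biUnion (Set.finite_Icc 1 n)
      (fun m hm => (Polynomial.nthRoots m (1 : ℂ)).toFinset.finite_toSet)) ?_
    rintro μ ⟨⟨m, h1, h2, h3⟩, -⟩
    simp only [Set.mem_iUnion, Set.mem_Icc]
    exact ⟨m, ⟨h1, h2⟩, by simpa [Polynomial.mem_nthRoots h1] using h3⟩
  obtain ⟨δ, hδ, hb⟩ := Metric.isOpen_iff.1 hfin.isClosed.isOpen_compl 1 (by simp)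
  refine ⟨δ, hδ, fun μ m h1 h2 h3 h4 => ?_⟩
  by_contra hne
  exact hb (by rwa [Metric.mem_ball, dist_eq_norm]) ⟨⟨m, h1, h2, h3⟩, hne⟩

lemma exists_finite_closure {G : Type*} [Group G] (T : Set G) (h : (Subgroup.closure T).FG) :
    ∃ F : Set G, F.Finite ∧ F ⊆ T ∧ Subgroup.closure F = Subgroup.closure T := by
  obtain ⟨s, hs⟩ := h
  have key : ∀ x ∈ Subgroup.closure T, ∃ F : Set G, F.Finite ∧ F ⊆ T ∧ x ∈ Subgroup.closure F := by
    intro x hx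
    induction hx using closure_induction with
    | mem x hx => exact ⟨{x}, Set.finite_singleton x, by simpa, Subgroup.subset_closure rfl⟩
    | one => exact ⟨∅, Set.finite_empty, by simp, one_mem _⟩
    | mul x y _ _ hx hy =>
      obtain ⟨F, h1, h2, h3⟩ := hx
      obtain ⟨F', h1', h2', h3'⟩ := hy
      exact ⟨F ∪ F', h1.union h1', Set.union_subset h2 h2',
        mul_mem (Subgroup.closure_mono Set.subset_union_left h3)
          (Subgroup.closure_mono Set.subset_union_right h3')⟩
    | inv x _ hx =>
      obtain ⟨F, h1, h2, h3⟩ := hx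
      exact ⟨F, h1, h2, inv_mem h3⟩
  have hmem : ∀ x ∈ s, x ∈ Subgroup.closure T := fun x hx => hs ▸ Subgroup.subset_closure hx
  choose! F h1 h2 h3 using fun x hx => key x (hmem x hx)
  refine ⟨⋃ x ∈ s, F x, s.finite_toSet.biUnion fun x hx => h1 x hx,
    Set.iUnion₂_subset fun x hx => h2 x hx, le_antisymm (Subgroup.closure_mono
      (Set.iUnion₂_subset fun x hx => h2 x hx)) ?_⟩
  rw [← hs, closure_le]
  exact fun x hx => Subgroup.closure_mono (Set.subset_iUnion₂ (s := fun x _ => F x) x hx) (h3 x hx)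

/-- A finitely generated group of polynomial growth with a faithful bounded finite-dimensional
complex representation is virtually abelian. -/
theorem PolyGrowth.virtually_abelian {G : Type*} [Group G] [Group.FG G] {d : ℕ}
    (hG : PolyGrowth G d) {E : Type*} [NormedAddCommGroup E] [NormedSpace ℂ E]
    [FiniteDimensional ℂ E] (ρ : G →* (E →L[ℂ] E)) (hρ : ∀ g, ‖ρ g‖ ≤ 1)
    (hinj : Function.Injective ρ) :
    ∃ A : Subgroup G, A.FiniteIndex ∧ ∀ a ∈ A, ∀ b ∈ A, a * b = b * a := by
  classical
  obtain ⟨δ₁, hδ₁, hroot⟩ := exists_pos_forall_root_of_unity (finrank ℂ E)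
  set L : ℕ := 2 ^ (d + 1) with hL
  set δ : ℝ := min δ₁ (1 / (2 * (8 * L + 2))) with hδdef
  have hδ : 0 < δ := by positivity
  have hδ2 : (8 * L + 2) * (2 * δ) ≤ 1 := by
    have : δ ≤ 1 / (2 * (8 * L + 2)) := min_le_right _ _
    rw [le_div_iff₀ (by positivity)] at this
    linarith
  have hL1 : (1 : ℝ) ≤ L := by exact_mod_cast Nat.one_le_two_pow
  have hδ1 : δ ≤ 1 / 2 := by nlinarith
  set T₀ : Set G := {g | ‖ρ g - 1‖ < δ} with hT₀
  set A := Subgroup.closure T₀ with hA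
  have hAfi : A.FiniteIndex := by
    have : ProperSpace (E →L[ℂ] E) := FiniteDimensional.proper ℂ _
    obtain ⟨t, htf, ht⟩ := Metric.totallyBounded_iff.1
      (isCompact_closedBall (0 : E →L[ℂ] E) 1).totallyBounded (δ / 2) (by positivity)
    have hcov : ∀ g, ∃ c ∈ t, dist (ρ g) c < δ / 2 := by
      intro g
      have := ht (show ρ g ∈ Metric.closedBall 0 1 by simpa using hρ g)
      simpa using this
    choose c hc1 hc2 using hcov
    have : Finite t := htf
    have hfin : Finite (G ⧸ A) := by
      refine Finite.of_injective (β := t) (fun q => ⟨c (Quotient.out q), hc1 _⟩) fun q q' h => ?_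
      simp only [Subtype.mk.injEq] at h
      rw [← Quotient.out_eq' q, ← Quotient.out_eq' q']
      refine QuotientGroup.eq.2 (Subgroup.subset_closure ?_)
      have h1 := hc2 (Quotient.out q)
      have h2 := hc2 (Quotient.out q')
      rw [h] at h1
      have h3 := dist_triangle_right (ρ (Quotient.out q)) (ρ (Quotient.out q'))
        (c (Quotient.out q'))
      have h4 := norm_map_sub_map_le hρ (Quotient.out q)⁻¹ (Quotient.out q') (Quotient.out q)
      rw [inv_mul_cancel, map_one, ← dist_eq_norm (ρ (Quotient.out q')), dist_comm] at h4
      change ‖_‖ < δ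
      linarith
    exact finiteIndex_of_finite_quotient
  have hAfg : A.FG := (Group.fg_iff_subgroup_fg A).1 (fg_of_index_ne_zero A)
  obtain ⟨T, hTf, hTs, hTcl⟩ := exists_finite_closure T₀ hAfg
  refine ⟨A, hAfi, ?_⟩
  have hcent : ∀ z, (∀ t ∈ T, Commute z t) → ∀ a ∈ A, Commute z a := by
    intro z hz a ha
    rw [hA, ← hTcl] at ha
    have : Subgroup.closure T ≤ centralizer {z} := by
      rw [closure_le]
      intro t ht
      rw [SetLike.mem_coe, mem_centralizer_singleton_iff]
      exact (hz t ht).eq.symm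
    exact (show a * z = z * a from mem_centralizer_singleton_iff.1 (this ha)).symm
  suffices hTT : ∀ a ∈ T, ∀ b ∈ T, Commute a b by
    intro a ha b hb
    exact (hcent a (fun t ht => ((hcent t (hTT t ht) a ha).symm)) b hb).eq
  -- no nontrivial commutator of small elements is central
  have hnc : ∀ a ∈ A, ∀ b ∈ A, ‖ρ ⁅a, b⁆ - 1‖ < δ → ⁅a, b⁆ ≠ 1 → ∃ x ∈ T, ⁅⁅a, b⁆, x⁆ ≠ 1 := by
    intro a ha b hb hsm hne
    by_contra! hcon
    have hz := hcent ⁅a, b⁆ (fun t ht => commutatorElement_eq_one_iff_commute.1 (hcon t ht))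
    refine hne (hinj ?_)
    rw [map_one]
    refine map_eq_one_of_eigenvalues hρ fun μ hμ => ?_
    obtain ⟨m, h1, h2, h3⟩ := eigenvalue_pow_eq_one (hz a ha) (hz b hb) hμ
    exact hroot μ m h1 h2 h3 ((norm_eigenvalue_sub_one_le hμ).trans_lt
      (hsm.trans_le (min_le_left _ _)))
  have hTA : ∀ t ∈ T, t ∈ A := fun t ht => Subgroup.subset_closure (hTs ht)
  by_contra! hnon
  obtain ⟨a, ha, b, hb, hab⟩ := hnon
  have hcsm : ∀ g, ‖ρ g - 1‖ < δ → ∀ x ∈ T, ‖ρ ⁅g, x⁆ - 1‖ ≤ 2 * δ * ‖ρ g - 1‖ := by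
    intro g _ x hx
    have h1 := norm_map_commutator_sub_one hρ g x
    have h2 : ‖ρ x - 1‖ < δ := hTs hx
    nlinarith [norm_nonneg (ρ g - 1), norm_nonneg (ρ x - 1)]
  set S : Set G := insert 1 (T ∪ T⁻¹) with hS
  have hSf : S.Finite := (hTf.union hTf.inv).insert 1
  have hS1 : (1 : G) ∈ S := Set.mem_insert _ _
  have hSinv : S⁻¹ = S := by rw [hS]; ext x; simp [or_comm]
  have hTS : ∀ t ∈ T, t ∈ S := fun t ht => Or.inr (Or.inl ht)
  let P := {g : G // (∃ x ∈ A, ∃ y ∈ A, g = ⁅x, y⁆) ∧ ‖ρ g - 1‖ < δ ∧ g ≠ 1}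
  have hstep : ∀ g : P, ∃ g' : P, ∃ x ∈ T, g'.1 = ⁅g.1, x⁆ := by
    rintro ⟨g, ⟨x, hx, y, hy, rfl⟩, h2, h3⟩
    obtain ⟨t, ht, htne⟩ := hnc x hx y hy h2 h3
    refine ⟨⟨⁅⁅x, y⁆, t⁆, ⟨⁅x, y⁆, ?_, t, hTA t ht, rfl⟩, ?_, htne⟩, t, ht, rfl⟩
    · rw [commutatorElement_def]
      exact mul_mem (mul_mem (mul_mem hx hy) (inv_mem hx)) (inv_mem hy)
    · have := hcsm _ h2 t ht
      nlinarith [norm_nonneg (ρ ⁅x, y⁆ - 1)]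
  choose nxt hnxt using hstep
  have hab' : ‖ρ ⁅a, b⁆ - 1‖ < δ := by
    have h1 := hcsm a (hTs ha) b hb
    have h2 : ‖ρ a - 1‖ < δ := hTs ha
    nlinarith [norm_nonneg (ρ a - 1)]
  let g₀ : P := ⟨⁅a, b⁆, ⟨a, hTA a ha, b, hTA b hb, rfl⟩, hab',
    fun h => hab (commutatorElement_eq_one_iff_commute.1 h)⟩
  let g : ℕ → G := fun i => (nxt^[i] g₀).1
  have hg_succ : ∀ i, ∃ x ∈ T, g (i + 1) = ⁅g i, x⁆ := by
    intro i
    simp only [g, Function.iterate_succ_apply']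
    exact hnxt _
  have hg_prop := fun i => (nxt^[i] g₀).2
  have hcommlen : ∀ x y n m, x ∈ S ^ n → y ∈ S ^ m → ⁅x, y⁆ ∈ S ^ (n + m + n + m) := by
    intro x y n m hx hy
    have hinv : ∀ x n, x ∈ S ^ n → x⁻¹ ∈ S ^ n := by
      intro x n hx
      have : x⁻¹ ∈ (S ^ n)⁻¹ := Set.inv_mem_inv.2 hx
      rwa [← inv_pow, hSinv] at this
    rw [commutatorElement_def, pow_add, pow_add, pow_add]
    exact Set.mul_mem_mul (Set.mul_mem_mul (Set.mul_mem_mul hx hy) (hinv _ _ hx)) (hinv _ _ hy)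
  have hlen : ∀ i, g i ∈ S ^ (6 * 2 ^ i - 2) := by
    intro i
    induction i with
    | zero =>
      have := hcommlen a b 1 1 (by simpa using hTS a ha) (by simpa using hTS b hb)
      change ⁅a, b⁆ ∈ _
      simpa using this
    | succ i ih =>
      obtain ⟨x, hx, e⟩ := hg_succ i
      rw [e]
      have := hcommlen _ x _ 1 ih (by simpa using hTS x hx)
      have hp : 1 ≤ 2 ^ i := Nat.one_le_two_pow
      convert this using 2
      rw [pow_succ]; omega
  have hpowlen : ∀ i, ∀ k < L, g i ^ k ∈ S ^ (6 * L * 2 ^ i) := by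
    intro i k hk
    have h1 : g i ^ k ∈ S ^ ((6 * 2 ^ i - 2) * k) := by rw [pow_mul]; exact Set.pow_mem_pow (hlen i)
    refine Set.pow_subset_pow_right hS1 ?_ h1
    calc (6 * 2 ^ i - 2) * k ≤ (6 * 2 ^ i) * L := Nat.mul_le_mul (Nat.sub_le _ _) hk.le
      _ = _ := by ring
  have hpos : ∀ i, 0 < ‖ρ (g i) - 1‖ := fun i => norm_pos_iff.2 fun h =>
    (hg_prop i).2.2 (hinj (by rw [map_one]; exact sub_eq_zero.1 h))
  obtain ⟨C, hC⟩ := hG S hSf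
  have hwords : ∀ m, L ^ m ≤ C * (6 * L * 2 ^ m + 1) ^ d := by
    intro m
    obtain ⟨F, h1, h2, -⟩ := exists_words hρ (S := S) (L := L) g (fun i => 6 * L * 2 ^ i) hpowlen hpos
      (fun i => by have := (hg_prop i).2.1; change ‖ρ (g i) - 1‖ < δ at this; nlinarith)
      (fun i => by
        obtain ⟨x, hx, e⟩ := hg_succ i
        have h3 := hcsm (g i) (hg_prop i).2.1 x hx
        rw [e]
        have h4 := mul_le_mul_of_nonneg_left h3 (show (0 : ℝ) ≤ 8 * L + 2 by positivity)
        nlinarith [hpos i]) m 0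
    rw [← h1]
    refine (hC _ F h2).trans ?_
    gcongr
    rw [← mul_sum]
    gcongr
    simp only [zero_add]
    exact (Nat.geomSum_lt le_rfl (by simp)).le
  obtain ⟨m, hm⟩ := exists_nat_gt (C * (6 * L + 1) ^ d)
  have h1 := hwords m
  have h2 : C * (6 * L * 2 ^ m + 1) ^ d ≤ C * (6 * L + 1) ^ d * 2 ^ (m * d) := by
    rw [pow_mul, mul_assoc C, ← mul_pow]
    gcongr
    nlinarith [Nat.one_le_two_pow (n := m)]
  have h3 : L ^ m = 2 ^ m * 2 ^ (m * d) := by rw [hL, ← pow_mul, ← pow_add]; congr 1; ring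
  rw [h3] at h1
  have h4 := Nat.le_of_mul_le_mul_right (h1.trans h2) (by positivity)
  have h5 : m < 2 ^ m := Nat.lt_two_pow_self
  simp only [Nat.cast_id] at hm
  omega

end

namespace WalkGraph

variable {X : Type*} {Γ : WalkGraph X}

/-- The space of Lipschitz harmonic functions, to be normed by the Lipschitz constant. -/
def LipSpace (Γ : WalkGraph X) (o : X) : Type _ := Γ.lipHarm o

instance (o : X) : AddCommGroup (LipSpace Γ o) := inferInstanceAs (AddCommGroup (Γ.lipHarm o))
instance (o : X) : Module ℂ (LipSpace Γ o) := inferInstanceAs (Module ℂ (Γ.lipHarm o))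

def LipSpace.fn {o : X} (u : LipSpace Γ o) : X → ℂ := (Γ.lipHarm o).subtype u

lemma LipSpace.fn_add {o : X} (u v : LipSpace Γ o) : (u + v).fn = u.fn + v.fn := rfl

lemma LipSpace.fn_sub {o : X} (u v : LipSpace Γ o) : (u - v).fn = u.fn - v.fn := rfl

lemma LipSpace.fn_smul {o : X} (a : ℂ) (u : LipSpace Γ o) : (a • u).fn = a • u.fn := rfl

lemma LipSpace.fn_zero {o : X} : (0 : LipSpace Γ o).fn = 0 := rfl

lemma LipSpace.fn_injective {o : X} : Function.Injective (LipSpace.fn : LipSpace Γ o → X → ℂ) :=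
  (Γ.lipHarm o).injective_subtype

lemma LipSpace.fn_mem {o : X} (u : LipSpace Γ o) : u.fn ∈ Γ.lipHarm o := u.2

/-- The best Lipschitz constant. -/
def LipSpace.lip {o : X} (u : LipSpace Γ o) : ℝ :=
  ⨆ e : {e : X × X // e.2 ∈ Γ.nb e.1}, ‖u.fn e.1.2 - u.fn e.1.1‖

lemma LipSpace.le_lip {o : X} (u : LipSpace Γ o) {x y : X} (h : y ∈ Γ.nb x) :
    ‖u.fn y - u.fn x‖ ≤ u.lip := by
  obtain ⟨-, -, c, hc⟩ := u.fn_mem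
  refine le_ciSup (f := fun e : {e : X × X // e.2 ∈ Γ.nb e.1} => ‖u.fn e.1.2 - u.fn e.1.1‖)
    ⟨c, ?_⟩ ⟨(x, y), h⟩
  rintro _ ⟨e, rfl⟩
  exact hc _ _ e.2

lemma LipSpace.lip_le {o : X} {u : LipSpace Γ o} {c : ℝ}
    (h : ∀ x, ∀ y ∈ Γ.nb x, ‖u.fn y - u.fn x‖ ≤ c) : u.lip ≤ c := by
  have : Nonempty {e : X × X // e.2 ∈ Γ.nb e.1} := ⟨⟨(o, o), Γ.refl o⟩⟩
  exact ciSup_le fun e => h _ _ e.2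

lemma LipSpace.lip_nonneg {o : X} (u : LipSpace Γ o) : 0 ≤ u.lip :=
  (norm_nonneg _).trans (u.le_lip (Γ.refl o))

instance (o : X) : Norm (LipSpace Γ o) := ⟨LipSpace.lip⟩

lemma LipSpace.core (hc : Γ.Connected) (o : X) : NormedSpace.Core ℂ (LipSpace Γ o) where
  norm_nonneg := LipSpace.lip_nonneg
  norm_smul a u := by
    change LipSpace.lip _ = ‖a‖ * LipSpace.lip _
    have key : ∀ (a : ℂ) (u : LipSpace Γ o), (a • u).lip ≤ ‖a‖ * u.lip := by
      intro a u
      refine LipSpace.lip_le fun x y h => ?_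
      rw [LipSpace.fn_smul, Pi.smul_apply, Pi.smul_apply, ← smul_sub, norm_smul]
      gcongr
      exact u.le_lip h
    refine le_antisymm (key a u) ?_
    rcases eq_or_ne a 0 with rfl | ha
    · rw [norm_zero, zero_mul]; exact LipSpace.lip_nonneg _
    · have := key a⁻¹ (a • u)
      rw [inv_smul_smul₀ ha, norm_inv] at this
      rwa [← le_inv_mul_iff₀ (norm_pos_iff.2 ha)]
  norm_triangle u v := by
    change LipSpace.lip _ ≤ u.lip + v.lip
    refine LipSpace.lip_le fun x y h => ?_
    rw [LipSpace.fn_add, Pi.add_apply, Pi.add_apply, add_sub_add_comm]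
    exact (norm_add_le _ _).trans (add_le_add (u.le_lip h) (v.le_lip h))
  norm_eq_zero_iff u := by
    constructor
    · intro h
      apply LipSpace.fn_injective
      rw [LipSpace.fn_zero]
      ext x
      obtain ⟨r, hr⟩ := hc o x
      have h1 := Γ.norm_sub_le_of_mem_ball (fun x y hy => u.le_lip hy) o r x hr
      rw [show u.lip = 0 from h, u.fn_mem.2.1, zero_mul, sub_zero] at h1
      simpa using h1
    · rintro rfl
      exact le_antisymm (LipSpace.lip_le fun x y _ => by simp [LipSpace.fn_zero]) (LipSpace.lip_nonneg _)

variable {H : Type*} [Group H] [MulAction H X]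

lemma Invariant.mem_nb_iff (hinv : Γ.Invariant H) (h : H) {x y : X} :
    h • y ∈ Γ.nb (h • x) ↔ y ∈ Γ.nb x :=
  ⟨fun e => by simpa using hinv h⁻¹ _ _ e, hinv h x y⟩

/-- The translation action on Lipschitz harmonic functions vanishing at `o`. -/
def Invariant.translate (hinv : Γ.Invariant H) (o : X) (h : H) :
    LipSpace Γ o →ₗ[ℂ] LipSpace Γ o where
  toFun u := ⟨fun x => u.fn (h⁻¹ • x) - u.fn (h⁻¹ • o), by
    obtain ⟨h1, -, c, hc⟩ := u.fn_mem
    refine ⟨?_, sub_self _, c, fun x y hy => ?_⟩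
    · have : Nonempty X := ⟨o⟩
      change Γ.avg ((fun x => u.fn (h⁻¹ • x)) - fun _ => u.fn (h⁻¹ • o)) = _
      rw [map_sub, avg_const]
      ext x
      rw [Pi.sub_apply, ← hinv.avg_smul, h1]
    · simpa using hc _ _ ((hinv.mem_nb_iff h⁻¹).2 hy)⟩
  map_add' u v := LipSpace.fn_injective (by
    ext x
    change (u + v).fn (h⁻¹ • x) - (u + v).fn (h⁻¹ • o) =
      (u.fn (h⁻¹ • x) - u.fn (h⁻¹ • o)) + (v.fn (h⁻¹ • x) - v.fn (h⁻¹ • o))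
    simp only [LipSpace.fn_add, Pi.add_apply]; ring)
  map_smul' a u := LipSpace.fn_injective (by
    ext x
    change (a • u).fn (h⁻¹ • x) - (a • u).fn (h⁻¹ • o) = a • (u.fn (h⁻¹ • x) - u.fn (h⁻¹ • o))
    simp only [LipSpace.fn_smul, Pi.smul_apply, smul_eq_mul]; ring)

lemma Invariant.fn_translate (hinv : Γ.Invariant H) (o : X) (h : H) (u : LipSpace Γ o) (x : X) :
    (hinv.translate o h u).fn x = u.fn (h⁻¹ • x) - u.fn (h⁻¹ • o) := rfl

lemma Invariant.lip_translate_le (hinv : Γ.Invariant H) (o : X) (h : H) (u : LipSpace Γ o) :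
    (hinv.translate o h u).lip ≤ u.lip := by
  refine LipSpace.lip_le fun x y hy => ?_
  rw [hinv.fn_translate, hinv.fn_translate, sub_sub_sub_cancel_right]
  exact u.le_lip ((hinv.mem_nb_iff h⁻¹).2 hy)

/-- A finite-dimensional space of functions is determined by finitely many values. -/
lemma LipSpace.exists_finset (o : X) [Module.Finite ℂ (LipSpace Γ o)] :
    ∃ F : Finset X, ∀ u : LipSpace Γ o, (∀ x ∈ F, u.fn x = 0) → u = 0 := by
  classical
  let N : Finset X → Submodule ℂ (LipSpace Γ o) := fun F =>
    ⨅ x ∈ F, LinearMap.ker ((LinearMap.proj (R := ℂ) (φ := fun _ : X => ℂ) x).comp (Γ.lipHarm o).subtype :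
      LipSpace Γ o →ₗ[ℂ] ℂ)
  have hN : ∀ F u, u ∈ N F ↔ ∀ x ∈ F, u.fn x = 0 := fun F u => by
    simp only [N, Submodule.mem_iInf, LinearMap.mem_ker]; rfl
  obtain ⟨F, hF⟩ : ∃ F, ∀ F', ¬ N F' < N F := by
    obtain ⟨m, ⟨F, rfl⟩, hm⟩ := WellFounded.has_min (wellFounded_lt (α := Submodule ℂ (LipSpace Γ o)))
      (Set.range N) ⟨_, ∅, rfl⟩
    exact ⟨F, fun F' => hm _ ⟨F', rfl⟩⟩
  refine ⟨F, fun u hu => LipSpace.fn_injective ?_⟩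
  rw [LipSpace.fn_zero]
  ext x
  by_contra hx
  refine hF (insert x F) (lt_of_le_of_ne (fun v hv => (hN _ _).2 fun y hy => (hN _ _).1 hv y
    (Finset.mem_insert_of_mem hy)) fun e => hx ?_)
  have := (hN F u).2 hu
  rw [← e] at this
  exact (hN _ _).1 this x (Finset.mem_insert_self _ _)

theorem Invariant.exists_rep.{u, v} {X : Type u} {Γ : WalkGraph X} {H : Type v} [Group H]
    [MulAction H X] [MulAction.IsPretransitive H X] (hinv : Γ.Invariant H)
    (hc : Γ.Connected) (o : X) {C d : ℕ} (hg : Γ.BallLE o C d) :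
    ∃ (E : Type u) (_ : NormedAddCommGroup E) (_ : NormedSpace ℂ E) (_ : FiniteDimensional ℂ E)
      (ρ : H →* (E →L[ℂ] E)), (∀ h, ‖ρ h‖ ≤ 1) ∧
      (∃ F : Finset X, ∀ h : H, (∀ x ∈ F, h • x = x) → ρ h = 1) ∧
      ∀ h, ρ h = 1 → ∀ u ∈ Γ.lipHarm o, ∀ x, u (h⁻¹ • x) - u (h⁻¹ • o) = u x := by
  classical
  let i1 : NormedAddCommGroup (LipSpace Γ o) := NormedAddCommGroup.ofCore (LipSpace.core hc o)
  let i2 : NormedSpace ℂ (LipSpace Γ o) := NormedSpace.ofCore (LipSpace.core hc o)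
  have hfin : Module.Finite ℂ (LipSpace Γ o) := hinv.finite_lipHarm hc hg
  have hle : ∀ h u, ‖hinv.translate o h u‖ ≤ 1 * ‖u‖ := fun h u => by
    rw [one_mul]; exact hinv.lip_translate_le o h u
  let ρ : H →* (LipSpace Γ o →L[ℂ] LipSpace Γ o) :=
    { toFun := fun h => (hinv.translate o h).mkContinuous 1 (hle h)
      map_one' := by
        ext u
        apply LipSpace.fn_injective
        ext x
        change u.fn ((1 : H)⁻¹ • x) - u.fn ((1 : H)⁻¹ • o) = u.fn x
        rw [inv_one, one_smul, one_smul, u.fn_mem.2.1, sub_zero]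
      map_mul' := fun g h => by
        ext u
        apply LipSpace.fn_injective
        ext x
        change u.fn ((g * h)⁻¹ • x) - u.fn ((g * h)⁻¹ • o) =
          (u.fn (h⁻¹ • g⁻¹ • x) - u.fn (h⁻¹ • o)) - (u.fn (h⁻¹ • g⁻¹ • o) - u.fn (h⁻¹ • o))
        rw [mul_inv_rev, mul_smul, mul_smul]; ring }
  refine ⟨LipSpace Γ o, i1, i2, hfin, ρ, fun h => LinearMap.mkContinuous_norm_le _ zero_le_one (hle h),
    ?_, fun h hh u hu x => ?_⟩
  · obtain ⟨F, hF⟩ := LipSpace.exists_finset (Γ := Γ) o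
    refine ⟨insert o F, fun h hh => ?_⟩
    have hh' : ∀ x ∈ insert o F, h⁻¹ • x = x := fun x hx => by
      conv_lhs => rw [← hh x hx]
      rw [inv_smul_smul]
    ext u
    rw [← sub_eq_zero]
    refine hF _ fun x hx => ?_
    rw [LipSpace.fn_sub, Pi.sub_apply, sub_eq_zero]
    change u.fn (h⁻¹ • x) - u.fn (h⁻¹ • o) = u.fn x
    rw [hh' x (Finset.mem_insert_of_mem hx), hh' o (Finset.mem_insert_self _ _), u.fn_mem.2.1,
      sub_zero]
  · have := congrArg (fun T : LipSpace Γ o →L[ℂ] LipSpace Γ o => (T ⟨u, hu⟩).fn x) hh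
    exact this

end WalkGraph

section
open Subgroup QuotientGroup

/-- A group `H` with a subgroup `K` and a generating set `S`, a union of cosets of `K`, such
that balls in the coset graph have polynomially bounded size. -/
structure GrowthData {H : Type*} [Group H] (K : Subgroup H) (S : Set H) (d : ℕ) : Prop where
  one_mem : (1 : H) ∈ S
  inv_mem : ∀ s ∈ S, s⁻¹ ∈ S
  mul_mem : ∀ s ∈ S, ∀ k ∈ K, s * k ∈ S
  closure_eq : Subgroup.closure S = ⊤
  growth : ∃ C : ℕ, ∀ r : ℕ, ∀ F : Finset H, (F : Set H) ⊆ S ^ r →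
    Set.InjOn (fun h : H => (h : H ⧸ K)) F → F.card ≤ C * (r + 1) ^ d

/-- A subgroup which contains the pointwise stabilizer of finitely many cosets of `K`. -/
def OpenSubgroup' {H : Type*} [Group H] (K U : Subgroup H) : Prop :=
  ∃ F : Finset H, ∀ k : H, (∀ g ∈ F, g⁻¹ * k * g ∈ K) → k ∈ U

variable {H : Type*} [Group H] {K : Subgroup H} {S : Set H} {d : ℕ}

lemma OpenSubgroup'.mono {U U' : Subgroup H} (h : OpenSubgroup' K U) (hU : U ≤ U') :
    OpenSubgroup' K U' := by
  obtain ⟨F, hF⟩ := h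
  exact ⟨F, fun k hk => hU (hF k hk)⟩

lemma OpenSubgroup'.inf {U U' : Subgroup H} (h : OpenSubgroup' K U) (h' : OpenSubgroup' K U') :
    OpenSubgroup' K (U ⊓ U') := by
  classical
  obtain ⟨F, hF⟩ := h
  obtain ⟨F', hF'⟩ := h'
  exact ⟨F ∪ F', fun k hk => ⟨hF k fun g hg => hk g (mem_union_left _ hg),
    hF' k fun g hg => hk g (mem_union_right _ hg)⟩⟩

lemma openSubgroup'_self : OpenSubgroup' K K := ⟨{1}, fun k hk => by simpa using hk 1 (by simp)⟩

lemma OpenSubgroup'.normalCore {U : Subgroup H} (h : OpenSubgroup' K U) [U.FiniteIndex] :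
    OpenSubgroup' K U.normalCore := by
  classical
  obtain ⟨F, hF⟩ := h
  have := Fintype.ofFinite (H ⧸ U)
  refine ⟨univ.biUnion fun q : H ⧸ U => F.image fun g => (Quotient.out q) * g,
    fun k hk b => ?_⟩
  obtain ⟨u, hu⟩ := mk_out_eq_mul U b⁻¹
  set r := Quotient.out (QuotientGroup.mk b⁻¹ : H ⧸ U) with hr
  have h1 : r⁻¹ * k * r ∈ U := hF _ fun g hg => by
    have := hk (r * g) (mem_biUnion.2 ⟨_, mem_univ _, mem_image.2 ⟨g, hg, rfl⟩⟩)
    simpa [mul_assoc] using this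
  rw [hu] at h1
  have := U.mul_mem (U.mul_mem u.2 h1) (U.inv_mem u.2)
  simpa [mul_assoc] using this

namespace GrowthData

variable (hD : GrowthData K S d)
include hD

lemma pow_mono {m n : ℕ} (h : m ≤ n) : S ^ m ⊆ S ^ n := Set.pow_subset_pow_right hD.one_mem h

lemma inv_eq : S⁻¹ = S := Set.Subset.antisymm (fun x hx => by simpa using hD.inv_mem _ hx)
  fun x hx => hD.inv_mem _ hx

lemma inv_mem_pow {x : H} {n : ℕ} (h : x ∈ S ^ n) : x⁻¹ ∈ S ^ n := by
  have : x⁻¹ ∈ (S ^ n)⁻¹ := Set.inv_mem_inv.2 h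
  rwa [← inv_pow, hD.inv_eq] at this

lemma mul_mem_pow {x y : H} {m n : ℕ} (hx : x ∈ S ^ m) (hy : y ∈ S ^ n) : x * y ∈ S ^ (m + n) := by
  rw [pow_add]; exact Set.mul_mem_mul hx hy

lemma subset_K : (K : Set H) ⊆ S := fun k hk => by simpa using hD.mul_mem 1 hD.one_mem k hk

lemma mul_mem_left {s k : H} (hs : s ∈ S) (hk : k ∈ K) : k * s ∈ S := by
  have := hD.inv_mem _ (hD.mul_mem _ (hD.inv_mem s hs) k⁻¹ (K.inv_mem hk))
  simpa using this

lemma exists_mem_pow (h : H) : ∃ r, h ∈ S ^ r := by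
  have hh : h ∈ Subgroup.closure S := by rw [hD.closure_eq]; trivial
  induction hh using Subgroup.closure_induction with
  | mem x hx => exact ⟨1, by simpa using hx⟩
  | one => exact ⟨0, by simp⟩
  | mul x y _ _ hx hy =>
    obtain ⟨r, hr⟩ := hx
    obtain ⟨s, hs⟩ := hy
    exact ⟨r + s, hD.mul_mem_pow hr hs⟩
  | inv x _ hx => exact hx.imp fun r hr => hD.inv_mem_pow hr

lemma exists_subset_pow {F : Set H} (hF : F.Finite) : ∃ r, F ⊆ S ^ r := by
  choose f hf using hD.exists_mem_pow
  obtain ⟨r, hr⟩ := (hF.image f).bddAbove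
  exact ⟨r, fun x hx => hD.pow_mono (hr ⟨x, hx, rfl⟩) (hf x)⟩

lemma exists_card_le : ∃ C : ℕ, ∀ r : ℕ, ∀ T : Finset (H ⧸ K),
    (T : Set (H ⧸ K)) ⊆ QuotientGroup.mk '' S ^ r → T.card ≤ C * (r + 1) ^ d := by
  classical
  obtain ⟨C, hC⟩ := hD.growth
  refine ⟨C, fun r T hT => ?_⟩
  have : ∀ t : T, ∃ s ∈ S ^ r, (s : H ⧸ K) = t := fun t => hT t.2
  choose f hf1 hf2 using this
  have hinj : Function.Injective f := fun a b h => Subtype.ext (by rw [← hf2, ← hf2, h])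
  have := hC r (univ.image f) (by
    intro x hx
    obtain ⟨t, -, rfl⟩ := mem_image.1 hx
    exact hf1 t) (by
    intro x hx y hy hxy
    obtain ⟨t, -, rfl⟩ := mem_image.1 hx
    obtain ⟨t', -, rfl⟩ := mem_image.1 hy
    simp only [hf2] at hxy
    rw [Subtype.ext hxy])
  rwa [card_image_of_injective _ hinj, card_univ, Fintype.card_coe] at this

lemma finite_image (r : ℕ) : ((QuotientGroup.mk : H → H ⧸ K) '' S ^ r).Finite := by
  obtain ⟨C, hC⟩ := hD.exists_card_le
  by_contra h
  obtain ⟨T, hT, hc⟩ := Set.Infinite.exists_subset_card_eq h (C * (r + 1) ^ d + 1)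
  have := hC r T hT
  omega

lemma finite_image_of_open {U : Subgroup H} (hU : OpenSubgroup' K U) (r : ℕ) :
    ((QuotientGroup.mk : H → H ⧸ U) '' S ^ r).Finite := by
  classical
  obtain ⟨F, hF⟩ := hU
  obtain ⟨m, hm⟩ := hD.exists_subset_pow F.finite_toSet
  let φ : H → (F → H ⧸ K) := fun h g => ((h * g : H) : H ⧸ K)
  have h1 : (φ '' S ^ r).Finite := by
    refine (Set.Finite.pi' (fun _ : F => hD.finite_image (r + m))).subset ?_
    rintro _ ⟨h, hh, rfl⟩ g
    exact ⟨h * g, hD.mul_mem_pow hh (hm g.2), rfl⟩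
  obtain ⟨T, hT, hTe⟩ := (Set.exists_subset_bijOn (S ^ r) φ)
  have hTf : T.Finite := Set.Finite.of_finite_image (by rwa [hTe.image_eq]) hTe.injOn
  refine (hTf.image (QuotientGroup.mk : H → H ⧸ U)).subset ?_
  rintro _ ⟨h, hh, rfl⟩
  obtain ⟨t, ht, e⟩ := hTe.surjOn ⟨h, hh, rfl⟩
  refine ⟨t, ht, QuotientGroup.eq.2 (hF _ fun g hg => ?_)⟩
  have := congrFun e ⟨g, hg⟩
  have := QuotientGroup.eq.1 this
  simpa [mul_assoc] using this

lemma exists_closure_finiteIndex (L : Subgroup H) [L.FiniteIndex] :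
    ∃ k, Subgroup.closure (S ^ k ∩ L) = L := by
  obtain ⟨R, hR, hR1⟩ := L.exists_isComplement_right 1
  have hRf : R.Finite := hR.finite_right
  obtain ⟨m, hm⟩ := hD.exists_subset_pow hRf
  refine ⟨m + 1 + m, le_antisymm ((Subgroup.closure_le _).2 Set.inter_subset_right) ?_⟩
  conv_lhs => rw [← Subgroup.closure_mul_image_eq hR hR1 hD.closure_eq]
  refine Subgroup.closure_mono ?_
  rintro _ ⟨g, hg, rfl⟩
  obtain ⟨r, hr, s, hs, rfl⟩ := hg
  refine ⟨hD.mul_mem_pow (hD.mul_mem_pow (hm hr) (by simpa using hs))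
    (hD.inv_mem_pow (hm (Subtype.prop _))), hR.mul_inv_toRightFun_mem _⟩

lemma polyGrowth_quotient {U : Subgroup H} [U.Normal] (hU : OpenSubgroup' K U) :
    PolyGrowth (H ⧸ U) d := by
  classical
  intro T hT
  obtain ⟨C, hC⟩ := hD.exists_card_le
  obtain ⟨m, hm⟩ := hD.exists_subset_pow (hT.image Quotient.out)
  have hKf : ((QuotientGroup.mk : H → H ⧸ U) '' K).Finite :=
    (hD.finite_image_of_open hU 1).subset (Set.image_mono (by simpa using hD.subset_K))
  set c := hKf.toFinset.card
  refine ⟨c * (C * (m + 1) ^ d), fun r F hF => ?_⟩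
  have hlift : ∀ r, ∀ q ∈ T ^ r, ∃ h ∈ S ^ (m * r), (h : H ⧸ U) = q := by
    intro r
    induction r with
    | zero => intro q hq; exact ⟨1, by simp, by simpa using hq.symm⟩
    | succ r ih =>
      intro q hq
      rw [pow_succ] at hq
      obtain ⟨a, ha, b, hb, rfl⟩ := hq
      obtain ⟨h, hh, rfl⟩ := ih a ha
      refine ⟨h * Quotient.out b, ?_, ?_⟩
      · rw [mul_add, mul_one]
        exact hD.mul_mem_pow hh (hm ⟨b, hb, rfl⟩)
      · rw [mk_mul, out_eq']
  choose! f hf1 hf2 using hlift r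
  have h1 : F.card ≤ c * (F.image fun q => ((f q : H) : H ⧸ K)).card := by
    refine card_le_mul_card_image _ _ fun b hb => ?_
    obtain ⟨q₀, hq₀, rfl⟩ := mem_image.1 hb
    refine card_le_card_of_injOn (fun q => q₀⁻¹ * q) ?_ ?_
    · intro q hq
      rw [mem_coe, mem_filter] at hq
      rw [Set.Finite.coe_toFinset]
      refine ⟨(f q₀)⁻¹ * f q, QuotientGroup.eq.1 hq.2.symm, ?_⟩
      rw [mk_mul, mk_inv, hf2 _ (hF hq₀), hf2 _ (hF hq.1)]
    · intro a _ b _ hab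
      exact mul_left_cancel hab
  have h2 : (F.image fun q => ((f q : H) : H ⧸ K)).card ≤ C * (m * r + 1) ^ d := by
    refine hC _ _ ?_
    intro x hx
    obtain ⟨q, hq, rfl⟩ := mem_image.1 hx
    exact ⟨f q, hf1 _ (hF hq), rfl⟩
  calc F.card ≤ c * (C * (m * r + 1) ^ d) := h1.trans (Nat.mul_le_mul_left _ h2)
    _ ≤ c * (C * ((m + 1) * (r + 1)) ^ d) := by gcongr; nlinarith
    _ = _ := by rw [mul_pow]; ring

lemma fg_quotient {U : Subgroup H} [U.Normal] (hU : OpenSubgroup' K U) : Group.FG (H ⧸ U) := by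
  have hf := hD.finite_image_of_open hU 1
  rw [pow_one] at hf
  refine ⟨hf.toFinset, ?_⟩
  rw [Set.Finite.coe_toFinset]
  have := MonoidHom.map_closure (mk' U) S
  rw [hD.closure_eq, ← MonoidHom.range_eq_map, range_mk'] at this
  exact this.symm

end GrowthData

lemma exists_surjective_hom_int (A : Type*) [CommGroup A] [Group.FG A] [Infinite A] :
    ∃ χ : A →* Multiplicative ℤ, Function.Surjective χ := by
  obtain ⟨n, ι, _, p, hp, e, ⟨φ⟩⟩ := AddCommGroup.equiv_free_prod_directSum_zmod (Additive A)
  rcases Nat.eq_zero_or_pos n with rfl | hn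
  · exfalso
    have : ∀ i, NeZero (p i ^ e i) := fun i => ⟨pow_ne_zero _ (hp i).ne_zero⟩
    have h1 : Finite (DirectSum ι fun i => ZMod (p i ^ e i)) := by
      classical
      exact Finite.of_injective (fun f : DirectSum ι fun i => ZMod (p i ^ e i) =>
        (fun i => f i : ∀ i, ZMod (p i ^ e i))) DFunLike.coe_injective
    have : Finite (Additive A) := Finite.of_equiv _ φ.symm.toEquiv
    exact not_finite (Additive A)
  · let f : (Fin n →₀ ℤ) × (DirectSum ι fun i => ZMod (p i ^ e i)) →+ ℤ :=
      (Finsupp.applyAddHom (⟨0, hn⟩ : Fin n)).comp (AddMonoidHom.fst _ _)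
    refine ⟨AddMonoidHom.toMultiplicativeRight (f.comp φ.toAddMonoidHom), fun z => ?_⟩
    refine ⟨Additive.toMul (φ.symm (Finsupp.single ⟨0, hn⟩ (Multiplicative.toAdd z), 0)), ?_⟩
    simp [f]

/-- The group generated by the conjugates of `T` by `t ^ i`, `i ≤ r`. -/
def conjClosure (t : H) (T : Set H) (r : ℕ) : Subgroup H :=
  Subgroup.closure {x | ∃ i ≤ r, ∃ m ∈ T, x = t ^ i * m * (t ^ i)⁻¹}

lemma conjClosure_mono (t : H) (T : Set H) {r s : ℕ} (h : r ≤ s) :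
    conjClosure t T r ≤ conjClosure t T s :=
  Subgroup.closure_mono fun _ ⟨i, hi, m, hm, e⟩ => ⟨i, hi.trans h, m, hm, e⟩

lemma mem_conjClosure {t : H} {T : Set H} {r i : ℕ} (hi : i ≤ r) {m : H} (hm : m ∈ T) :
    t ^ i * m * (t ^ i)⁻¹ ∈ conjClosure t T r :=
  Subgroup.subset_closure ⟨i, hi, m, hm, rfl⟩

namespace GrowthData

lemma exists_hom_int_of_infinite_range (hD : GrowthData K S d) {L : Subgroup H} [L.FiniteIndex]
    {B : Type*} [CommGroup B] (ψ : L →* B) (hψ : OpenSubgroup' K (ψ.ker.map L.subtype))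
    (hinf : Infinite ψ.range) :
    ∃ H₁ : Subgroup H, H₁.Normal ∧ H₁.FiniteIndex ∧ ∃ χ : H₁ →* Multiplicative ℤ,
      Function.Surjective χ ∧ OpenSubgroup' K (χ.ker.map H₁.subtype) := by
  have hLo : OpenSubgroup' K L := hψ.mono (map_subtype_le _)
  have hfi : L.normalCore.FiniteIndex := inferInstance
  set ψ' : L.normalCore →* B := ψ.comp (inclusion L.normalCore_le) with hψ'
  have hinf' : Infinite ψ'.range := by
    by_contra h
    rw [not_infinite_iff_finite] at h
    have e : ψ'.range = (L.normalCore.subgroupOf L).map ψ := by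
      rw [hψ', MonoidHom.range_comp, inclusion_range]
    have hi := index_map (L.normalCore.subgroupOf L) ψ
    have hfi2 : (L.normalCore.subgroupOf L).FiniteIndex := inferInstance
    have : (ψ'.range.subgroupOf ψ.range).FiniteIndex := by
      refine ⟨?_⟩
      have h3 : ψ'.range.subgroupOf ψ.range = (L.normalCore.subgroupOf L).map ψ.rangeRestrict := by
        ext ⟨x, hx⟩
        rw [mem_subgroupOf, e]
        simp only [Subgroup.mem_map]
        exact ⟨fun ⟨y, h1, h2⟩ => ⟨y, h1, Subtype.ext h2⟩,
          fun ⟨y, h1, h2⟩ => ⟨y, h1, congrArg Subtype.val h2⟩⟩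
      rw [h3, index_map, MonoidHom.range_eq_top.2 ψ.rangeRestrict_surjective,
        index_top, mul_one]
      exact ((finiteIndex_of_le le_sup_left :
        ((L.normalCore.subgroupOf L) ⊔ _).FiniteIndex)).index_ne_zero
    have hf : Finite (ψ'.range.subgroupOf ψ.range) :=
      Finite.of_injective (fun x => (⟨x.1.1, x.2⟩ : ψ'.range)) fun a b hab => by
        have := congrArg Subtype.val hab
        exact Subtype.ext (Subtype.ext this)
    have : Finite ψ.range := by
      have := finite_quotient_of_finiteIndex (H := ψ'.range.subgroupOf ψ.range)
      exact Finite.of_equiv _ (groupEquivQuotientProdSubgroup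
        (s := ψ'.range.subgroupOf ψ.range)).symm
    exact not_finite ψ.range
  have hker : OpenSubgroup' K (ψ'.ker.map L.normalCore.subtype) := by
    refine (hψ.inf hLo.normalCore).mono ?_
    rintro x ⟨⟨y, hy, rfl⟩, hx⟩
    exact ⟨⟨y, hx⟩, hy, rfl⟩
  have hfg : Group.FG ψ'.range := by
    rw [Group.fg_iff_subgroup_fg]
    obtain ⟨k, hk⟩ := hD.exists_closure_finiteIndex L.normalCore
    set T : Set L.normalCore := L.normalCore.subtype ⁻¹' (S ^ k) with hT
    have hTc : Subgroup.closure T = ⊤ := by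
      apply Subgroup.map_injective L.normalCore.subtype_injective
      rw [MonoidHom.map_closure, ← MonoidHom.range_eq_map, range_subtype]
      convert hk using 2
      ext x
      constructor
      · rintro ⟨y, hy, rfl⟩; exact ⟨hy, y.2⟩
      · rintro ⟨h1, h2⟩; exact ⟨⟨x, h2⟩, h1, rfl⟩
    have hTf : (ψ' '' T).Finite := by
      have hfin := hD.finite_image_of_open hker k
      obtain ⟨R, hR, hRe⟩ := Set.exists_subset_bijOn T
        (fun y => (QuotientGroup.mk (y : H) : H ⧸ ψ'.ker.map L.normalCore.subtype))
      have hRf : R.Finite := Set.Finite.of_finite_image (hfin.subset (by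
        rintro _ ⟨y, hy, rfl⟩; exact ⟨y, hR hy, rfl⟩)) hRe.injOn
      refine (hRf.image ψ').subset ?_
      rintro _ ⟨y, hy, rfl⟩
      obtain ⟨t, ht, e⟩ := hRe.surjOn ⟨y, hy, rfl⟩
      refine ⟨t, ht, ?_⟩
      obtain ⟨z, hz, hz'⟩ := QuotientGroup.eq.1 e
      have : z = t⁻¹ * y := Subtype.ext hz'
      subst this
      have : ψ' (t⁻¹ * y) = 1 := hz
      rw [map_mul, map_inv, inv_mul_eq_one] at this
      exact this
    refine ⟨hTf.toFinset, ?_⟩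
    rw [Set.Finite.coe_toFinset, ← MonoidHom.map_closure, hTc, MonoidHom.range_eq_map]
  obtain ⟨χ, hχ⟩ := exists_surjective_hom_int ψ'.range
  refine ⟨L.normalCore, inferInstance, hfi, χ.comp ψ'.rangeRestrict,
    hχ.comp ψ'.rangeRestrict_surjective, hker.mono (Subgroup.map_mono fun x hx => ?_)⟩
  have : ψ'.rangeRestrict x = 1 := Subtype.ext hx
  rw [MonoidHom.mem_ker, MonoidHom.comp_apply, this, map_one]

variable (hD : GrowthData K S d)
include hD

lemma finite_nb (x : H ⧸ K) : {y : H ⧸ K | ∃ g s : H, s ∈ S ∧ (g : H ⧸ K) = x ∧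
    ((g * s : H) : H ⧸ K) = y}.Finite := by
  obtain ⟨g₀, rfl⟩ := mk_surjective x
  have h1 := hD.finite_image 1
  rw [pow_one] at h1
  refine (h1.image (fun y => g₀ • y)).subset ?_
  rintro _ ⟨g, s, hs, e, rfl⟩
  refine ⟨_, ⟨g₀⁻¹ * g * s, hD.mul_mem_left hs (QuotientGroup.eq.1 e.symm), rfl⟩, ?_⟩
  change ((g₀ * (g₀⁻¹ * g * s) : H) : H ⧸ K) = _
  congr 1; group

def graph : WalkGraph (H ⧸ K) where
  nb x := (hD.finite_nb x).toFinset
  deg := (hD.finite_nb ((1 : H) : H ⧸ K)).toFinset.card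
  symm := by
    intro x y h
    rw [Set.Finite.mem_toFinset] at h ⊢
    obtain ⟨g, s, hs, rfl, rfl⟩ := h
    exact ⟨g * s, s⁻¹, hD.inv_mem s hs, rfl, by simp⟩
  refl x := by
    rw [Set.Finite.mem_toFinset]
    obtain ⟨g, rfl⟩ := mk_surjective x
    exact ⟨g, 1, hD.one_mem, rfl, by simp⟩
  card_nb x := by
    obtain ⟨g₀, rfl⟩ := mk_surjective x
    symm
    refine Finset.card_bij (fun y _ => g₀ • y) ?_ (fun a _ b _ h => smul_left_cancel g₀ h) ?_
    · intro y hy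
      rw [Set.Finite.mem_toFinset] at hy ⊢
      obtain ⟨g, s, hs, e, rfl⟩ := hy
      refine ⟨g₀ * g, s, hs, ?_, ?_⟩
      · change g₀ • (g : H ⧸ K) = _
        rw [e]
        change ((g₀ * 1 : H) : H ⧸ K) = _
        rw [mul_one]
      · rw [mul_assoc]; rfl
    · intro y hy
      rw [Set.Finite.mem_toFinset] at hy
      obtain ⟨g, s, hs, e, rfl⟩ := hy
      refine ⟨g₀⁻¹ • ((g * s : H) : H ⧸ K), ?_, smul_inv_smul _ _⟩
      rw [Set.Finite.mem_toFinset]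
      refine ⟨g₀⁻¹ * g, s, hs, ?_, ?_⟩
      · change g₀⁻¹ • (g : H ⧸ K) = _
        rw [e]
        change ((g₀⁻¹ * g₀ : H) : H ⧸ K) = _
        rw [inv_mul_cancel]
      · rw [mul_assoc]; rfl

lemma mem_graph_nb {x y : H ⧸ K} : y ∈ hD.graph.nb x ↔
    ∃ g s : H, s ∈ S ∧ (g : H ⧸ K) = x ∧ ((g * s : H) : H ⧸ K) = y :=
  Set.Finite.mem_toFinset _

lemma graph_invariant : hD.graph.Invariant H := by
  intro h x y hy
  rw [mem_graph_nb] at hy ⊢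
  obtain ⟨g, s, hs, rfl, rfl⟩ := hy
  exact ⟨h * g, s, hs, rfl, by rw [mul_assoc]; rfl⟩

lemma mem_graph_ball {r : ℕ} {y : H ⧸ K} :
    y ∈ hD.graph.ball ((1 : H) : H ⧸ K) r ↔ y ∈ (QuotientGroup.mk : H → H ⧸ K) '' S ^ r := by
  induction r generalizing y with
  | zero => simp [WalkGraph.ball]
  | succ r ih =>
    rw [WalkGraph.mem_ball_succ]
    constructor
    · rintro ⟨z, hz, hy⟩
      obtain ⟨h, hh, rfl⟩ := ih.1 hz
      obtain ⟨g, s, hs, e, rfl⟩ := hD.mem_graph_nb.1 hy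
      refine ⟨h * (h⁻¹ * g * s), ?_, by congr 1; group⟩
      rw [pow_succ]
      exact Set.mul_mem_mul hh (hD.mul_mem_left hs (QuotientGroup.eq.1 e.symm))
    · rintro ⟨g, hg, rfl⟩
      rw [pow_succ] at hg
      obtain ⟨h, hh, s, hs, rfl⟩ := hg
      exact ⟨h, ih.2 ⟨h, hh, rfl⟩, hD.mem_graph_nb.2 ⟨h, s, hs, rfl, rfl⟩⟩

lemma smul_mem_ball {Γ : WalkGraph (H ⧸ K)} (hinv : Γ.Invariant H) (h : H) {x y : H ⧸ K} {r : ℕ}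
    (hy : y ∈ Γ.ball x r) : h • y ∈ Γ.ball (h • x) r := by
  induction r generalizing y with
  | zero => simpa [WalkGraph.ball] using hy
  | succ r ih =>
    obtain ⟨z, hz, hy⟩ := Γ.mem_ball_succ.1 hy
    exact Γ.mem_ball_succ.2 ⟨_, ih hz, hinv h _ _ hy⟩

lemma graph_connected : hD.graph.Connected := by
  intro x y
  obtain ⟨g, rfl⟩ := mk_surjective x
  obtain ⟨h, rfl⟩ := mk_surjective y
  obtain ⟨r, hr⟩ := hD.exists_mem_pow (g⁻¹ * h)
  refine ⟨r, ?_⟩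
  have := hD.smul_mem_ball hD.graph_invariant g (hD.mem_graph_ball.2 ⟨_, hr, rfl⟩)
  change ((g * (g⁻¹ * h) : H) : H ⧸ K) ∈ hD.graph.ball ((g * 1 : H) : H ⧸ K) r at this
  simpa using this

lemma exists_graph_card_ball_le :
    ∃ C : ℕ, ∀ r, (hD.graph.ball ((1 : H) : H ⧸ K) r).card ≤ C * (r + 1) ^ d := by
  obtain ⟨C, hC⟩ := hD.exists_card_le
  exact ⟨C, fun r => hC r _ fun y hy => hD.mem_graph_ball.1 hy⟩

/-- A group acting transitively on an infinite graph of polynomial growth virtually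
surjects onto `ℤ` with open kernel. -/
theorem exists_hom_int [Infinite (H ⧸ K)] :
    ∃ H₁ : Subgroup H, H₁.Normal ∧ H₁.FiniteIndex ∧ ∃ χ : H₁ →* Multiplicative ℤ,
      Function.Surjective χ ∧ OpenSubgroup' K (χ.ker.map H₁.subtype) := by
  classical
  set o : H ⧸ K := ((1 : H) : H ⧸ K) with ho
  obtain ⟨C, hC⟩ := hD.exists_graph_card_ball_le
  obtain ⟨E, _, _, _, ρ, hρ, ⟨F, hF⟩, hker⟩ := hD.graph_invariant.exists_rep hD.graph_connected o hC
  have hopen : OpenSubgroup' K ρ.ker := by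
    refine ⟨F.image Quotient.out, fun k hk => hF k fun x hx => ?_⟩
    have := hk _ (Finset.mem_image_of_mem _ hx)
    rw [← out_eq' x]
    change ((k * Quotient.out x : H) : H ⧸ K) = _
    rw [eq_comm, QuotientGroup.eq]
    simpa [mul_assoc] using this
  have hfg := hD.fg_quotient hopen
  let ρ' : H ⧸ ρ.ker →* (E →L[ℂ] E) := lift ρ.ker ρ le_rfl
  have hinj : Function.Injective ρ' := by
    intro a b hab
    obtain ⟨g, rfl⟩ := mk_surjective a
    obtain ⟨h, rfl⟩ := mk_surjective b
    have hab : ρ g = ρ h := hab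
    rw [QuotientGroup.eq, MonoidHom.mem_ker, map_mul, ← hab, ← map_mul, inv_mul_cancel, map_one]
  obtain ⟨A, hA, hcomm⟩ := (hD.polyGrowth_quotient hopen).virtually_abelian ρ' (fun q => by
    obtain ⟨g, rfl⟩ := mk_surjective q
    exact hρ g) hinj
  let _ : CommGroup A := { (inferInstance : Group A) with
    mul_comm := fun a b => Subtype.ext (hcomm a a.2 b b.2) }
  by_cases hAf : Finite A
  · -- finite image: the action on harmonic functions gives a homomorphism to the reals
    have hfinQ : Finite (H ⧸ ρ.ker) := by
      have := finite_quotient_of_finiteIndex (H := A)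
      exact Finite.of_equiv _ (groupEquivQuotientProdSubgroup (s := A)).symm
    have hfi : ρ.ker.FiniteIndex := finiteIndex_of_finite_quotient
    obtain ⟨u, hu1, hu2, hu3, z, hz⟩ := hD.graph_invariant.exists_harmonic hD.graph_connected o hC
    have hmem : (fun x => (u x : ℂ)) ∈ hD.graph.lipHarm o := by
      refine ⟨?_, by simp [hu3], 1, fun x y hy => ?_⟩
      · ext x
        have := congrFun hu1 x
        rw [WalkGraph.avg_apply] at this ⊢
        conv_rhs => rw [← this]
        simp
      · rw [← Complex.ofReal_sub, Complex.norm_real]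
        exact hu2 x y hy
    have hadd : ∀ h ∈ ρ.ker, ∀ x, u (h • x) = u x + u (h • o) := by
      intro h hh x
      have h1 := hker h⁻¹ (Subgroup.inv_mem _ hh) _ hmem x
      simp only [inv_inv] at h1
      have h2 : u (h • x) - u (h • o) = u x := by exact_mod_cast h1
      linarith
    let ψ : ρ.ker →* Multiplicative ℝ :=
      { toFun := fun h => Multiplicative.ofAdd (u ((h : H) • o))
        map_one' := by simp [hu3]
        map_mul' := fun g h => by
          rw [← ofAdd_add, Subgroup.coe_mul, mul_smul, hadd _ g.2, add_comm] }
    refine hD.exists_hom_int_of_infinite_range ψ ((hopen.inf openSubgroup'_self).mono ?_) ?_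
    · rintro k ⟨hk1, hk2⟩
      refine ⟨⟨k, hk1⟩, ?_, rfl⟩
      change Multiplicative.ofAdd (u (k • o)) = 1
      have : k • o = o := by
        change ((k * 1 : H) : H ⧸ K) = _
        rw [ho, eq_comm, QuotientGroup.eq]
        simpa using hk2
      rw [this, hu3]; rfl
    · by_contra hfin
      rw [not_infinite_iff_finite] at hfin
      have hr : (Set.range fun h : ρ.ker => u ((h : H) • o)).Finite := by
        have h1 : (Set.range ψ).Finite := hfin
        have : (Set.range fun h : ρ.ker => u ((h : H) • o)) = Multiplicative.toAdd '' Set.range ψ := by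
          rw [← Set.range_comp]; rfl
        rw [this]
        exact h1.image _
      have hv : (Set.range u).Finite := by
        have := Fintype.ofFinite (H ⧸ ρ.ker)
        refine (Set.finite_univ.image2 (fun (q : H ⧸ ρ.ker) (c : ℝ) => u (Quotient.out q • o) + c)
          hr).subset ?_
        rintro _ ⟨x, rfl⟩
        obtain ⟨g, rfl⟩ := mk_surjective x
        obtain ⟨k, hk⟩ := mk_out_eq_mul ρ.ker g
        refine ⟨(g : H ⧸ ρ.ker), trivial, _, ⟨⟨g * (k : H)⁻¹ * g⁻¹,
          (inferInstance : ρ.ker.Normal).conj_mem _ (Subgroup.inv_mem _ k.2) g⟩, rfl⟩, ?_⟩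
        simp only
        rw [← hadd _ ((inferInstance : ρ.ker.Normal).conj_mem _ (Subgroup.inv_mem _ k.2) g), hk, smul_smul]
        congr 1
        change ((g * (k : H)⁻¹ * g⁻¹ * (g * k) * 1 : H) : H ⧸ K) = _
        congr 1; group
      obtain ⟨c, hc⟩ := (hv.image norm).bddAbove
      have := hD.graph_invariant.eq_of_bounded_harmonic hD.graph_connected hC hu1
        (fun x => hc ⟨_, ⟨x, rfl⟩, rfl⟩) z o
      exact hz (this.trans hu3)
  · rw [not_finite_iff_infinite] at hAf
    set L := A.comap (mk' ρ.ker) with hL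
    have hLfi : L.FiniteIndex := ⟨by
      rw [hL, index_comap_of_surjective _ (mk'_surjective _)]
      exact hA.index_ne_zero⟩
    let ψ : L →* A := ((mk' ρ.ker).comp L.subtype).codRestrict A fun x => x.2
    have hsurj : Function.Surjective ψ := by
      rintro ⟨q, hq⟩
      obtain ⟨g, rfl⟩ := mk_surjective q
      exact ⟨⟨g, hq⟩, rfl⟩
    refine hD.exists_hom_int_of_infinite_range ψ (hopen.mono ?_) ?_
    · intro k hk
      have hk' : (k : H ⧸ ρ.ker) = 1 := (eq_one_iff k).2 hk
      refine ⟨⟨k, ?_⟩, ?_, rfl⟩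
      · change (k : H ⧸ ρ.ker) ∈ A
        rw [hk']; exact A.one_mem
      · exact Subtype.ext hk'
    · exact Infinite.of_surjective (fun x : ψ.range => x.1) fun a => by
        obtain ⟨l, rfl⟩ := hsurj a
        exact ⟨⟨_, l, rfl⟩, rfl⟩

/-- Milnor's argument: polynomial growth forces the conjugates by powers of `t` to be
generated by finitely many of them. -/
lemma exists_conj_mem (t : H) {T : Set H} {k : ℕ} (hT : T ⊆ S ^ k) (hK : (K : Set H) ⊆ T) :
    ∃ r, ∀ m ∈ T, t ^ (r + 1) * m * (t ^ (r + 1))⁻¹ ∈ conjClosure t T r := by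
  classical
  by_contra hcon
  push Not at hcon
  choose m hm hn using hcon
  set n : ℕ → H := fun r => t ^ (r + 1) * m r * (t ^ (r + 1))⁻¹ with hndef
  obtain ⟨j, hj⟩ := hD.exists_mem_pow t
  have hKQ : ∀ r, K ≤ conjClosure t T r := fun r x hx => by
    simpa using mem_conjClosure (t := t) (Nat.zero_le r) (hK hx)
  have key : ∀ R, ∃ F : Finset H, F.card = 2 ^ R ∧ (∀ x ∈ F, x ∈ conjClosure t T R) ∧
      (∀ x ∈ F, (t ^ (R + 1))⁻¹ * x ∈ S ^ ((j + k) * (R + 1))) ∧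
      Set.InjOn (fun h : H => (h : H ⧸ K)) F := by
    intro R
    induction R with
    | zero =>
      refine ⟨{1}, by simp, by simp, ?_, by simp⟩
      intro x hx
      rw [mem_singleton.1 hx]
      simp only [zero_add, pow_one, mul_one]
      exact hD.pow_mono (Nat.le_add_right _ _) (hD.inv_mem_pow hj)
    | succ R ih =>
      obtain ⟨F, hc, hQ, hS, hinj⟩ := ih
      have hne : ∀ x ∈ F, ∀ y ∈ F, ((n R * x : H) : H ⧸ K) ≠ (y : H ⧸ K) := by
        intro x hx y hy e
        have h1 := hKQ R (QuotientGroup.eq.1 e)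
        have h2 := (conjClosure t T R).mul_mem (hQ _ hx)
          ((conjClosure t T R).mul_mem h1 ((conjClosure t T R).inv_mem (hQ _ hy)))
        have h3 := (conjClosure t T R).inv_mem h2
        refine hn R ?_
        have e3 : (x * ((n R * x)⁻¹ * y * y⁻¹))⁻¹ = n R := by group
        rw [e3] at h3
        exact h3
      refine ⟨F ∪ F.image (n R * ·), ?_, ?_, ?_, ?_⟩
      · rw [card_union_of_disjoint, card_image_of_injective _ (mul_right_injective _),
          hc, pow_succ, mul_two]
        rw [disjoint_left]
        intro y hy hy'
        obtain ⟨x, hx, rfl⟩ := mem_image.1 hy'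
        exact hne x hx _ hy rfl
      · intro x hx
        rcases mem_union.1 hx with hx | hx
        · exact conjClosure_mono t T (Nat.le_succ R) (hQ x hx)
        · obtain ⟨y, hy, rfl⟩ := mem_image.1 hx
          exact Subgroup.mul_mem _ (mem_conjClosure le_rfl (hm R))
            (conjClosure_mono t T (Nat.le_succ R) (hQ y hy))
      · intro x hx
        rcases mem_union.1 hx with hx | hx
        · have e : (t ^ (R + 1 + 1))⁻¹ * x = t⁻¹ * ((t ^ (R + 1))⁻¹ * x) := by
            rw [pow_succ t (R + 1)]; group
          rw [e]
          refine hD.pow_mono ?_ (hD.mul_mem_pow (hD.inv_mem_pow hj) (hS x hx))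
          nlinarith
        · obtain ⟨y, hy, rfl⟩ := mem_image.1 hx
          have e : (t ^ (R + 1 + 1))⁻¹ * (n R * y) = t⁻¹ * m R * ((t ^ (R + 1))⁻¹ * y) := by
            rw [pow_succ t (R + 1)]; simp only [hndef]; group
          rw [e]
          refine hD.pow_mono ?_ (hD.mul_mem_pow (hD.mul_mem_pow (hD.inv_mem_pow hj) (hT (hm R)))
            (hS y hy))
          nlinarith
      · intro x hx y hy hxy
        rw [mem_coe, mem_union, mem_image] at hx hy
        rcases hx with hx | ⟨x, hx, rfl⟩ <;> rcases hy with hy | ⟨y, hy, rfl⟩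
        · exact hinj hx hy hxy
        · exact absurd hxy.symm (hne y hy x hx)
        · exact absurd hxy (hne x hx y hy)
        · refine congrArg (n R * ·) (hinj hx hy ?_)
          have := QuotientGroup.eq.1 hxy
          refine QuotientGroup.eq.2 ?_
          have e : (n R * x)⁻¹ * (n R * y) = x⁻¹ * y := by group
          rwa [e] at this
  obtain ⟨C, hC⟩ := hD.growth
  obtain ⟨R, hR⟩ := exists_mul_pow_lt_pow (C * (2 * j + k + 1) ^ d) 1 d one_lt_two
  obtain ⟨F, hc, -, hS, hinj⟩ := key R
  have h1 := hC ((2 * j + k) * (R + 1)) F (fun x hx => by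
    have h2 : t ^ (R + 1) ∈ S ^ (j * (R + 1)) := by rw [pow_mul]; exact Set.pow_mem_pow hj
    have h3 := hD.mul_mem_pow h2 (hS x hx)
    rw [mul_inv_cancel_left] at h3
    refine hD.pow_mono (le_of_eq ?_) h3
    ring) hinj
  rw [hc] at h1
  have h2 : (2:ℕ) ^ R ≤ C * (2 * j + k + 1) ^ d * (1 * R + 1) ^ d := by
    calc 2 ^ R ≤ C * ((2 * j + k) * (R + 1) + 1) ^ d := h1
      _ ≤ C * ((2 * j + k + 1) * (1 * R + 1)) ^ d := by gcongr; nlinarith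
      _ = _ := by rw [mul_pow, mul_assoc]
  have h3 : (2:ℝ) ^ R ≤ C * (2 * j + k + 1) ^ d * (1 * R + 1) ^ d := by exact_mod_cast h2
  push_cast at hR
  linarith

lemma exists_forall_conj_mem (t : H) {T : Set H} {k : ℕ} (hT : T ⊆ S ^ k) (hK : (K : Set H) ⊆ T) :
    ∃ r, ∀ n : ℕ, ∀ m ∈ T, t ^ n * m * (t ^ n)⁻¹ ∈ conjClosure t T r := by
  obtain ⟨r, hr⟩ := hD.exists_conj_mem t hT hK
  have hconj : ∀ x ∈ conjClosure t T r, t * x * t⁻¹ ∈ conjClosure t T r := by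
    intro x hx
    have : conjClosure t T r ≤ (conjClosure t T r).comap (MulAut.conj t).toMonoidHom := by
      refine (closure_le _).2 ?_
      rintro _ ⟨i, hi, m, hm, rfl⟩
      change t * (t ^ i * m * (t ^ i)⁻¹) * t⁻¹ ∈ conjClosure t T r
      have e : t * (t ^ i * m * (t ^ i)⁻¹) * t⁻¹ = t ^ (i + 1) * m * (t ^ (i + 1))⁻¹ := by
        rw [pow_succ' t i]; group
      rw [e]
      rcases hi.lt_or_eq with h | rfl
      · exact mem_conjClosure h hm
      · exact hr m hm
    exact this hx
  refine ⟨r, fun n m hm => ?_⟩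
  induction n with
  | zero => exact mem_conjClosure (Nat.zero_le r) hm
  | succ n ih =>
    have e : t ^ (n + 1) * m * (t ^ (n + 1))⁻¹ = t * (t ^ n * m * (t ^ n)⁻¹) * t⁻¹ := by
      rw [pow_succ' t n]; group
    rw [e]
    exact hconj _ ih

/-- The kernel of a homomorphism to the integers is generated by elements of bounded length. -/
lemma exists_closure_ker (χ : H →* Multiplicative ℤ) (hχ : K ≤ χ.ker) {t : H}
    (ht : χ t = Multiplicative.ofAdd 1) :
    ∃ k, Subgroup.closure (S ^ k ∩ χ.ker) = χ.ker := by
  classical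
  have hχt : ∀ h : H, h * t ^ (-(χ h).toAdd) ∈ χ.ker := fun h => by
    rw [MonoidHom.mem_ker, map_mul, map_zpow, ht, ← ofAdd_zsmul]
    simp
  have hfin : ((fun s : H => t ^ (-(χ s).toAdd)) '' S).Finite := by
    have h1 := hD.finite_image 1
    rw [pow_one] at h1
    refine (h1.image (Quotient.lift (fun s : H => t ^ (-(χ s).toAdd)) ?_)).subset ?_
    · intro a b hab
      have : χ (a⁻¹ * b) = 1 := hχ (QuotientGroup.leftRel_apply.1 hab)
      rw [map_mul, map_inv, inv_mul_eq_one] at this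
      simp only [this]
    · rintro _ ⟨s, hs, rfl⟩
      exact ⟨_, ⟨s, hs, rfl⟩, rfl⟩
  obtain ⟨k, hk⟩ := hD.exists_subset_pow hfin
  set T : Set H := S ^ (1 + k) ∩ χ.ker with hTdef
  have hTS : T ⊆ S ^ (1 + k) := Set.inter_subset_left
  have hKT : (K : Set H) ⊆ T := fun x hx =>
    ⟨hD.pow_mono (Nat.le_add_right _ _) (by simpa using hD.subset_K hx), hχ hx⟩
  obtain ⟨r, hr⟩ := hD.exists_forall_conj_mem t hTS hKT
  obtain ⟨r', hr'⟩ := hD.exists_forall_conj_mem t⁻¹ hTS hKT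
  set L := conjClosure t T r ⊔ conjClosure t⁻¹ T r' with hL
  have hLz : ∀ i : ℤ, ∀ m ∈ T, t ^ i * m * (t ^ i)⁻¹ ∈ L := by
    intro i m hm
    obtain ⟨n, rfl | rfl⟩ := i.eq_nat_or_neg
    · have := hr n m hm
      rw [← zpow_natCast] at this
      exact (le_sup_left : _ ≤ L) this
    · have := hr' n m hm
      rw [← zpow_natCast, inv_zpow', ] at this
      exact (le_sup_right : _ ≤ L) this
  have hLcl : L ≤ Subgroup.closure {x | ∃ i : ℤ, ∃ m ∈ T, x = t ^ i * m * (t ^ i)⁻¹} := by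
    refine sup_le ?_ ?_
    · refine Subgroup.closure_mono ?_
      rintro _ ⟨i, -, m, hm, rfl⟩
      exact ⟨i, m, hm, by simp⟩
    · refine Subgroup.closure_mono ?_
      rintro _ ⟨i, -, m, hm, rfl⟩
      exact ⟨-i, m, hm, by simp⟩
  have hconj : ∀ i : ℤ, ∀ x ∈ L, t ^ i * x * (t ^ i)⁻¹ ∈ L := by
    intro i x hx
    have : L ≤ L.comap (MulAut.conj (t ^ i)).toMonoidHom := by
      refine hLcl.trans ((closure_le _).2 ?_)
      rintro _ ⟨i', m, hm, rfl⟩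
      change t ^ i * (t ^ i' * m * (t ^ i')⁻¹) * (t ^ i)⁻¹ ∈ L
      have e : t ^ i * (t ^ i' * m * (t ^ i')⁻¹) * (t ^ i)⁻¹ = t ^ (i + i') * m * (t ^ (i + i'))⁻¹ := by
        rw [zpow_add]; group
      rw [e]
      exact hLz _ _ hm
    exact this hx
  have hTL : ∀ m ∈ T, m ∈ L := fun m hm => by simpa using hLz 0 m hm
  have hLker : L ≤ χ.ker := by
    refine hLcl.trans ((closure_le _).2 ?_)
    rintro _ ⟨i', m, hm, rfl⟩
    exact (inferInstance : χ.ker.Normal).conj_mem _ hm.2 _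
  have hprod : ∀ h : H, h * t ^ (-(χ h).toAdd) ∈ L := by
    intro h
    have hh : h ∈ Subgroup.closure S := by rw [hD.closure_eq]; trivial
    induction hh using closure_induction with
    | mem x hx => exact hTL _ ⟨hD.mul_mem_pow (by simpa using hx) (hk ⟨x, hx, rfl⟩), hχt x⟩
    | one => simp [L.one_mem]
    | mul x y _ _ hx hy =>
      have := L.mul_mem hx (hconj (χ x).toAdd _ hy)
      convert this using 1
      rw [map_mul, toAdd_mul, neg_add_rev, zpow_add]
      group
    | inv x _ hx =>
      have := hconj (-(χ x).toAdd) _ (L.inv_mem hx)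
      convert this using 1
      rw [map_inv, toAdd_inv]
      group
  have hLe : L = χ.ker := le_antisymm hLker fun x hx => by
    have := hprod x
    rw [MonoidHom.mem_ker.1 hx] at this
    simpa using this
  obtain ⟨j, hj⟩ := hD.exists_mem_pow t
  have hbd : ∀ u ∈ S ^ j, ∀ i ≤ r + r', ∀ m ∈ T,
      u ^ i * m * (u ^ i)⁻¹ ∈ S ^ (j * (r + r') + (1 + k) + j * (r + r')) := by
    intro u hu i hi m hm
    have h1 : u ^ i ∈ S ^ (j * (r + r')) := by
      refine hD.pow_mono (Nat.mul_le_mul_left j hi) ?_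
      rw [pow_mul]; exact Set.pow_mem_pow hu
    exact hD.mul_mem_pow (hD.mul_mem_pow h1 (hTS hm)) (hD.inv_mem_pow h1)
  refine ⟨j * (r + r') + (1 + k) + j * (r + r'),
    le_antisymm ((closure_le _).2 Set.inter_subset_right) ?_⟩
  conv_lhs => rw [← hLe]
  refine sup_le (Subgroup.closure_mono ?_) (Subgroup.closure_mono ?_)
  · rintro _ ⟨i, hi, m, hm, rfl⟩
    exact ⟨hbd t hj i (by omega) m hm, (inferInstance : χ.ker.Normal).conj_mem _ hm.2 _⟩
  · rintro _ ⟨i, hi, m, hm, rfl⟩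
    exact ⟨hbd t⁻¹ (hD.inv_mem_pow hj) i (by omega) m hm,
      (inferInstance : χ.ker.Normal).conj_mem _ hm.2 _⟩

lemma restrict {L : Subgroup H} {k d' : ℕ} (hk : 1 ≤ k) (hcl : Subgroup.closure (S ^ k ∩ L) = L)
    (hg : ∃ C : ℕ, ∀ r : ℕ, ∀ F : Finset H, (∀ x ∈ F, x ∈ L) → (F : Set H) ⊆ S ^ r →
      Set.InjOn (fun h : H => (h : H ⧸ K)) F → F.card ≤ C * (r + 1) ^ d') :
    GrowthData (K.subgroupOf L) {x : L | (x : H) ∈ S ^ k} d' where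
  one_mem := hD.pow_mono (Nat.zero_le k) (by simp)
  inv_mem s hs := hD.inv_mem_pow hs
  mul_mem s hs x hx := by
    obtain ⟨k, rfl⟩ := Nat.exists_eq_add_of_le' hk
    change (s : H) * (x : H) ∈ S ^ (k + 1)
    have hs' : (s : H) ∈ S ^ (k + 1) := hs
    rw [pow_succ] at hs' ⊢
    obtain ⟨a, ha, b, hb, e⟩ := hs'
    exact ⟨a, ha, b * x, hD.mul_mem b hb x hx, by simp only at e ⊢; rw [← e, mul_assoc]⟩
  closure_eq := by
    apply Subgroup.map_injective L.subtype_injective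
    rw [MonoidHom.map_closure, ← MonoidHom.range_eq_map, L.range_subtype]
    convert hcl using 2
    ext x
    constructor
    · rintro ⟨y, hy, rfl⟩; exact ⟨hy, y.2⟩
    · rintro ⟨h1, h2⟩; exact ⟨⟨x, h2⟩, h1, rfl⟩
  growth := by
    classical
    obtain ⟨C, hC⟩ := hg
    refine ⟨C * (k + 1) ^ d', fun r F hF hinj => ?_⟩
    have hpow : ∀ r, ∀ x ∈ ({x : L | (x : H) ∈ S ^ k} : Set L) ^ r, (x : H) ∈ S ^ (k * r) := by
      intro r
      induction r with
      | zero => intro x hx; rw [pow_zero, Set.mem_one] at hx; simp [hx]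
      | succ r ih =>
        intro x hx
        rw [pow_succ] at hx
        obtain ⟨a, ha, b, hb, rfl⟩ := hx
        exact hD.mul_mem_pow (ih a ha) hb
    have := hC (k * r) (F.map ⟨Subtype.val, Subtype.val_injective⟩) ?_ ?_ ?_
    · rw [card_map] at this
      calc F.card ≤ C * (k * r + 1) ^ d' := this
        _ ≤ C * ((k + 1) * (r + 1)) ^ d' := by gcongr; nlinarith
        _ = _ := by rw [mul_pow, mul_assoc]
    · intro x hx
      obtain ⟨y, -, rfl⟩ := Finset.mem_map.1 hx
      exact y.2
    · intro x hx
      obtain ⟨y, hy, rfl⟩ := Finset.mem_map.1 hx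
      exact hpow r y (hF hy)
    · intro x hx y hy hxy
      obtain ⟨x, hx', rfl⟩ := Finset.mem_map.1 hx
      obtain ⟨y, hy', rfl⟩ := Finset.mem_map.1 hy
      have e : (x : H)⁻¹ * y ∈ K := QuotientGroup.eq.1 hxy
      exact congrArg _ (hinj hx' hy' (QuotientGroup.eq.2 e))

lemma restrict_finiteIndex (L : Subgroup H) [L.FiniteIndex] :
    ∃ k, GrowthData (K.subgroupOf L) {x : L | (x : H) ∈ S ^ k} d := by
  obtain ⟨k, hk⟩ := hD.exists_closure_finiteIndex L
  refine ⟨k + 1, hD.restrict (Nat.le_add_left 1 k) (le_antisymm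
    ((closure_le _).2 Set.inter_subset_right) ?_) ?_⟩
  · conv_lhs => rw [← hk]
    exact Subgroup.closure_mono (Set.inter_subset_inter_left _ (hD.pow_mono (Nat.le_succ k)))
  · obtain ⟨C, hC⟩ := hD.growth
    exact ⟨C, fun r F _ h1 h2 => hC r F h1 h2⟩

end GrowthData

lemma GrowthData.restrict_ker (hD : GrowthData K S (d + 1)) (χ : H →* Multiplicative ℤ) (hχ : K ≤ χ.ker)
    {t : H} (ht : χ t = Multiplicative.ofAdd 1) :
    ∃ k, GrowthData (K.subgroupOf χ.ker) {x : χ.ker | (x : H) ∈ S ^ k} d := by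
  classical
  obtain ⟨k, hk⟩ := hD.exists_closure_ker χ hχ ht
  refine ⟨k + 1, hD.restrict (Nat.le_add_left 1 k) (le_antisymm
    ((closure_le _).2 Set.inter_subset_right) ?_) ?_⟩
  · conv_lhs => rw [← hk]
    exact Subgroup.closure_mono (Set.inter_subset_inter_left _ (hD.pow_mono (Nat.le_succ k)))
  · obtain ⟨C, hC⟩ := hD.growth
    obtain ⟨j, hj⟩ := hD.exists_mem_pow t
    refine ⟨C * (j + 1 + 1) ^ (d + 1), fun r F hF hS hinj => ?_⟩
    have hχ' : ∀ i : ℕ, ∀ x ∈ F, χ (t ^ i * x) = Multiplicative.ofAdd (i : ℤ) := by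
      intro i x hx
      rw [map_mul, MonoidHom.mem_ker.1 (hF x hx), mul_one, map_pow, ht, ← ofAdd_nsmul]
      simp
    have hinj2 : Set.InjOn (fun p : ℕ × H => ((t ^ p.1 * p.2 : H) : H ⧸ K))
        (range (r + 1) ×ˢ F : Finset (ℕ × H)) := by
      rintro ⟨i, x⟩ hx ⟨i', y⟩ hy e
      rw [mem_coe, mem_product] at hx hy
      have e1 := QuotientGroup.eq.1 e
      have e2 : χ ((t ^ i * x)⁻¹ * (t ^ i' * y)) = 1 := hχ e1
      rw [map_mul, map_inv, hχ' i x hx.2, hχ' i' y hy.2, inv_mul_eq_one] at e2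
      have e3 : i = i' := by exact_mod_cast Multiplicative.ofAdd.injective e2
      subst e3
      refine Prod.ext rfl (hinj hx.2 hy.2 (QuotientGroup.eq.2 ?_))
      have e4 : (t ^ i * x)⁻¹ * (t ^ i * y) = x⁻¹ * y := by group
      simp only at e1
      rwa [e4] at e1
    have := hC (j * r + r) ((range (r + 1) ×ˢ F).image fun p => t ^ p.1 * p.2) ?_ ?_
    · rw [card_image_of_injOn fun a ha b hb e => hinj2 ha hb (congrArg _ e),
        card_product, card_range] at this
      have h2 : (r + 1) * F.card ≤ (r + 1) * (C * (j + 1 + 1) ^ (d + 1) * (r + 1) ^ d) := by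
        calc (r + 1) * F.card ≤ C * (j * r + r + 1) ^ (d + 1) := this
          _ ≤ C * ((j + 1 + 1) * (r + 1)) ^ (d + 1) := by gcongr; nlinarith
          _ = _ := by rw [mul_pow, pow_succ (r + 1)]; ring
      exact Nat.le_of_mul_le_mul_left h2 (Nat.succ_pos r)
    · intro x hx
      obtain ⟨⟨i, y⟩, hy, rfl⟩ := mem_image.1 hx
      rw [mem_product, mem_range] at hy
      refine hD.mul_mem_pow ?_ (hS hy.2)
      refine hD.pow_mono (Nat.mul_le_mul_left j (Nat.le_of_lt_succ hy.1)) ?_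
      rw [pow_mul]; exact Set.pow_mem_pow hj
    · intro x hx y hy hxy
      obtain ⟨p, hp, rfl⟩ := mem_image.1 hx
      obtain ⟨q, hq, rfl⟩ := mem_image.1 hy
      rw [hinj2 hp hq hxy]

lemma isVirtuallyNilpotent_of_surjective {G G' : Type*} [Group G] [Group G']
    (h : Group.IsVirtuallyNilpotent G) (f : G →* G') (hf : Function.Surjective f) :
    Group.IsVirtuallyNilpotent G' := by
  obtain ⟨N, hN, hfi⟩ := h
  refine ⟨N.map f, ?_, ⟨?_⟩⟩
  · exact Group.nilpotent_of_surjective (f.subgroupMap N) (f.subgroupMap_surjective N)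
  · exact fun h0 => hfi.index_ne_zero (Nat.eq_zero_of_zero_dvd (h0 ▸ N.index_map_dvd hf))

lemma isVirtuallyNilpotent_of_finiteIndex {G : Type*} [Group G] (L : Subgroup G) [L.FiniteIndex]
    (h : Group.IsVirtuallyNilpotent L) : Group.IsVirtuallyNilpotent G := by
  obtain ⟨N, hN, hfi⟩ := h
  refine ⟨N.map L.subtype, ?_, ⟨?_⟩⟩
  · exact Group.nilpotent_of_surjective (L.subtype.subgroupMap N) (L.subtype.subgroupMap_surjective N)
  · rw [index_map, L.ker_subtype, sup_bot_eq, L.range_subtype]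
    exact mul_ne_zero hfi.index_ne_zero FiniteIndex.index_ne_zero

/-- Among the normal subgroups contained in a term of a filtration there is a largest one, if
the quotient by one of them is Noetherian. -/
lemma exists_largest_bounded_normal {G : Type*} [Group G] (b : ℕ → Set G)
    (hb : ∀ r s, b r * b s ⊆ b (r + s)) (B : Subgroup G) [B.Normal] {r₀ : ℕ}
    (hB : (B : Set G) ⊆ b r₀) (hfg : SubgroupsFG (G ⧸ B)) :
    ∃ W : Subgroup G, W.Normal ∧ (∃ r, (W : Set G) ⊆ b r) ∧ B ≤ W ∧
      ∀ W' : Subgroup G, W'.Normal → (∃ r, (W' : Set G) ⊆ b r) → W' ≤ W := by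
  classical
  let P : Subgroup G → Prop := fun W => W.Normal ∧ (∃ r, (W : Set G) ⊆ b r)
  have hsup : ∀ W W', P W → P W' → P (W ⊔ W') := by
    rintro W W' ⟨h1, r, hr⟩ ⟨h2, s, hs⟩
    refine ⟨inferInstance, r + s, ?_⟩
    rw [mul_normal]
    exact (Set.mul_subset_mul hr hs).trans (hb r s)
  have hPB : P B := ⟨inferInstance, r₀, hB⟩
  let Winf : Subgroup G := sSup {W | P W}
  obtain ⟨X, hX⟩ := hfg (Winf.map (mk' B))
  have hdir : DirectedOn (· ≤ ·) {W | P W} := fun W hW W' hW' =>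
    ⟨W ⊔ W', hsup W W' hW hW', le_sup_left, le_sup_right⟩
  have hmem : ∀ q ∈ Winf.map (mk' B), ∃ W, P W ∧ q ∈ W.map (mk' B) := by
    rintro _ ⟨x, hx, rfl⟩
    obtain ⟨W, hW, hxW⟩ := (mem_sSup_of_directedOn ⟨B, hPB⟩ hdir).1 hx
    exact ⟨W, hW, x, hxW, rfl⟩
  have hfin : ∀ Y : Finset (G ⧸ B), (∀ q ∈ Y, q ∈ Winf.map (mk' B)) →
      ∃ W, P W ∧ B ≤ W ∧ ∀ q ∈ Y, q ∈ W.map (mk' B) := by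
    intro Y
    induction Y using Finset.induction_on with
    | empty => intro _; exact ⟨B, hPB, le_rfl, by simp⟩
    | insert a Y _ ih =>
      intro h
      obtain ⟨W, hW, hBW, hY⟩ := ih fun q hq => h q (Finset.mem_insert_of_mem hq)
      obtain ⟨W', hW', ha⟩ := hmem a (h a (Finset.mem_insert_self _ _))
      refine ⟨W ⊔ W', hsup _ _ hW hW', hBW.trans le_sup_left, fun q hq => ?_⟩
      rcases Finset.mem_insert.1 hq with rfl | hq
      · exact Subgroup.map_mono le_sup_right ha
      · exact Subgroup.map_mono le_sup_left (hY q hq)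
  obtain ⟨W, hW, hBW, hXW⟩ := hfin X fun q hq => hX ▸ Subgroup.subset_closure hq
  refine ⟨W, hW.1, hW.2, hBW, fun W' h1 h2 => ?_⟩
  have h3 : W'.map (mk' B) ≤ W.map (mk' B) := by
    refine (Subgroup.map_mono (le_sSup ⟨h1, h2⟩ : W' ≤ Winf)).trans ?_
    rw [← hX, closure_le]
    exact hXW
  have h4 := Subgroup.map_le_iff_le_comap.1 h3
  rwa [comap_map_eq, ker_mk', sup_eq_left.2 hBW] at h4

/-- There is a bounded open normal subgroup with virtually nilpotent Noetherian quotient. -/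
def HasStructure {H : Type*} [Group H] (K : Subgroup H) (S : Set H) : Prop :=
  ∃ W : Subgroup H, ∃ _ : W.Normal, (∃ r, (W : Set H) ⊆ S ^ r) ∧ OpenSubgroup' K W ∧
    Group.IsVirtuallyNilpotent (H ⧸ W) ∧ SubgroupsFG (H ⧸ W)

namespace GrowthData

variable (hD : GrowthData K S d)
include hD

lemma hasStructure_of_finite [Finite (H ⧸ K)] : HasStructure K S := by
  obtain ⟨m, hm⟩ := hD.exists_subset_pow (Set.finite_range (Quotient.out : H ⧸ K → H))
  refine ⟨⊤, inferInstance, ⟨m + 1, fun h _ => ?_⟩, ⟨∅, fun _ _ => trivial⟩, ⟨⊤, ?_, inferInstance⟩,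
    subgroupsFG_of_finite _⟩
  · obtain ⟨k, hk⟩ := mk_out_eq_mul K h
    have : h = Quotient.out (h : H ⧸ K) * (k : H)⁻¹ := by rw [hk]; group
    rw [this]
    exact hD.mul_mem_pow (hm ⟨_, rfl⟩) (by simpa using hD.inv_mem _ (hD.subset_K k.2))
  · have : Subsingleton (H ⧸ (⊤ : Subgroup H)) := subsingleton_quotient_top
    have : Subsingleton (⊤ : Subgroup (H ⧸ (⊤ : Subgroup H))) :=
      ⟨fun a b => Subtype.ext (Subsingleton.elim _ _)⟩
    exact Group.isNilpotent_of_subsingleton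

lemma exists_normal_of_restrict (L : Subgroup H) [L.Normal] (hL : OpenSubgroup' K L) {k : ℕ}
    (h : HasStructure (K.subgroupOf L) {x : L | (x : H) ∈ S ^ k}) :
    ∃ W : Subgroup H, ∃ _ : W.Normal, W ≤ L ∧ (∃ r, (W : Set H) ⊆ S ^ r) ∧ OpenSubgroup' K W ∧
      Group.IsVirtuallyNilpotent (L.map (mk' W)) ∧
      SubgroupsFG (L.map (mk' W)) := by
  classical
  obtain ⟨B, hBn, ⟨r, hr⟩, ⟨F2, hF2⟩, hvn, hfg⟩ := h
  obtain ⟨F1, hF1⟩ := hL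
  have hpow : ∀ r, ∀ x ∈ ({x : L | (x : H) ∈ S ^ k} : Set L) ^ r, (x : H) ∈ S ^ (k * r) := by
    intro r
    induction r with
    | zero => intro x hx; rw [pow_zero, Set.mem_one] at hx; simp [hx]
    | succ r ih =>
      intro x hx
      rw [pow_succ] at hx
      obtain ⟨a, ha, b, hb, rfl⟩ := hx
      exact hD.mul_mem_pow (ih a ha) hb
  obtain ⟨W, hWn, ⟨s, hs⟩, hBW, hmax⟩ := exists_largest_bounded_normal
    (fun r => {x : L | (x : H) ∈ S ^ r}) (by
      rintro r s _ ⟨x, hx, y, hy, rfl⟩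
      exact hD.mul_mem_pow hx hy) B (r₀ := k * r) (fun x hx => hpow r x (hr hx)) hfg
  have hWn' : (W.map L.subtype).Normal := by
    refine ⟨?_⟩
    rintro _ ⟨w, hw, rfl⟩ g
    obtain ⟨j, hj⟩ := hD.exists_mem_pow g
    have h1 : W.map (MulAut.conjNormal g : MulAut L).toMonoidHom ≤ W := by
      refine hmax _ (hWn.map _ (MulEquiv.surjective _)) ⟨j + s + j, ?_⟩
      rintro _ ⟨x, hx, rfl⟩
      change ((MulAut.conjNormal g x : L) : H) ∈ S ^ (j + s + j)
      rw [MulAut.conjNormal_apply]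
      exact hD.mul_mem_pow (hD.mul_mem_pow hj (hs hx)) (hD.inv_mem_pow hj)
    refine ⟨MulAut.conjNormal g w, h1 ⟨w, hw, rfl⟩, ?_⟩
    simp
  let f : L ⧸ B →* L.map (mk' (W.map L.subtype)) :=
    lift B ((mk' (W.map L.subtype)).subgroupMap L) fun x hx => by
      refine Subtype.ext ?_
      exact (eq_one_iff _).2 ⟨x, hBW hx, rfl⟩
  have hf : Function.Surjective f := fun y => by
    obtain ⟨x, hx⟩ := MonoidHom.subgroupMap_surjective _ _ y
    exact ⟨x, hx⟩
  refine ⟨W.map L.subtype, hWn', ?_, ⟨s, ?_⟩, ⟨F1 ∪ F2.image Subtype.val, fun x hx => ?_⟩,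
    isVirtuallyNilpotent_of_surjective hvn f hf, hfg.of_surjective f hf⟩
  · rintro _ ⟨w, -, rfl⟩; exact w.2
  · rintro _ ⟨w, hw, rfl⟩; exact hs hw
  · have hxL : x ∈ L := hF1 x fun g hg => hx g (Finset.mem_union_left _ hg)
    refine ⟨⟨x, hxL⟩, hBW (hF2 _ fun g hg => ?_), rfl⟩
    exact hx g (Finset.mem_union_right _ (Finset.mem_image.2 ⟨g, hg, rfl⟩))

lemma hasStructure_of_finiteIndex (L : Subgroup H) [L.Normal] [L.FiniteIndex]
    (hL : OpenSubgroup' K L) {k : ℕ}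
    (h : HasStructure (K.subgroupOf L) {x : L | (x : H) ∈ S ^ k}) : HasStructure K S := by
  obtain ⟨W, hW, -, hb, ho, hv, hfg⟩ := hD.exists_normal_of_restrict L hL h
  have : (L.map (mk' W)).FiniteIndex := ⟨fun h0 =>
    (FiniteIndex.index_ne_zero (H := L))
      (Nat.eq_zero_of_zero_dvd (h0 ▸ L.index_map_dvd (mk'_surjective W)))⟩
  exact ⟨W, hW, hb, ho, isVirtuallyNilpotent_of_finiteIndex _ hv, .of_finiteIndex _ hfg⟩

lemma hasStructure_of_ker (χ : H →* Multiplicative ℤ) (hχ : K ≤ χ.ker) {t : H}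
    (ht : χ t = Multiplicative.ofAdd 1) {k : ℕ}
    (h : HasStructure (K.subgroupOf χ.ker) {x : χ.ker | (x : H) ∈ S ^ k}) : HasStructure K S := by
  obtain ⟨W, hW, hWL, hb, ho, hv, hfg⟩ :=
    hD.exists_normal_of_restrict χ.ker (openSubgroup'_self.mono hχ) h
  have : (χ.ker.map (mk' W)).Normal :=
    (inferInstance : χ.ker.Normal).map _ (mk'_surjective W)
  refine ⟨W, hW, hb, ho, ?_, ?_⟩
  · refine (hD.polyGrowth_quotient ho).isVirtuallyNilpotent_of_sup_zpowers
      (χ.ker.map (mk' W)) hfg hv (t : H ⧸ W) ?_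
    refine eq_top_iff.2 fun q _ => ?_
    obtain ⟨x, rfl⟩ := mk_surjective q
    have hx : x * t ^ (-(χ x).toAdd) ∈ χ.ker := by
      rw [MonoidHom.mem_ker, map_mul, map_zpow, ht, ← ofAdd_zsmul]
      simp
    have e : (x : H ⧸ W) = ((x * t ^ (-(χ x).toAdd) : H) : H ⧸ W) * (t : H ⧸ W) ^ (χ x).toAdd := by
      rw [← mk_zpow, ← mk_mul]
      congr 1; group
    rw [e]
    exact mul_mem_sup ⟨_, hx, rfl⟩ ⟨_, rfl⟩
  · refine SubgroupsFG.of_ker_of_codomain (lift W χ hWL) (fun M hM => ?_)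
      (subgroupsFG_of_isCyclic _)
    refine hfg.le_fg M (hM.trans fun q hq => ?_)
    obtain ⟨x, rfl⟩ := mk_surjective q
    exact ⟨x, hq, rfl⟩

end GrowthData

/-- A homomorphism to the integers with open kernel vanishes on compact subgroups. -/
lemma GrowthData.subgroupOf_le_ker (hD : GrowthData K S d) {L : Subgroup H}
    (χ : L →* Multiplicative ℤ) (hχ : OpenSubgroup' K (χ.ker.map L.subtype)) :
    K.subgroupOf L ≤ χ.ker := by
  intro k hk
  have hk' : (k : H) ∈ K := hk
  have hfin := hD.finite_image_of_open hχ 1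
  have : ¬ Function.Injective fun n : ℕ => (((k : H) ^ n : H) : H ⧸ χ.ker.map L.subtype) := by
    intro hinj
    refine Set.infinite_range_of_injective hinj (hfin.subset ?_)
    rintro _ ⟨n, rfl⟩
    exact ⟨_, by simpa using hD.subset_K (K.pow_mem hk' n), rfl⟩
  rw [Function.not_injective_iff] at this
  obtain ⟨a, b, e, hab⟩ := this
  obtain ⟨x, hx, hxe⟩ := QuotientGroup.eq.1 e
  have hxk : x = (k ^ a)⁻¹ * k ^ b := Subtype.ext (by simpa using hxe)
  have h1 : χ ((k ^ a)⁻¹ * k ^ b) = 1 := hxk ▸ hx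
  rw [map_mul, map_inv, inv_mul_eq_one, map_pow, map_pow] at h1
  have h2 := congrArg Multiplicative.toAdd h1
  rw [toAdd_pow, toAdd_pow, nsmul_eq_mul, nsmul_eq_mul] at h2
  have h3 : ((a : ℤ) - b) * (χ k).toAdd = 0 := by rw [sub_mul]; exact sub_eq_zero.2 h2
  rcases mul_eq_zero.1 h3 with h | h
  · exact absurd (by exact_mod_cast sub_eq_zero.1 h) hab
  · exact h

/-- Gromov-Trofimov theorem. -/
theorem GrowthData.hasStructure.{u} (d : ℕ) : ∀ {H : Type u} [Group H] {K : Subgroup H} {S : Set H},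
    GrowthData K S d → HasStructure K S := by
  induction d with
  | zero =>
    intro H _ K S hD
    by_cases hfin : Finite (H ⧸ K)
    · exact hD.hasStructure_of_finite
    · rw [not_finite_iff_infinite] at hfin
      obtain ⟨C, hC⟩ := hD.exists_graph_card_ball_le
      have h1 := hC C
      have h2 := hD.graph.succ_le_card_ball hD.graph_connected (1 : H) C
      simp at h1
      simp at h2
      omega
  | succ d ih =>
    intro H _ K S hD
    by_cases hfin : Finite (H ⧸ K)
    · exact hD.hasStructure_of_finite
    · rw [not_finite_iff_infinite] at hfin
      obtain ⟨H₁, hn, hfi, χ, hχ, hopen⟩ := hD.exists_hom_int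
      obtain ⟨k, hD1⟩ := hD.restrict_finiteIndex H₁
      have hle := hD.subgroupOf_le_ker χ hopen
      obtain ⟨t, ht⟩ := hχ (Multiplicative.ofAdd 1)
      obtain ⟨k', hD2⟩ := hD1.restrict_ker χ hle ht
      refine hD.hasStructure_of_finiteIndex H₁ (hopen.mono ?_)
        (hD1.hasStructure_of_ker χ hle ht (ih hD2))
      rintro _ ⟨x, -, rfl⟩
      exact x.2

end

section
open Subgroup QuotientGroup

/-- A geodesic length function of polynomial growth on a group. -/
structure LengthData {Γ : Type*} [Group Γ] (l : Γ → ℕ) (C d : ℕ) : Prop where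
  one : l 1 = 0
  inv : ∀ g, l g⁻¹ = l g
  mul : ∀ g h, l (g * h) ≤ l g + l h
  split : ∀ g r, l g ≤ r + 1 → ∃ a b, g = a * b ∧ l a ≤ r ∧ l b ≤ 1
  growth : ∀ (r : ℕ) (F : Finset Γ), (∀ x ∈ F, l x ≤ r) →
    (∀ x ∈ F, ∀ y ∈ F, l (x⁻¹ * y) = 0 → x = y) → F.card ≤ C * (r + 1) ^ d

/-- A coarsely dense subgroup which is nilpotent modulo a bounded normal subgroup, all
constants being at most `A`. -/
def NilpotentStructure {Γ : Type*} [Group Γ] (l : Γ → ℕ) (A : ℕ) : Prop :=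
  ∃ (L M : Subgroup Γ) (X : Set Γ) (C c : ℕ), C ≤ A ∧ c ≤ A ∧ L = Subgroup.closure (X ∪ M) ∧
    (∀ x ∈ L, ∀ m ∈ M, x * m * x⁻¹ ∈ M) ∧ leftComm X c ⊆ M ∧
    (∀ g, ∃ γ ∈ L, l (γ⁻¹ * g) ≤ C) ∧ (∀ m ∈ M, l m ≤ C) ∧
    ∀ F : Finset Γ, (∀ x ∈ F, l x ≤ 2 * C + 1) → (∀ x ∈ F, ∀ y ∈ F, x⁻¹ * y ∈ M → x = y) →
      F.card ≤ A

lemma NilpotentStructure.mono {Γ : Type*} [Group Γ] {l : Γ → ℕ} {A B : ℕ}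
    (h : NilpotentStructure l A) (hAB : A ≤ B) : NilpotentStructure l B := by
  obtain ⟨L, M, X, C, c, h1, h2, h3, h4, h5, h6, h7, h8⟩ := h
  exact ⟨L, M, X, C, c, h1.trans hAB, h2.trans hAB, h3, h4, h5, h6, h7,
    fun F hF hF' => (h8 F hF hF').trans hAB⟩

lemma exists_eventually_of_finset {𝓤 : Ultrafilter ℕ} {ι : Type*} (I : Finset ι)
    {p : ι → ℕ → Prop} (h : ∀ᶠ n in 𝓤, ∃ i ∈ I, p i n) : ∃ i ∈ I, ∀ᶠ n in 𝓤, p i n := by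
  by_contra hcon
  push Not at hcon
  have h1 : ∀ i ∈ I, ∀ᶠ n in 𝓤, ¬ p i n := hcon
  rw [← Filter.eventually_all_finset] at h1
  obtain ⟨n, ⟨i, hi, hp⟩, hn⟩ := (h.and h1).exists
  exact hn i hi hp

lemma eventually_forall_of_seq {𝓤 : Ultrafilter ℕ} {α : ℕ → Type*} [∀ n, Nonempty (α n)]
    {p : ∀ n, α n → Prop} (h : ∀ f : ∀ n, α n, ∀ᶠ n in 𝓤, p n (f n)) :
    ∀ᶠ n in 𝓤, ∀ x, p n x := by
  by_contra hcon
  rw [← Ultrafilter.eventually_not] at hcon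
  have h1 : ∀ᶠ n in 𝓤, ∃ x, ¬ p n x := hcon.mono fun n hn => not_forall.1 hn
  obtain ⟨f, hf⟩ := Filter.skolem.1 h1
  obtain ⟨n, h2, h3⟩ := (hf.and (h f)).exists
  exact h2 h3

variable {Γ : ℕ → Type} [∀ n, Group (Γ n)] {l : ∀ n, Γ n → ℕ} {C d : ℕ}

def boundedSeq (hl : ∀ n, LengthData (l n) C d) (𝓤 : Ultrafilter ℕ) : Subgroup (∀ n, Γ n) where
  carrier := {g | ∃ r, ∀ᶠ n in 𝓤, l n (g n) ≤ r}
  one_mem' := ⟨0, Eventually.of_forall fun n => by simp [(hl n).one]⟩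
  mul_mem' := by
    rintro a b ⟨r, hr⟩ ⟨s, hs⟩
    refine ⟨r + s, ?_⟩
    filter_upwards [hr, hs] with n h1 h2
    exact ((hl n).mul _ _).trans (add_le_add h1 h2)
  inv_mem' := by
    rintro a ⟨r, hr⟩
    exact ⟨r, hr.mono fun n hn => by rw [Pi.inv_apply, (hl n).inv]; exact hn⟩

variable (hl : ∀ n, LengthData (l n) C d) (𝓤 : Ultrafilter ℕ)

def zeroSeq : Subgroup (boundedSeq hl 𝓤) where
  carrier := {g | ∀ᶠ n in 𝓤, l n (g.1 n) = 0}
  one_mem' := Eventually.of_forall fun n => (hl n).one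
  mul_mem' := by
    rintro a b h1 h2
    filter_upwards [h1, h2] with n h1 h2
    have := (hl n).mul (a.1 n) (b.1 n)
    change l n (a.1 n * b.1 n) = 0
    omega
  inv_mem' := by
    rintro a h
    exact h.mono fun n hn => ((hl n).inv _).trans hn

def unitSeq : Set (boundedSeq hl 𝓤) := {g | ∀ᶠ n in 𝓤, l n (g.1 n) ≤ 1}

lemma mem_unitSeq_pow (r : ℕ) (g : boundedSeq hl 𝓤) :
    g ∈ unitSeq hl 𝓤 ^ (r + 1) ↔ ∀ᶠ n in 𝓤, l n (g.1 n) ≤ r + 1 := by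
  induction r generalizing g with
  | zero => rw [zero_add, pow_one]; rfl
  | succ r ih =>
    rw [pow_succ]
    constructor
    · rintro ⟨a, ha, b, hb, rfl⟩
      filter_upwards [(ih a).1 ha, hb] with n h1 h2
      exact ((hl n).mul _ _).trans (add_le_add h1 h2)
    · intro h
      have h1 : ∀ᶠ n in 𝓤, ∃ p : Γ n × Γ n, g.1 n = p.1 * p.2 ∧ l n p.1 ≤ r + 1 ∧ l n p.2 ≤ 1 :=
        h.mono fun n hn => by
          obtain ⟨a, b, e, h1, h2⟩ := (hl n).split (g.1 n) (r + 1) hn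
          exact ⟨(a, b), e, h1, h2⟩
      obtain ⟨p, hp⟩ := Filter.skolem.1 h1
      let b : boundedSeq hl 𝓤 := ⟨fun n => (p n).2, 1, hp.mono fun n hn => hn.2.2⟩
      refine ⟨g * b⁻¹, (ih _).2 ?_, b, hp.mono fun n hn => hn.2.2, inv_mul_cancel_right g b⟩
      filter_upwards [hp] with n hn
      change l n (g.1 n * (p n).2⁻¹) ≤ r + 1
      rw [hn.1, mul_inv_cancel_right]
      exact hn.2.1

lemma growthData_seq : GrowthData (zeroSeq hl 𝓤) (unitSeq hl 𝓤) d where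
  one_mem := Eventually.of_forall fun n => by
    change l n 1 ≤ 1
    rw [(hl n).one]; exact Nat.zero_le 1
  inv_mem s hs := by
    filter_upwards [hs] with n hn
    exact ((hl n).inv _).trans_le hn
  mul_mem s hs k hk := by
    filter_upwards [hs, hk] with n h1 h2
    have := (hl n).mul (s.1 n) (k.1 n)
    change l n (s.1 n * k.1 n) ≤ 1
    omega
  closure_eq := by
    refine eq_top_iff.2 fun g _ => ?_
    obtain ⟨r, hr⟩ := g.2
    have := (mem_unitSeq_pow hl 𝓤 r g).2 (hr.mono fun n hn => hn.trans (Nat.le_succ r))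
    have hcl : ∀ r, unitSeq hl 𝓤 ^ r ⊆ Subgroup.closure (unitSeq hl 𝓤) := by
      intro r
      induction r with
      | zero => intro x hx; rw [pow_zero, Set.mem_one] at hx; rw [hx]; exact Subgroup.one_mem _
      | succ r ih =>
        rw [pow_succ]
        rintro _ ⟨a, ha, b, hb, rfl⟩
        exact Subgroup.mul_mem _ (ih ha) (Subgroup.subset_closure hb)
    exact hcl _ this
  growth := by
    classical
    refine ⟨C * 2 ^ d, fun r F hF hinj => ?_⟩
    have h1 : ∀ x ∈ F, ∀ᶠ n in 𝓤, l n (x.1 n) ≤ r + 1 := fun x hx => by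
      refine (mem_unitSeq_pow hl 𝓤 r x).1 (Set.pow_subset_pow_right ?_ (Nat.le_succ r) (hF hx))
      exact Eventually.of_forall fun n => by
        change l n 1 ≤ 1
        rw [(hl n).one]; exact Nat.zero_le 1
    have h2 : ∀ x ∈ F, ∀ y ∈ F, ∀ᶠ n in 𝓤, l n ((x.1 n)⁻¹ * y.1 n) = 0 → x = y := by
      intro x hx y hy
      by_cases hxy : x = y
      · exact Eventually.of_forall fun n _ => hxy
      · have : ¬ ∀ᶠ n in 𝓤, l n ((x.1 n)⁻¹ * y.1 n) = 0 := fun h =>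
          hxy (hinj hx hy (QuotientGroup.eq.2 h))
        rw [← Ultrafilter.eventually_not] at this
        exact this.mono fun n hn h => absurd h hn
    have h3 : ∀ᶠ n in 𝓤, ∀ x ∈ F, l n (x.1 n) ≤ r + 1 := (Filter.eventually_all_finset F).2 h1
    have h4 : ∀ᶠ n in 𝓤, ∀ x ∈ F, ∀ y ∈ F, l n ((x.1 n)⁻¹ * y.1 n) = 0 → x = y :=
      (Filter.eventually_all_finset F).2 fun x hx =>
        (Filter.eventually_all_finset F).2 fun y hy => h2 x hx y hy
    obtain ⟨n, h5, h6⟩ := (h3.and h4).exists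
    have hinj' : Set.InjOn (fun x : boundedSeq hl 𝓤 => x.1 n) F := fun x hx y hy e => by
      refine h6 x hx y hy ?_
      simp only at e
      rw [e, inv_mul_cancel, (hl n).one]
    have h7 := (hl n).growth (r + 1) (F.image fun x => x.1 n) (by
        intro x hx
        obtain ⟨y, hy, rfl⟩ := Finset.mem_image.1 hx
        exact h5 y hy) (by
        intro x hx y hy e
        obtain ⟨x, hx', rfl⟩ := Finset.mem_image.1 hx
        obtain ⟨y, hy', rfl⟩ := Finset.mem_image.1 hy
        rw [h6 x hx' y hy' e])
    rw [Finset.card_image_of_injOn hinj'] at h7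
    calc F.card ≤ C * (r + 1 + 1) ^ d := h7
      _ ≤ C * (2 * (r + 1)) ^ d := by gcongr; omega
      _ = _ := by rw [mul_pow, mul_assoc]

lemma exists_internal (W : Subgroup (boundedSeq hl 𝓤)) {r : ℕ}
    (hW : (W : Set (boundedSeq hl 𝓤)) ⊆ unitSeq hl 𝓤 ^ r) (ho : OpenSubgroup' (zeroSeq hl 𝓤) W) :
    ∃ M : ∀ n, Set (Γ n), ∀ f : ∀ n, Γ n, (∀ᶠ n in 𝓤, f n ∈ M n) ↔
      ∃ hf : f ∈ boundedSeq hl 𝓤, (⟨f, hf⟩ : boundedSeq hl 𝓤) ∈ W := by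
  classical
  obtain ⟨F, hF⟩ := ho
  let U : Subgroup (boundedSeq hl 𝓤) :=
    ⨅ g ∈ insert 1 F, (zeroSeq hl 𝓤).comap (MulAut.conj g⁻¹).toMonoidHom
  have hU : ∀ u, u ∈ U ↔ ∀ g ∈ insert 1 F, g⁻¹ * u * g ∈ zeroSeq hl 𝓤 := by
    intro u
    simp only [U, Subgroup.mem_iInf, Subgroup.mem_comap]
    refine forall₂_congr fun g _ => ?_
    simp
  have hUo : OpenSubgroup' (zeroSeq hl 𝓤) U := ⟨insert 1 F, fun k hk => (hU k).2 hk⟩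
  have hfin : ((QuotientGroup.mk : _ → boundedSeq hl 𝓤 ⧸ U) '' W).Finite :=
    ((growthData_seq hl 𝓤).finite_image_of_open hUo r).subset (Set.image_mono hW)
  obtain ⟨I, hIW, hI⟩ := Set.exists_subset_bijOn (W : Set (boundedSeq hl 𝓤))
    (QuotientGroup.mk : _ → boundedSeq hl 𝓤 ⧸ U)
  have hIf : I.Finite := Set.Finite.of_finite_image (by rwa [hI.image_eq]) hI.injOn
  refine ⟨fun n => {x | ∃ i ∈ hIf.toFinset, ∀ g ∈ insert 1 F,
    l n ((g.1 n)⁻¹ * ((i.1 n)⁻¹ * x) * g.1 n) = 0}, fun f => ⟨fun hf => ?_, ?_⟩⟩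
  · obtain ⟨i, hi, hp⟩ := exists_eventually_of_finset _ hf
    have hiW : i ∈ W := hIW (hIf.mem_toFinset.1 hi)
    have hu0 : ∀ᶠ n in 𝓤, l n ((i.1 n)⁻¹ * f n) = 0 := hp.mono fun n hn => by
      simpa using hn 1 (Finset.mem_insert_self _ _)
    let u : boundedSeq hl 𝓤 := ⟨fun n => (i.1 n)⁻¹ * f n, 0, hu0.mono fun n hn => hn.le⟩
    have hu : u ∈ W := hF u fun g hg => by
      filter_upwards [hp] with n hn
      exact hn g (Finset.mem_insert_of_mem hg)
    have e : f = (i * u).1 := by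
      funext n
      exact (mul_inv_cancel_left (i.1 n) (f n)).symm
    have hf' : f ∈ boundedSeq hl 𝓤 := e ▸ (i * u).2
    have e' : (⟨f, hf'⟩ : boundedSeq hl 𝓤) = i * u := Subtype.ext e
    exact ⟨hf', e' ▸ W.mul_mem hiW hu⟩
  · rintro ⟨hf, hfW⟩
    obtain ⟨i, hi, e⟩ := hI.surjOn ⟨_, hfW, rfl⟩
    have h1 := (hU _).1 (QuotientGroup.eq.1 e)
    have h2 : ∀ᶠ n in 𝓤, ∀ g ∈ insert 1 F, l n ((g.1 n)⁻¹ * ((i.1 n)⁻¹ * f n) * g.1 n) = 0 :=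
      (Filter.eventually_all_finset _).2 fun g hg => h1 g hg
    exact h2.mono fun n hn => ⟨i, hIf.mem_toFinset.2 hi, hn⟩

lemma leftComm_finite {G : Type*} [Group G] {T : Set G} (hT : T.Finite) (n : ℕ) :
    (leftComm T n).Finite := by
  induction n with
  | zero => exact hT
  | succ n ih =>
    refine (ih.image2 (fun y x => ⁅y, x⁆) hT).subset ?_
    rintro _ ⟨y, hy, x, hx, rfl⟩
    exact ⟨y, hy, x, hx, rfl⟩

lemma exists_lift_generators {H : Type*} [Group H] (W : Subgroup H) [W.Normal]
    (hv : Group.IsVirtuallyNilpotent (H ⧸ W)) (hfg : SubgroupsFG (H ⧸ W)) :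
    ∃ (X : Set H) (c : ℕ) (L : Subgroup H), X.Finite ∧ leftComm X c ⊆ W ∧ L.FiniteIndex ∧
      ∀ h ∈ L, ∃ v ∈ Subgroup.closure X, ∃ w ∈ W, h = v * w := by
  classical
  obtain ⟨N, hN, hfi⟩ := hv
  obtain ⟨X', hX'⟩ := hfg N
  obtain ⟨c, hc⟩ := (isNilpotent_iff_lowerCentralSeries N).1 hN
  set X : Set H := Quotient.out '' (X' : Set (H ⧸ W)) with hX
  have hXX' : mk' W '' X = X' := by
    rw [hX, Set.image_image]
    simp
  have hlc : leftComm (X' : Set (H ⧸ W)) c ⊆ {1} := by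
    have h1 : ∀ n, leftComm (X' : Set (H ⧸ W)) n ⊆ N.lowerCentralSeries n := by
      have hXN : ∀ x ∈ X', x ∈ N := fun x hx => hX' ▸ Subgroup.subset_closure hx
      intro n
      induction n with
      | zero => exact fun x hx => hXN x hx
      | succ n ih =>
        rintro _ ⟨y, hy, x, hx, rfl⟩
        exact commutator_mem_commutator (ih hy) (hXN x hx)
    have h2 := h1 c
    rwa [hc] at h2
  refine ⟨X, c, N.comap (mk' W), X'.finite_toSet.image _, ?_, ⟨?_⟩, ?_⟩
  · intro x hx
    have h1 : (x : H ⧸ W) ∈ leftComm (X' : Set (H ⧸ W)) c := by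
      rw [← hXX', leftComm_image]
      exact ⟨x, hx, rfl⟩
    exact (eq_one_iff x).1 (hlc h1)
  · rw [index_comap_of_surjective _ (mk'_surjective W)]
    exact hfi.index_ne_zero
  · intro h hh
    have h1 : mk' W h ∈ N := hh
    rw [← hX', ← hXX', ← MonoidHom.map_closure] at h1
    obtain ⟨v, hv, e⟩ := h1
    exact ⟨v, hv, v⁻¹ * h, QuotientGroup.eq.1 e, by group⟩

variable {Γ : ℕ → Type} [∀ n, Group (Γ n)] {l : ∀ n, Γ n → ℕ} {C d : ℕ}

theorem eventually_nilpotentStructure (hl : ∀ n, LengthData (l n) C d) (𝓤 : Ultrafilter ℕ) :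
    ∃ A, ∀ᶠ n in 𝓤, NilpotentStructure (l n) A := by
  classical
  have hD := growthData_seq hl 𝓤
  obtain ⟨W, hWn, ⟨r, hr⟩, ho, hv, hfg⟩ := GrowthData.hasStructure d hD
  obtain ⟨M, hM⟩ := exists_internal hl 𝓤 W hr ho
  obtain ⟨X, c, L, hXf, hXW, hLfi, hL⟩ := exists_lift_generators W hv hfg
  have hone : ∀ᶠ n in 𝓤, 1 ∈ M n := (hM 1).2 ⟨Subgroup.one_mem _, W.one_mem⟩
  have hmul : ∀ᶠ n in 𝓤, ∀ p : Γ n × Γ n, p.1 ∈ M n → p.2 ∈ M n → p.1 * p.2 ∈ M n := by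
    refine eventually_forall_of_seq fun f => ?_
    rw [Ultrafilter.eventually_imp, Ultrafilter.eventually_imp]
    intro h1 h2
    obtain ⟨h1', h1⟩ := (hM fun n => (f n).1).1 h1
    obtain ⟨h2', h2⟩ := (hM fun n => (f n).2).1 h2
    exact (hM fun n => (f n).1 * (f n).2).2 ⟨Subgroup.mul_mem _ h1' h2', W.mul_mem h1 h2⟩
  have hinv : ∀ᶠ n in 𝓤, ∀ x : Γ n, x ∈ M n → x⁻¹ ∈ M n := by
    refine eventually_forall_of_seq fun f => ?_
    rw [Ultrafilter.eventually_imp]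
    intro h1
    obtain ⟨h1', h1⟩ := (hM f).1 h1
    exact (hM fun n => (f n)⁻¹).2 ⟨Subgroup.inv_mem _ h1', W.inv_mem h1⟩
  have hconj : ∀ᶠ n in 𝓤, ∀ x ∈ hXf.toFinset, ∀ m : Γ n, m ∈ M n ↔ x.1 n * m * (x.1 n)⁻¹ ∈ M n := by
    refine (Filter.eventually_all_finset _).2 fun x _ => eventually_forall_of_seq fun f => ?_
    by_cases h : ∀ᶠ n in 𝓤, f n ∈ M n
    · obtain ⟨h1', h1⟩ := (hM f).1 h
      have h2 := (hM fun n => x.1 n * f n * (x.1 n)⁻¹).2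
        ⟨(boundedSeq hl 𝓤).mul_mem ((boundedSeq hl 𝓤).mul_mem x.2 h1')
          ((boundedSeq hl 𝓤).inv_mem x.2), hWn.conj_mem _ h1 x⟩
      filter_upwards [h, h2] with n h3 h4
      exact ⟨fun _ => h4, fun _ => h3⟩
    · have h2 : ¬ ∀ᶠ n in 𝓤, x.1 n * f n * (x.1 n)⁻¹ ∈ M n := by
        intro h2
        obtain ⟨h1', h1⟩ := (hM fun n => x.1 n * f n * (x.1 n)⁻¹).1 h2
        refine h ((hM f).2 ?_)
        have h3 := hWn.conj_mem _ h1 x⁻¹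
        have e : f = (x⁻¹ * (⟨_, h1'⟩ : boundedSeq hl 𝓤) * x⁻¹⁻¹).1 := by
          funext n
          change f n = (x.1 n)⁻¹ * (x.1 n * f n * (x.1 n)⁻¹) * (x.1 n)⁻¹⁻¹
          group
        have hf' : f ∈ boundedSeq hl 𝓤 := e ▸ Subtype.prop _
        have e' : (⟨f, hf'⟩ : boundedSeq hl 𝓤) = x⁻¹ * (⟨_, h1'⟩ : boundedSeq hl 𝓤) * x⁻¹⁻¹ :=
          Subtype.ext e
        exact ⟨hf', e' ▸ h3⟩
      rw [← Ultrafilter.eventually_not] at h h2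
      filter_upwards [h, h2] with n h3 h4
      exact ⟨fun h => absurd h h3, fun h => absurd h h4⟩
  let ev : ∀ n, boundedSeq hl 𝓤 →* Γ n := fun n =>
    (Pi.evalMonoidHom Γ n).comp (boundedSeq hl 𝓤).subtype
  have hcomm : ∀ᶠ n in 𝓤, leftComm (ev n '' X) c ⊆ M n := by
    have h1 : ∀ᶠ n in 𝓤, ∀ x ∈ (leftComm_finite hXf c).toFinset, x.1 n ∈ M n :=
      (Filter.eventually_all_finset _).2 fun x hx =>
        (hM x.1).2 ⟨x.2, hXW ((leftComm_finite hXf c).mem_toFinset.1 hx)⟩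
    filter_upwards [h1] with n hn
    rw [leftComm_image]
    rintro _ ⟨x, hx, rfl⟩
    exact hn x ((leftComm_finite hXf c).mem_toFinset.2 hx)
  have hfin0 : Finite (boundedSeq hl 𝓤 ⧸ L) := finite_quotient_of_finiteIndex
  obtain ⟨m, hm⟩ := hD.exists_subset_pow (Set.finite_range (Quotient.out : boundedSeq hl 𝓤 ⧸ L → _))
  set C₁ := max (m + 1) (r + 1) with hC₁
  have hlocal : ∀ᶠ n in 𝓤, ∀ g : Γ n, l n g ≤ C₁ + 1 →
      ∃ γ ∈ Subgroup.closure (ev n '' X ∪ M n), l n (γ⁻¹ * g) ≤ C₁ := by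
    refine eventually_forall_of_seq fun f => ?_
    rw [Ultrafilter.eventually_imp]
    intro hf
    let g : boundedSeq hl 𝓤 := ⟨f, _, hf⟩
    obtain ⟨k, hk⟩ := mk_out_eq_mul L g⁻¹
    obtain ⟨v, hv, w, hw, hvw⟩ := hL _ k.2
    have hs : (Quotient.out ((g⁻¹ : boundedSeq hl 𝓤) : boundedSeq hl 𝓤 ⧸ L)) ∈
        unitSeq hl 𝓤 ^ (m + 1) := hD.pow_mono (Nat.le_succ m) (hm ⟨_, rfl⟩)
    rw [hk, mem_unitSeq_pow] at hs
    filter_upwards [hs, (hM w.1).2 ⟨w.2, hw⟩] with n h1 h2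
    refine ⟨(k : boundedSeq hl 𝓤).1 n, ?_, ?_⟩
    · rw [hvw]
      refine Subgroup.mul_mem _ ?_ (Subgroup.subset_closure (Or.inr h2))
      have : v.1 n ∈ (Subgroup.closure X).map (ev n) := ⟨v, hv, rfl⟩
      rw [MonoidHom.map_closure] at this
      exact Subgroup.closure_mono Set.subset_union_left this
    · rw [← (hl n).inv]
      have e : (((k : boundedSeq hl 𝓤).1 n)⁻¹ * f n)⁻¹ = (g⁻¹ * k).1 n := by
        change _ = (f n)⁻¹ * (k : boundedSeq hl 𝓤).1 n
        group
      rw [e]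
      exact h1.trans (le_max_left _ _)
  have hbdd : ∀ᶠ n in 𝓤, ∀ x : Γ n, x ∈ M n → l n x ≤ C₁ := by
    refine eventually_forall_of_seq fun f => ?_
    rw [Ultrafilter.eventually_imp]
    intro h1
    obtain ⟨h1', h1⟩ := (hM f).1 h1
    have := (mem_unitSeq_pow hl 𝓤 r _).1 (hD.pow_mono (Nat.le_succ r) (hr h1))
    exact this.mono fun n hn => hn.trans (le_max_right _ _)
  have hfin := hD.finite_image_of_open ho (2 * C₁ + 1)
  set m₀ := hfin.toFinset.card with hm₀
  have hcount : ∀ᶠ n in 𝓤, ∀ p : Fin (m₀ + 1) → Γ n, (∀ i, l n (p i) ≤ 2 * C₁ + 1) →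
      ∃ q ∈ (Finset.univ : Finset (Fin (m₀ + 1) × Fin (m₀ + 1))),
        q.1 ≠ q.2 ∧ (p q.1)⁻¹ * p q.2 ∈ M n := by
    refine eventually_forall_of_seq fun f => ?_
    rw [Ultrafilter.eventually_imp]
    intro hf
    let g : Fin (m₀ + 1) → boundedSeq hl 𝓤 := fun i => ⟨fun n => f n i, _, hf.mono fun n hn => hn i⟩
    obtain ⟨i, -, j, -, hij, e⟩ := Finset.exists_ne_map_eq_of_card_lt_of_maps_to
      (s := (Finset.univ : Finset (Fin (m₀ + 1)))) (t := hfin.toFinset) (by simp [← hm₀])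
      (f := fun i => (g i : boundedSeq hl 𝓤 ⧸ W)) (by
        intro i _
        rw [Set.Finite.coe_toFinset]
        exact ⟨g i, (mem_unitSeq_pow hl 𝓤 (2 * C₁) _).2 (hf.mono fun n hn => hn i), rfl⟩)
    have h1 := (hM ((g i)⁻¹ * g j).1).2 ⟨Subtype.prop _, QuotientGroup.eq.1 e⟩
    exact h1.mono fun n hn => ⟨(i, j), Finset.mem_univ _, hij, hn⟩
  refine ⟨max C₁ (max c m₀), ?_⟩
  filter_upwards [hone, hmul, hinv, hconj, hcomm, hlocal, hbdd, hcount] with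
    n hone hmul hinv hconj hcomm hlocal hbdd hcount
  let M' : Subgroup (Γ n) :=
    { carrier := M n
      one_mem' := hone
      mul_mem' := fun {a b} ha hb => hmul (a, b) ha hb
      inv_mem' := fun {a} ha => hinv a ha }
  refine ⟨Subgroup.closure (ev n '' X ∪ M n), M', ev n '' X, C₁, c, le_max_left _ _,
    (le_max_left _ _).trans (le_max_right _ _), rfl, ?_, hcomm, ?_, hbdd, ?_⟩
  · have h1 : Subgroup.closure (ev n '' X ∪ M n) ≤ normalizer (M' : Set (Γ n)) := by
      refine (closure_le _).2 (Set.union_subset ?_ ?_)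
      · rintro _ ⟨x, hx, rfl⟩
        exact mem_normalizer_iff.2 fun m => hconj x (hXf.mem_toFinset.2 hx) m
      · exact M'.le_normalizer
    intro x hx y hy
    exact (mem_normalizer_iff.1 (h1 hx) y).1 hy
  · have key : ∀ R, ∀ g : Γ n, l n g ≤ R →
        ∃ γ ∈ Subgroup.closure (ev n '' X ∪ M n), l n (γ⁻¹ * g) ≤ C₁ := by
      intro R
      induction R with
      | zero => exact fun g hg => hlocal g (by omega)
      | succ R ih =>
        intro g hg
        obtain ⟨a, b, rfl, ha, hb⟩ := (hl n).split g R hg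
        obtain ⟨γ, hγ, h1⟩ := ih a ha
        obtain ⟨γ', hγ', h2⟩ := hlocal (γ⁻¹ * (a * b)) (by
          rw [← mul_assoc]
          exact ((hl n).mul _ _).trans (add_le_add h1 hb))
        exact ⟨γ * γ', Subgroup.mul_mem _ hγ hγ', by rwa [mul_inv_rev, mul_assoc]⟩
    exact fun g => key _ g le_rfl
  · intro F hF hF'
    refine le_trans ?_ ((le_max_right _ _).trans (le_max_right _ _))
    by_contra hcard
    push Not at hcard
    let p : Fin (m₀ + 1) → Γ n := fun i => (F.equivFin.symm (Fin.castLE hcard i) : Γ n)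
    obtain ⟨⟨i, j⟩, -, hij, hq⟩ := hcount p fun i => hF _ (Subtype.prop _)
    refine hij ?_
    have := hF' _ (Subtype.prop _) _ (Subtype.prop _) hq
    simpa [p] using Subtype.ext this

/-- Groups with geodesic lengths of uniformly polynomial growth are uniformly almost nilpotent. -/
theorem exists_nilpotentStructure (C d : ℕ) : ∃ A, ∀ (Γ : Type) [Group Γ] (l : Γ → ℕ),
    LengthData l C d → NilpotentStructure l A := by
  by_contra hcon
  push Not at hcon
  choose Γ hΓ l hl hA using hcon
  obtain ⟨A, h⟩ := eventually_nilpotentStructure hl (hyperfilter ℕ)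
  have h2 : ∀ᶠ n in hyperfilter ℕ, A ≤ n := Nat.hyperfilter_le_atTop (eventually_ge_atTop A)
  obtain ⟨n, h3, h4⟩ := (h.and h2).exists
  exact hA n (h3.mono h4)

end

section
open Subgroup QuotientGroup Set Fintype
open scoped IsMulCommutative

variable {Q : Type} [Group Q]

lemma exists_exponents {A : Type*} [CommGroup A] {T : Set Q} (hTf : T.Finite) (f : Q →* A) (n : ℕ) :
    ∀ q ∈ T ^ n, ∃ a : Q → ℕ, (∀ s, a s ≤ n) ∧ f q = ∏ s ∈ hTf.toFinset, f s ^ a s := by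
  classical
  induction n with
  | zero =>
    intro q hq
    rw [pow_zero, Set.mem_one] at hq
    exact ⟨0, by simp, by simp [hq]⟩
  | succ n ih =>
    intro q hq
    rw [pow_succ] at hq
    obtain ⟨x, hx, s, hs, rfl⟩ := hq
    obtain ⟨a, ha, e⟩ := ih x hx
    refine ⟨fun u => a u + if u = s then 1 else 0, fun u => ?_, ?_⟩
    · have := ha u
      simp only; split_ifs <;> omega
    · simp only [pow_add, prod_mul_distrib]
      rw [map_mul, e]
      congr 1
      rw [Finset.prod_eq_single s]
      · simp
      · intro b _ hb; simp [hb]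
      · intro h; exact absurd (hTf.mem_toFinset.2 hs) h

lemma prod_center_mem_pow {T : Set Q} {κ : Type*} (J : Finset κ) (f : κ → Subgroup.center Q)
    {L : ℕ} (h : ∀ x ∈ J, (f x : Q) ∈ T ^ L) :
    ((∏ x ∈ J, f x : Subgroup.center Q) : Q) ∈ T ^ (L * J.card) := by
  classical
  induction J using Finset.induction_on with
  | empty => simp
  | insert a J ha ih =>
    rw [Finset.prod_insert ha, card_insert_of_notMem ha, mul_add, mul_one, add_comm, pow_add]
    exact Set.mul_mem_mul (h a (mem_insert_self _ _))
      (ih fun x hx => h x (Finset.mem_insert_of_mem hx))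

def prodHom {ι : Type*} [Fintype ι] (φ : ι → Q →* Subgroup.center Q) : (ι → Q) →* Q :=
  (Subgroup.center Q).subtype.comp
    { toFun := fun q => ∏ i, φ i (q i)
      map_one' := by simp
      map_mul' := fun a b => by simp [prod_mul_distrib] }

lemma prodHom_apply {ι : Type*} [Fintype ι] (φ : ι → Q →* Subgroup.center Q) (q : ι → Q) :
    prodHom φ q = ((∏ i, φ i (q i) : Subgroup.center Q) : Q) := rfl

/-- A central subgroup with short representatives of large powers has large balls. -/
lemma card_range_prodHom_le [Finite Q] {T : Set Q} (hT1 : 1 ∈ T) {D r w : ℕ} (hr : 1 ≤ r)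
    (hrD : r ≤ D) (hTD : T ^ D = Set.univ) {ι : Type*} [Fintype ι] (φ : ι → Q →* Subgroup.center Q)
    (hφ : ∀ i a, ∀ s ∈ T ^ a, (φ i s : Q) ∈ T ^ (w * (a + 1))) :
    Nat.card (prodHom φ).range * r ^ (Fintype.card ι * T.ncard) ≤
      (2 * D) ^ (Fintype.card ι * T.ncard) *
        (((prodHom φ).range : Set Q) ∩ T ^ (w * r * (Fintype.card ι * T.ncard))).ncard := by
  classical
  have hTf : T.Finite := toFinite T
  set T' := hTf.toFinset
  have hT' : T.ncard = T'.card := ncard_eq_toFinset_card T hTf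
  set m := Fintype.card ι * T.ncard with hm
  have hmJ : (Finset.univ ×ˢ T' : Finset (ι × Q)).card = m := by
    rw [card_product, card_univ, ← hT']
  set R : Set Q := ((prodHom φ).range : Set Q) ∩ T ^ (w * r * m)
  let E : (ι × T' → Fin (D / r + 1)) → Q := fun j =>
    ((∏ p : ι × T', φ p.1 p.2 ^ (r * (j p : ℕ)) : Subgroup.center Q) : Q)
  have hsub : ((prodHom φ).range : Set Q) ⊆ (Set.range E) * R := by
    rintro _ ⟨q, rfl⟩
    have h1 : ∀ i, ∃ a : Q → ℕ, (∀ s, a s ≤ D) ∧ φ i (q i) = ∏ s ∈ T', φ i s ^ a s := fun i =>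
      exists_exponents hTf (φ i) D (q i) (by rw [hTD]; trivial)
    choose a ha he using h1
    refine ⟨E fun p => ⟨a p.1 p.2 / r, Nat.lt_succ_of_le (Nat.div_le_div_right (ha _ _))⟩, ⟨_, rfl⟩,
      ((∏ p : ι × T', φ p.1 (p.2.1 ^ (a p.1 p.2 % r)) : Subgroup.center Q) : Q), ⟨?_, ?_⟩, ?_⟩
    · refine ⟨fun i => (T'.toList.map fun s => s ^ (a i s % r)).prod, ?_⟩
      rw [prodHom_apply]
      congr 1
      rw [prod_prod_type]
      refine Finset.prod_congr rfl fun i _ => ?_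
      rw [map_list_prod, List.map_map]
      rw [prod_coe_sort T' (fun s => φ i (s ^ (a i s % r))), ← prod_map_toList]
      rfl
    · have h2 := prod_center_mem_pow (T := T) (Finset.univ : Finset (ι × T'))
        (fun p => φ p.1 (p.2.1 ^ (a p.1 p.2 % r))) (L := w * r) (by
          intro p _
          refine Set.pow_subset_pow_right hT1 ?_ (hφ p.1 (a p.1 p.2 % r) _
            (Set.pow_mem_pow (hTf.mem_toFinset.1 p.2.2)))
          exact Nat.mul_le_mul_left w (Nat.mod_lt _ (by omega)))
      rwa [card_univ, card_prod, card_coe, ← hT'] at h2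
    · simp only [E]
      rw [prodHom_apply, ← Subgroup.coe_mul, ← prod_mul_distrib, prod_prod_type]
      congr 1
      refine Finset.prod_congr rfl fun i _ => ?_
      rw [he i, ← prod_coe_sort T' (fun s => φ i s ^ a i s)]
      refine Finset.prod_congr rfl fun s _ => ?_
      simp only
      rw [map_pow, ← pow_add, Nat.div_add_mod]
  have hcard : Nat.card (prodHom φ).range ≤ (D / r + 1) ^ m * R.ncard := by
    calc Nat.card (prodHom φ).range = ((prodHom φ).range : Set Q).ncard := rfl
      _ ≤ (Set.range E * R).ncard := ncard_le_ncard hsub (toFinite _)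
      _ ≤ (Set.range E).ncard * R.ncard := natCard_mul_le
      _ ≤ (D / r + 1) ^ m * R.ncard := by
          gcongr
          rw [← image_univ]
          refine (ncard_image_le (toFinite _)).trans ?_
          rw [ncard_univ, Nat.card_eq_fintype_card, card_fun, Fintype.card_fin,
            card_prod, card_coe, ← hT']
  calc Nat.card (prodHom φ).range * r ^ m ≤ (D / r + 1) ^ m * R.ncard * r ^ m := by gcongr
    _ = ((D / r + 1) * r) ^ m * R.ncard := by rw [mul_pow]; ring
    _ ≤ (2 * D) ^ m * R.ncard := by
        refine Nat.mul_le_mul_right _ (Nat.pow_le_pow_left ?_ m)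
        have := Nat.div_mul_le_self D r
        rw [add_mul]; omega

/-- Balls of a group split as balls in a quotient and balls in the kernel. -/
lemma ncard_pow_quotient_mul_le [Finite Q] (T : Set Q) (A : Subgroup Q) [A.Normal] (m n : ℕ) :
    ((mk' A '' T) ^ m).ncard * ((A : Set Q) ∩ T ^ n).ncard ≤ (T ^ (m + n)).ncard := by
  classical
  have h1 : ∀ q ∈ (mk' A '' T) ^ m, ∃ x ∈ T ^ m, (x : Q ⧸ A) = q := by
    intro q hq
    rw [← Set.image_pow] at hq
    exact hq
  choose! f hf1 hf2 using h1
  rw [← ncard_prod]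
  refine ncard_le_ncard_of_injOn (fun p => f p.1 * p.2) ?_ ?_ (toFinite _)
  · rintro ⟨q, a⟩ ⟨hq, ha⟩
    rw [pow_add]
    exact Set.mul_mem_mul (hf1 q hq) ha.2
  · rintro ⟨q, a⟩ ⟨hq, ha⟩ ⟨q', a'⟩ ⟨hq', ha'⟩ e
    simp only at e hq hq'
    have h2 := congrArg (QuotientGroup.mk : Q → Q ⧸ A) e
    rw [mk_mul, mk_mul, (eq_one_iff a).2 ha.1,
      (eq_one_iff a').2 ha'.1, mul_one, mul_one, hf2 q hq, hf2 q' hq'] at h2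
    subst h2
    rw [mul_left_cancel e]

lemma leftComm_subset_pow {T : Set Q} (hT1 : 1 ∈ T) (hTi : ∀ s ∈ T, s⁻¹ ∈ T) (j : ℕ) :
    leftComm T j ⊆ T ^ (4 ^ j) ∧ (leftComm T j)⁻¹ ⊆ T ^ (4 ^ j) := by
  have hinv : ∀ n, ∀ x ∈ T ^ n, x⁻¹ ∈ T ^ n := by
    intro n x hx
    have h1 : T⁻¹ = T := Set.Subset.antisymm (fun x hx => by simpa using hTi _ hx)
      fun x hx => hTi _ hx
    have : x⁻¹ ∈ (T ^ n)⁻¹ := Set.inv_mem_inv.2 hx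
    rwa [← inv_pow, h1] at this
  have key : leftComm T j ⊆ T ^ (4 ^ j) := by
    induction j with
    | zero => simp [leftComm]
    | succ j ih =>
      rintro _ ⟨y, hy, x, hx, rfl⟩
      have hp : 1 ≤ 4 ^ j := Nat.one_le_pow _ _ (by norm_num)
      refine Set.pow_subset_pow_right hT1 (m := 4 ^ j + 1 + 4 ^ j + 1) (by rw [pow_succ]; omega) ?_
      rw [pow_add, pow_add, pow_add, pow_one]
      exact Set.mul_mem_mul (Set.mul_mem_mul (Set.mul_mem_mul (ih hy) hx) (hinv _ _ (ih hy)))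
        (hTi x hx)
  exact ⟨key, fun x hx => by simpa using hinv _ _ (key hx)⟩

lemma ncard_leftComm_le [Finite Q] (T : Set Q) (j : ℕ) : (leftComm T j).ncard ≤ T.ncard ^ (j + 1) := by
  induction j with
  | zero => simp [leftComm]
  | succ j ih =>
    have : leftComm T (j + 1) ⊆ (fun p : Q × Q => ⁅p.1, p.2⁆) '' (leftComm T j ×ˢ T) := by
      rintro _ ⟨y, hy, x, hx, rfl⟩
      exact ⟨(y, x), ⟨hy, hx⟩, rfl⟩
    calc _ ≤ _ := ncard_le_ncard this (toFinite _)
      _ ≤ _ := ncard_image_le (toFinite _)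
      _ = _ := ncard_prod
      _ ≤ _ := by rw [pow_succ _ (j + 1)]; gcongr

/-- Reduction of a volume estimate to the quotient by the image of a family of central
homomorphisms. -/
lemma card_le_of_quotient [Finite Q] {T : Set Q} (hT1 : 1 ∈ T) {D r w m B K q : ℕ} (hr : 1 ≤ r)
    (hrD : r ≤ D) (hTD : T ^ D = Set.univ) {ι : Type*} [Fintype ι] (φ : ι → Q →* Subgroup.center Q)
    (hφ : ∀ i a, ∀ s ∈ T ^ a, (φ i s : Q) ∈ T ^ (w * (a + 1)))
    (hm : Fintype.card ι * T.ncard ≤ m) [(prodHom φ).range.Normal]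
    (hquot : Nat.card (Q ⧸ (prodHom φ).range) * r ^ q ≤
      K * D ^ q * ((mk' (prodHom φ).range '' T) ^ (B * r)).ncard) :
    Nat.card Q * r ^ (q + m) ≤ (K * 2 ^ m) * D ^ (q + m) * (T ^ ((B + w * m) * r)).ncard := by
  have h1 := card_range_prodHom_le hT1 hr hrD hTD φ hφ
  set m' := Fintype.card ι * T.ncard
  have h2 : Nat.card (prodHom φ).range * r ^ m ≤
      (2 * D) ^ m * (((prodHom φ).range : Set Q) ∩ T ^ (w * m * r)).ncard := by
    obtain ⟨e, rfl⟩ := Nat.exists_eq_add_of_le hm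
    calc Nat.card (prodHom φ).range * r ^ (m' + e) = Nat.card (prodHom φ).range * r ^ m' * r ^ e := by
          rw [pow_add, mul_assoc]
      _ ≤ (2 * D) ^ m' * (((prodHom φ).range : Set Q) ∩ T ^ (w * r * m')).ncard * (2 * D) ^ e := by
          gcongr; omega
      _ ≤ (2 * D) ^ m' * (((prodHom φ).range : Set Q) ∩ T ^ (w * (m' + e) * r)).ncard * (2 * D) ^ e := by
          refine Nat.mul_le_mul_right _ (Nat.mul_le_mul_left _ (ncard_le_ncard
            (Set.inter_subset_inter_right _ (Set.pow_subset_pow_right hT1 ?_)) (toFinite _)))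
          nlinarith [Nat.zero_le (w * e * r)]
      _ = _ := by rw [pow_add]; ring
  have h3 := ncard_pow_quotient_mul_le T (prodHom φ).range (B * r) (w * m * r)
  have hcard : Nat.card Q = Nat.card (Q ⧸ (prodHom φ).range) * Nat.card (prodHom φ).range :=
    card_eq_card_quotient_mul_card_subgroup _
  calc Nat.card Q * r ^ (q + m) = (Nat.card (Q ⧸ (prodHom φ).range) * r ^ q) *
        (Nat.card (prodHom φ).range * r ^ m) := by rw [hcard, pow_add]; ring
    _ ≤ _ := Nat.mul_le_mul hquot h2
    _ = K * 2 ^ m * D ^ (q + m) * (((mk' (prodHom φ).range '' T) ^ (B * r)).ncard *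
        (((prodHom φ).range : Set Q) ∩ T ^ (w * m * r)).ncard) := by
        rw [pow_add, mul_pow]; ring
    _ ≤ _ := by
        rw [add_mul B]
        gcongr

lemma range_prodHom_normal {ι : Type*} [Fintype ι] (φ : ι → Q →* Subgroup.center Q) :
    (prodHom φ).range.Normal := by
  refine ⟨?_⟩
  rintro _ ⟨q, rfl⟩ g
  have h := (∏ i, φ i (q i) : Subgroup.center Q).2
  rw [prodHom_apply, Subgroup.mem_center_iff.1 h g, mul_inv_cancel_right, ← prodHom_apply]
  exact ⟨q, rfl⟩

/-- Moderate growth of finite nilpotent groups. -/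
theorem exists_nilpotent_card_le (c k : ℕ) : ∃ B K q : ℕ, ∀ (Q : Type) [Group Q] [Finite Q]
    (T : Set Q) (D r : ℕ), Subgroup.upperCentralSeries Q c = ⊤ → 1 ∈ T → (∀ s ∈ T, s⁻¹ ∈ T) →
    T.ncard ≤ k → T ^ D = Set.univ → 1 ≤ r → r ≤ D →
    Nat.card Q * r ^ q ≤ K * D ^ q * (T ^ (B * r)).ncard := by
  classical
  induction c with
  | zero =>
    refine ⟨0, 1, 0, fun Q _ _ T D r hc hT1 hTi hk hTD hr hrD => ?_⟩
    have : Subsingleton Q := by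
      rw [Subgroup.upperCentralSeries_zero] at hc
      refine ⟨fun x y => ?_⟩
      have hx : ∀ x : Q, x = 1 := fun x => Subgroup.mem_bot.1 (hc ▸ Subgroup.mem_top x)
      rw [hx x, hx y]
    simp [← Set.singleton_one]
  | succ c ih =>
    obtain ⟨B, K, q, h⟩ := ih
    have hTquot : ∀ (Q : Type) [Group Q] [Finite Q] (A : Subgroup Q) [A.Normal] (T : Set Q) (D : ℕ),
        1 ∈ T → (∀ s ∈ T, s⁻¹ ∈ T) → T.ncard ≤ k → T ^ D = Set.univ →
        leftComm T c ⊆ A → ∀ r, 1 ≤ r → r ≤ D →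
        Nat.card (Q ⧸ A) * r ^ q ≤ K * D ^ q * ((mk' A '' T) ^ (B * r)).ncard := by
      intro Q _ _ A _ T D hT1 hTi hk hTD hlc r hr hrD
      have hgen : (mk' A '' T) ^ D = Set.univ := by
        rw [← Set.image_pow, hTD, image_univ]
        exact (mk'_surjective A).range_eq
      refine h (Q ⧸ A) _ D r ?_ ⟨1, hT1, map_one _⟩ ?_ ((ncard_image_le (toFinite _)).trans hk)
        hgen hr hrD
      · refine ucs_eq_top_of_leftComm (T := mk' A '' T) ?_ ?_
        · refine eq_top_iff.2 fun x _ => ?_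
          have hx : x ∈ (mk' A '' T) ^ D := by rw [hgen]; trivial
          have hcl : ∀ n, (mk' A '' T) ^ n ⊆
              (Subgroup.closure (mk' A '' T) : Set (Q ⧸ A)) := by
            intro n
            induction n with
            | zero =>
              intro y hy; rw [pow_zero, Set.mem_one] at hy; rw [hy]; exact Subgroup.one_mem _
            | succ n ih =>
              rw [pow_succ]
              rintro _ ⟨a, ha, b, hb, rfl⟩
              exact Subgroup.mul_mem _ (ih ha) (Subgroup.subset_closure hb)
          exact hcl D hx
        · rw [leftComm_image]
          rintro _ ⟨x, hx, rfl⟩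
          exact (eq_one_iff x).2 (hlc hx)
      · rintro _ ⟨s, hs, rfl⟩
        exact ⟨s⁻¹, hTi s hs, map_inv _ _⟩
    rcases Nat.eq_zero_or_pos c with rfl | hcpos
    · refine ⟨B + 1 * k, K * 2 ^ k, q + k, fun Q _ _ T D r hc hT1 hTi hk hTD hr hrD => ?_⟩
      have hcen : Subgroup.center Q = ⊤ := by rw [← hc, zero_add, Subgroup.upperCentralSeries_one]
      let φ : Unit → Q →* Subgroup.center Q := fun _ =>
        (MonoidHom.id Q).codRestrict _ fun x => by rw [hcen]; trivial
      have := range_prodHom_normal φ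
      refine card_le_of_quotient hT1 hr hrD hTD φ ?_ (by simpa using hk) ?_
      · intro i a s hs
        exact Set.pow_subset_pow_right hT1 (by omega) hs
      · refine hTquot Q (prodHom φ).range T D hT1 hTi hk hTD (fun x _ => ⟨fun _ => x, ?_⟩) r hr hrD
        rw [prodHom_apply]; simp [φ]
    · obtain ⟨c, rfl⟩ := Nat.exists_eq_add_of_le' hcpos
      refine ⟨B + (2 * 4 ^ c + 2) * (k ^ (c + 1) * k), K * 2 ^ (k ^ (c + 1) * k),
        q + k ^ (c + 1) * k, fun Q _ _ T D r hc hT1 hTi hk hTD hr hrD => ?_⟩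
      have hft : Fintype (leftComm T c) := ofFinite _
      have hlc : ∀ j, ∀ i, i + j = c + 1 + 1 → leftComm T j ⊆ Subgroup.upperCentralSeries Q i := by
        intro j
        induction j with
        | zero => intro i hi x _; obtain rfl : i = c + 1 + 1 := by omega
                  rw [hc]; trivial
        | succ j ihj =>
          rintro i hi _ ⟨y, hy, x, hx, rfl⟩
          have := ihj (i + 1) (by omega) hy
          exact (Subgroup.mem_upperCentralSeries_succ_iff.1 this) x
      have hy2 : ∀ y ∈ leftComm T c, ∀ x, ⁅y, x⁆ ∈ Subgroup.center Q := by
        intro y hy x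
        have := Subgroup.mem_upperCentralSeries_succ_iff.1 (hlc c 2 (by omega) hy) x
        rwa [Subgroup.upperCentralSeries_one] at this
      let φ : leftComm T c → Q →* Subgroup.center Q := fun y =>
        { toFun := fun x => ⟨⁅y.1, x⁆, hy2 y.1 y.2 x⟩
          map_one' := by simp
          map_mul' := fun a b => by
            refine Subtype.ext ?_
            have hb := Subgroup.mem_center_iff.1 (hy2 y.1 y.2 b) a
            change ⁅y.1, a * b⁆ = ⁅y.1, a⁆ * ⁅y.1, b⁆
            have e : ⁅y.1, a * b⁆ = ⁅y.1, a⁆ * (a * ⁅y.1, b⁆ * a⁻¹) := by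
              simp only [commutatorElement_def]; group
            rw [e, hb, mul_inv_cancel_right] }
      have := range_prodHom_normal φ
      refine card_le_of_quotient hT1 hr hrD hTD φ ?_ ?_ ?_
      · intro y a s hs
        have hinv : s⁻¹ ∈ T ^ a := by
          have h1 : T⁻¹ = T := Set.Subset.antisymm (fun x hx => by simpa using hTi _ hx)
            fun x hx => hTi _ hx
          have : s⁻¹ ∈ (T ^ a)⁻¹ := Set.inv_mem_inv.2 hs
          rwa [← inv_pow, h1] at this
        obtain ⟨h1, h2⟩ := leftComm_subset_pow hT1 hTi c
        refine Set.pow_subset_pow_right hT1 (m := 4 ^ c + a + 4 ^ c + a) ?_ ?_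
        · nlinarith [Nat.zero_le (4 ^ c * a)]
        · change y.1 * s * y.1⁻¹ * s⁻¹ ∈ _
          rw [pow_add, pow_add, pow_add]
          exact Set.mul_mem_mul (Set.mul_mem_mul (Set.mul_mem_mul (h1 y.2) hs)
            (h2 (Set.inv_mem_inv.2 y.2))) hinv
      · refine Nat.mul_le_mul ?_ hk
        rw [← Nat.card_eq_fintype_card]
        exact (ncard_leftComm_le T c).trans (Nat.pow_le_pow_left hk _)
      · refine hTquot Q (prodHom φ).range T D hT1 hTi hk hTD ?_ r hr hrD
        rintro _ ⟨y, hy, x, hx, rfl⟩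
        refine ⟨fun z => if z = ⟨y, hy⟩ then x else 1, ?_⟩
        rw [prodHom_apply, Finset.prod_eq_single ⟨y, hy⟩]
        · simp [φ]
        · intro b _ hb; simp [hb]
        · intro h; exact absurd (Finset.mem_univ _) h

end

/-- The number of vertices of `G` at distance at most `r` from `o`. -/
local notation "β(" G "," o "," r ")" => Nat.card (Set.ofPred fun y => SimpleGraph.dist G o y ≤ r)

section
open QuotientGroup Set

variable {V : Type} {G : SimpleGraph V}

lemma dist_iso (φ : G ≃g G) (x y : V) (hG : G.Connected) : G.dist (φ x) (φ y) = G.dist x y := by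
  have key : ∀ (φ : G ≃g G) (x y : V), G.dist (φ x) (φ y) ≤ G.dist x y := by
    intro φ x y
    obtain ⟨p, hp⟩ := (hG x y).exists_walk_length_eq_dist
    rw [← hp, ← SimpleGraph.Walk.length_map φ.toHom p]
    exact SimpleGraph.dist_le _
  refine le_antisymm (key φ x y) ?_
  simpa using key φ.symm (φ x) (φ y)

lemma lengthData_of_transitive (hG : G.Connected) (ht : IsVertexTransitive G) (o : V)
    [Finite V] {C d : ℕ} (hb : ∀ r, β(G, o, r) ≤ C * (r + 1) ^ d) :
    LengthData (fun g : G ≃g G => G.dist o (g o)) C d where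
  one := by simp
  inv g := by
    rw [← dist_iso g o _ hG]
    rw [RelIso.apply_inv_self, SimpleGraph.dist_comm]
  mul g h := by
    refine (hG.dist_triangle (v := g o)).trans ?_
    rw [RelIso.mul_apply, dist_iso g o _ hG]
  split g r h := by
    rcases Nat.lt_or_ge (G.dist o (g o)) (r + 1) with h1 | h1
    · exact ⟨g, 1, by simp, by simpa using Nat.lt_succ_iff.1 h1, by simp⟩
    · have h2 : G.dist o (g o) = r + 1 := le_antisymm h h1
      obtain ⟨p, hp⟩ := (hG o (g o)).exists_walk_length_eq_dist
      obtain ⟨a, ha⟩ := ht o (p.getVert r)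
      refine ⟨a, a⁻¹ * g, by simp, ?_, ?_⟩
      · rw [ha]
        exact (SimpleGraph.dist_le (p.take r)).trans (by simp [SimpleGraph.Walk.take_length])
      · rw [← dist_iso a o _ hG, RelIso.mul_apply, RelIso.apply_inv_self, ha]
        have := SimpleGraph.dist_le (p.drop r)
        rw [SimpleGraph.Walk.drop_length] at this
        omega
  growth r F hF hF' := by
    classical
    refine le_trans ?_ (hb r)
    rw [← ncard_coe_finset F]
    refine ncard_le_ncard_of_injOn (fun g : G ≃g G => g o) (fun g hg => hF g hg) ?_ (toFinite _)
    intro x hx y hy e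
    refine hF' x hx y hy ?_
    have e' : x o = y o := e
    simp only [RelIso.mul_apply, ← e', RelIso.inv_apply_self, SimpleGraph.dist_self]

lemma mem_pow_of_lift {Q R : Type*} [Group Q] [Group R] (f : Q →* R) {S : Set Q} {n : ℕ} {y : R}
    (hy : y ∈ (f '' S) ^ n) : ∃ x ∈ S ^ n, f x = y := by
  rw [← Set.image_pow] at hy
  exact hy

/-- Moderate growth of vertex-transitive graphs, up to dilating balls by a constant. -/
lemma exists_moderate_growth_dilated (C d : ℕ) : ∃ B K q : ℕ, ∀ (V : Type) [Finite V]
    (G : SimpleGraph V), G.Connected → IsVertexTransitive G → ∀ o : V,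
    (∀ r, β(G, o, r) ≤ C * (r + 1) ^ d) →
    ∀ D r, (∀ x, G.dist o x ≤ D) → 1 ≤ r → r ≤ D →
    Nat.card V * r ^ q ≤ K * D ^ q * β(G, o, B * r) := by
  classical
  obtain ⟨A, hA⟩ := exists_nilpotentStructure C d
  obtain ⟨B, K, q, hBK⟩ := exists_nilpotent_card_le A A
  refine ⟨(2 * A + 1) * B, C * (2 * A + 1) ^ d * (K * 2 ^ q * A), q, ?_⟩
  intro V _ G hG ht o hb D r hD hr hrD
  have hl := lengthData_of_transitive hG ht o hb
  obtain ⟨L, M, X, C₁, c, hC₁, hc, hL, hnorm, hX, hdense, hM, hfin⟩ := hA _ _ hl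
  set l : (G ≃g G) → ℕ := fun g => G.dist o (g o) with hldef
  have hML : M ≤ L := by rw [hL]; exact fun x hx => Subgroup.subset_closure (Or.inr hx)
  have hXL : X ⊆ L := by rw [hL]; exact fun x hx => Subgroup.subset_closure (Or.inl hx)
  have hN : (M.subgroupOf L).Normal := ⟨fun m hm x => hnorm x x.2 m hm⟩
  have hfinΓ : Finite (G ≃g G) := Finite.of_injective (fun g : G ≃g G => (g : V → V))
    DFunLike.coe_injective
  let π : L →* L ⧸ M.subgroupOf L := mk' _
  have hπ : ∀ x y : L, π x = π y ↔ (x : G ≃g G)⁻¹ * y ∈ M := fun x y => QuotientGroup.eq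
  let S : Set L := {γ | l γ ≤ 2 * C₁ + 1}
  let T := π '' S
  have hT1 : (1 : L ⧸ M.subgroupOf L) ∈ T := ⟨1, by simp [S, hldef], map_one _⟩
  have hTi : ∀ s ∈ T, s⁻¹ ∈ T := by
    rintro _ ⟨x, hx, rfl⟩
    exact ⟨x⁻¹, by simpa [S, hl.inv] using hx, map_inv _ _⟩
  -- counting classes modulo `M` among short elements
  have hcount : ∀ (U : Set (L ⧸ M.subgroupOf L)) (f : L ⧸ M.subgroupOf L → L), (∀ u ∈ U, π (f u) = u) →
      (∀ u ∈ U, l (f u) ≤ 2 * C₁ + 1) → U.ncard ≤ A := by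
    intro U f hf hl'
    have hinj : InjOn (fun u => (f u : G ≃g G)) U := by
      intro u hu v hv e
      rw [← hf u hu, ← hf v hv, Subtype.ext e]
    have hUf : U.Finite := toFinite _
    have h1 := hfin (hUf.toFinset.image fun u => (f u : G ≃g G)) (by
      intro x hx
      obtain ⟨u, hu, rfl⟩ := Finset.mem_image.1 hx
      exact hl' u (hUf.mem_toFinset.1 hu)) (by
      intro x hx y hy hxy
      obtain ⟨u, hu, rfl⟩ := Finset.mem_image.1 hx
      obtain ⟨v, hv, rfl⟩ := Finset.mem_image.1 hy
      have := (hπ _ _).2 hxy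
      rw [hf u (hUf.mem_toFinset.1 hu), hf v (hUf.mem_toFinset.1 hv)] at this
      rw [this])
    rw [card_image_of_injOn (by simpa using hinj)] at h1
    rwa [ncard_eq_toFinset_card U hUf]
  have hTk : T.ncard ≤ A := by
    have : ∀ u ∈ T, ∃ x ∈ S, π x = u := fun u hu => hu
    choose! f hf1 hf2 using this
    exact hcount T f hf2 hf1
  have hgen : ∀ n g, l g ≤ n → ∀ γ : L, l ((γ : G ≃g G)⁻¹ * g) ≤ C₁ → π γ ∈ T ^ (n + 1) := by
    intro n
    induction n with
    | zero =>
      intro g hg γ hγ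
      rw [zero_add, pow_one]
      refine ⟨γ, ?_, rfl⟩
      have h1 := hl.mul (g : G ≃g G) ((γ : G ≃g G)⁻¹ * g)⁻¹
      rw [hl.inv] at h1
      have e : g * ((γ : G ≃g G)⁻¹ * g)⁻¹ = γ := by group
      rw [e] at h1
      change l γ ≤ _
      omega
    | succ n ih =>
      intro g hg γ hγ
      obtain ⟨a, b, rfl, ha, hb'⟩ := hl.split g n hg
      obtain ⟨γ', hγ', hγ'2⟩ := hdense a
      have h1 := ih a ha ⟨γ', hγ'⟩ hγ'2
      rw [pow_succ]
      refine ⟨_, h1, π (⟨γ', hγ'⟩⁻¹ * γ), ⟨_, ?_, rfl⟩, by simp [map_mul]⟩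
      have e : (γ'⁻¹ * γ : G ≃g G) = γ'⁻¹ * a * (b * ((γ : G ≃g G)⁻¹ * (a * b))⁻¹) := by group
      change l (γ'⁻¹ * γ) ≤ _
      rw [e]
      have h2 := hl.mul (γ'⁻¹ * a) (b * ((γ : G ≃g G)⁻¹ * (a * b))⁻¹)
      have h3 := hl.mul b ((γ : G ≃g G)⁻¹ * (a * b))⁻¹
      rw [hl.inv] at h3
      omega
  have hTD : T ^ (D + 1) = Set.univ := by
    refine Set.eq_univ_of_forall fun u => ?_
    obtain ⟨γ, rfl⟩ := mk'_surjective _ u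
    refine hgen D γ (hD _) γ ?_
    simp [hldef]
  have hucs : Subgroup.upperCentralSeries (L ⧸ M.subgroupOf L) A = ⊤ := by
    have h1 : Subgroup.upperCentralSeries (L ⧸ M.subgroupOf L) c = ⊤ := by
      refine ucs_eq_top_of_leftComm (T := π '' (L.subtype ⁻¹' X)) ?_ ?_
      · have hcl : Subgroup.closure (L.subtype ⁻¹' (X ∪ M)) = ⊤ := by
          have : Subgroup.closure ((fun x : L => (x : G ≃g G)) ⁻¹' (X ∪ M)) = ⊤ := by
            subst hL
            exact Subgroup.closure_closure_coe_preimage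
          exact this
        have h2 : Subgroup.map π (Subgroup.closure (L.subtype ⁻¹' (X ∪ M))) = ⊤ := by
          rw [hcl]; exact Subgroup.map_top_of_surjective _ (mk'_surjective _)
        rw [MonoidHom.map_closure] at h2
        rw [eq_top_iff, ← h2, Subgroup.closure_le]
        rintro _ ⟨x, hx | hx, rfl⟩
        · exact Subgroup.subset_closure ⟨x, hx, rfl⟩
        · have : π x = 1 := (eq_one_iff x).2 hx
          rw [this]; exact Subgroup.one_mem _
      · rw [leftComm_image]
        rintro _ ⟨x, hx, rfl⟩
        refine (eq_one_iff x).2 (hX ?_)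
        have h3 : L.subtype x ∈ L.subtype '' leftComm (L.subtype ⁻¹' X) c := ⟨x, hx, rfl⟩
        rw [← leftComm_image, image_preimage_eq_of_subset (by simpa using hXL)] at h3
        exact h3
    exact eq_top_iff.2 (h1 ▸ Subgroup.upperCentralSeries_mono _ hc)
  have hmain := hBK (L ⧸ M.subgroupOf L) T (D + 1) r hucs hT1 hTi hTk hTD hr (by omega)
  have hVQ : Nat.card V ≤ C * (2 * A + 1) ^ d * Nat.card (L ⧸ M.subgroupOf L) := by
    have h1 : ∀ v : V, ∃ γ : L, G.dist ((γ : G ≃g G) o) v ≤ C₁ := by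
      intro v
      obtain ⟨g, hg⟩ := ht o v
      obtain ⟨γ, hγ, h⟩ := hdense g
      refine ⟨⟨γ, hγ⟩, ?_⟩
      simp only [hldef] at h
      rw [← dist_iso γ o _ hG, RelIso.mul_apply, RelIso.apply_inv_self, hg] at h
      exact h
    choose γ hγ using h1
    have := Fintype.ofFinite V
    have := Fintype.ofFinite (L ⧸ M.subgroupOf L)
    rw [Nat.card_eq_fintype_card, Nat.card_eq_fintype_card, ← card_univ, ← card_univ]
    refine card_le_mul_card_image_of_maps_to (f := fun v => π (γ v)) (fun _ _ => Finset.mem_univ _) _ ?_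
    intro u _
    rcases Finset.eq_empty_or_nonempty (Finset.univ.filter fun v => π (γ v) = u) with h | ⟨w, hw⟩
    · rw [h]; simp
    · have hw' := (mem_filter.1 hw).2
      refine le_trans ?_ ((hb (2 * C₁)).trans ?_)
      · rw [← ncard_coe_finset]
        refine ncard_le_ncard_of_injOn (fun v => (γ w : G ≃g G).symm v) ?_
          ((γ w : G ≃g G).symm.injective.injOn) (toFinite _)
        intro v hv
        have hv' : π (γ v) = u := by simpa using hv
        have h2 := hM _ ((hπ _ _).1 (hw'.trans hv'.symm))
        simp only [hldef] at h2
        rw [← dist_iso (γ w : G ≃g G) o _ hG, RelIso.mul_apply, RelIso.apply_inv_self] at h2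
        change G.dist o ((γ w : G ≃g G).symm v) ≤ _
        rw [← dist_iso (γ w : G ≃g G) o _ hG, RelIso.apply_symm_apply]
        have := hG.dist_triangle (u := (γ w : G ≃g G) o) (v := (γ v : G ≃g G) o) (w := v)
        have := hγ v
        omega
      · gcongr
  have hTB : (T ^ (B * r)).ncard ≤ A * β(G, o, (2 * A + 1) * B * r) := by
    have hS : ∀ n, ∀ x ∈ S ^ n, l x ≤ (2 * A + 1) * n := by
      intro n
      induction n with
      | zero => intro x hx; rw [pow_zero, Set.mem_one] at hx; subst hx; simp [hldef]
      | succ n ih =>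
        intro x hx
        rw [pow_succ] at hx
        obtain ⟨y, hy, s, hs, rfl⟩ := hx
        have h1 := hl.mul (y : G ≃g G) s
        have h2 := ih y hy
        have h3 : l s ≤ 2 * C₁ + 1 := hs
        change l ((y : G ≃g G) * s) ≤ _
        rw [mul_add, mul_one]
        exact h1.trans (add_le_add h2 (by omega))
    have h1 : ∀ u ∈ T ^ (B * r), ∃ x ∈ S ^ (B * r), π x = u := fun u hu => mem_pow_of_lift π hu
    choose! f hf1 hf2 using h1
    have hUf : (T ^ (B * r)).Finite := toFinite _
    have hbf : {y : V | G.dist o y ≤ (2 * A + 1) * B * r}.Finite := toFinite _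
    rw [ncard_eq_toFinset_card _ hUf]
    change _ ≤ A * ncard _
    rw [ncard_eq_toFinset_card _ hbf]
    refine card_le_mul_card_image_of_maps_to (f := fun u => (f u : G ≃g G) o) ?_ _ ?_
    · intro u hu
      have := hS _ _ (hf1 u (hUf.mem_toFinset.1 hu))
      rw [hbf.mem_toFinset]
      change l (f u) ≤ _
      rwa [mul_assoc]
    · intro v _
      rcases Finset.eq_empty_or_nonempty
        (hUf.toFinset.filter fun u => (f u : G ≃g G) o = v) with h | ⟨w, hw⟩
      · rw [h]; simp
      · have hw' := mem_filter.1 hw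
        rw [← ncard_coe_finset, ← ncard_image_of_injective _ (mul_right_injective (π (f w))⁻¹)]
        refine hcount _ (fun u => (f w)⁻¹ * f (π (f w) * u)) ?_ ?_
        · rintro _ ⟨u, hu, rfl⟩
          have hu' := mem_filter.1 (mem_coe.1 hu)
          simp only [mul_inv_cancel_left, map_mul, map_inv, hf2 u (hUf.mem_toFinset.1 hu'.1)]
        · rintro _ ⟨u, hu, rfl⟩
          have hu' := mem_filter.1 (mem_coe.1 hu)
          simp only [mul_inv_cancel_left]
          change l ((f w : G ≃g G)⁻¹ * f u) ≤ _
          simp only [hldef, RelIso.mul_apply, hu'.2, ← hw'.2, RelIso.inv_apply_self,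
            SimpleGraph.dist_self]
          omega
  calc Nat.card V * r ^ q ≤ C * (2 * A + 1) ^ d * Nat.card (L ⧸ M.subgroupOf L) * r ^ q := by gcongr
    _ = C * (2 * A + 1) ^ d * (Nat.card (L ⧸ M.subgroupOf L) * r ^ q) := by ring
    _ ≤ C * (2 * A + 1) ^ d * (K * (2 * D) ^ q * (A * β(G, o, (2 * A + 1) * B * r))) := by
        refine Nat.mul_le_mul_left _ (hmain.trans (Nat.mul_le_mul (Nat.mul_le_mul_left _
          (Nat.pow_le_pow_left ?_ _)) hTB))
        omega
    _ = _ := by rw [mul_pow]; ring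

theorem exists_moderate_growth (C d : ℕ) : ∃ K q : ℕ, ∀ (V : Type) [Finite V]
    (G : SimpleGraph V), G.Connected → IsVertexTransitive G → ∀ o : V,
    (∀ r, β(G, o, r) ≤ C * (r + 1) ^ d) →
    ∀ D r, (∀ x, G.dist o x ≤ D) → 1 ≤ r → r ≤ D →
    Nat.card V * r ^ q ≤ K * D ^ q * β(G, o, r) := by
  obtain ⟨B, K, q, h⟩ := exists_moderate_growth_dilated C d
  refine ⟨(2 * (B + 1)) ^ q * K * (C * (B + 1) ^ d + 1), q, ?_⟩
  intro V _ G hG ht o hb D r hD hr hrD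
  have hpos : ∀ r, 1 ≤ β(G, o, r) := fun r => (ncard_pos (toFinite _)).2 ⟨o, by simp⟩
  have hmono : ∀ r r', r ≤ r' → β(G, o, r) ≤ β(G, o, r') := fun r r' hr =>
    ncard_le_ncard (fun y hy => le_trans hy hr) (toFinite _)
  rcases Nat.lt_or_ge r (B + 1) with h1 | h1
  · have h2 := h V G hG ht o hb D 1 hD le_rfl (by omega)
    rw [one_pow, mul_one, mul_one] at h2
    calc Nat.card V * r ^ q ≤ K * D ^ q * (C * (B + 1) ^ d) * (2 * (B + 1)) ^ q :=
          Nat.mul_le_mul (h2.trans (Nat.mul_le_mul_left _ (hb B))) (Nat.pow_le_pow_left (by omega) _)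
      _ ≤ K * D ^ q * (C * (B + 1) ^ d + 1) * (2 * (B + 1)) ^ q * β(G, o, r) := by
          refine le_trans ?_ (Nat.le_mul_of_pos_right _ (hpos r))
          gcongr; omega
      _ = _ := by ring
  · have hs : 1 ≤ r / (B + 1) := (Nat.one_le_div_iff (by omega)).2 h1
    have h2 := h V G hG ht o hb D (r / (B + 1)) hD hs ((Nat.div_le_self _ _).trans hrD)
    have h3 : r ≤ 2 * (B + 1) * (r / (B + 1)) := by
      have := Nat.lt_mul_div_succ r (b := B + 1) (by omega)
      nlinarith
    calc Nat.card V * r ^ q ≤ Nat.card V * (2 * (B + 1) * (r / (B + 1))) ^ q := by gcongr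
      _ = (2 * (B + 1)) ^ q * (Nat.card V * (r / (B + 1)) ^ q) := by rw [mul_pow _ (r / (B + 1))]; ring
      _ ≤ (2 * (B + 1)) ^ q * (K * D ^ q * β(G, o, r)) := by
          refine Nat.mul_le_mul_left _ (h2.trans (Nat.mul_le_mul_left _ (hmono _ _ ?_)))
          have := Nat.div_mul_le_self r (B + 1)
          nlinarith
      _ ≤ (2 * (B + 1)) ^ q * (K * D ^ q * β(G, o, r)) *
          (C * (B + 1) ^ d + 1) := Nat.le_mul_of_pos_right _ (by omega)
      _ = _ := by ring

end

section
open Matrix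

lemma card_cast_pos {V : Type} [Fintype V] (x : V) : (0 : ℝ) < Fintype.card V :=
  Nat.cast_pos.2 (Fintype.card_pos_iff.2 ⟨x⟩)

variable {V : Type} [Fintype V] [DecidableEq V]

structure SymStoch (P : Matrix V V ℝ) : Prop where
  nonneg : ∀ x y, 0 ≤ P x y
  symm : ∀ x y, P x y = P y x
  row : ∀ x, ∑ y, P x y = 1

namespace SymStoch

variable {P : Matrix V V ℝ}

lemma col (hP : SymStoch P) (y : V) : ∑ x, P x y = 1 := by
  rw [← hP.row y]; exact sum_congr rfl fun x _ => hP.symm x y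

lemma pow (hP : SymStoch P) (n : ℕ) : SymStoch (P ^ n) := by
  have hT : Pᵀ = P := by ext x y; exact hP.symm y x
  induction n with
  | zero =>
    refine ⟨fun x y => ?_, fun x y => ?_, fun x => ?_⟩
    · rw [pow_zero, Matrix.one_apply]; split_ifs <;> norm_num
    · rw [pow_zero, Matrix.one_apply, Matrix.one_apply]; simp [eq_comm]
    · simp [Matrix.one_apply]
  | succ n ih =>
    refine ⟨fun x y => ?_, fun x y => ?_, fun x => ?_⟩
    · rw [pow_succ, Matrix.mul_apply]
      exact sum_nonneg fun z _ => mul_nonneg (ih.nonneg _ _) (hP.nonneg _ _)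
    · have h : (P ^ (n + 1))ᵀ = P ^ (n + 1) := by rw [Matrix.transpose_pow, hT]
      exact congrFun (congrFun h.symm x) y
    · simp only [pow_succ, Matrix.mul_apply]
      rw [sum_comm]
      simp only [← mul_sum, hP.row, mul_one, ih.row]

lemma apply_le_one (hP : SymStoch P) (x y : V) : P x y ≤ 1 := by
  rw [← hP.row x]
  exact single_le_sum (f := fun y => P x y) (fun z _ => hP.nonneg x z) (mem_univ y)

lemma dot_mulVec (hP : SymStoch P) (f g : V → ℝ) : (P *ᵥ f) ⬝ᵥ g = f ⬝ᵥ (P *ᵥ g) := by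
  have hT : Pᵀ = P := by ext x y; exact hP.symm y x
  rw [Matrix.dotProduct_mulVec, ← Matrix.mulVec_transpose, hT]

lemma energy_eq (hP : SymStoch P) (f : V → ℝ) :
    ∑ x, ∑ y, P x y * (f x - f y) ^ 2 = 2 * (f ⬝ᵥ f - f ⬝ᵥ (P *ᵥ f)) := by
  have h1 : ∑ x, ∑ y, P x y * (f x) ^ 2 = f ⬝ᵥ f := by
    simp only [← sum_mul, hP.row, one_mul, dotProduct, sq]
  have h2 : ∑ x, ∑ y, P x y * (f y) ^ 2 = f ⬝ᵥ f := by
    rw [sum_comm]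
    simp only [← sum_mul, hP.col, one_mul, dotProduct, sq]
  have h3 : ∑ x, ∑ y, P x y * (f x * f y) = f ⬝ᵥ (P *ᵥ f) := by
    simp only [dotProduct, mulVec, mul_sum]
    exact sum_congr rfl fun x _ => sum_congr rfl fun y _ => by ring
  have h4 : ∀ x y, P x y * (f x - f y) ^ 2 =
      P x y * (f x) ^ 2 + P x y * (f y) ^ 2 - 2 * (P x y * (f x * f y)) := fun x y => by ring
  simp only [h4, sum_sub_distrib, sum_add_distrib, ← mul_sum, h1, h2, h3]
  ring

lemma dot_mulVec_le (hP : SymStoch P) (f : V → ℝ) : f ⬝ᵥ (P *ᵥ f) ≤ f ⬝ᵥ f := by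
  have h := hP.energy_eq f
  have : 0 ≤ ∑ x, ∑ y, P x y * (f x - f y) ^ 2 :=
    sum_nonneg fun x _ => sum_nonneg fun y _ => mul_nonneg (hP.nonneg _ _) (sq_nonneg _)
  linarith

lemma norm_mulVec_le (hP : SymStoch P) (f : V → ℝ) : (P *ᵥ f) ⬝ᵥ (P *ᵥ f) ≤ f ⬝ᵥ f := by
  rw [hP.dot_mulVec, Matrix.mulVec_mulVec, ← sq]
  exact (hP.pow 2).dot_mulVec_le f

lemma dot_pow (hP : SymStoch P) (f : V → ℝ) (a b : ℕ) :
    ((P ^ a) *ᵥ f) ⬝ᵥ ((P ^ b) *ᵥ f) = f ⬝ᵥ ((P ^ (a + b)) *ᵥ f) := by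
  rw [(hP.pow a).dot_mulVec, Matrix.mulVec_mulVec, ← pow_add]

/-- Markov type two for real valued functions. -/
lemma norm_pow_ge (hP : SymStoch P) (f : V → ℝ) {lam : ℝ} (hl : 0 < lam)
    (h : lam * (f ⬝ᵥ f) ≤ f ⬝ᵥ (P *ᵥ f)) (t : ℕ) :
    lam ^ (2 * t) * (f ⬝ᵥ f) ≤ ((P ^ t) *ᵥ f) ⬝ᵥ ((P ^ t) *ᵥ f) := by
  set u : ℕ → ℝ := fun t => ((P ^ t) *ᵥ f) ⬝ᵥ ((P ^ t) *ᵥ f) with hu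
  have hnn : ∀ t, 0 ≤ u t := fun t => sum_nonneg fun x _ => mul_self_nonneg _
  have hcs : ∀ g k : V → ℝ, (g ⬝ᵥ k) ^ 2 ≤ (g ⬝ᵥ g) * (k ⬝ᵥ k) := by
    intro g k
    have := sum_mul_sq_le_sq_mul_sq univ g k
    simpa [dotProduct, sq] using this
  have h0 : u 0 = f ⬝ᵥ f := by simp [hu]
  have key : ∀ t, lam ^ 2 * u t ≤ u (t + 1) := by
    intro t
    induction t with
    | zero =>
      have h1 := hcs f (P *ᵥ f)
      have h2 : u 1 = (P *ᵥ f) ⬝ᵥ (P *ᵥ f) := by simp [hu]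
      rw [zero_add, h0, h2]
      rcases (hnn 0).eq_or_lt with h3 | h3
      · rw [h0] at h3; rw [← h3, mul_zero]; rw [← h2]; exact hnn 1
      · rw [h0] at h3
        have h4 : (lam * (f ⬝ᵥ f)) ^ 2 ≤ (f ⬝ᵥ (P *ᵥ f)) ^ 2 := by gcongr
        refine le_of_mul_le_mul_left ?_ h3
        nlinarith
    | succ t ih =>
      have h1 := hcs ((P ^ t) *ᵥ f) ((P ^ (t + 2)) *ᵥ f)
      have h2 : ((P ^ t) *ᵥ f) ⬝ᵥ ((P ^ (t + 2)) *ᵥ f) = u (t + 1) := by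
        simp only [hu]; rw [hP.dot_pow, hP.dot_pow]; congr 3; ring
      rw [h2] at h1
      change u (t + 1) ^ 2 ≤ u t * u (t + 1 + 1) at h1
      rcases (hnn (t + 1)).eq_or_lt with h3 | h3
      · rw [← h3, mul_zero]; exact hnn _
      · have h4 := mul_le_mul_of_nonneg_right ih (hnn (t + 1 + 1))
        refine le_of_mul_le_mul_left ?_ h3
        nlinarith [mul_le_mul_of_nonneg_left h1 (sq_nonneg lam)]
  induction t with
  | zero => simp
  | succ t ih =>
    have := key t
    calc lam ^ (2 * (t + 1)) * (f ⬝ᵥ f) = lam ^ 2 * (lam ^ (2 * t) * (f ⬝ᵥ f)) := by ring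
      _ ≤ lam ^ 2 * u t := by gcongr
      _ ≤ _ := this

end SymStoch

variable {G : SimpleGraph V} [DecidableRel G.Adj] {Δ : ℕ}

lemma sum_srwMatrix_mul (hreg : ∀ x, G.degree x = Δ) (x : V) (g : V → ℝ) :
    ∑ y, srwMatrix G x y * g y = (Δ : ℝ)⁻¹ * ∑ y ∈ G.neighborFinset x, g y := by
  rw [mul_sum, SimpleGraph.neighborFinset_eq_filter, sum_filter]
  refine sum_congr rfl fun y _ => ?_
  simp only [srwMatrix, hreg]
  split_ifs <;> simp

lemma srwMatrix_symStoch (hΔ : 0 < Δ) (hreg : ∀ x, G.degree x = Δ) : SymStoch (srwMatrix G) where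
  nonneg x y := by simp only [srwMatrix]; split_ifs <;> positivity
  symm x y := by simp only [srwMatrix, hreg, G.adj_comm]
  row x := by
    have h := sum_srwMatrix_mul hreg x (fun _ => (1 : ℝ))
    simp only [mul_one, sum_const, SimpleGraph.card_neighborFinset_eq_degree, hreg,
      nsmul_eq_mul] at h
    rw [h]
    exact inv_mul_cancel₀ (by positivity)

variable [Fintype (G ≃g G)]

lemma sum_aut (ht : IsVertexTransitive G) (g : V → ℝ) (x : V) :
    (Fintype.card V : ℝ) * ∑ φ : G ≃g G, g (φ x) = Fintype.card (G ≃g G) * ∑ y, g y := by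
  have h1 : ∀ y, ∑ φ : G ≃g G, g (φ y) = ∑ φ : G ≃g G, g (φ x) := by
    intro y
    obtain ⟨ψ, rfl⟩ := ht x y
    exact Fintype.sum_equiv (Equiv.mulRight ψ) _ _ fun φ => rfl
  have h2 : ∑ y, ∑ φ : G ≃g G, g (φ y) = Fintype.card V * ∑ φ : G ≃g G, g (φ x) := by
    rw [sum_congr rfl fun y _ => h1 y, sum_const, card_univ, nsmul_eq_mul]
  rw [← h2, sum_comm]
  have h3 : ∀ φ : G ≃g G, ∑ y, g (φ y) = ∑ y, g y := fun φ =>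
    Fintype.sum_equiv φ.toEquiv _ _ fun y => rfl
  rw [sum_congr rfl fun φ _ => h3 φ, sum_const, card_univ, nsmul_eq_mul]

lemma sum_aut_sq_walk (hΔ : 0 < Δ) (hreg : ∀ x, G.degree x = Δ)
    (ht : IsVertexTransitive G) (f : V → ℝ) {u w : V} (p : G.Walk u w) :
    (Fintype.card V : ℝ) * ∑ φ : G ≃g G, (f (φ u) - f (φ w)) ^ 2 ≤
      (p.length : ℝ) ^ 2 * (Fintype.card (G ≃g G) * Δ *
        ∑ x, ∑ y, srwMatrix G x y * (f x - f y) ^ 2) := by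
  set Q : ℝ := Fintype.card (G ≃g G) * Δ * ∑ x, ∑ y, srwMatrix G x y * (f x - f y) ^ 2 with hQ
  have hedge : ∀ u v, G.Adj u v →
      (Fintype.card V : ℝ) * ∑ φ : G ≃g G, (f (φ u) - f (φ v)) ^ 2 ≤ Q := by
    intro u v huv
    have h1 := sum_aut ht (fun x => Δ * ∑ y, srwMatrix G x y * (f x - f y) ^ 2) u
    have e : Q = (Fintype.card (G ≃g G) : ℝ) *
        ∑ x, (Δ : ℝ) * ∑ y, srwMatrix G x y * (f x - f y) ^ 2 := by
      rw [hQ, mul_assoc, ← mul_sum]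
    rw [e, ← h1]
    gcongr with φ
    rw [sum_srwMatrix_mul hreg, mul_inv_cancel_left₀ (by positivity)]
    exact single_le_sum (f := fun y => (f (φ u) - f y) ^ 2) (fun _ _ => sq_nonneg _)
      ((G.mem_neighborFinset _ _).2 ((φ.map_adj_iff).2 huv))
  induction p with
  | nil => simp
  | @cons u v w h p ih =>
    have h1 := hedge u v h
    set k : ℝ := (p.length : ℝ)
    have hk : 0 ≤ k := Nat.cast_nonneg _
    rw [SimpleGraph.Walk.length_cons, Nat.cast_succ]
    change _ ≤ (k + 1) ^ 2 * Q
    rcases p.length.eq_zero_or_pos with h0 | h0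
    · obtain rfl := SimpleGraph.Walk.eq_of_length_eq_zero h0
      have : k = 0 := by simp [k, h0]
      rw [this]; simpa using h1
    · have hk0 : 0 < k := Nat.cast_pos.2 h0
      have h2 : k * ∑ φ : G ≃g G, (f (φ u) - f (φ w)) ^ 2 ≤
          k * (1 + k) * ∑ φ : G ≃g G, (f (φ u) - f (φ v)) ^ 2 +
            (k + 1) * ∑ φ : G ≃g G, (f (φ v) - f (φ w)) ^ 2 := by
        rw [mul_sum, mul_sum, mul_sum, ← sum_add_distrib]
        refine sum_le_sum fun φ _ => ?_
        nlinarith [sq_nonneg (k * (f (φ u) - f (φ v)) - (f (φ v) - f (φ w)))]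
      refine le_of_mul_le_mul_left ?_ hk0
      have h3 := mul_le_mul_of_nonneg_left h2 (Nat.cast_nonneg (α := ℝ) (Fintype.card V))
      have h4 := mul_le_mul_of_nonneg_left h1 (by positivity : 0 ≤ k * (1 + k))
      have h5 := mul_le_mul_of_nonneg_left ih (by positivity : 0 ≤ k + 1)
      nlinarith

/-- A Nash type inequality at a fixed scale. -/
lemma nash_fixed_scale (hΔ : 0 < Δ) (hG : G.Connected) (hreg : ∀ x, G.degree x = Δ)
    (ht : IsVertexTransitive G) (o : V) (r : ℕ) (f : V → ℝ) (hf : ∀ x, 0 ≤ f x)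
    (hf1 : ∑ x, f x = 1) :
    f ⬝ᵥ f ≤ (β(G, o, r) : ℝ)⁻¹ + Δ * r ^ 2 * (f ⬝ᵥ f - f ⬝ᵥ (srwMatrix G *ᵥ f)) := by
  classical
  have hP := srwMatrix_symStoch hΔ hreg
  set B : Finset V := univ.filter fun y => G.dist o y ≤ r with hB
  have hBc : β(G, o, r) = B.card := by rw [hB, ← Set.ncard_coe_finset, coe_filter_univ]; rfl
  rw [hBc]
  have hBo : o ∈ B := by simp [hB]
  have hBpos : (0 : ℝ) < B.card := Nat.cast_pos.2 (card_pos.2 ⟨o, hBo⟩)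
  set N : ℝ := (Fintype.card V : ℝ)
  have hN : 0 < N := card_cast_pos o
  set Γ : ℝ := (Fintype.card (G ≃g G) : ℝ)
  have hΓ : 0 < Γ := Nat.cast_pos.2 (Fintype.card_pos_iff.2 ⟨RelIso.refl _⟩)
  have hsq : ∀ y, N * ∑ φ : G ≃g G, f (φ y) ^ 2 = Γ * (f ⬝ᵥ f) := fun y => by
    rw [sum_aut ht (fun x => f x ^ 2)]; simp [dotProduct, sq, Γ]
  have h1 : ∀ y ∈ B, Γ * (f ⬝ᵥ f) ≤ N * ∑ φ : G ≃g G, f (φ o) * f (φ y) +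
      r ^ 2 * (Γ * Δ * (f ⬝ᵥ f - f ⬝ᵥ (srwMatrix G *ᵥ f))) := by
    intro y hy
    obtain ⟨p, hp⟩ := (hG o y).exists_walk_length_eq_dist
    have h2 := sum_aut_sq_walk hΔ hreg ht f p
    rw [hP.energy_eq, hp] at h2
    have hd : (G.dist o y : ℝ) ≤ r := by exact_mod_cast (mem_filter.1 hy).2
    have h3 : N * ∑ φ : G ≃g G, (f (φ o) - f (φ y)) ^ 2 = 2 * (Γ * (f ⬝ᵥ f)) -
        2 * (N * ∑ φ : G ≃g G, f (φ o) * f (φ y)) := by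
      have e : ∀ φ : G ≃g G, (f (φ o) - f (φ y)) ^ 2 =
        f (φ o) ^ 2 + f (φ y) ^ 2 - 2 * (f (φ o) * f (φ y)) := fun φ => by ring
      rw [sum_congr rfl fun φ _ => e φ, sum_sub_distrib, sum_add_distrib,
        ← mul_sum, mul_sub, mul_add, hsq, hsq]
      ring
    rw [h3] at h2
    have hE := hP.dot_mulVec_le f
    have h4 : (G.dist o y : ℝ) ^ 2 * (Γ * Δ * (2 * (f ⬝ᵥ f - f ⬝ᵥ (srwMatrix G *ᵥ f)))) ≤
        r ^ 2 * (Γ * Δ * (2 * (f ⬝ᵥ f - f ⬝ᵥ (srwMatrix G *ᵥ f)))) := by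
      refine mul_le_mul_of_nonneg_right (by gcongr) (mul_nonneg (by positivity) (by linarith))
    linarith
  have h2 := sum_le_sum h1
  rw [sum_const, sum_add_distrib, sum_const, nsmul_eq_mul, nsmul_eq_mul, ← mul_sum, sum_comm] at h2
  have h3 : N * ∑ φ : G ≃g G, ∑ y ∈ B, f (φ o) * f (φ y) ≤ Γ := by
    have h4 := sum_aut ht f o
    rw [hf1, mul_one] at h4
    rw [show Γ = N * ∑ φ : G ≃g G, f (φ o) from h4.symm]
    gcongr with φ
    rw [← mul_sum]
    have h5 : ∑ y ∈ B, f (φ y) ≤ ∑ y, f (φ y) :=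
      sum_le_sum_of_subset_of_nonneg (subset_univ _) fun _ _ _ => hf _
    have h6 : ∑ y, f (φ y) = 1 := by rw [← hf1]; exact Fintype.sum_equiv φ.toEquiv _ _ fun y => rfl
    nlinarith [hf (φ o)]
  have h4 : (B.card : ℝ) * Γ * (f ⬝ᵥ f) ≤ (B.card : ℝ) * Γ * ((B.card : ℝ)⁻¹ +
      Δ * r ^ 2 * (f ⬝ᵥ f - f ⬝ᵥ (srwMatrix G *ᵥ f))) := by
    have : (B.card : ℝ) * Γ * (B.card : ℝ)⁻¹ = Γ := by field_simp
    rw [mul_add, this]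
    nlinarith
  exact le_of_mul_le_mul_left h4 (by positivity)

def returnSum (P : Matrix V V ℝ) (o : V) (t : ℕ) : ℝ := (P ^ (2 * t)) o o + (P ^ (2 * t + 1)) o o

lemma SymStoch.single_dot {P : Matrix V V ℝ} (x y : V) (j : ℕ) :
    (Pi.single x 1 : V → ℝ) ⬝ᵥ ((P ^ j) *ᵥ Pi.single y 1) = (P ^ j) x y := by
  simp

lemma SymStoch.even_le {P : Matrix V V ℝ} (hP : SymStoch P) (o : V) (t : ℕ) :
    (P ^ (2 * (t + 1))) o o ≤ (P ^ (2 * t)) o o := by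
  have h := hP.norm_mulVec_le ((P ^ t) *ᵥ Pi.single o 1)
  rw [mulVec_mulVec, ← pow_succ', hP.dot_pow, hP.dot_pow, single_dot, single_dot] at h
  rwa [show 2 * (t + 1) = t + 1 + (t + 1) by ring, two_mul t]

lemma SymStoch.odd_le {P : Matrix V V ℝ} (hP : SymStoch P) (o : V) (t : ℕ) :
    (P ^ (2 * t + 1)) o o ≤ (P ^ (2 * t)) o o := by
  have h := hP.dot_mulVec_le ((P ^ t) *ᵥ Pi.single o 1)
  rw [mulVec_mulVec, ← pow_succ', hP.dot_pow, hP.dot_pow, single_dot, single_dot] at h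
  rwa [show 2 * t + 1 = t + (t + 1) by ring, two_mul t]

lemma SymStoch.returnSum_nonneg {P : Matrix V V ℝ} (hP : SymStoch P) (o : V) (t : ℕ) :
    0 ≤ returnSum P o t := add_nonneg ((hP.pow _).nonneg _ _) ((hP.pow _).nonneg _ _)

lemma SymStoch.le_returnSum {P : Matrix V V ℝ} (hP : SymStoch P) (o : V) (t : ℕ) :
    (P ^ (2 * t)) o o ≤ returnSum P o t := le_add_of_nonneg_right ((hP.pow _).nonneg _ _)

lemma returnSum_succ_le (hΔ : 0 < Δ) (hG : G.Connected) (hreg : ∀ x, G.degree x = Δ)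
    (ht : IsVertexTransitive G) (o : V) (r t : ℕ) :
    returnSum (srwMatrix G) o (t + 1) ≤ 4 * (β(G, o, r) : ℝ)⁻¹ +
      Δ * r ^ 2 * (returnSum (srwMatrix G) o t - returnSum (srwMatrix G) o (t + 1)) := by
  have hP := srwMatrix_symStoch hΔ hreg
  set P := srwMatrix G
  set e : V → ℝ := Pi.single o 1 with he
  have hcol : ∀ j, ∀ x, ((P ^ j) *ᵥ e) x = (P ^ j) x o := fun j x => by simp [he]
  have h := nash_fixed_scale hΔ hG hreg ht o r ((2 : ℝ)⁻¹ • ((P ^ t) *ᵥ e + (P ^ (t + 1)) *ᵥ e)) (by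
      intro x
      simp only [Pi.smul_apply, Pi.add_apply, hcol, smul_eq_mul]
      have := (hP.pow t).nonneg x o
      have := (hP.pow (t + 1)).nonneg x o
      positivity)
    (by
      simp only [Pi.smul_apply, Pi.add_apply, hcol, smul_eq_mul, ← mul_sum,
        sum_add_distrib, (hP.pow _).col]
      norm_num)
  change _ ≤ _ + _ * (_ - _ ⬝ᵥ (P *ᵥ _)) at h
  rw [mulVec_smul, mulVec_add, mulVec_mulVec, mulVec_mulVec, ← pow_succ', ← pow_succ'] at h
  simp only [smul_dotProduct, dotProduct_smul, add_dotProduct, dotProduct_add, hP.dot_pow,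
    smul_eq_mul, he, SymStoch.single_dot] at h
  rw [show t + t = 2 * t by ring, show t + (t + 1) = 2 * t + 1 by ring,
    show t + 1 + t = 2 * t + 1 by ring, show t + 1 + (t + 1) = 2 * (t + 1) by ring,
    show t + (t + 1 + 1) = 2 * (t + 1) by ring,
    show t + 1 + (t + 1 + 1) = 2 * (t + 1) + 1 by ring] at h
  have h1 := hP.even_le o t
  have h2 := hP.odd_le o (t + 1)
  have h3 := (hP.pow (2 * t + 1)).nonneg o o
  simp only [returnSum]
  linarith

lemma returnSum_decay (hΔ : 0 < Δ) (hG : G.Connected) (hreg : ∀ x, G.degree x = Δ)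
    (ht : IsVertexTransitive G) (o : V) {r : ℕ} (hr : 1 ≤ r) {b : ℝ} (hb : 0 < b)
    (hbr : b ≤ β(G, o, r)) (t m : ℕ) :
    (returnSum (srwMatrix G) o (t + m) - 4 / b) * (Δ * r ^ 2 + m) ≤
      Δ * r ^ 2 * returnSum (srwMatrix G) o t := by
  have hP := srwMatrix_symStoch hΔ hreg
  set s := returnSum (srwMatrix G) o
  set κ : ℝ := Δ * r ^ 2
  have hκ : 0 < κ := by positivity
  have hstep : ∀ j, (s (j + 1) - 4 / b) * (1 + κ) ≤ κ * (s j - 4 / b) := by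
    intro j
    have h1 := returnSum_succ_le hΔ hG hreg ht o r j
    have h2 : 4 * (β(G, o, r) : ℝ)⁻¹ ≤ 4 / b := by rw [div_eq_mul_inv]; gcongr
    change s (j + 1) ≤ _ + κ * (s j - s (j + 1)) at h1
    nlinarith
  induction m with
  | zero =>
    simp only [add_zero, Nat.cast_zero]
    have : 0 ≤ 4 / b := by positivity
    nlinarith
  | succ m ih =>
    have h1 := hstep (t + m)
    rw [add_assoc] at h1
    set v := s (t + (m + 1)) - 4 / b
    set v0 := s (t + m) - 4 / b
    have hs : 0 ≤ s t := hP.returnSum_nonneg o t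
    have hm : (0 : ℝ) ≤ m := Nat.cast_nonneg m
    push_cast
    rcases le_or_gt v 0 with hv | hv
    · have : v * (κ + (m + 1)) ≤ 0 := mul_nonpos_of_nonpos_of_nonneg hv (by positivity)
      have : 0 ≤ κ * s t := by positivity
      linarith
    · have hv0 : 0 < v0 := by
        by_contra hcon
        have : κ * v0 ≤ 0 := mul_nonpos_of_nonneg_of_nonpos hκ.le (not_lt.1 hcon)
        have : 0 < v * (1 + κ) := by positivity
        linarith
      have h2 : v * (κ + (m + 1)) * (1 + κ) ≤ v0 * (κ + m) * (1 + κ) := by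
        calc v * (κ + (m + 1)) * (1 + κ) = v * (1 + κ) * (κ + (m + 1)) := by ring
          _ ≤ κ * v0 * (κ + (m + 1)) := by gcongr
          _ ≤ v0 * (κ + m) * (1 + κ) := by nlinarith [mul_nonneg hv0.le hm]
      exact (le_of_mul_le_mul_right h2 (by positivity)).trans ih

lemma SymStoch.entries_le {P : Matrix V V ℝ} (hP : SymStoch P) {t : ℕ} {δ : ℝ}
    (h : ∀ x, (P ^ (2 * t)) x x ≤ δ) {s : ℕ} (hs : 2 * t ≤ s) (x y : V) : (P ^ s) x y ≤ δ := by
  obtain ⟨e, rfl⟩ := Nat.exists_eq_add_of_le hs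
  have h0 : ∀ x y, (P ^ (2 * t)) x y ≤ δ := by
    intro x y
    have h1 : 0 ≤ ((P ^ t) *ᵥ (Pi.single x 1 - Pi.single y 1)) ⬝ᵥ
      ((P ^ t) *ᵥ (Pi.single x 1 - Pi.single y 1)) := sum_nonneg fun x _ => mul_self_nonneg _
    rw [hP.dot_pow, mulVec_sub] at h1
    simp only [sub_dotProduct, dotProduct_sub, single_dot] at h1
    rw [← two_mul, (hP.pow _).symm y x] at h1
    linarith [h x, h y]
  rw [add_comm, pow_add, Matrix.mul_apply]
  calc ∑ z, (P ^ e) x z * (P ^ (2 * t)) z y ≤ ∑ z, (P ^ e) x z * δ :=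
        sum_le_sum fun z _ => mul_le_mul_of_nonneg_left (h0 z y) ((hP.pow e).nonneg x z)
    _ = δ := by rw [← sum_mul, (hP.pow e).row, one_mul]

end

section
open Matrix Classical

variable {V : Type} [Fintype V] [DecidableEq V]

def matchings (V : Type) [Fintype V] [DecidableEq V] : Finset (V → V) :=
  univ.filter IsPerfectMatchingFn

def cyl (D : Finset V) (η₀ : V → V) : Finset (V → V) :=
  (matchings V).filter fun η => ∀ x ∈ D, η x = η₀ x

lemma mem_matchings {η : V → V} : η ∈ matchings V ↔ IsPerfectMatchingFn η := by simp [matchings]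

lemma mem_cyl {D : Finset V} {η₀ η : V → V} :
    η ∈ cyl D η₀ ↔ IsPerfectMatchingFn η ∧ ∀ x ∈ D, η x = η₀ x := by
  simp [cyl, mem_matchings]

lemma conj_swap_isPerfectMatchingFn {η : V → V} (h : IsPerfectMatchingFn η) (σ : Equiv.Perm V) :
    IsPerfectMatchingFn (σ ∘ η ∘ σ.symm) := by
  refine ⟨fun x => by simp [h.1 _], fun x hx => h.2 (σ.symm x) ?_⟩
  rw [Equiv.eq_symm_apply]
  exact hx

lemma card_fiber_eq {D : Finset V} {η₀ : V → V} (hD : ∀ x ∈ D, η₀ x ∈ D) {a b c : V}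
    (hb : b ∉ insert a D) (hc : c ∉ insert a D) :
    ((cyl D η₀).filter fun η => η a = b).card = ((cyl D η₀).filter fun η => η a = c).card := by
  have key : ∀ b c, b ∉ insert a D → c ∉ insert a D →
      ((cyl D η₀).filter fun η => η a = b).card ≤ ((cyl D η₀).filter fun η => η a = c).card := by
    intro b c hb hc
    rw [mem_insert, not_or] at hb hc
    refine card_le_card_of_injOn (fun η => Equiv.swap b c ∘ η ∘ (Equiv.swap b c).symm) ?_ ?_
    · intro η hη
      rw [mem_coe, mem_filter, mem_cyl] at hη ⊢
      obtain ⟨⟨h1, h2⟩, h3⟩ := hη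
      have hne : ∀ x ∈ D, Equiv.swap b c x = x := fun x hx =>
        Equiv.swap_apply_of_ne_of_ne (by rintro rfl; exact hb.2 hx) (by rintro rfl; exact hc.2 hx)
      refine ⟨⟨conj_swap_isPerfectMatchingFn h1 _, fun x hx => ?_⟩, ?_⟩
      · simp only [Function.comp_apply, Equiv.symm_swap]
        rw [hne x hx, h2 x hx, hne _ (hD x hx)]
      · simp only [Function.comp_apply, Equiv.symm_swap]
        rw [Equiv.swap_apply_of_ne_of_ne (Ne.symm hb.1) (Ne.symm hc.1), h3, Equiv.swap_apply_left]
    · intro η _ η' _ h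
      funext x
      have := congrFun h (Equiv.swap b c x)
      simpa using this
  exact le_antisymm (key b c hb hc) (key c b hc hb)

lemma matching_notMem {D : Finset V} {η₀ η : V → V} (hD : ∀ x ∈ D, η₀ x ∈ D)
    (hη : η ∈ cyl D η₀) {a : V} (ha : a ∉ D) : η a ∉ insert a D := by
  rw [mem_cyl] at hη
  rw [mem_insert, not_or]
  refine ⟨hη.1.2 a, fun h => ha ?_⟩
  have := hη.2 _ h
  rw [hη.1.1 a] at this
  rw [this]; exact hD _ h

lemma cyl_insert {D : Finset V} {η₀ η₁ : V → V} (h1 : η₁ ∈ cyl D η₀) (a : V) :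
    cyl (insert a (insert (η₁ a) D)) η₁ = (cyl D η₀).filter fun η => η a = η₁ a := by
  ext η
  rw [mem_cyl] at h1
  rw [mem_filter, mem_cyl, mem_cyl]
  constructor
  · rintro ⟨hη, h⟩
    refine ⟨⟨hη, fun x hx => ?_⟩, h a (by simp)⟩
    rw [h x (by simp [hx]), h1.2 x hx]
  · rintro ⟨⟨hη, h⟩, ha⟩
    refine ⟨hη, fun x hx => ?_⟩
    rcases mem_insert.1 hx with rfl | hx
    · exact ha
    rcases mem_insert.1 hx with rfl | hx
    · rw [h1.1.1 a, ← ha, hη.1 a]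
    · rw [h x hx, h1.2 x hx]

lemma sum_cyl_le {D : Finset V} {η₀ : V → V} (hη₀ : IsPerfectMatchingFn η₀)
    (hD : ∀ x ∈ D, η₀ x ∈ D) {a : V} (ha : a ∉ D) (ψ : (V → V) → ℝ) (c : V → ℝ)
    (h : ∀ η₁ ∈ cyl D η₀, ∑ η ∈ cyl (insert a (insert (η₁ a) D)) η₁, ψ η ≤
      c (η₁ a) * (cyl (insert a (insert (η₁ a) D)) η₁).card) :
    (∑ η ∈ cyl D η₀, ψ η) * ((Fintype.card V : ℝ) - D.card - 1) ≤
      (∑ b ∈ (insert a D)ᶜ, c b) * (cyl D η₀).card := by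
  have h0 : η₀ ∈ cyl D η₀ := mem_cyl.2 ⟨hη₀, fun _ _ => rfl⟩
  set n₀ := ((cyl D η₀).filter fun η => η a = η₀ a).card with hn₀
  have hmaps : ∀ η ∈ cyl D η₀, η a ∈ (insert a D)ᶜ := fun η hη =>
    mem_compl.2 (matching_notMem hD hη ha)
  have hfib : ∀ b ∈ (insert a D)ᶜ, ((cyl D η₀).filter fun η => η a = b).card = n₀ := fun b hb =>
    card_fiber_eq hD (mem_compl.1 hb) (matching_notMem hD h0 ha)
  have hcard : ((cyl D η₀).card : ℝ) = ((Fintype.card V : ℝ) - D.card - 1) * n₀ := by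
    rw [card_eq_sum_card_fiberwise hmaps, sum_congr rfl hfib, sum_const,
      smul_eq_mul, Nat.cast_mul, card_compl, Nat.cast_sub (card_le_univ _),
      card_insert_of_notMem ha]
    push_cast; ring
  have hn₀pos : 0 < n₀ := card_pos.2 ⟨η₀, mem_filter.2 ⟨h0, rfl⟩⟩
  have hle : ∑ η ∈ cyl D η₀, ψ η ≤ (∑ b ∈ (insert a D)ᶜ, c b) * n₀ := by
    rw [← sum_fiberwise_of_maps_to hmaps, sum_mul]
    refine sum_le_sum fun b hb => ?_
    obtain ⟨η₁, hη₁⟩ := card_pos.1 ((hfib b hb).symm ▸ hn₀pos)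
    obtain ⟨h1, h2⟩ := mem_filter.1 hη₁
    have := h η₁ h1
    rw [cyl_insert h1, h2, hfib b hb] at this
    exact this
  have hpos : 0 ≤ (Fintype.card V : ℝ) - D.card - 1 := by
    have h3 : (0 : ℝ) ≤ ((cyl D η₀).card : ℝ) := Nat.cast_nonneg _
    rw [hcard] at h3
    exact nonneg_of_mul_nonneg_left h3 (Nat.cast_pos.2 hn₀pos)
  calc (∑ η ∈ cyl D η₀, ψ η) * ((Fintype.card V : ℝ) - D.card - 1)
      ≤ ((∑ b ∈ (insert a D)ᶜ, c b) * n₀) * ((Fintype.card V : ℝ) - D.card - 1) := by gcongr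
    _ = _ := by rw [hcard]; ring

/-- The normalised contribution to the transition probability from `b` to `y` of trajectories
that use exactly `j` matching edges, all of them incident to fresh vertices. -/
def jumpKernel (P : Matrix V V ℝ) (ℓ R : ℕ) (η : V → V) : ℕ → ℕ → Finset V → V → V → ℝ
  | 0, T, _, b, y => (P ^ T) b y
  | j + 1, T, h, b, y => (R : ℝ)⁻¹ * ∑ s ∈ range R, ∑ a ∈ hᶜ, (P ^ (ℓ + s)) b a *
      jumpKernel P ℓ R η j (T - (ℓ + s + 1)) (insert a (insert (η a) h)) (η a) y

variable {P : Matrix V V ℝ} {ℓ R : ℕ}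

lemma jumpKernel_nonneg (hP : SymStoch P) (η : V → V) (j T : ℕ) (h : Finset V) (b y : V) :
    0 ≤ jumpKernel P ℓ R η j T h b y := by
  induction j generalizing T h b with
  | zero => exact (hP.pow T).nonneg b y
  | succ j ih =>
    exact mul_nonneg (by positivity) (sum_nonneg fun s _ => sum_nonneg fun a _ =>
      mul_nonneg ((hP.pow _).nonneg _ _) (ih _ _ _))

lemma sum_sum_pow_eq (hP : SymStoch P) (hR : 0 < R) (b : V) :
    (R : ℝ)⁻¹ * ∑ s ∈ range R, ∑ a, (P ^ (ℓ + s)) b a = 1 := by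
  simp only [(hP.pow _).row, sum_const, card_range, nsmul_eq_mul, mul_one]
  exact inv_mul_cancel₀ (by positivity)

lemma sum_sum_pow_subset_le (hR : 0 < R) {δ : ℝ}
    (hδ : ∀ s, ℓ ≤ s → ∀ x y, (P ^ s) x y ≤ δ) (b : V) (S : Finset V) :
    (R : ℝ)⁻¹ * ∑ s ∈ range R, ∑ a ∈ S, (P ^ (ℓ + s)) b a ≤ S.card * δ := by
  have : ∑ s ∈ range R, ∑ a ∈ S, (P ^ (ℓ + s)) b a ≤ ∑ s ∈ range R, ∑ a ∈ S, δ :=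
    sum_le_sum fun s _ => sum_le_sum fun a _ => hδ _ (by omega) _ _
  simp only [sum_const, card_range, nsmul_eq_mul] at this
  calc _ ≤ (R : ℝ)⁻¹ * (R * (S.card * δ)) := by gcongr
    _ = _ := inv_mul_cancel_left₀ (by positivity) _

lemma jumpKernel_sum_ge (hP : SymStoch P) (hR : 0 < R) {δ : ℝ}
    (hδ : ∀ s, ℓ ≤ s → ∀ x y, (P ^ s) x y ≤ δ) (hδ0 : 0 ≤ δ) (η : V → V) (j T : ℕ)
    (h : Finset V) (b : V) :
    1 - j * (h.card + 2 * j) * δ ≤ ∑ y, jumpKernel P ℓ R η j T h b y := by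
  induction j generalizing T h b with
  | zero => simp [jumpKernel, (hP.pow T).row b]
  | succ j ih =>
    set m : ℝ := 1 - j * (h.card + 2 + 2 * j) * δ with hm
    have h1 : ∀ s a, m ≤
        ∑ y, jumpKernel P ℓ R η j (T - (ℓ + s + 1)) (insert a (insert (η a) h)) (η a) y := by
      intro s a
      refine le_trans ?_ (ih _ _ _)
      have : ((insert a (insert (η a) h)).card : ℝ) ≤ h.card + 2 := by
        have := (card_insert_le a (insert (η a) h)).trans
          (Nat.succ_le_succ (card_insert_le (η a) h))
        exact_mod_cast this
      rw [hm]
      gcongr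
    have h2 : (R : ℝ)⁻¹ * ∑ s ∈ range R, ∑ a ∈ hᶜ, (P ^ (ℓ + s)) b a * m ≤
        ∑ y, jumpKernel P ℓ R η (j + 1) T h b y := by
      simp only [jumpKernel]
      rw [← mul_sum, sum_comm (s := (univ : Finset V))]
      gcongr with s hs
      rw [sum_comm (s := (univ : Finset V))]
      gcongr with a ha
      rw [← mul_sum]
      exact mul_le_mul_of_nonneg_left (h1 s a) ((hP.pow _).nonneg _ _)
    refine le_trans ?_ h2
    simp only [← sum_mul]
    rw [← mul_assoc]
    set w := (R : ℝ)⁻¹ * ∑ s ∈ range R, ∑ a ∈ hᶜ, (P ^ (ℓ + s)) b a with hw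
    have h3 : w + (R : ℝ)⁻¹ * ∑ s ∈ range R, ∑ a ∈ h, (P ^ (ℓ + s)) b a = 1 := by
      rw [hw, ← mul_add, ← sum_add_distrib, ← sum_sum_pow_eq hP hR b (ℓ := ℓ)]
      simp only [sum_compl_add_sum]
    have h4 := sum_sum_pow_subset_le hR hδ b h
    have hw0 : 0 ≤ w := mul_nonneg (by positivity) (sum_nonneg fun s _ =>
      sum_nonneg fun a _ => (hP.pow _).nonneg _ _)
    have h5 : 0 ≤ (R : ℝ)⁻¹ * ∑ s ∈ range R, ∑ a ∈ h, (P ^ (ℓ + s)) b a :=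
      mul_nonneg (by positivity) (sum_nonneg fun s _ => sum_nonneg fun a _ => (hP.pow _).nonneg _ _)
    have h6 : 0 ≤ j * (h.card + 2 + 2 * j) * δ := by positivity
    have h7 : w * (j * (h.card + 2 + 2 * j) * δ) ≤ j * (h.card + 2 + 2 * j) * δ := by nlinarith
    have h8 : 0 ≤ (j : ℝ) * δ := by positivity
    rw [hm]
    push_cast
    nlinarith

/-- The average of `g` over every cylinder with at most `J` prescribed vertices is at most `B`. -/
def CylBounded (g : (V → V) → ℝ) (B : ℝ) (J : ℕ) : Prop :=
  ∀ (η₀ : V → V) (D : Finset V), IsPerfectMatchingFn η₀ → (∀ x ∈ D, η₀ x ∈ D) → D.card ≤ J →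
    ∑ η ∈ cyl D η₀, g η ≤ B * (cyl D η₀).card

/-- The recursion for the bounds on the expected jump kernel, started from a deterministic vertex
(first component) and from a fresh partner (second component). -/
def kernelBound (δ u J : ℝ) : ℕ → ℝ × ℝ
  | 0 => (δ, u)
  | j + 1 => (J * δ * (kernelBound δ u J j).1 + (kernelBound δ u J j).2,
      (kernelBound δ u J j).2 + J * u * (kernelBound δ u J j).1)

lemma kernelBound_nonneg {δ u J : ℝ} (hδ : 0 ≤ δ) (hu : 0 ≤ u) (hJ : 0 ≤ J) (j : ℕ) :
    0 ≤ (kernelBound δ u J j).1 ∧ 0 ≤ (kernelBound δ u J j).2 := by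
  induction j with
  | zero => exact ⟨hδ, hu⟩
  | succ j ih =>
    obtain ⟨h1, h2⟩ := ih
    simp only [kernelBound]
    constructor <;> positivity

lemma insert_pair_invariant {D : Finset V} {η₀ η₁ : V → V} (hD : ∀ x ∈ D, η₀ x ∈ D)
    (h1 : η₁ ∈ cyl D η₀) (a : V) :
    ∀ x ∈ insert a (insert (η₁ a) D), η₁ x ∈ insert a (insert (η₁ a) D) := by
  rw [mem_cyl] at h1
  intro x hx
  rcases mem_insert.1 hx with rfl | hx
  · simp
  rcases mem_insert.1 hx with rfl | hx
  · rw [h1.1.1 a]; simp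
  · rw [h1.2 x hx]; simp [hD x hx]

lemma card_insert_pair_le (D : Finset V) (a b : V) : (insert a (insert b D)).card ≤ D.card + 2 :=
  (card_insert_le a (insert b D)).trans (Nat.succ_le_succ (card_insert_le b D))

section step

variable {g : (V → V) → ℝ} {B : ℝ} {J J' : ℕ}

lemma step_bound (hP : SymStoch P) (hR : 0 < R) (hB : 0 ≤ B) {F E : ℝ} (hE : 0 ≤ E) {j : ℕ}
    (hF1 : ∀ (η₀ : V → V) (D h : Finset V) (b y : V) (T : ℕ), IsPerfectMatchingFn η₀ →
      (∀ x ∈ D, η₀ x ∈ D) → D.card + 2 * j ≤ J' → h ⊆ D → j * (ℓ + R) + ℓ ≤ T →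
      ∑ η ∈ cyl D η₀, jumpKernel P ℓ R η j T h b y * g η ≤ F * B * (cyl D η₀).card)
    (hE1 : ∀ (η₀ : V → V) (D h : Finset V) (a y : V) (T : ℕ), IsPerfectMatchingFn η₀ →
      (∀ x ∈ D, η₀ x ∈ D) → a ∉ D → D.card + 2 * (j + 1) ≤ J' → h ⊆ D →
      j * (ℓ + R) + ℓ ≤ T →
      ∑ η ∈ cyl D η₀, jumpKernel P ℓ R η j T (insert a (insert (η a) h)) (η a) y * g η ≤
        E * B * (cyl D η₀).card)
    {η₀ : V → V} {D h : Finset V} (b y : V) {T : ℕ} (hη₀ : IsPerfectMatchingFn η₀)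
    (hD : ∀ x ∈ D, η₀ x ∈ D) (hcard : D.card + 2 * (j + 1) ≤ J') (hh : h ⊆ D)
    (hT : (j + 1) * (ℓ + R) + ℓ ≤ T) :
    ∑ η ∈ cyl D η₀, jumpKernel P ℓ R η (j + 1) T h b y * g η ≤
      (((R : ℝ)⁻¹ * ∑ s ∈ range R, ∑ a ∈ D \ h, (P ^ (ℓ + s)) b a) * F + E) * B *
        (cyl D η₀).card := by
  set n : ℝ := ((cyl D η₀).card : ℝ)
  have hn : 0 ≤ n := Nat.cast_nonneg _
  have e1 : ∑ η ∈ cyl D η₀, jumpKernel P ℓ R η (j + 1) T h b y * g η =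
      (R : ℝ)⁻¹ * ∑ s ∈ range R, ∑ a ∈ hᶜ, (P ^ (ℓ + s)) b a *
        ∑ η ∈ cyl D η₀, jumpKernel P ℓ R η j (T - (ℓ + s + 1)) (insert a (insert (η a) h))
          (η a) y * g η := by
    simp only [jumpKernel, mul_assoc]
    rw [← mul_sum]
    congr 1
    simp only [sum_mul, mul_sum, mul_assoc]
    rw [sum_comm]
    refine sum_congr rfl fun s _ => ?_
    rw [sum_comm]
  have e2 : ∀ s ∈ range R, ∑ a ∈ hᶜ, (P ^ (ℓ + s)) b a *
        ∑ η ∈ cyl D η₀, jumpKernel P ℓ R η j (T - (ℓ + s + 1)) (insert a (insert (η a) h))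
          (η a) y * g η ≤
      (∑ a ∈ D \ h, (P ^ (ℓ + s)) b a) * (F * B * n) + E * B * n := by
    intro s hs
    have hT' : j * (ℓ + R) + ℓ ≤ T - (ℓ + s + 1) := by
      have := mem_range.1 hs
      have e : (j + 1) * (ℓ + R) = j * (ℓ + R) + (ℓ + R) := by ring
      omega
    have hsplit : hᶜ = (D \ h) ∪ Dᶜ := by
      ext x
      simp only [mem_compl, mem_union, Finset.mem_sdiff]
      have := @hh x
      tauto
    have hdisj : Disjoint (D \ h) Dᶜ :=
      disjoint_left.2 fun x hx hx' => mem_compl.1 hx' (Finset.mem_sdiff.1 hx).1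
    rw [hsplit, sum_union hdisj]
    refine add_le_add ?_ ?_
    · rw [sum_mul]
      refine sum_le_sum fun a ha => ?_
      refine mul_le_mul_of_nonneg_left ?_ ((hP.pow _).nonneg _ _)
      have haD := (Finset.mem_sdiff.1 ha).1
      refine le_trans (le_of_eq ?_) (hF1 η₀ D (insert a (insert (η₀ a) h)) (η₀ a) y _ hη₀ hD
        (by omega) ?_ hT')
      · refine sum_congr rfl fun η hη => ?_
        rw [(mem_cyl.1 hη).2 a haD]
      · intro x hx
        rcases mem_insert.1 hx with rfl | hx
        · exact haD
        rcases mem_insert.1 hx with rfl | hx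
        · exact hD a haD
        · exact hh hx
    · have hle : ∑ a ∈ Dᶜ, (P ^ (ℓ + s)) b a ≤ 1 := by
        rw [← (hP.pow (ℓ + s)).row b]
        exact sum_le_sum_of_subset_of_nonneg (subset_univ _) fun _ _ _ => (hP.pow _).nonneg _ _
      calc _ ≤ ∑ a ∈ Dᶜ, (P ^ (ℓ + s)) b a * (E * B * n) := by
            refine sum_le_sum fun a ha => ?_
            exact mul_le_mul_of_nonneg_left (hE1 η₀ D h a y _ hη₀ hD (mem_compl.1 ha) hcard
              hh hT') ((hP.pow _).nonneg _ _)
        _ ≤ E * B * n := by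
            rw [← sum_mul]
            have : 0 ≤ E * B * n := by positivity
            nlinarith
  rw [e1]
  calc _ ≤ (R : ℝ)⁻¹ * ∑ s ∈ range R,
        ((∑ a ∈ D \ h, (P ^ (ℓ + s)) b a) * (F * B * n) + E * B * n) := by
          gcongr with s hs; exact e2 s hs
    _ = _ := by
      rw [sum_add_distrib, ← sum_mul, sum_const, card_range,
        nsmul_eq_mul, mul_add, inv_mul_cancel_left₀ (by positivity)]
      ring

/-- Joint bounds for expectations of the jump kernel against a cylinder-bounded weight. -/
lemma jumpKernel_expect (hP : SymStoch P) (hR : 0 < R) {δ : ℝ}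
    (hδ : ∀ s, ℓ ≤ s → ∀ x y, (P ^ s) x y ≤ δ) (hδ0 : 0 ≤ δ) (hB : 0 ≤ B) (hJ' : J' ≤ J)
    {u : ℝ} (hu : u * ((Fintype.card V : ℝ) - J) = 1) (hu0 : 0 < u)
    (hg0 : ∀ η, 0 ≤ g η) (hg : CylBounded g B J') (j : ℕ) :
    (∀ (η₀ : V → V) (D h : Finset V) (b y : V) (T : ℕ), IsPerfectMatchingFn η₀ →
      (∀ x ∈ D, η₀ x ∈ D) → D.card + 2 * j ≤ J' → h ⊆ D → j * (ℓ + R) + ℓ ≤ T →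
      ∑ η ∈ cyl D η₀, jumpKernel P ℓ R η j T h b y * g η ≤
        (kernelBound δ u J j).1 * B * (cyl D η₀).card) ∧
    (∀ (η₀ : V → V) (D h : Finset V) (a y : V) (T : ℕ), IsPerfectMatchingFn η₀ →
      (∀ x ∈ D, η₀ x ∈ D) → a ∉ D → D.card + 2 * (j + 1) ≤ J' → h ⊆ D →
      j * (ℓ + R) + ℓ ≤ T →
      ∑ η ∈ cyl D η₀, jumpKernel P ℓ R η j T (insert a (insert (η a) h)) (η a) y * g η ≤
        (kernelBound δ u J j).2 * B * (cyl D η₀).card) := by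
  have hsmall : ∀ (D : Finset V), D.card + 2 ≤ J' → ∀ {S Q : ℝ}, 0 ≤ S →
      S * ((Fintype.card V : ℝ) - D.card - 1) ≤ Q → S ≤ u * Q := by
    intro D hDc S Q hS h
    have h1 : (D.card : ℝ) + 2 ≤ J := by exact_mod_cast hDc.trans hJ'
    have h2 : S * ((Fintype.card V : ℝ) - J) ≤ Q := le_trans (by nlinarith) h
    calc S = u * (S * ((Fintype.card V : ℝ) - J)) := by linear_combination (-S) * hu
      _ ≤ u * Q := by gcongr
  induction j with
  | zero =>
    refine ⟨fun η₀ D h b y T hη₀ hD hc _ hT => ?_, fun η₀ D h a y T hη₀ hD ha hc _ hT => ?_⟩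
    · simp only [jumpKernel, kernelBound]
      rw [← mul_sum]
      calc _ ≤ δ * ∑ η ∈ cyl D η₀, g η :=
            mul_le_mul_of_nonneg_right (hδ T (by omega) b y) (sum_nonneg fun _ _ => hg0 _)
        _ ≤ δ * (B * (cyl D η₀).card) := by gcongr; exact hg η₀ D hη₀ hD (by omega)
        _ = _ := by ring
    · simp only [jumpKernel, kernelBound]
      have h1 := sum_cyl_le hη₀ hD ha (fun η => (P ^ T) (η a) y * g η) (fun b => (P ^ T) b y * B)
        (by
          intro η₁ hη₁
          have h2 := hg η₁ _ (mem_cyl.1 hη₁).1 (insert_pair_invariant hD hη₁ a)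
            ((card_insert_pair_le D a (η₁ a)).trans (by omega))
          have h3 : ∑ η ∈ cyl (insert a (insert (η₁ a) D)) η₁, (P ^ T) (η a) y * g η =
              (P ^ T) (η₁ a) y * ∑ η ∈ cyl (insert a (insert (η₁ a) D)) η₁, g η := by
            rw [mul_sum]
            refine sum_congr rfl fun η hη => ?_
            rw [(mem_cyl.1 hη).2 a (by simp)]
          rw [h3, mul_assoc]
          exact mul_le_mul_of_nonneg_left h2 ((hP.pow T).nonneg _ _))
      have h4 : (∑ b ∈ (insert a D)ᶜ, (P ^ T) b y * B) * (cyl D η₀).card ≤ B * (cyl D η₀).card := by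
        gcongr
        rw [← sum_mul]
        have : ∑ b ∈ (insert a D)ᶜ, (P ^ T) b y ≤ 1 := by
          rw [← (hP.pow T).col y]
          exact sum_le_sum_of_subset_of_nonneg (subset_univ _) fun _ _ _ => (hP.pow _).nonneg _ _
        nlinarith
      have h5 := hsmall D (by omega) (sum_nonneg fun η _ =>
        mul_nonneg ((hP.pow T).nonneg _ _) (hg0 η)) (h1.trans h4)
      rwa [← mul_assoc] at h5
  | succ j ih =>
    obtain ⟨ihF, ihE⟩ := ih
    obtain ⟨hF0, hE0⟩ := kernelBound_nonneg hδ0 hu0.le (Nat.cast_nonneg (α := ℝ) J) j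
    set F := (kernelBound δ u J j).1 with hF
    set E := (kernelBound δ u J j).2 with hE
    refine ⟨fun η₀ D h b y T hη₀ hD hc hh hT => ?_, fun η₀ D h a y T hη₀ hD ha hc hh hT => ?_⟩
    · refine (step_bound hP hR hB hE0 ihF ihE b y hη₀ hD hc hh hT).trans ?_
      simp only [kernelBound]
      rw [← hF, ← hE]
      gcongr (?_ * F + E) * B * _
      refine (sum_sum_pow_subset_le hR hδ b (D \ h)).trans ?_
      gcongr
      exact (card_le_card sdiff_subset).trans (by omega)
    · have h1 := sum_cyl_le hη₀ hD ha
        (fun η => jumpKernel P ℓ R η (j + 1) T (insert a (insert (η a) h)) (η a) y * g η)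
        (fun b => (((R : ℝ)⁻¹ * ∑ s ∈ range R, ∑ a ∈ D, (P ^ (ℓ + s)) b a) * F + E) * B)
        (by
          intro η₁ hη₁
          have h3 : ∑ η ∈ cyl (insert a (insert (η₁ a) D)) η₁,
              jumpKernel P ℓ R η (j + 1) T (insert a (insert (η a) h)) (η a) y * g η =
              ∑ η ∈ cyl (insert a (insert (η₁ a) D)) η₁,
              jumpKernel P ℓ R η (j + 1) T (insert a (insert (η₁ a) h)) (η₁ a) y * g η := by
            refine sum_congr rfl fun η hη => ?_
            rw [(mem_cyl.1 hη).2 a (by simp)]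
          rw [h3]
          refine (step_bound hP hR hB hE0 ihF ihE (η₁ a) y (mem_cyl.1 hη₁).1
            (insert_pair_invariant hD hη₁ a) ?_ ?_ hT).trans ?_
          · have := card_insert_pair_le D a (η₁ a)
            omega
          · exact insert_subset_insert _ (insert_subset_insert _ hh)
          · gcongr with s hs
            · intro _ _ _
              exact (hP.pow _).nonneg _ _
            · intro x hx
              simp only [Finset.mem_sdiff, mem_insert] at hx
              tauto)
      have hw : ∑ b ∈ (insert a D)ᶜ, ((R : ℝ)⁻¹ * ∑ s ∈ range R, ∑ a ∈ D,
          (P ^ (ℓ + s)) b a) ≤ J := by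
        calc _ ≤ ∑ b, ((R : ℝ)⁻¹ * ∑ s ∈ range R, ∑ a ∈ D, (P ^ (ℓ + s)) b a) :=
              sum_le_sum_of_subset_of_nonneg (subset_univ _) fun _ _ _ =>
                mul_nonneg (by positivity) (sum_nonneg fun _ _ => sum_nonneg
                  fun _ _ => (hP.pow _).nonneg _ _)
          _ = D.card := by
              rw [← mul_sum, sum_comm]
              have : ∀ s ∈ range R, ∑ b, ∑ a ∈ D, (P ^ (ℓ + s)) b a = D.card := by
                intro s _
                refine sum_comm.trans ?_
                simp [(hP.pow _).col]
              rw [sum_congr rfl this, sum_const, card_range, nsmul_eq_mul,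
                inv_mul_cancel_left₀ (by positivity)]
          _ ≤ J := by exact_mod_cast (by omega : D.card ≤ J)
      have hcompl : (((insert a D)ᶜ).card : ℝ) = (Fintype.card V : ℝ) - D.card - 1 := by
        rw [card_compl, Nat.cast_sub (card_le_univ _), card_insert_of_notMem ha]
        push_cast; ring
      simp only [add_mul, sum_add_distrib, ← sum_mul, sum_const, nsmul_eq_mul, hcompl] at h1
      simp only [kernelBound]
      rw [← hF, ← hE]
      set n : ℝ := ((cyl D η₀).card : ℝ)
      set S := ∑ η ∈ cyl D η₀,
        jumpKernel P ℓ R η (j + 1) T (insert a (insert (η a) h)) (η a) y * g η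
      have hFBn : 0 ≤ F * B * n := by positivity
      have h4 : (S - E * B * n) * ((Fintype.card V : ℝ) - D.card - 1) ≤ J * (F * B * n) := by
        have := mul_le_mul_of_nonneg_right hw hFBn
        linarith
      rcases le_or_gt (S - E * B * n) 0 with h5 | h5
      · have : 0 ≤ J * u * (F * B * n) := by positivity
        linarith
      · have := hsmall D (by omega) h5.le h4
        linarith

end step

variable {Q : Matrix V V ℝ}

section moments

variable {J k T : ℕ} {δ u : ℝ}

lemma CylBounded.mono {g : (V → V) → ℝ} {B : ℝ} {J J' : ℕ} (h : CylBounded g B J)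
    (hJ : J' ≤ J) : CylBounded g B J' :=
  fun η₀ D h1 h2 h3 => h η₀ D h1 h2 (h3.trans hJ)

lemma CylBounded.jumpKernel_mul (hP : SymStoch P) (hR : 0 < R)
    (hδ : ∀ s, ℓ ≤ s → ∀ x y, (P ^ s) x y ≤ δ) (hδ0 : 0 ≤ δ)
    (hu : u * ((Fintype.card V : ℝ) - J) = 1) (hu0 : 0 < u) (hT : k * (ℓ + R) + ℓ ≤ T)
    {g : (V → V) → ℝ} {B : ℝ} {J' : ℕ} (hB : 0 ≤ B) (hg0 : ∀ η, 0 ≤ g η)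
    (hg : CylBounded g B (J' + 2 * k)) (hJ' : J' + 2 * k ≤ J) (x y : V) :
    CylBounded (fun η => jumpKernel P ℓ R η k T ∅ x y * g η) ((kernelBound δ u J k).1 * B) J' :=
  fun η₀ D h1 h2 h3 => (jumpKernel_expect hP hR hδ hδ0 hB hJ' hu hu0 hg0 hg k).1 η₀ D ∅ x y T
    h1 h2 (by omega) (empty_subset _) hT

lemma CylBounded.sum {ι : Type} {s : Finset ι} {g : ι → (V → V) → ℝ} {B : ℝ} {J : ℕ}
    (h : ∀ i ∈ s, CylBounded (g i) B J) : CylBounded (fun η => ∑ i ∈ s, g i η) (s.card * B) J := by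
  intro η₀ D h1 h2 h3
  rw [sum_comm]
  calc _ ≤ ∑ i ∈ s, B * (cyl D η₀).card := sum_le_sum fun i hi => h i hi η₀ D h1 h2 h3
    _ = _ := by rw [sum_const, nsmul_eq_mul]; ring

lemma cylBounded_sq_pow (hP : SymStoch P) (hR : 0 < R)
    (hδ : ∀ s, ℓ ≤ s → ∀ x y, (P ^ s) x y ≤ δ) (hδ0 : 0 ≤ δ)
    (hu : u * ((Fintype.card V : ℝ) - J) = 1) (hu0 : 0 < u) (hT : k * (ℓ + R) + ℓ ≤ T) (x : V)
    (r J' : ℕ) (hJ : J' + 4 * k * r ≤ J) :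
    CylBounded (fun η => (∑ y, jumpKernel P ℓ R η k T ∅ x y ^ 2) ^ r)
      ((Fintype.card V * (kernelBound δ u J k).1 ^ 2) ^ r) J' := by
  have hF := (kernelBound_nonneg hδ0 hu0.le (Nat.cast_nonneg (α := ℝ) J) k).1
  induction r generalizing J' with
  | zero =>
    intro η₀ D _ _ _
    simp
  | succ r ih =>
    have hJ2 : J' + 4 * k + 4 * k * r ≤ J := by
      rw [show 4 * k * (r + 1) = 4 * k * r + 4 * k by ring] at hJ; omega
    have h0 := ih (J' + 4 * k) hJ2
    have hU := fun η y => jumpKernel_nonneg (ℓ := ℓ) (R := R) hP η k T ∅ x y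
    have hZ : ∀ η, 0 ≤ (∑ y, jumpKernel P ℓ R η k T ∅ x y ^ 2) ^ r := fun η => by positivity
    have h1 : ∀ y ∈ univ, CylBounded (fun η => jumpKernel P ℓ R η k T ∅ x y *
        (jumpKernel P ℓ R η k T ∅ x y * (∑ y, jumpKernel P ℓ R η k T ∅ x y ^ 2) ^ r))
        ((kernelBound δ u J k).1 * ((kernelBound δ u J k).1 *
          (Fintype.card V * (kernelBound δ u J k).1 ^ 2) ^ r)) J' := by
      intro y _
      refine CylBounded.jumpKernel_mul hP hR hδ hδ0 hu hu0 hT (by positivity)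
        (fun η => mul_nonneg (hU η y) (hZ η)) ?_ (by omega) x y
      refine CylBounded.jumpKernel_mul hP hR hδ hδ0 hu hu0 hT (by positivity) hZ ?_ (by omega) x y
      exact h0.mono (by omega)
    have h2 := CylBounded.sum h1
    convert h2 using 1
    · funext η
      rw [pow_succ', sum_mul]
      exact sum_congr rfl fun y _ => by ring
    · rw [card_univ]; ring

lemma cyl_empty (η₀ : V → V) : cyl ∅ η₀ = matchings V := by simp [cyl]

/-- With high probability all jump kernels have small second moments. -/
lemma card_exists_sq_large (hP : SymStoch P) (hR : 0 < R)
    (hδ : ∀ s, ℓ ≤ s → ∀ x y, (P ^ s) x y ≤ δ) (hδ0 : 0 < δ)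
    (hu : u * ((Fintype.card V : ℝ) - J) = 1) (hu0 : 0 < u) (hT : k * (ℓ + R) + ℓ ≤ T)
    {r : ℕ} (hJ : 4 * k * r ≤ J) {τ : ℝ} (hτ : 0 < τ)
    (hF : 0 < (kernelBound δ u J k).1) :
    (((matchings V).filter fun η => ∃ x, (1 + τ) * (Fintype.card V *
        (kernelBound δ u J k).1 ^ 2) < ∑ y, jumpKernel P ℓ R η k T ∅ x y ^ 2).card : ℝ) *
      (1 + τ) ^ r ≤ Fintype.card V * (matchings V).card := by
  rcases (matchings V).eq_empty_or_nonempty with h | ⟨η₀, hη₀⟩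
  · simp [h]
  rcases isEmpty_or_nonempty V with hV | ⟨⟨o⟩⟩
  · simp
  set A : ℝ := Fintype.card V * (kernelBound δ u J k).1 ^ 2 with hA
  have hA0 : 0 < A := by
    have : (0 : ℝ) < Fintype.card V := card_cast_pos o
    positivity
  set Z : V → (V → V) → ℝ := fun x η => ∑ y, jumpKernel P ℓ R η k T ∅ x y ^ 2
  have h1 : ∀ x, (((matchings V).filter fun η => (1 + τ) * A < Z x η).card : ℝ) * (1 + τ) ^ r ≤
      (matchings V).card := by
    intro x
    have h2 := cylBounded_sq_pow hP hR hδ hδ0.le hu hu0 hT x r 0 (by simpa using hJ) η₀ ∅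
      (mem_matchings.1 hη₀) (by simp) (by simp)
    rw [cyl_empty] at h2
    change ∑ η ∈ matchings V, Z x η ^ r ≤ A ^ r * _ at h2
    have h3 : (((matchings V).filter fun η => (1 + τ) * A < Z x η).card : ℝ) * ((1 + τ) * A) ^ r ≤
        ∑ η ∈ matchings V, Z x η ^ r := by
      rw [← nsmul_eq_mul, ← sum_const]
      calc _ ≤ ∑ η ∈ (matchings V).filter (fun η => (1 + τ) * A < Z x η), Z x η ^ r := by
            refine sum_le_sum fun η hη => ?_
            gcongr
            exact (mem_filter.1 hη).2.le
        _ ≤ _ := sum_le_sum_of_subset_of_nonneg (filter_subset _ _) fun η _ _ => by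
            have : 0 ≤ Z x η := sum_nonneg fun _ _ => sq_nonneg _
            positivity
    have h4 := h3.trans h2
    rw [mul_pow] at h4
    refine le_of_mul_le_mul_left ?_ (pow_pos hA0 r)
    linarith
  have h5 : ((matchings V).filter fun η => ∃ x, (1 + τ) * A < Z x η).card ≤
      ∑ x, ((matchings V).filter fun η => (1 + τ) * A < Z x η).card := by
    refine le_trans (card_le_card ?_) card_biUnion_le
    intro η hη
    obtain ⟨h, x, hx⟩ := mem_filter.1 hη
    exact mem_biUnion.2 ⟨x, mem_univ _, mem_filter.2 ⟨h, hx⟩⟩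
  calc _ ≤ (∑ x, (((matchings V).filter fun η => (1 + τ) * A < Z x η).card : ℝ)) * (1 + τ) ^ r := by
        gcongr; exact_mod_cast h5
    _ ≤ ∑ x : V, ((matchings V).card : ℝ) := by rw [sum_mul]; exact sum_le_sum fun x _ => h1 x
    _ = _ := by rw [sum_const, card_univ, nsmul_eq_mul]

end moments

lemma sum_abs_sub_le_of_sq {f : V → ℝ} {m A c : ℝ} (hc : 0 ≤ c) (hm : m ≤ ∑ y, f y)
    (hA : Fintype.card V * ∑ y, f y ^ 2 ≤ A) (h : A - 2 * m + 1 ≤ c ^ 2) :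
    ∑ y, |f y - (Fintype.card V : ℝ)⁻¹| ≤ c := by
  rcases isEmpty_or_nonempty V with hV | ⟨⟨o⟩⟩
  · simpa using hc
  set N : ℝ := (Fintype.card V : ℝ)
  have hN : 0 < N := card_cast_pos o
  refine abs_le_of_sq_le_sq' ?_ hc |>.2
  have h1 : (∑ y, |f y - N⁻¹|) ^ 2 ≤ N * ∑ y, |f y - N⁻¹| ^ 2 := by
    simpa [N] using sq_sum_le_card_mul_sum_sq (s := univ) (f := fun y => |f y - N⁻¹|)
  have h2 : ∑ y, |f y - N⁻¹| ^ 2 = ∑ y, f y ^ 2 - 2 * N⁻¹ * ∑ y, f y + N⁻¹ := by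
    have e : ∀ y, |f y - N⁻¹| ^ 2 = f y ^ 2 - 2 * N⁻¹ * f y + N⁻¹ ^ 2 := fun y => by
      rw [sq_abs]; ring
    rw [sum_congr rfl fun y _ => e y, sum_add_distrib, sum_sub_distrib,
      ← mul_sum, sum_const, card_univ, nsmul_eq_mul]
    congr 1
    change N * _ = _
    field_simp
  rw [h2] at h1
  have h3 : N * (∑ y, f y ^ 2 - 2 * N⁻¹ * ∑ y, f y + N⁻¹) =
    N * ∑ y, f y ^ 2 - 2 * ∑ y, f y + 1 := by field_simp
  linarith

section domination

lemma pow_add_expand (A B : Matrix V V ℝ) (T : ℕ) :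
    (A + B) ^ T = A ^ T + ∑ m ∈ range T, A ^ m * B * (A + B) ^ (T - (m + 1)) := by
  induction T with
  | zero => simp
  | succ T ih =>
    rw [sum_range_succ']
    simp only [Nat.add_sub_add_right, pow_zero, one_mul, Nat.sub_zero]
    calc (A + B) ^ (T + 1) = A * (A + B) ^ T + B * (A + B) ^ T := by rw [pow_succ', add_mul]
      _ = A * (A ^ T + ∑ m ∈ range T, A ^ m * B * (A + B) ^ (T - (m + 1))) +
          B * (A + B) ^ T := by rw [← ih]
      _ = _ := by
        rw [mul_add, mul_sum, ← pow_succ', add_assoc]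
        simp only [pow_succ' A, mul_assoc]

variable {η : V → V} {q e : ℝ}

lemma pow_apply_expand (hQ : ∀ x y, Q x y = q * P x y + e * if η x = y then 1 else 0) (T : ℕ)
    (b y : V) : (Q ^ T) b y = q ^ T * (P ^ T) b y + ∑ m ∈ range T,
      q ^ m * e * ∑ a, (P ^ m) b a * (Q ^ (T - (m + 1))) (η a) y := by
  set M : Matrix V V ℝ := Matrix.of fun x y => if η x = y then 1 else 0 with hM
  have hQ' : Q = q • P + e • M := by ext x y; simp [hQ, hM]
  have hMm : ∀ (X : Matrix V V ℝ) a, (M * X) a y = X (η a) y := by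
    intro X a; simp [Matrix.mul_apply, hM]
  have h := congrFun (congrFun (pow_add_expand (q • P) (e • M) T) b) y
  rw [← hQ', Matrix.add_apply, Matrix.sum_apply, smul_pow, Matrix.smul_apply, smul_eq_mul] at h
  rw [h]
  congr 1
  refine sum_congr rfl fun m _ => ?_
  rw [smul_pow, mul_assoc, smul_mul_assoc, smul_mul_assoc, mul_smul_comm, Matrix.smul_apply,
    Matrix.smul_apply, Matrix.mul_apply]
  simp only [hMm, smul_eq_mul]
  ring

lemma jumpKernel_le_pow (hP : SymStoch P) (hQP : SymStoch Q)
    (hQ : ∀ x y, Q x y = q * P x y + e * if η x = y then 1 else 0) (hq : 0 ≤ q) (hq1 : q ≤ 1)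
    (he : 0 ≤ e) (hR : 0 < R) (j T : ℕ) (h : Finset V) (b y : V) (hT : j * (ℓ + R) + ℓ ≤ T) :
    q ^ T * (e * R) ^ j * jumpKernel P ℓ R η j T h b y ≤ (Q ^ T) b y := by
  have hterm : ∀ T m b y, 0 ≤ q ^ m * e * ∑ a, (P ^ m) b a * (Q ^ (T - (m + 1))) (η a) y :=
    fun T m b y => mul_nonneg (by positivity) (sum_nonneg fun a _ =>
      mul_nonneg ((hP.pow _).nonneg _ _) ((hQP.pow _).nonneg _ _))
  induction j generalizing T h b with
  | zero =>
    rw [pow_apply_expand hQ T b y, pow_zero, mul_one]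
    exact le_add_of_nonneg_right (sum_nonneg fun m _ => hterm _ _ _ _)
  | succ j ih =>
    have e1 : (j + 1) * (ℓ + R) = j * (ℓ + R) + (ℓ + R) := by ring
    rw [pow_apply_expand hQ T b y]
    have h1 : ∑ s ∈ range R, q ^ (ℓ + s) * e * ∑ a, (P ^ (ℓ + s)) b a *
        (Q ^ (T - (ℓ + s + 1))) (η a) y ≤ ∑ m ∈ range T,
        q ^ m * e * ∑ a, (P ^ m) b a * (Q ^ (T - (m + 1))) (η a) y := by
      rw [← sum_image (s := range R) (g := fun s => ℓ + s)
        (f := fun m => q ^ m * e * ∑ a, (P ^ m) b a * (Q ^ (T - (m + 1))) (η a) y)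
        (fun a _ b _ h => by simpa using h)]
      refine sum_le_sum_of_subset_of_nonneg ?_ fun m _ _ => hterm _ _ _ _
      intro m hm
      obtain ⟨s, hs, rfl⟩ := mem_image.1 hm
      have := mem_range.1 hs
      exact mem_range.2 (by omega)
    have h2 : 0 ≤ q ^ T * (P ^ T) b y := mul_nonneg (by positivity) ((hP.pow T).nonneg _ _)
    refine le_trans ?_ (h1.trans (le_add_of_nonneg_left h2))
    obtain ⟨W, hW⟩ : ∃ W : ℕ → V → ℝ, ∀ s a, W s a = (e * R) ^ j *
        jumpKernel P ℓ R η j (T - (ℓ + s + 1)) (insert a (insert (η a) h)) (η a) y :=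
      ⟨_, fun _ _ => rfl⟩
    have h3 : q ^ T * (e * R) ^ (j + 1) * jumpKernel P ℓ R η (j + 1) T h b y =
        ∑ s ∈ range R, q ^ T * e * ∑ a ∈ hᶜ, (P ^ (ℓ + s)) b a * W s a := by
      have hR' : (R : ℝ) * (R : ℝ)⁻¹ = 1 := mul_inv_cancel₀ (by positivity)
      simp only [jumpKernel, hW, mul_left_comm _ ((e * R) ^ j), ← mul_sum]
      linear_combination (q ^ T * e * (e * R) ^ j * ∑ s ∈ range R, ∑ a ∈ hᶜ, (P ^ (ℓ + s)) b a *
        jumpKernel P ℓ R η j (T - (ℓ + s + 1)) (insert a (insert (η a) h)) (η a) y) * hR'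
    rw [h3]
    refine sum_le_sum fun s hs => ?_
    have hs' := mem_range.1 hs
    have h4 : ∀ a, q ^ (T - (ℓ + s + 1)) * W s a ≤ (Q ^ (T - (ℓ + s + 1))) (η a) y := fun a => by
      rw [hW, ← mul_assoc]; exact ih _ _ _ (by omega)
    have h5 : q ^ T ≤ q ^ (ℓ + s) * q ^ (T - (ℓ + s + 1)) := by
      rw [← pow_add]
      exact pow_le_pow_of_le_one hq hq1 (by omega)
    have hU : ∀ a, 0 ≤ (P ^ (ℓ + s)) b a * W s a := fun a =>
      mul_nonneg ((hP.pow _).nonneg _ _) (hW s a ▸ mul_nonneg (by positivity)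
        (jumpKernel_nonneg hP _ _ _ _ _ _))
    calc _ ≤ q ^ (ℓ + s) * q ^ (T - (ℓ + s + 1)) * e * ∑ a ∈ hᶜ, (P ^ (ℓ + s)) b a * W s a := by
          gcongr
          exact sum_nonneg fun a _ => hU a
      _ ≤ q ^ (ℓ + s) * q ^ (T - (ℓ + s + 1)) * e * ∑ a, (P ^ (ℓ + s)) b a * W s a := by
          refine mul_le_mul_of_nonneg_left ?_ (by positivity)
          exact sum_le_sum_of_subset_of_nonneg (subset_univ _) fun a _ _ => hU a
      _ = q ^ (ℓ + s) * e * ∑ a, (P ^ (ℓ + s)) b a * (q ^ (T - (ℓ + s + 1)) * W s a) := by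
          simp only [mul_sum]
          exact sum_congr rfl fun a _ => by ring
      _ ≤ _ := by
          gcongr with a
          · exact (hP.pow _).nonneg _ _
          · exact h4 a

end domination

/-- A minorisation by an almost uniform kernel yields geometric convergence. -/
lemma tv_le_of_kernel_of_mass (hQ : SymStoch Q) {T : ℕ} {κ w c : ℝ} (hκ : 0 ≤ κ) (hc : 0 ≤ c)
    {U : V → V → ℝ} (hU : ∀ x y, κ * U x y ≤ (Q ^ T) x y) (hmass : ∀ x, w ≤ ∑ y, U x y)
    (hU1 : ∀ x, ∑ y, |U x y - (Fintype.card V : ℝ)⁻¹| ≤ c) (m : ℕ) (x : V) :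
    (2 : ℝ)⁻¹ * ∑ y, |(Q ^ (T * m)) x y - (Fintype.card V : ℝ)⁻¹| ≤ (1 - κ * (w - c)) ^ m := by
  set N : ℝ := (Fintype.card V : ℝ)
  have hN : 0 < N := card_cast_pos x
  have hκ1 : κ * w ≤ 1 := by
    calc κ * w ≤ κ * ∑ y, U x y := by gcongr; exact hmass x
      _ ≤ ∑ y, (Q ^ T) x y := by rw [mul_sum]; exact sum_le_sum fun y _ => hU x y
      _ = 1 := (hQ.pow T).row x
  have hstep : ∀ (f : V → ℝ) (M : ℝ), 0 ≤ M → ∑ y, f y = 0 → (∀ y, |f y| ≤ M) →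
      ∀ x, |((Q ^ T) *ᵥ f) x| ≤ (1 - κ * (w - c)) * M := by
    intro f M hM hf0 hf x
    have e : ((Q ^ T) *ᵥ f) x = ∑ y, ((Q ^ T) x y - κ * U x y) * f y +
        κ * ∑ y, (U x y - N⁻¹) * f y := by
      have : ∑ y, (U x y - N⁻¹) * f y = ∑ y, U x y * f y := by
        simp only [sub_mul, sum_sub_distrib]
        rw [← mul_sum, hf0]; ring
      rw [this, mul_sum, ← sum_add_distrib]
      simp only [mulVec, dotProduct]
      exact sum_congr rfl fun y _ => by ring
    have h1 : |∑ y, ((Q ^ T) x y - κ * U x y) * f y| ≤ (1 - κ * ∑ y, U x y) * M := by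
      calc _ ≤ ∑ y, |((Q ^ T) x y - κ * U x y) * f y| := abs_sum_le_sum_abs _ _
        _ ≤ ∑ y, ((Q ^ T) x y - κ * U x y) * M := by
          refine sum_le_sum fun y _ => ?_
          rw [abs_mul, abs_of_nonneg (sub_nonneg.2 (hU x y))]
          exact mul_le_mul_of_nonneg_left (hf y) (sub_nonneg.2 (hU x y))
        _ = _ := by rw [← sum_mul, sum_sub_distrib, (hQ.pow T).row, mul_sum]
    have h2 : |∑ y, (U x y - N⁻¹) * f y| ≤ c * M := by
      calc _ ≤ ∑ y, |(U x y - N⁻¹) * f y| := abs_sum_le_sum_abs _ _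
        _ ≤ ∑ y, |U x y - N⁻¹| * M := by
          refine sum_le_sum fun y _ => ?_
          rw [abs_mul]; gcongr; exact hf y
        _ ≤ _ := by rw [← sum_mul]; gcongr; exact hU1 x
    rw [e]
    refine (abs_add_le _ _).trans ?_
    rw [abs_mul, abs_of_nonneg hκ]
    have h3 := mul_le_mul_of_nonneg_left h2 hκ
    have h4 : κ * w * M ≤ κ * (∑ y, U x y) * M := by gcongr; exact hmass x
    linarith
  have hiter : ∀ (f : V → ℝ) (M : ℝ), 0 ≤ M → ∑ y, f y = 0 → (∀ y, |f y| ≤ M) →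
      ∀ m x, |((Q ^ (T * m)) *ᵥ f) x| ≤ (1 - κ * (w - c)) ^ m * M := by
    intro f M hM hf0 hf m
    induction m with
    | zero => intro x; simpa using hf x
    | succ m ih =>
      intro x
      have h0 : ∑ y, ((Q ^ (T * m)) *ᵥ f) y = 0 := by
        simp only [mulVec, dotProduct]
        rw [sum_comm]
        simp only [← sum_mul, (hQ.pow _).col, one_mul, hf0]
      have h1 := hstep _ ((1 - κ * (w - c)) ^ m * M)
        (mul_nonneg (pow_nonneg (by nlinarith) _) hM) h0 ih x
      rw [mulVec_mulVec, ← pow_add] at h1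
      rw [show T * (m + 1) = T + T * m by ring]
      refine h1.trans (le_of_eq (by ring))
  set σ : V → ℝ := fun y => SignType.sign ((Q ^ (T * m)) x y - N⁻¹) with hσ
  have hσ1 : ∀ y, |σ y| ≤ 1 := by
    intro y
    simp only [hσ]
    rcases SignType.sign ((Q ^ (T * m)) x y - N⁻¹) with _ | _ | _ <;> simp
  set μ : ℝ := N⁻¹ * ∑ y, σ y with hμ
  have hμ1 : |μ| ≤ 1 := by
    rw [hμ, abs_mul, abs_of_nonneg (by positivity : 0 ≤ N⁻¹)]
    calc N⁻¹ * |∑ y, σ y| ≤ N⁻¹ * ∑ y : V, 1 := by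
          gcongr
          exact (abs_sum_le_sum_abs _ _).trans (sum_le_sum fun y _ => hσ1 y)
      _ = 1 := by simp [N, inv_mul_cancel₀ hN.ne']
  have h1 := hiter (fun y => σ y - μ) 2 (by norm_num) (by
      rw [sum_sub_distrib, sum_const, card_univ, nsmul_eq_mul, hμ,
        mul_inv_cancel_left₀ hN.ne', sub_self])
    (fun y => (abs_sub _ _).trans (by linarith [hσ1 y])) m x
  have h2 : ((Q ^ (T * m)) *ᵥ fun y => σ y - μ) x = ∑ y, |(Q ^ (T * m)) x y - N⁻¹| := by
    have e : ∀ y, |(Q ^ (T * m)) x y - N⁻¹| = (Q ^ (T * m)) x y * σ y - N⁻¹ * σ y := by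
      intro y
      rw [← sub_mul, ← sign_mul_self, mul_comm]
    rw [sum_congr rfl fun y _ => e y, sum_sub_distrib, ← mul_sum]
    simp only [mulVec, dotProduct, mul_sub, sum_sub_distrib]
    rw [← sum_mul, (hQ.pow _).row, one_mul]
  rw [h2] at h1
  have := (le_abs_self _).trans h1
  linarith

lemma tv_le_of_kernel (hQ : SymStoch Q) {T : ℕ} {κ : ℝ} (hκ : 0 ≤ κ) {U : V → V → ℝ}
    (hU : ∀ x y, κ * U x y ≤ (Q ^ T) x y)
    (hU1 : ∀ x, ∑ y, |U x y - (Fintype.card V : ℝ)⁻¹| ≤ 1 / 4) (m : ℕ) (x : V) :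
    (2 : ℝ)⁻¹ * ∑ y, |(Q ^ (T * m)) x y - (Fintype.card V : ℝ)⁻¹| ≤ (1 - κ / 2) ^ m := by
  set N : ℝ := (Fintype.card V : ℝ)
  have hN : 0 < N := card_cast_pos x
  have hmass : ∀ x, 3 / 4 ≤ ∑ y, U x y := by
    intro x
    have h1 : ∑ y, (N⁻¹ - U x y) ≤ ∑ y, |U x y - N⁻¹| :=
      sum_le_sum fun y _ => by rw [abs_sub_comm]; exact le_abs_self _
    rw [sum_sub_distrib, sum_const, card_univ, nsmul_eq_mul] at h1
    change N * N⁻¹ - _ ≤ _ at h1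
    rw [mul_inv_cancel₀ hN.ne'] at h1
    linarith [hU1 x]
  refine (tv_le_of_kernel_of_mass hQ hκ (by norm_num) hU hmass hU1 m x).trans (le_of_eq ?_)
  congr 1
  ring

/-- The total variation distance to equilibrium decays geometrically once it is below `1 / 4`. -/
lemma tv_le_half_pow (hQ : SymStoch Q) {T : ℕ}
    (h : ∀ x, (2 : ℝ)⁻¹ * ∑ y, |(Q ^ T) x y - (Fintype.card V : ℝ)⁻¹| ≤ 1 / 4) (m : ℕ) (x : V) :
    (2 : ℝ)⁻¹ * ∑ y, |(Q ^ (T * m)) x y - (Fintype.card V : ℝ)⁻¹| ≤ (1 / 2) ^ m := by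
  refine (tv_le_of_kernel_of_mass hQ zero_le_one (by norm_num : (0 : ℝ) ≤ 1 / 2)
    (fun x y => by rw [one_mul]) (fun x => ((hQ.pow T).row x).ge)
    (fun x => by linarith [h x]) m x).trans (le_of_eq ?_)
  norm_num

end

section
open Matrix Classical Topology Real

lemma kernelBound_pos {δ u J : ℝ} (hδ : 0 < δ) (hu : 0 < u) (hJ : 0 ≤ J) (j : ℕ) :
    0 < (kernelBound δ u J j).1 ∧ 0 < (kernelBound δ u J j).2 := by
  induction j with
  | zero => exact ⟨hδ, hu⟩
  | succ j ih =>
    obtain ⟨h1, h2⟩ := ih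
    simp only [kernelBound]
    constructor <;> positivity

lemma kernelBound_tendsto {l : Filter ℕ} {N J δ u : ℕ → ℝ}
    (h1 : Tendsto (fun n => J n * δ n) l (𝓝 0)) (h2 : Tendsto (fun n => J n / N n) l (𝓝 0))
    (h3 : Tendsto (fun n => N n * u n) l (𝓝 1)) (hN : ∀ᶠ n in l, N n ≠ 0) (j : ℕ) :
    Tendsto (fun n => J n * (kernelBound (δ n) (u n) (J n) j).1) l (𝓝 0) ∧
      Tendsto (fun n => N n * (kernelBound (δ n) (u n) (J n) j).2) l (𝓝 1) := by
  induction j with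
  | zero => exact ⟨h1, h3⟩
  | succ j ih =>
    obtain ⟨ih1, ih2⟩ := ih
    simp only [kernelBound]
    constructor
    · have := (h1.mul ih1).add (h2.mul ih2)
      rw [zero_mul, zero_mul, zero_add] at this
      refine this.congr' ?_
      filter_upwards [hN] with n hn
      field_simp
    · have := ih2.add (h3.mul ih1)
      rw [mul_zero, add_zero] at this
      exact this.congr fun n => by ring

lemma kernelBound_fst_tendsto {l : Filter ℕ} {N J δ u : ℕ → ℝ}
    (h1 : Tendsto (fun n => J n * δ n) l (𝓝 0)) (h2 : Tendsto (fun n => J n / N n) l (𝓝 0))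
    (h3 : Tendsto (fun n => N n * u n) l (𝓝 1)) (hN : ∀ᶠ n in l, N n ≠ 0) (j : ℕ) :
    Tendsto (fun n => N n * (kernelBound (δ n) (u n) (J n) (j + 1)).1 -
      N n * (J n * δ n) ^ (j + 1) * δ n) l (𝓝 1) := by
  have h := fun j => (kernelBound_tendsto h1 h2 h3 hN j).2
  induction j with
  | zero => exact (h 0).congr fun n => by simp only [kernelBound]; ring
  | succ j ih =>
    have := (h1.mul ih).add (h (j + 1))
    rw [zero_mul, zero_add] at this
    refine this.congr fun n => ?_
    rw [kernelBound.eq_def _ _ _ (j + 1 + 1)]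
    ring

lemma eventually_parameters (Δ C d k : ℕ) {a b A τ : ℝ} (hb : 0 < b)
    (hba : 3 * b < a) (hbd : b * d < 1) (hk : 1 < (k + 1) * b) (hk0 : 0 < k) (hτ : 0 < τ) :
    ∀ᶠ N : ℕ in atTop, 1 ≤ N ∧ C * (⌈(N : ℝ) ^ b⌉₊ + 1) ^ d < N ∧ 4 * k * ⌈A * log N⌉₊ < N ∧
      N * (kernelBound (6 * (N : ℝ) ^ (-b)) ((N : ℝ) - (4 * k * ⌈A * log N⌉₊ : ℕ))⁻¹
        (4 * k * ⌈A * log N⌉₊ : ℕ) k).1 ≤ 1 + τ ∧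
      k * (2 * k) * (6 * (N : ℝ) ^ (-b)) ≤ τ ∧
      2 * Δ * (⌈(N : ℝ) ^ b⌉₊ : ℝ) ^ 3 ≤ (N : ℝ) ^ a := by
  have hcast : Tendsto (fun N : ℕ => (N : ℝ)) atTop atTop := tendsto_natCast_atTop_atTop
  have hneg : ∀ c : ℝ, 0 < c → Tendsto (fun N : ℕ => (N : ℝ) ^ (-c)) atTop (𝓝 0) := fun c hc =>
    (tendsto_rpow_neg_atTop hc).comp hcast
  set J : ℕ → ℝ := fun N => (4 * k * ⌈A * log N⌉₊ : ℕ) with hJ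
  have hJle : ∀ N : ℕ, 1 ≤ N → J N ≤ 4 * k * (|A| * log N + 1) := by
    intro N hN
    have hl : 0 ≤ log N := log_natCast_nonneg N
    have h1 : (⌈A * log N⌉₊ : ℝ) ≤ |A| * log N + 1 := by
      calc (⌈A * log N⌉₊ : ℝ) ≤ (⌈|A| * log N⌉₊ : ℝ) := by
            exact_mod_cast Nat.ceil_le_ceil (by gcongr; exact le_abs_self A)
        _ ≤ _ := (Nat.ceil_lt_add_one (by positivity)).le
    simp only [hJ]
    push_cast
    gcongr
  have hJ0 : ∀ N, 0 ≤ J N := fun N => Nat.cast_nonneg _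
  have hJlim : ∀ c : ℝ, 0 < c → Tendsto (fun N : ℕ => J N * (N : ℝ) ^ (-c)) atTop (𝓝 0) := by
    intro c hc
    have hlog : Tendsto (fun N : ℕ => log N * (N : ℝ) ^ (-c)) atTop (𝓝 0) := by
      have h := ((isLittleO_log_rpow_atTop hc).tendsto_div_nhds_zero).comp hcast
      refine h.congr fun N => ?_
      simp only [Function.comp_apply]
      rw [rpow_neg (Nat.cast_nonneg N), div_eq_mul_inv]
    have hup : Tendsto (fun N : ℕ => 4 * k * (|A| * (log N * (N : ℝ) ^ (-c)) +
        (N : ℝ) ^ (-c))) atTop (𝓝 0) := by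
      have := ((hlog.const_mul |A|).add (hneg c hc)).const_mul (4 * k : ℝ)
      simpa using this
    refine tendsto_of_tendsto_of_tendsto_of_le_of_le' tendsto_const_nhds hup
      (Eventually.of_forall fun N => mul_nonneg (hJ0 N) (by positivity)) ?_
    filter_upwards [eventually_ge_atTop 1] with N hN
    calc J N * (N : ℝ) ^ (-c) ≤ 4 * k * (|A| * log N + 1) * (N : ℝ) ^ (-c) := by
          gcongr; exact hJle N hN
      _ = _ := by ring
  have hJN : Tendsto (fun N : ℕ => J N / N) atTop (𝓝 0) :=
    (hJlim 1 one_pos).congr fun N => by rw [rpow_neg_one]; rfl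
  have hpos : ∀ᶠ N : ℕ in atTop, (0 : ℝ) < N := by
    filter_upwards [eventually_gt_atTop 0] with N hN
    exact_mod_cast hN
  have hNu : Tendsto (fun N : ℕ => (N : ℝ) * ((N : ℝ) - J N)⁻¹) atTop (𝓝 1) := by
    have h := (hJN.const_sub 1).inv₀ (by norm_num)
    rw [sub_zero, inv_one] at h
    refine h.congr' ?_
    filter_upwards [hpos] with N hN
    have : 1 - J N / N = ((N : ℝ) - J N) * (N : ℝ)⁻¹ := by field_simp
    rw [this, mul_inv, inv_inv, mul_comm]
  have hδ : Tendsto (fun N : ℕ => J N * (6 * (N : ℝ) ^ (-b))) atTop (𝓝 0) := by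
    have := (hJlim b hb).const_mul 6
    rw [mul_zero] at this
    exact this.congr fun N => by ring
  obtain ⟨j, rfl⟩ : ∃ j, k = j + 1 := ⟨k - 1, by omega⟩
  have hfst := kernelBound_fst_tendsto hδ hJN hNu (hpos.mono fun N h => h.ne') j
  set c : ℝ := ((j + 1 + 1) * b - 1) / (j + 1) with hc
  have hc0 : 0 < c := by
    push_cast at hk
    have : (0 : ℝ) < j + 1 := by positivity
    exact div_pos (by linarith) this
  have hrem : Tendsto (fun N : ℕ => (N : ℝ) * (J N * (6 * (N : ℝ) ^ (-b))) ^ (j + 1) *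
      (6 * (N : ℝ) ^ (-b))) atTop (𝓝 0) := by
    have h := ((hJlim c hc0).pow (j + 1)).const_mul ((6 : ℝ) ^ (j + 2))
    rw [zero_pow (Nat.succ_ne_zero j), mul_zero] at h
    refine h.congr' ?_
    filter_upwards [hpos] with N hN
    have e : ((N : ℝ) ^ (-c)) ^ (j + 1) = N * ((N : ℝ) ^ (-b)) ^ (j + 2) := by
      rw [← rpow_natCast, ← rpow_natCast, ← rpow_mul hN.le, ← rpow_mul hN.le]
      conv_rhs => rw [← rpow_one_add' hN.le (by push_cast; push_cast at hk; nlinarith)]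
      congr 1
      rw [hc]
      push_cast
      field_simp
      ring
    rw [mul_pow, e]
    ring
  have hF := hfst.add hrem
  rw [add_zero] at hF
  have hF1 := hF.eventually (eventually_le_nhds (by linarith : 1 < 1 + τ))
  have hmass : Tendsto (fun N : ℕ => ((j + 1 : ℕ) : ℝ) * (2 * (j + 1 : ℕ)) *
      (6 * (N : ℝ) ^ (-b))) atTop (𝓝 0) := by
    have := ((hneg b hb).const_mul 6).const_mul (((j + 1 : ℕ) : ℝ) * (2 * (j + 1 : ℕ)))
    simpa using this
  have hceil : ∀ N : ℕ, 1 ≤ N → (⌈(N : ℝ) ^ b⌉₊ : ℝ) + 1 ≤ 3 * (N : ℝ) ^ b := by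
    intro N hN
    have h1 : (1 : ℝ) ≤ (N : ℝ) ^ b := one_le_rpow (by exact_mod_cast hN) hb.le
    have := Nat.ceil_lt_add_one (by positivity : 0 ≤ (N : ℝ) ^ b)
    linarith
  have hball : Tendsto (fun N : ℕ => (C * 3 ^ d : ℝ) * (N : ℝ) ^ (-(1 - b * d))) atTop (𝓝 0) := by
    simpa using (hneg (1 - b * d) (by linarith)).const_mul (C * 3 ^ d : ℝ)
  have hcube : Tendsto (fun N : ℕ => (2 * Δ * 3 ^ 3 : ℝ) * (N : ℝ) ^ (-(a - 3 * b)))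
      atTop (𝓝 0) := by
    simpa using (hneg (a - 3 * b) (by linarith)).const_mul (2 * Δ * 3 ^ 3 : ℝ)
  filter_upwards [eventually_ge_atTop 1, hball.eventually (gt_mem_nhds one_pos),
    hJN.eventually (gt_mem_nhds one_pos), hF1, hmass.eventually (eventually_le_nhds hτ),
    hcube.eventually (gt_mem_nhds one_pos)] with N h1 h2 h3 h4 h5 h6
  have hN : (0 : ℝ) < N := by exact_mod_cast h1
  refine ⟨h1, ?_, ?_, ?_, h5, ?_⟩
  · have : (C * (⌈(N : ℝ) ^ b⌉₊ + 1) ^ d : ℝ) < N := by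
      calc (C * (⌈(N : ℝ) ^ b⌉₊ + 1) ^ d : ℝ) ≤ C * (3 * (N : ℝ) ^ b) ^ d := by
            gcongr; exact hceil N h1
        _ = (C * 3 ^ d : ℝ) * (N : ℝ) ^ (-(1 - b * d)) * N := by
            rw [mul_pow, ← rpow_natCast ((N : ℝ) ^ b), ← rpow_mul hN.le,
              show b * d = -(1 - b * d) + 1 by ring, rpow_add_one hN.ne']
            ring_nf
        _ < 1 * N := by gcongr
        _ = N := one_mul _
    exact_mod_cast this
  · have : J N < N := by rwa [div_lt_one hN] at h3
    exact (Nat.cast_lt (α := ℝ)).1 this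
  · linarith
  · calc 2 * Δ * (⌈(N : ℝ) ^ b⌉₊ : ℝ) ^ 3 ≤ 2 * Δ * (3 * (N : ℝ) ^ b) ^ 3 := by
          gcongr; linarith [hceil N h1]
      _ = (2 * Δ * 3 ^ 3 : ℝ) * (N : ℝ) ^ (-(a - 3 * b)) * (N : ℝ) ^ a := by
          rw [mul_pow, ← rpow_natCast ((N : ℝ) ^ b), ← rpow_mul hN.le, mul_assoc _ _ ((N : ℝ) ^ a),
            ← rpow_add hN]
          push_cast
          ring_nf
      _ ≤ 1 * (N : ℝ) ^ a := by gcongr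
      _ = _ := one_mul _

variable {V : Type} [Fintype V] [DecidableEq V] {G : SimpleGraph V} [DecidableRel G.Adj] {Δ : ℕ}

lemma starMatrix_apply (hΔ : 0 < Δ) (hreg : ∀ x, G.degree x = Δ) (η : V → V) {ε : ℝ}
    (hε : 0 < ε) (x y : V) : starMatrix G η ε x y =
      (Δ / (Δ + ε)) * srwMatrix G x y + (ε / (Δ + ε)) * if η x = y then 1 else 0 := by
  have h1 : (0 : ℝ) < Δ := by exact_mod_cast hΔ
  simp only [starMatrix, srwMatrix, hreg]
  split_ifs <;> field_simp <;> ring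

lemma starMatrix_symStoch (hΔ : 0 < Δ) (hreg : ∀ x, G.degree x = Δ) {η : V → V}
    (hη : IsPerfectMatchingFn η) {ε : ℝ} (hε : 0 < ε) : SymStoch (starMatrix G η ε) where
  nonneg x y := by
    rw [starMatrix_apply hΔ hreg η hε]
    have := (srwMatrix_symStoch hΔ hreg).nonneg x y
    split_ifs <;> positivity
  symm x y := by
    rw [starMatrix_apply hΔ hreg η hε, starMatrix_apply hΔ hreg η hε,
      (srwMatrix_symStoch hΔ hreg).symm x y]
    have : η x = y ↔ η y = x := ⟨fun h => by rw [← h, hη.1 x], fun h => by rw [← h, hη.1 y]⟩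
    simp only [this]
  row x := by
    have h1 : (0 : ℝ) < Δ := by exact_mod_cast hΔ
    simp only [starMatrix_apply hΔ hreg η hε, sum_add_distrib, ← mul_sum,
      (srwMatrix_symStoch hΔ hreg).row]
    simp only [sum_ite_eq, mem_univ, if_true]
    field_simp

lemma starPi_eq (hreg : ∀ x, G.degree x = Δ) {ε : ℝ} (hε : 0 < ε) (x : V) :
    starPi G ε x = (Fintype.card V : ℝ)⁻¹ := by
  have h := G.sum_degrees_eq_twice_card_edges
  simp only [hreg, sum_const, card_univ, smul_eq_mul] at h
  have h2 : (2 * G.edgeFinset.card : ℝ) = Fintype.card V * Δ := by exact_mod_cast h.symm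
  have hN := card_cast_pos x
  simp only [starPi, hreg]
  rw [h2]
  have : (0 : ℝ) ≤ Δ := Nat.cast_nonneg _
  field_simp

lemma exists_dist_gt {C d : ℕ} (o : V) {r : ℕ} (hball : β(G, o, r) ≤ C * (r + 1) ^ d)
    (h : C * (r + 1) ^ d < Fintype.card V) : ∃ x, r < G.dist o x := by
  by_contra! hcon
  have : {y : V | G.dist o y ≤ r} = Set.univ := Set.eq_univ_of_forall hcon
  rw [this, Nat.card_congr (Equiv.Set.univ V), Nat.card_eq_fintype_card] at hball
  omega

lemma le_card_ball (hG : G.Connected) {o x : V} {r : ℕ} (h : r ≤ G.dist o x) :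
    r + 1 ≤ β(G, o, r) := by
  have h1 : ∀ i : Fin (r + 1), ∃ y, G.dist o y = i := by
    intro i
    obtain ⟨p, hp⟩ := (hG o x).exists_walk_length_eq_dist
    refine ⟨p.getVert i, ?_⟩
    have h2 : G.dist o (p.getVert i) ≤ i := (SimpleGraph.dist_le (p.take i)).trans (by simp)
    have h3 : G.dist (p.getVert i) x ≤ p.length - i :=
      (SimpleGraph.dist_le (p.drop i)).trans (by simp)
    have h4 := hG.dist_triangle (u := o) (v := p.getVert i) (w := x)
    omega
  choose f hf using h1
  have hinj : Function.Injective fun i : Fin (r + 1) =>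
      (⟨f i, by rw [Set.mem_ofPred_eq, hf]; omega⟩ : {y : V | G.dist o y ≤ r}) := by
    intro i j hij
    have : f i = f j := congrArg Subtype.val hij
    exact Fin.ext (by rw [← hf i, ← hf j, this])
  have h2 := Nat.card_le_card_of_injective _ hinj
  rwa [Nat.card_fin] at h2

/-- Quantitative decay of transition probabilities from the trivial volume bound. -/
lemma srw_pow_le (hΔ : 0 < Δ) (hG : G.Connected) (hreg : ∀ x, G.degree x = Δ)
    (ht : IsVertexTransitive G) {r : ℕ} (hr : 1 ≤ r)
    (hball : ∀ o, r + 1 ≤ β(G, o, r)) {s : ℕ} (hs : 2 * (Δ * r ^ 3) ≤ s)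
    (x y : V) : (srwMatrix G ^ s) x y ≤ 6 / r := by
  have hP := srwMatrix_symStoch hΔ hreg
  have hr0 : (0 : ℝ) < r := by exact_mod_cast hr
  have hΔ0 : (0 : ℝ) < Δ := by exact_mod_cast hΔ
  have : Finite (G ≃g G) := Finite.of_injective (fun φ => (φ : V → V)) DFunLike.coe_injective
  have := Fintype.ofFinite (G ≃g G)
  refine hP.entries_le (fun x => ?_) hs x y
  have h1 := returnSum_decay hΔ hG hreg ht x hr hr0
    (by exact_mod_cast (Nat.le_succ r).trans (hball x)) 0 (Δ * r ^ 3)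
  have h2 : returnSum (srwMatrix G) x 0 ≤ 2 := by
    have h3 := hP.apply_le_one x x
    simp only [returnSum, mul_zero, pow_zero, zero_add, pow_one, Matrix.one_apply_eq]
    linarith
  refine (hP.le_returnSum x _).trans ?_
  rw [zero_add] at h1
  set v := returnSum (srwMatrix G) x (Δ * r ^ 3)
  by_contra! hcon
  have h4 : 2 / (r : ℝ) < v - 4 / r := by
    have : (6 : ℝ) / r = 4 / r + 2 / r := by ring
    linarith
  have h5 : 2 / (r : ℝ) * (Δ * r ^ 2 + (Δ * r ^ 3 : ℕ)) <
      (v - 4 / r) * (Δ * r ^ 2 + (Δ * r ^ 3 : ℕ)) := by gcongr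
  have h6 : 2 / (r : ℝ) * (Δ * r ^ 2 + (Δ * r ^ 3 : ℕ)) = 2 * Δ * r + 2 * Δ * r ^ 2 := by
    push_cast; field_simp
  have h7 : Δ * (r : ℝ) ^ 2 * returnSum (srwMatrix G) x 0 ≤ Δ * (r : ℝ) ^ 2 * 2 := by gcongr
  have h8 : 0 < 2 * (Δ : ℝ) * r := by positivity
  linarith

/-- Connected transitive `Δ`-regular graphs with balls of at most `C * (r + 1) ^ d` vertices. -/
def TransPoly (Δ C d : ℕ) (G : SimpleGraph V) [DecidableRel G.Adj] : Prop :=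
  G.Connected ∧ (∀ x, G.degree x = Δ) ∧ IsVertexTransitive G ∧ ∀ o r, β(G, o, r) ≤ C * (r + 1) ^ d

lemma exp_neg_le_ratio (hΔ : 0 < Δ) {ε : ℝ} (hε : 0 < ε) : exp (-ε) ≤ Δ / (Δ + ε) := by
  have h1 : (1 : ℝ) ≤ Δ := by exact_mod_cast hΔ
  have h2 := add_one_le_exp ε
  rw [exp_neg, inv_le_comm₀ (exp_pos _) (by positivity), inv_div]
  refine le_trans ?_ h2
  rw [div_le_iff₀ (by linarith)]
  nlinarith

/-- For most matchings the walk on the augmented graph relaxes on the time scale `1 / ε`. -/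
theorem exists_mixing_upper (hΔ : 0 < Δ) (C d : ℕ) {a : ℝ} (ha : 0 < a) :
    ∃ κ K : ℝ, 0 < κ ∧ κ < 1 ∧ 0 < K ∧ ∀ᶠ N : ℕ in atTop,
      ∀ (V : Type) [Fintype V] [DecidableEq V] (G : SimpleGraph V) [DecidableRel G.Adj],
      TransPoly Δ C d G → Fintype.card V = N →
      ∀ ε : ℝ, 0 < ε → ε < 1 → ε ≤ (N : ℝ) ^ (-a) → ∃ T : ℕ, T * ε ≤ K ∧
        (((matchings V).filter fun η => ¬ ∀ m, mixedAt (starMatrix G η ε) (starPi G ε)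
          ((1 - κ) ^ m) (T * m)).card : ℝ) * N ≤ (matchings V).card := by
  obtain ⟨b, hb, hba, hbd⟩ : ∃ b : ℝ, 0 < b ∧ 3 * b < a ∧ b * d < 1 := by
    refine ⟨min (a / 4) (1 / (d + 1)), lt_min (by positivity) (by positivity), ?_, ?_⟩
    · linarith [min_le_left (a / 4) (1 / ((d : ℝ) + 1))]
    · calc min (a / 4) (1 / ((d : ℝ) + 1)) * d ≤ 1 / (d + 1) * d := by
            gcongr; exact min_le_right _ _
        _ < 1 := by rw [one_div, inv_mul_lt_iff₀ (by positivity)]; linarith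
  set k : ℕ := ⌈1 / b⌉₊ with hk
  have hk0 : 0 < k := Nat.ceil_pos.2 (by positivity)
  have hk1 : 1 < ((k : ℝ) + 1) * b := by
    have h1 : 1 / b ≤ k := Nat.le_ceil _
    rw [div_le_iff₀ hb] at h1
    linarith
  set κ : ℝ := exp (-(3 * k + 1)) * (1 / (Δ + 1)) ^ k with hκ
  have hΔ0 : (0 : ℝ) < Δ := by exact_mod_cast hΔ
  have hκ0 : 0 < κ := by positivity
  have hκ1 : κ ≤ 1 := by
    rw [hκ]
    refine mul_le_one₀ (exp_le_one_iff.2 (by linarith [Nat.cast_nonneg (α := ℝ) k]))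
      (by positivity) (pow_le_one₀ (by positivity) ?_)
    rw [div_le_one (by positivity)]; linarith
  refine ⟨κ / 2, 3 * k + 1, by positivity, by linarith, by positivity, ?_⟩
  set A : ℝ := 2 / log (1 + 1 / 100) with hA
  have hlog : 0 < log (1 + 1 / 100) := log_pos (by norm_num)
  filter_upwards [eventually_parameters Δ C d k (A := A) (τ := 1 / 100) hb hba hbd hk1 hk0
    (by norm_num)] with N hN V _ _ G _ ⟨hG, hreg, ht, hball⟩ hcard ε hε0 hε1 hεN
  obtain ⟨hN1, hC, hJN, hF, hmass, hcube⟩ := hN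
  set r : ℕ := ⌈(N : ℝ) ^ b⌉₊ with hr
  set m₀ : ℕ := ⌈A * log N⌉₊ with hm₀
  set J : ℕ := 4 * k * m₀ with hJ
  set δ : ℝ := 6 * (N : ℝ) ^ (-b) with hδ
  set u : ℝ := ((N : ℝ) - J)⁻¹ with hu
  have hN0 : (0 : ℝ) < N := by exact_mod_cast hN1
  have hJN' : (0 : ℝ) < N - J := sub_pos.2 (by exact_mod_cast hJN)
  have hu0 : 0 < u := inv_pos.2 hJN'
  have hu1 : u * ((Fintype.card V : ℝ) - J) = 1 := by rw [hcard]; exact inv_mul_cancel₀ hJN'.ne'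
  have hδ0 : 0 < δ := by positivity
  have hr1 : 1 ≤ r := Nat.ceil_pos.2 (by positivity)
  have hP := srwMatrix_symStoch hΔ hreg
  have hballs : ∀ o, r + 1 ≤ β(G, o, r) := by
    intro o
    obtain ⟨x, hx⟩ := exists_dist_gt o (hball o r) (hcard ▸ hC)
    exact le_card_ball hG hx.le
  set ℓ : ℕ := 2 * (Δ * r ^ 3) with hℓ
  have hPδ : ∀ s, ℓ ≤ s → ∀ x y, (srwMatrix G ^ s) x y ≤ δ := by
    intro s hs x y
    refine (srw_pow_le hΔ hG hreg ht hr1 hballs hs x y).trans ?_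
    rw [hδ, rpow_neg hN0.le, ← div_eq_mul_inv]
    gcongr
    exact Nat.le_ceil _
  set R : ℕ := ⌈1 / ε⌉₊ with hR
  have hR0 : 0 < R := Nat.ceil_pos.2 (by positivity)
  set T : ℕ := k * (ℓ + R) + ℓ with hT
  have hℓε : ℓ * ε ≤ 1 := by
    have h1 : (ℓ : ℝ) ≤ (N : ℝ) ^ a := by
      refine le_trans (le_of_eq ?_) hcube
      rw [hℓ]; push_cast; ring
    calc ℓ * ε ≤ (N : ℝ) ^ a * (N : ℝ) ^ (-a) := by gcongr
      _ = 1 := by rw [← rpow_add hN0, add_neg_cancel, rpow_zero]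
  have hRε : 1 ≤ R * ε := by
    have := Nat.le_ceil (1 / ε)
    rwa [div_le_iff₀ hε0] at this
  have hRε2 : R * ε ≤ 2 := by
    have h1 := Nat.ceil_lt_add_one (by positivity : 0 ≤ 1 / ε)
    have h2 : (R : ℝ) * ε ≤ (1 / ε + 1) * ε := by gcongr
    have h3 : (1 / ε + 1) * ε = 1 + ε := by field_simp
    linarith
  have hTε : T * ε ≤ 3 * k + 1 := by
    have : (T : ℝ) * ε = k * (ℓ * ε + R * ε) + ℓ * ε := by rw [hT]; push_cast; ring
    rw [this]
    have : (k : ℝ) * (ℓ * ε + R * ε) ≤ k * 3 := by gcongr; linarith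
    linarith
  refine ⟨T, hTε, ?_⟩
  have hFpos := (kernelBound_pos hδ0 hu0 (Nat.cast_nonneg (α := ℝ) J) k).1
  have hcount := card_exists_sq_large hP hR0 hPδ hδ0 hu1 hu0 (le_refl T) (le_of_eq hJ.symm)
    (by norm_num : (0 : ℝ) < 1 / 100) hFpos
  set F := (kernelBound δ u J k).1
  have hpow : (N : ℝ) ^ 2 ≤ (1 + 1 / 100 : ℝ) ^ m₀ := by
    have h1 : A * log N ≤ m₀ := Nat.le_ceil _
    rw [hA, div_mul_eq_mul_div, div_le_iff₀ hlog] at h1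
    rw [← log_le_log_iff (by positivity) (by positivity), log_pow, log_pow]
    exact_mod_cast h1
  have hgood : ∀ η ∈ matchings V, (¬ ∃ x, (1 + 1 / 100) * (Fintype.card V * F ^ 2) <
      ∑ y, jumpKernel (srwMatrix G) ℓ R η k T ∅ x y ^ 2) →
      ∀ m, mixedAt (starMatrix G η ε) (starPi G ε) ((1 - κ / 2) ^ m) (T * m) := by
    intro η hη h m x
    push Not at h
    have hη' := mem_matchings.1 hη
    simp only [starPi_eq hreg hε0]
    refine tv_le_of_kernel (starMatrix_symStoch hΔ hreg hη' hε0) hκ0.le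
      (U := fun x y => jumpKernel (srwMatrix G) ℓ R η k T ∅ x y) (fun x y => ?_) (fun x => ?_) m x
    · refine le_trans ?_ (jumpKernel_le_pow hP (starMatrix_symStoch hΔ hreg hη' hε0)
        (starMatrix_apply hΔ hreg η hε0) (by positivity)
        (by rw [div_le_one (by positivity)]; linarith) (by positivity) hR0 k T ∅ x y le_rfl)
      refine mul_le_mul_of_nonneg_right ?_ (jumpKernel_nonneg hP _ _ _ _ _ _)
      rw [hκ]
      refine mul_le_mul ?_ (pow_le_pow_left₀ (by positivity) ?_ _) (by positivity) (by positivity)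
      · have h1 := exp_neg_le_ratio hΔ hε0
        calc _ ≤ exp (T * (-ε)) := exp_le_exp.2 (by linarith)
          _ = exp (-ε) ^ T := exp_nat_mul _ _
          _ ≤ _ := by gcongr
      · rw [div_mul_eq_mul_div, mul_comm ε]
        gcongr
    · refine sum_abs_sub_le_of_sq (m := 1 - 1 / 100) (A := (1 + 1 / 100) ^ 3) (by norm_num)
        ?_ ?_ (by norm_num)
      · refine le_trans ?_ (jumpKernel_sum_ge hP hR0 hPδ hδ0.le η k T ∅ x)
        rw [card_empty, Nat.cast_zero, zero_add]
        linarith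
      · calc (Fintype.card V : ℝ) * ∑ y, jumpKernel (srwMatrix G) ℓ R η k T ∅ x y ^ 2
            ≤ Fintype.card V * ((1 + 1 / 100) * (Fintype.card V * F ^ 2)) := by gcongr; exact h x
          _ = (1 + 1 / 100) * (N * F) ^ 2 := by rw [hcard]; ring
          _ ≤ (1 + 1 / 100) * (1 + 1 / 100) ^ 2 := by gcongr
          _ = _ := by ring
  have hsub : ((matchings V).filter fun η => ¬ ∀ m, mixedAt (starMatrix G η ε) (starPi G ε)
      ((1 - κ / 2) ^ m) (T * m)).card ≤ ((matchings V).filter fun η => ∃ x, (1 + 1 / 100) *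
      (Fintype.card V * F ^ 2) < ∑ y, jumpKernel (srwMatrix G) ℓ R η k T ∅ x y ^ 2).card := by
    refine card_le_card fun η hη => ?_
    obtain ⟨h1, h2⟩ := mem_filter.1 hη
    refine mem_filter.2 ⟨h1, ?_⟩
    by_contra hcon
    exact h2 (hgood η h1 hcon)
  rw [hcard] at hcount hsub
  refine le_of_mul_le_mul_right ?_ hN0
  calc _ ≤ (((matchings V).filter fun η => ∃ x, (1 + 1 / 100) * ((N : ℝ) * F ^ 2) <
        ∑ y, jumpKernel (srwMatrix G) ℓ R η k T ∅ x y ^ 2).card : ℝ) * N * N := by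
        gcongr
    _ = (((matchings V).filter fun η => ∃ x, (1 + 1 / 100) * ((N : ℝ) * F ^ 2) <
        ∑ y, jumpKernel (srwMatrix G) ℓ R η k T ∅ x y ^ 2).card : ℝ) * (N : ℝ) ^ 2 := by ring
    _ ≤ (((matchings V).filter fun η => ∃ x, (1 + 1 / 100) * ((N : ℝ) * F ^ 2) <
        ∑ y, jumpKernel (srwMatrix G) ℓ R η k T ∅ x y ^ 2).card : ℝ) *
        (1 + 1 / 100 : ℝ) ^ m₀ := by gcongr
    _ ≤ N * (matchings V).card := hcount
    _ = _ := mul_comm _ _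

/-- Multiscale iteration of the Nash-type decay under a regular volume lower bound. -/
lemma exists_returnSum_mul_le (hΔ : 0 < Δ) (hG : G.Connected) (hreg : ∀ x, G.degree x = Δ)
    (ht : IsVertexTransitive G) (o : V) {D q : ℕ} {E A : ℝ} (hE : 0 < E) (hA : 8 ≤ A)
    (hAE : 2 ≤ A * E)
    (hvol : ∀ r : ℕ, 1 ≤ r → r ≤ D → (r : ℝ) ^ q ≤ E * β(G, o, r)) (i : ℕ)
    (hi : 2 ^ i ≤ D) : ∃ t : ℕ, t ≤ 2 ^ (q + 2) * Δ * 4 ^ i ∧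
      returnSum (srwMatrix G) o t * ((2 : ℝ) ^ i) ^ q ≤ A * E := by
  have hP := srwMatrix_symStoch hΔ hreg
  have hΔ0 : (0 : ℝ) < Δ := by exact_mod_cast hΔ
  have : Finite (G ≃g G) := Finite.of_injective (fun φ => (φ : V → V)) DFunLike.coe_injective
  have := Fintype.ofFinite (G ≃g G)
  induction i with
  | zero =>
    refine ⟨0, Nat.zero_le _, ?_⟩
    have h3 := hP.apply_le_one o o
    simp only [returnSum, mul_zero, pow_zero, zero_add, pow_one, Matrix.one_apply_eq, one_pow,
      mul_one]
    linarith
  | succ i ih =>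
    obtain ⟨t, ht1, ht2⟩ := ih ((Nat.pow_le_pow_right (by norm_num) (Nat.le_succ i)).trans hi)
    set r : ℕ := 2 ^ (i + 1) with hr
    have hr1 : 1 ≤ r := Nat.one_le_two_pow
    have hr0 : (0 : ℝ) < r := by exact_mod_cast hr1
    have hrc : (r : ℝ) = 2 ^ (i + 1) := by rw [hr]; push_cast; rfl
    have hr2 : r ^ 2 = 4 ^ (i + 1) := by rw [hr, ← pow_mul, mul_comm, pow_mul]; norm_num
    have hb : 0 < (r : ℝ) ^ q / E := by positivity
    have h1 := returnSum_decay hΔ hG hreg ht o hr1 hb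
      (by rw [div_le_iff₀ hE, mul_comm]; exact hvol r hr1 hi) t (2 ^ (q + 1) * Δ * r ^ 2)
    refine ⟨t + 2 ^ (q + 1) * Δ * r ^ 2, ?_, ?_⟩
    · rw [hr2]
      calc t + 2 ^ (q + 1) * Δ * 4 ^ (i + 1)
          ≤ 2 ^ (q + 2) * Δ * 4 ^ i + 2 ^ (q + 1) * Δ * 4 ^ (i + 1) := by gcongr
        _ ≤ 2 ^ (q + 2) * Δ * 4 ^ (i + 1) := by
            have : 0 ≤ 2 ^ q * Δ * 4 ^ i := Nat.zero_le _
            simp only [pow_succ]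
            nlinarith
    · rw [← hrc]
      set s := returnSum (srwMatrix G) o t
      set v := returnSum (srwMatrix G) o (t + 2 ^ (q + 1) * Δ * r ^ 2)
      have hs : 0 ≤ s := hP.returnSum_nonneg o t
      have e1 : Δ * (r : ℝ) ^ 2 + ((2 ^ (q + 1) * Δ * r ^ 2 : ℕ) : ℝ) =
          Δ * (r : ℝ) ^ 2 * (1 + 2 ^ (q + 1)) := by push_cast; ring
      rw [e1] at h1
      have h2 : (v - 4 / ((r : ℝ) ^ q / E)) * (1 + 2 ^ (q + 1)) ≤ s := by
        have h0 : 0 < Δ * (r : ℝ) ^ 2 := by positivity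
        refine le_of_mul_le_mul_left ?_ h0
        linarith
      have e2 : (r : ℝ) ^ q = ((2 : ℝ) ^ i) ^ q * 2 ^ q := by rw [hrc, pow_succ, mul_pow]
      have h3 : s * (r : ℝ) ^ q ≤ A * E * 2 ^ q := by rw [e2, ← mul_assoc]; gcongr
      have h4 : (v * (r : ℝ) ^ q - 4 * E) * (1 + 2 ^ (q + 1)) ≤ A * E * 2 ^ q := by
        refine le_trans (le_of_eq ?_) ((mul_le_mul_of_nonneg_right h2
          (by positivity : (0 : ℝ) ≤ (r : ℝ) ^ q)).trans h3)
        field_simp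
      have h5 : (A * E / 2) * (1 + 2 ^ (q + 1)) = A * E * 2 ^ q + A * E / 2 := by ring
      have h6 : v * (r : ℝ) ^ q - 4 * E ≤ A * E / 2 := by
        refine le_of_mul_le_mul_right (h4.trans ?_) (by positivity : (0 : ℝ) < 1 + 2 ^ (q + 1))
        rw [h5]; nlinarith
      nlinarith

lemma exists_dist_eq_diam_from (hG : G.Connected) (ht : IsVertexTransitive G) (o : V) :
    ∃ z, G.dist o z = G.diam := by
  have := hG.nonempty
  obtain ⟨u, v, h⟩ := G.exists_dist_eq_diam
  obtain ⟨φ, hφ⟩ := ht u o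
  exact ⟨φ v, by rw [← hφ, dist_iso φ u v hG, h]⟩

lemma dist_le_diam_of_connected (hG : G.Connected) (x y : V) : G.dist x y ≤ G.diam := by
  have := hG.nonempty
  exact SimpleGraph.dist_le_diam (SimpleGraph.connected_iff_ediam_ne_top.1 hG)

/-- The heat kernel at times of order the squared diameter is comparable to uniform. -/
theorem exists_diffusive_bound (hΔ : 0 < Δ) (C d : ℕ) :
    ∃ (C₁ : ℝ) (B : ℕ), 2 ≤ C₁ ∧ 0 < B ∧ ∀ (V : Type) [Fintype V] [DecidableEq V]
      (G : SimpleGraph V) [DecidableRel G.Adj],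
      TransPoly Δ C d G → 1 ≤ G.diam →
      ∀ o, (srwMatrix G ^ (2 * (B * G.diam ^ 2))) o o ≤ C₁ / Fintype.card V := by
  obtain ⟨K, q, hKq⟩ := exists_moderate_growth C d
  refine ⟨(8 + 2 * (C * 2 ^ d)) * K * 2 ^ q + 2, 2 ^ (q + 2) * Δ, by
    have : (0 : ℝ) ≤ (8 + 2 * (C * 2 ^ d)) * K * 2 ^ q := by positivity
    linarith, by positivity, ?_⟩
  rintro V _ _ G _ ⟨hG, hreg, ht, hball⟩ hD o
  have hP := srwMatrix_symStoch hΔ hreg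
  set D := G.diam with hDdef
  set A : ℝ := 8 + 2 * (C * 2 ^ d) with hA
  have hN := card_cast_pos o
  have hmg : ∀ r : ℕ, 1 ≤ r → r ≤ D → (Fintype.card V : ℝ) * (r : ℝ) ^ q ≤
      K * D ^ q * β(G, o, r) := fun r h1 h2 => by
    have := hKq V G hG ht o (hball o) D r (fun x => dist_le_diam_of_connected hG o x) h1 h2
    rw [Nat.card_eq_fintype_card] at this
    exact_mod_cast this
  have hKD := hmg 1 le_rfl hD
  have hball1 : (β(G, o, 1) : ℝ) ≤ C * 2 ^ d := by exact_mod_cast hball o 1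
  rw [Nat.cast_one, one_pow, mul_one] at hKD
  have hKD' : (Fintype.card V : ℝ) ≤ K * D ^ q * (C * 2 ^ d) := hKD.trans (by gcongr)
  have hKD0 : (0 : ℝ) < K * D ^ q := by
    by_contra! hcon
    have : (K : ℝ) * D ^ q * (C * 2 ^ d) ≤ 0 := mul_nonpos_of_nonpos_of_nonneg hcon (by positivity)
    linarith
  obtain ⟨t, ht1, ht2⟩ := exists_returnSum_mul_le hΔ hG hreg ht o (D := D) (q := q)
    (E := K * D ^ q / Fintype.card V) (A := A) (by positivity)
    (by rw [hA]; have : (0 : ℝ) ≤ C * 2 ^ d := by positivity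
        linarith)
    (by rw [← mul_div_assoc, le_div_iff₀ hN, hA]; nlinarith)
    (fun r h1 h2 => by rw [div_mul_eq_mul_div, le_div_iff₀ hN, mul_comm]; exact hmg r h1 h2)
    (Nat.log 2 D) (Nat.pow_log_le_self 2 (by omega))
  have hlt : D < 2 ^ (Nat.log 2 D + 1) := Nat.lt_pow_succ_log_self (by norm_num) D
  have hle : 2 ^ Nat.log 2 D ≤ D := Nat.pow_log_le_self 2 (by omega)
  set i := Nat.log 2 D
  have hmono := antitone_nat_of_succ_le (f := fun t => (srwMatrix G ^ (2 * t)) o o) (hP.even_le o)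
  have htB : t ≤ 2 ^ (q + 2) * Δ * D ^ 2 := by
    refine ht1.trans (Nat.mul_le_mul_left _ ?_)
    calc 4 ^ i = (2 ^ i) ^ 2 := by rw [← pow_mul, mul_comm, pow_mul]; norm_num
      _ ≤ D ^ 2 := Nat.pow_le_pow_left hle 2
  refine (hmono htB).trans ((hP.le_returnSum o t).trans ?_)
  have hDq : (D : ℝ) ^ q ≤ 2 ^ q * ((2 : ℝ) ^ i) ^ q := by
    rw [← mul_pow]
    have : (D : ℝ) ≤ 2 * 2 ^ i := by rw [← pow_succ']; exact_mod_cast hlt.le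
    gcongr
  have h1 : returnSum (srwMatrix G) o t ≤ A * K * 2 ^ q / Fintype.card V := by
    refine le_of_mul_le_mul_right (ht2.trans ?_) (by positivity : (0 : ℝ) < ((2 : ℝ) ^ i) ^ q)
    calc A * (K * D ^ q / Fintype.card V) = A * K / Fintype.card V * D ^ q := by ring
      _ ≤ A * K / Fintype.card V * (2 ^ q * ((2 : ℝ) ^ i) ^ q) := by gcongr
      _ = _ := by ring
  refine h1.trans ?_
  gcongr
  linarith

/-- Domination by the base walk bounds the total variation distance away from one. -/
lemma mixedAt_of_diffusive (hΔ : 0 < Δ) (hreg : ∀ x, G.degree x = Δ) {η : V → V}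
    (hη : IsPerfectMatchingFn η) {ε : ℝ} (hε : 0 < ε) {T : ℕ} (hT : T * ε ≤ 1) {C₁ : ℝ}
    (hC : 2 ≤ C₁) (hP : ∀ o, (srwMatrix G ^ (2 * T)) o o ≤ C₁ / Fintype.card V) :
    mixedAt (starMatrix G η ε) (starPi G ε) (1 - exp (-1) / C₁) T := by
  intro x
  have hS := srwMatrix_symStoch hΔ hreg
  have hQ := starMatrix_symStoch hΔ hreg hη hε
  have hN := card_cast_pos x
  have hΔ0 : (0 : ℝ) < Δ := by exact_mod_cast hΔ
  set N : ℝ := (Fintype.card V : ℝ) with hNdef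
  have hC0 : 0 < C₁ := by linarith
  set w : ℝ := (Δ / (Δ + ε)) ^ T with hw
  have hw1 : w ≤ 1 := pow_le_one₀ (by positivity) (by rw [div_le_one (by positivity)]; linarith)
  have hw0 : exp (-1) ≤ w := by
    calc exp (-1) ≤ exp (-(T * ε)) := exp_le_exp.2 (by linarith)
      _ = exp (-ε) ^ T := by rw [← exp_nat_mul]; ring_nf
      _ ≤ w := pow_le_pow_left₀ (exp_pos _).le (exp_neg_le_ratio hΔ hε) T
  have hwpos : 0 < w := (exp_pos _).trans_le hw0
  have hdom : ∀ y, w * (srwMatrix G ^ T) x y ≤ (starMatrix G η ε ^ T) x y := by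
    intro y
    rw [pow_apply_expand (starMatrix_apply hΔ hreg η hε) T x y]
    refine le_add_of_nonneg_right (sum_nonneg fun m _ => mul_nonneg (by positivity)
      (sum_nonneg fun a _ => mul_nonneg ((hS.pow m).nonneg _ _) ((hQ.pow _).nonneg _ _)))
  have hsq : ∑ y, (srwMatrix G ^ T) x y ^ 2 ≤ C₁ / N := by
    refine le_trans (le_of_eq ?_) (hP x)
    rw [two_mul, pow_add, Matrix.mul_apply]
    exact sum_congr rfl fun y _ => by rw [sq, (hS.pow T).symm y x]
  have hterm : ∀ y, |(starMatrix G η ε ^ T) x y - starPi G ε y| ≤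
      (starMatrix G η ε ^ T) x y + N⁻¹ - 2 * w * ((2 / C₁) * (srwMatrix G ^ T) x y -
        N / C₁ ^ 2 * (srwMatrix G ^ T) x y ^ 2) := by
    intro y
    rw [starPi_eq hreg hε, ← hNdef]
    set f := (srwMatrix G ^ T) x y
    set g := (starMatrix G η ε ^ T) x y
    have hf : 0 ≤ f := (hS.pow T).nonneg x y
    have hfg : w * f ≤ g := hdom y
    have k1 : (2 / C₁) * f - N / C₁ ^ 2 * f ^ 2 ≤ f := by
      have : 2 / C₁ ≤ 1 := by rw [div_le_one hC0]; exact hC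
      have : 0 ≤ N / C₁ ^ 2 * f ^ 2 := by positivity
      nlinarith
    have k2 : (2 / C₁) * f - N / C₁ ^ 2 * f ^ 2 ≤ N⁻¹ := by
      have : N⁻¹ - ((2 / C₁) * f - N / C₁ ^ 2 * f ^ 2) = N * (f / C₁ - N⁻¹) ^ 2 := by
        field_simp; ring
      have : 0 ≤ N * (f / C₁ - N⁻¹) ^ 2 := by positivity
      linarith
    have k3 : w * ((2 / C₁) * f - N / C₁ ^ 2 * f ^ 2) ≤ N⁻¹ :=
      (mul_le_mul_of_nonneg_left k2 hwpos.le).trans (mul_le_of_le_one_left (by positivity) hw1)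
    have k4 := mul_le_mul_of_nonneg_left k1 hwpos.le
    rw [abs_le]
    constructor <;> linarith
  have hsum := sum_le_sum fun y (_ : y ∈ univ) => hterm y
  rw [sum_sub_distrib, sum_add_distrib, (hQ.pow T).row, ← mul_sum,
    sum_sub_distrib, ← mul_sum, ← mul_sum, (hS.pow T).row,
    sum_const, card_univ, nsmul_eq_mul, ← hNdef, mul_inv_cancel₀ hN.ne'] at hsum
  have k5 : N / C₁ ^ 2 * ∑ y, (srwMatrix G ^ T) x y ^ 2 ≤ 1 / C₁ := by
    refine (mul_le_mul_of_nonneg_left hsq (by positivity)).trans (le_of_eq ?_)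
    field_simp
  have k6 : w * (1 / C₁) ≤ w * (2 / C₁ * 1 - N / C₁ ^ 2 * ∑ y, (srwMatrix G ^ T) x y ^ 2) := by
    refine mul_le_mul_of_nonneg_left ?_ hwpos.le
    have : 2 / C₁ * 1 = 1 / C₁ + 1 / C₁ := by ring
    linarith
  have k7 : exp (-1) / C₁ ≤ w * (1 / C₁) := by rw [div_eq_mul_one_div]; gcongr
  linarith

/-- The energy of a function varying by at most one along edges and by at most `D` overall. -/
lemma star_energy_le (hΔ : 0 < Δ) (hreg : ∀ x, G.degree x = Δ) (η : V → V) {ε : ℝ} (hε : 0 < ε)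
    {f : V → ℝ} {D : ℝ} (hadj : ∀ x y, G.Adj x y → (f x - f y) ^ 2 ≤ 1)
    (hD : ∀ x y, (f x - f y) ^ 2 ≤ D ^ 2) :
    ∑ x, ∑ y, starMatrix G η ε x y * (f x - f y) ^ 2 ≤ Fintype.card V * (1 + ε * D ^ 2) := by
  have hΔ1 : (1 : ℝ) ≤ Δ := by exact_mod_cast hΔ
  have hS := srwMatrix_symStoch hΔ hreg
  have hrow : ∀ x, ∑ y, starMatrix G η ε x y * (f x - f y) ^ 2 ≤ 1 + ε * D ^ 2 := by
    intro x
    have hterm : ∀ y, starMatrix G η ε x y * (f x - f y) ^ 2 ≤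
        srwMatrix G x y + ε * D ^ 2 * if η x = y then 1 else 0 := by
      intro y
      rw [starMatrix_apply hΔ hreg η hε, add_mul]
      refine add_le_add ?_ ?_
      · have hq : Δ / (Δ + ε) ≤ 1 := by rw [div_le_one (by positivity)]; linarith
        have h1 : srwMatrix G x y * (f x - f y) ^ 2 ≤ srwMatrix G x y := by
          by_cases h : G.Adj x y
          · exact mul_le_of_le_one_right (hS.nonneg x y) (hadj x y h)
          · simp [srwMatrix, h]
        rw [mul_assoc]
        exact (mul_le_of_le_one_left (mul_nonneg (hS.nonneg x y) (sq_nonneg _)) hq).trans h1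
      · have he : ε / (Δ + ε) ≤ ε := div_le_self hε.le (by linarith)
        split_ifs
        · rw [mul_one, mul_one]
          exact mul_le_mul he (hD x y) (sq_nonneg _) hε.le
        · simp
    refine (sum_le_sum fun y _ => hterm y).trans (le_of_eq ?_)
    rw [sum_add_distrib, hS.row, ← mul_sum]
    simp
  refine (sum_le_sum fun x _ => hrow x).trans (le_of_eq ?_)
  rw [sum_const, card_univ, nsmul_eq_mul]

/-- A regular volume lower bound forces the distance function to have variance of order `D ^ 2`. -/
lemma le_variance_dist (hG : G.Connected) {o z : V} {D : ℕ} (hz : G.dist o z = D) {b μ : ℝ}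
    (hball : ∀ x, b ≤ β(G, x, D / 4)) :
    b * (D / 4) ^ 2 ≤ ∑ y, ((G.dist o y : ℝ) - μ) ^ 2 := by
  have key : ∀ x : V, (∀ y, G.dist x y ≤ D / 4 → ((D : ℝ) / 4) ^ 2 ≤ ((G.dist o y : ℝ) - μ) ^ 2) →
      b * ((D : ℝ) / 4) ^ 2 ≤ ∑ y, ((G.dist o y : ℝ) - μ) ^ 2 := by
    intro x hx
    have hB : β(G, x, D / 4) = (univ.filter fun y : V => G.dist x y ≤ D / 4).card := by
      rw [← Set.ncard_coe_finset, coe_filter_univ]; rfl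
    calc b * ((D : ℝ) / 4) ^ 2
        ≤ ∑ _y ∈ univ.filter (fun y : V => G.dist x y ≤ D / 4), ((D : ℝ) / 4) ^ 2 := by
          rw [sum_const, nsmul_eq_mul, ← hB]
          exact mul_le_mul_of_nonneg_right (hball x) (sq_nonneg _)
      _ ≤ ∑ y ∈ univ.filter (fun y : V => G.dist x y ≤ D / 4), ((G.dist o y : ℝ) - μ) ^ 2 :=
          sum_le_sum fun y hy => hx y (mem_filter.1 hy).2
      _ ≤ _ := sum_le_sum_of_subset_of_nonneg (subset_univ _) fun _ _ _ => sq_nonneg _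
  have hcast : ((D / 4 : ℕ) : ℝ) ≤ (D : ℝ) / 4 := Nat.cast_div_le
  rcases le_or_gt ((D : ℝ) / 2) μ with h | h
  · refine key o fun y hy => ?_
    have h1 : (G.dist o y : ℝ) ≤ (D : ℝ) / 4 := le_trans (by exact_mod_cast hy) hcast
    have h0 : (0 : ℝ) ≤ D := Nat.cast_nonneg D
    nlinarith
  · refine key z fun y hy => ?_
    have h1 : (G.dist z y : ℝ) ≤ (D : ℝ) / 4 := le_trans (by exact_mod_cast hy) hcast
    have h2 : (D : ℝ) ≤ G.dist o y + G.dist z y := by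
      rw [← hz, SimpleGraph.dist_comm (u := z) (v := y)]; exact_mod_cast hG.dist_triangle
    have h0 : (0 : ℝ) ≤ D := Nat.cast_nonneg D
    nlinarith

/-- Mixing cannot happen before the time scale `1 / (D⁻² + ε)`. -/
theorem exists_mixing_lower (hΔ : 0 < Δ) (C d : ℕ) : ∃ c₁ : ℝ, 0 < c₁ ∧
    ∀ (V : Type) [Fintype V] [DecidableEq V] (G : SimpleGraph V) [DecidableRel G.Adj],
      TransPoly Δ C d G → 4 ≤ G.diam →
      ∀ (ε : ℝ), 0 < ε → 1 / (G.diam : ℝ) ^ 2 + ε ≤ c₁ → ∀ η, IsPerfectMatchingFn η →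
      ∀ (θ L : ℝ) (t : ℕ), mixedAt (starMatrix G η ε) (starPi G ε) θ t →
        t * (1 / (G.diam : ℝ) ^ 2 + ε) ≤ L → c₁ * exp (-(2 * L / c₁)) ≤ 4 * θ ^ 2 := by
  obtain ⟨K, q, hKq⟩ := exists_moderate_growth C d
  refine ⟨1 / (16 * ((K + 1) * 8 ^ q)), by positivity, ?_⟩
  rintro V _ _ G _ ⟨hG, hreg, ht, hball⟩ hD ε hε hs η hη θ L t hmix htL
  set c₁ : ℝ := 1 / (16 * ((K + 1) * 8 ^ q)) with hc₁
  have hc0 : 0 < c₁ := by positivity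
  have hQ := starMatrix_symStoch hΔ hreg hη hε
  obtain ⟨o⟩ := hG.nonempty
  have hN := card_cast_pos o
  set N : ℝ := (Fintype.card V : ℝ) with hNdef
  obtain ⟨z, hz⟩ := exists_dist_eq_diam_from hG ht o
  have hdiam : ∀ x y, G.dist x y ≤ G.diam := dist_le_diam_of_connected hG
  set D := G.diam with hDdef
  have hD0 : (0 : ℝ) < D := by exact_mod_cast (by omega : 0 < D)
  set s : ℝ := 1 / (D : ℝ) ^ 2 + ε with hsdef
  have hs0 : 0 < s := by positivity
  have hvol : ∀ x, 16 * c₁ * N ≤ β(G, x, D / 4) := by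
    intro x
    have h1 := hKq V G hG ht x (hball x) D (D / 4) (hdiam x) (by omega) (by omega)
    rw [Nat.card_eq_fintype_card] at h1
    have h2 : D ^ q ≤ 8 ^ q * (D / 4) ^ q := by
      rw [← mul_pow]; exact Nat.pow_le_pow_left (by omega) q
    set b := β(G, x, D / 4)
    have h3 : 0 < (D / 4) ^ q := pow_pos (by omega) q
    have h4 : Fintype.card V ≤ (K + 1) * 8 ^ q * b := by
      refine Nat.le_of_mul_le_mul_right (h1.trans ?_) h3
      calc K * D ^ q * b ≤ (K + 1) * (8 ^ q * (D / 4) ^ q) * b := by gcongr; omega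
        _ = _ := by ring
    have h5 : N ≤ ((K : ℝ) + 1) * 8 ^ q * b := by rw [hNdef]; exact_mod_cast h4
    rw [hc₁]
    calc 16 * (1 / (16 * (((K : ℝ) + 1) * 8 ^ q))) * N = N / (((K : ℝ) + 1) * 8 ^ q) := by
          field_simp
      _ ≤ b := by rw [div_le_iff₀ (by positivity)]; linarith
  set μ : ℝ := (∑ y, (G.dist o y : ℝ)) / N with hμ
  have hμ0 : 0 ≤ μ := by positivity
  have hμD : μ ≤ D := by
    rw [hμ, div_le_iff₀ hN]
    refine (sum_le_sum fun y _ => (by exact_mod_cast hdiam o y :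
      (G.dist o y : ℝ) ≤ D)).trans (le_of_eq ?_)
    rw [sum_const, card_univ, nsmul_eq_mul, mul_comm]
  set f : V → ℝ := fun y => (G.dist o y : ℝ) - μ with hf
  have hfsum : ∑ y, f y = 0 := by
    rw [hf, sum_sub_distrib, sum_const, card_univ, nsmul_eq_mul, ← hNdef, hμ]
    field_simp
    ring
  have hfD : ∀ y, |f y| ≤ D := by
    intro y
    have h1 : (G.dist o y : ℝ) ≤ D := by exact_mod_cast hdiam o y
    have h2 : (0 : ℝ) ≤ G.dist o y := Nat.cast_nonneg _
    rw [abs_le]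
    constructor <;> simp only [hf] <;> linarith
  have hvar : c₁ * N * (D : ℝ) ^ 2 ≤ f ⬝ᵥ f := by
    have h1 := le_variance_dist hG hz hvol (μ := μ)
    have h2 : f ⬝ᵥ f = ∑ y, ((G.dist o y : ℝ) - μ) ^ 2 := sum_congr rfl fun y _ => (sq _).symm
    rw [h2]
    linarith
  have henergy : ∑ x, ∑ y, starMatrix G η ε x y * (f x - f y) ^ 2 ≤ N * (1 + ε * (D : ℝ) ^ 2) := by
    refine star_energy_le hΔ hreg η hε (fun x y h => ?_) (fun x y => ?_)
    · have h1 : (G.dist o x : ℝ) ≤ G.dist o y + 1 := by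
        have := hG.dist_triangle (u := o) (v := y) (w := x)
        rw [SimpleGraph.dist_eq_one_iff_adj.2 h.symm] at this
        exact_mod_cast this
      have h2 : (G.dist o y : ℝ) ≤ G.dist o x + 1 := by
        have := hG.dist_triangle (u := o) (v := x) (w := y)
        rw [SimpleGraph.dist_eq_one_iff_adj.2 h] at this
        exact_mod_cast this
      rw [sq_le_one_iff_abs_le_one, abs_le]
      constructor <;> simp only [hf] <;> linarith
    · have h1 : (G.dist o x : ℝ) ≤ D := by exact_mod_cast hdiam o x
      have h2 : (G.dist o y : ℝ) ≤ D := by exact_mod_cast hdiam o y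
      have h3 : (0 : ℝ) ≤ G.dist o x := Nat.cast_nonneg _
      have h4 : (0 : ℝ) ≤ G.dist o y := Nat.cast_nonneg _
      refine sq_le_sq' ?_ ?_ <;> simp only [hf] <;> linarith
  rw [hQ.energy_eq f] at henergy
  have hsD : N * (1 + ε * (D : ℝ) ^ 2) = s * (N * (D : ℝ) ^ 2) := by rw [hsdef]; field_simp
  set u : ℝ := s / (2 * c₁) with hu
  have hu0 : 0 < u := by positivity
  have hu1 : u ≤ 1 / 2 := by rw [hu, div_le_iff₀ (by positivity)]; linarith
  have hlam : (1 - u) * (f ⬝ᵥ f) ≤ f ⬝ᵥ (starMatrix G η ε *ᵥ f) := by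
    have h1 : s * (N * (D : ℝ) ^ 2) ≤ 2 * u * (f ⬝ᵥ f) := by
      calc s * (N * (D : ℝ) ^ 2) = 2 * u * (c₁ * N * (D : ℝ) ^ 2) := by rw [hu]; field_simp
        _ ≤ _ := by gcongr
    linarith
  have hpow := hQ.norm_pow_ge f (by linarith) hlam t
  have hcoord : ∀ x, |((starMatrix G η ε ^ t) *ᵥ f) x| ≤ 2 * θ * D := by
    intro x
    have h1 : ((starMatrix G η ε ^ t) *ᵥ f) x =
        ∑ y, ((starMatrix G η ε ^ t) x y - starPi G ε y) * f y := by
      simp only [starPi_eq hreg hε, sub_mul, sum_sub_distrib, ← mul_sum, hfsum, mul_zero, sub_zero]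
      rfl
    rw [h1]
    refine (abs_sum_le_sum_abs _ _).trans ?_
    calc ∑ y, |((starMatrix G η ε ^ t) x y - starPi G ε y) * f y|
        ≤ ∑ y, |(starMatrix G η ε ^ t) x y - starPi G ε y| * D := sum_le_sum fun y _ => by
            rw [abs_mul]; exact mul_le_mul_of_nonneg_left (hfD y) (abs_nonneg _)
      _ = (∑ y, |(starMatrix G η ε ^ t) x y - starPi G ε y|) * D := by rw [sum_mul]
      _ ≤ 2 * θ * D := mul_le_mul_of_nonneg_right (by linarith [hmix x]) hD0.le
  have hnorm : ((starMatrix G η ε ^ t) *ᵥ f) ⬝ᵥ ((starMatrix G η ε ^ t) *ᵥ f) ≤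
      N * (2 * θ * D) ^ 2 := by
    refine (sum_le_sum fun x _ => ?_).trans (le_of_eq (by rw [sum_const, card_univ, nsmul_eq_mul]))
    rw [← sq, ← sq_abs]
    exact pow_le_pow_left₀ (abs_nonneg _) (hcoord x) 2
  have hexp : exp (-(2 * L / c₁)) ≤ (1 - u) ^ (2 * t) := by
    have h1 : exp (-(2 * u)) ≤ 1 - u := by
      rw [exp_neg, inv_le_comm₀ (exp_pos _) (by linarith)]
      refine le_trans ?_ (add_one_le_exp (2 * u))
      rw [inv_le_iff_one_le_mul₀ (by linarith)]
      nlinarith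
    calc exp (-(2 * L / c₁)) ≤ exp (((2 * t : ℕ) : ℝ) * -(2 * u)) := by
          refine exp_le_exp.2 ?_
          have : ((2 * t : ℕ) : ℝ) * -(2 * u) = -(2 * (t * s) / c₁) := by
            rw [hu]; push_cast; field_simp
          rw [this]
          gcongr
      _ = exp (-(2 * u)) ^ (2 * t) := exp_nat_mul _ _
      _ ≤ _ := pow_le_pow_left₀ (exp_pos _).le h1 _
  have hND : 0 < N * (D : ℝ) ^ 2 := by positivity
  refine le_of_mul_le_mul_right ?_ hND
  calc c₁ * exp (-(2 * L / c₁)) * (N * (D : ℝ) ^ 2)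
      = exp (-(2 * L / c₁)) * (c₁ * N * (D : ℝ) ^ 2) := by ring
    _ ≤ (1 - u) ^ (2 * t) * (f ⬝ᵥ f) := by
        gcongr
        exact pow_nonneg (by linarith) _
    _ ≤ N * (2 * θ * D) ^ 2 := hpow.trans hnorm
    _ = _ := by ring

lemma matchings_nonempty (V : Type) [Fintype V] [DecidableEq V] (h : Even (Fintype.card V)) :
    (matchings V).Nonempty := by
  obtain ⟨m, hm⟩ := h
  have e : V ≃ Fin m ⊕ Fin m := Fintype.equivOfCardEq (by simp [hm])
  refine ⟨fun x => e.symm (e x).swap, mem_matchings.2 ⟨fun x => by simp, fun x hx => ?_⟩⟩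
  have h1 : (e x).swap = e x := e.symm_apply_eq.1 hx
  rcases hex : e x with i | i <;> rw [hex] at h1 <;> simp at h1

lemma tendsto_matchingProb (V : ℕ → Type) [∀ n, Fintype (V n)] [∀ n, DecidableEq (V n)]
    (heven : ∀ n, Even (Fintype.card (V n)))
    (hcard : Tendsto (fun n => Fintype.card (V n)) atTop atTop) (E : ∀ n, (V n → V n) → Prop)
    (h : ∀ᶠ n in atTop, ∃ F : (V n → V n) → Prop, (∀ η, IsPerfectMatchingFn η → F η → E n η) ∧
      (((matchings (V n)).filter fun η => ¬ F η).card : ℝ) * Fintype.card (V n) ≤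
        (matchings (V n)).card) :
    Tendsto (fun n => matchingProb (V n) (E n)) atTop (nhds 1) := by
  have h1 : Tendsto (fun n => 1 - 1 / (Fintype.card (V n) : ℝ)) atTop (nhds 1) := by
    have := (tendsto_const_div_atTop_nhds_zero_nat (1 : ℝ)).comp hcard
    simpa using this.const_sub 1
  have hM : ∀ n, (Nat.card {η : V n → V n // IsPerfectMatchingFn η} : ℝ) =
      (matchings (V n)).card := fun n => by
    rw [Nat.subtype_card (matchings (V n)) fun η => mem_matchings]
  have hE : ∀ n, (Nat.card {η : V n → V n // IsPerfectMatchingFn η ∧ E n η} : ℝ) =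
      ((matchings (V n)).filter (E n)).card := fun n => by
    rw [Nat.subtype_card ((matchings (V n)).filter (E n)) fun η => by
      rw [mem_filter, mem_matchings]]
  have hpos : ∀ n, (0 : ℝ) < (matchings (V n)).card := fun n => by
    exact_mod_cast (matchings_nonempty (V n) (heven n)).card_pos
  refine tendsto_of_tendsto_of_tendsto_of_le_of_le' h1 tendsto_const_nhds ?_
    (Eventually.of_forall fun n => ?_)
  · filter_upwards [h, hcard.eventually_ge_atTop 1] with n hn hN
    obtain ⟨F, hF, hbad⟩ := hn
    have hN0 : (0 : ℝ) < Fintype.card (V n) := by exact_mod_cast hN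
    rw [matchingProb, hM, hE, le_div_iff₀ (hpos n)]
    have hsub : ((matchings (V n)).filter F).card ≤ ((matchings (V n)).filter (E n)).card :=
      card_le_card fun η hη => by
        rw [mem_filter] at hη ⊢
        exact ⟨hη.1, hF η (mem_matchings.1 hη.1) hη.2⟩
    have hsplit := card_filter_add_card_filter_not (s := matchings (V n)) F
    have hsplit' : (((matchings (V n)).filter F).card : ℝ) +
        ((matchings (V n)).filter fun η => ¬ F η).card = (matchings (V n)).card := by
      exact_mod_cast hsplit
    have hsub' : (((matchings (V n)).filter F).card : ℝ) ≤
        ((matchings (V n)).filter (E n)).card := by exact_mod_cast hsub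
    rw [← le_div_iff₀ hN0] at hbad
    rw [sub_mul, one_mul, div_mul_eq_mul_div, one_mul]
    linarith
  · rw [matchingProb, hM, hE, div_le_one (hpos n)]
    exact_mod_cast card_filter_le _ _

variable {Q : Matrix V V ℝ} {stat : V → ℝ}

lemma tmix_le {θ θ' : ℝ} {t : ℕ} (h : mixedAt Q stat θ t) (hθ : θ ≤ θ') : tmix Q stat θ' ≤ t :=
  Nat.sInf_le fun x => (h x).trans hθ

lemma mixedAt_tmix {θ : ℝ} (h : ∃ t, mixedAt Q stat θ t) : mixedAt Q stat θ (tmix Q stat θ) :=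
  Nat.sInf_mem h

lemma exists_mixedAt_of_geometric {κ : ℝ} (hκ : 0 < κ) {T : ℕ}
    (h : ∀ m, mixedAt Q stat ((1 - κ) ^ m) (T * m)) {θ : ℝ} (hθ : 0 < θ) :
    ∃ t, mixedAt Q stat θ t := by
  obtain ⟨m, hm⟩ := exists_pow_lt_of_lt_one hθ (by linarith : 1 - κ < 1)
  exact ⟨T * m, fun x => (h m x).trans hm.le⟩

lemma eval_le_ceil_mul_pow (p : Polynomial ℝ) (r : ℕ) :
    p.eval (r : ℝ) ≤ (⌈∑ i ∈ range (p.natDegree + 1), |p.coeff i|⌉₊ + 1 : ℕ) *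
      ((r : ℝ) + 1) ^ p.natDegree := by
  rw [Polynomial.eval_eq_sum_range]
  calc ∑ i ∈ range (p.natDegree + 1), p.coeff i * (r : ℝ) ^ i
      ≤ ∑ i ∈ range (p.natDegree + 1), |p.coeff i| * ((r : ℝ) + 1) ^ p.natDegree := by
        refine sum_le_sum fun i hi => ?_
        have h0 : (0 : ℝ) ≤ r := Nat.cast_nonneg r
        have h1 : (r : ℝ) ^ i ≤ ((r : ℝ) + 1) ^ p.natDegree :=
          (pow_le_pow_left₀ h0 (by linarith) i).trans
            (pow_le_pow_right₀ (by linarith) (by rw [mem_range] at hi; omega))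
        exact mul_le_mul (le_abs_self _) h1 (by positivity) (abs_nonneg _)
    _ = (∑ i ∈ range (p.natDegree + 1), |p.coeff i|) * ((r : ℝ) + 1) ^ p.natDegree := by
        rw [sum_mul]
    _ ≤ _ := by
        gcongr
        push_cast
        linarith [Nat.le_ceil (∑ i ∈ range (p.natDegree + 1), |p.coeff i|)]

lemma card_ball_zero {G : SimpleGraph V} (hG : G.Connected) (o : V) : β(G, o, 0) = 1 := by
  have : {y : V | G.dist o y ≤ 0} = {o} := by
    ext y
    simp only [Set.mem_ofPred_eq, Nat.le_zero, hG.dist_eq_zero_iff, Set.mem_singleton_iff, eq_comm]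
  rw [this, Nat.card_unique]

lemma tendsto_diam {C d : ℕ} (V : ℕ → Type) [∀ n, Fintype (V n)] (G : ∀ n, SimpleGraph (V n))
    (hconn : ∀ n, (G n).Connected) (hcard : Tendsto (fun n => Fintype.card (V n)) atTop atTop)
    (hball : ∀ n o r, β(G n, o, r) ≤ C * (r + 1) ^ d) :
    Tendsto (fun n => (G n).diam) atTop atTop := by
  refine tendsto_atTop.2 fun r => ?_
  filter_upwards [hcard.eventually_gt_atTop (C * (r + 1) ^ d)] with n hn
  obtain ⟨o⟩ := (hconn n).nonempty
  obtain ⟨x, hx⟩ := exists_dist_gt o (hball n o r) hn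
  exact hx.le.trans (dist_le_diam_of_connected (hconn n) o x)

end

end TransGrowth

open TransGrowth in
/-- For vertex-transitive graphs with polynomial growth of balls and
`ε_n ≤ |V_n|^{-a_n}` with `a_n ≍ 1`: (i) whp the walks on `(G_n*)` do not exhibit cutoff,
and (ii) if moreover `ε_n ≫ 1/diam(G_n)²` then whp `t_mix^{G_n*}(1/4) ≍ 1/ε_n`. -/
theorem stmt2 (Δ : ℕ) (p : Polynomial ℝ) (a₁ a₂ : ℝ) (ha₁ : 0 < a₁) (ha₁₂ : a₁ ≤ a₂)
    (V : ℕ → Type) [∀ n, Fintype (V n)] [∀ n, DecidableEq (V n)]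
    (G : ∀ n, SimpleGraph (V n)) [∀ n, DecidableRel (G n).Adj]
    (hconn : ∀ n, (G n).Connected)
    (htrans : ∀ n, IsVertexTransitive (G n))
    (hreg : ∀ n (x : V n), (G n).degree x = Δ)
    (heven : ∀ n, Even (Fintype.card (V n)))
    (hcard : Tendsto (fun n => Fintype.card (V n)) atTop atTop)
    (hballs : ∀ n (x : V n) (r : ℕ), 1 ≤ r →
      (Nat.card {y : V n | (G n).dist x y ≤ r} : ℝ) ≤ p.eval (r : ℝ))
    (ε : ℕ → ℝ) (hε : ∀ n, ε n ∈ Set.Ioo (0 : ℝ) 1)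
    (aseq : ℕ → ℝ) (haseq : ∀ n, aseq n ∈ Set.Icc a₁ a₂)
    (hεsmall : ∀ n, ε n ≤ (Fintype.card (V n) : ℝ) ^ (-(aseq n))) :
    (∃ θ ∈ Set.Ioo (0 : ℝ) 1, Tendsto (fun n => matchingProb (V n) (fun η =>
          2 * tmix (starMatrix (G n) η (ε n)) (starPi (G n) (ε n)) (1 - θ) ≤
            tmix (starMatrix (G n) η (ε n)) (starPi (G n) (ε n)) θ))
        atTop (nhds 1)) ∧
    (Tendsto (fun n => ε n * ((G n).diam : ℝ) ^ 2) atTop atTop → ∃ c C : ℝ, 0 < c ∧ c ≤ C ∧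
        Tendsto (fun n => matchingProb (V n) (fun η =>
            c / ε n ≤ (tmix (starMatrix (G n) η (ε n)) (starPi (G n) (ε n)) (1/4) : ℝ) ∧
            (tmix (starMatrix (G n) η (ε n)) (starPi (G n) (ε n)) (1/4) : ℝ) ≤ C / ε n))
          atTop (nhds 1)) := by
  have hΔ : 0 < Δ := by
    obtain ⟨n, hn⟩ := (hcard.eventually_ge_atTop 2).exists
    have : Nontrivial (V n) := Fintype.one_lt_card_iff_nontrivial.1 hn
    obtain ⟨x⟩ := (hconn n).nonempty
    rw [← hreg n x]
    exact (hconn n).preconnected.degree_pos_of_nontrivial x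
  set C : ℕ := ⌈∑ i ∈ Finset.range (p.natDegree + 1), |p.coeff i|⌉₊ + 1 with hC
  have hball : ∀ n (o : V n) r,
      Nat.card {y : V n | (G n).dist o y ≤ r} ≤ C * (r + 1) ^ p.natDegree := by
    intro n o r
    rcases Nat.eq_zero_or_pos r with rfl | hr
    · rw [card_ball_zero (hconn n), zero_add, one_pow, mul_one]; omega
    · exact_mod_cast (hballs n o r hr).trans (eval_le_ceil_mul_pow p r)
  have hpg (n) : TransPoly Δ C p.natDegree (G n) := ⟨hconn n, hreg n, htrans n, hball n⟩
  obtain ⟨κ, K, hκ0, hκ1, hK, hupper⟩ := exists_mixing_upper hΔ C p.natDegree ha₁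
  obtain ⟨C₁, B, hC₁, hB, hdiff⟩ := exists_diffusive_bound hΔ C p.natDegree
  obtain ⟨c₁, hc₁, hlower⟩ := exists_mixing_lower hΔ C p.natDegree
  have hdiam := tendsto_diam V G hconn hcard hball
  have hεle : ∀ᶠ n in atTop, ε n ≤ (Fintype.card (V n) : ℝ) ^ (-a₁) := by
    filter_upwards [hcard.eventually_ge_atTop 1] with n hn
    exact (hεsmall n).trans (Real.rpow_le_rpow_of_exponent_le (by exact_mod_cast hn)
      (neg_le_neg (haseq n).1))
  have hε0 : Tendsto ε atTop (nhds 0) :=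
    squeeze_zero' (Eventually.of_forall fun n => (hε n).1.le) hεle
      ((tendsto_rpow_neg_atTop ha₁).comp (tendsto_natCast_atTop_atTop.comp hcard))
  have hs : ∀ᶠ n in atTop, 1 / ((G n).diam : ℝ) ^ 2 + ε n ≤ c₁ := by
    have h1 : Tendsto (fun n => 1 / ((G n).diam : ℝ) ^ 2) atTop (nhds 0) := by
      simp only [one_div]
      exact tendsto_inv_atTop_zero.comp
        ((tendsto_pow_atTop two_ne_zero).comp (tendsto_natCast_atTop_atTop.comp hdiam))
    have h2 := h1.add hε0
    rw [add_zero] at h2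
    exact h2.eventually_le_const hc₁
  constructor
  · set K₃ : ℝ := B + 1 + (K * B + K) with hK₃
    set w : ℝ := c₁ * Real.exp (-(2 * (2 * K₃) / c₁)) with hw
    have hw0 : 0 < w := by positivity
    set θ₀ : ℝ := Real.exp (-1) / C₁ with hθ₀
    have hθ₀0 : 0 < θ₀ := div_pos (Real.exp_pos _) (by linarith)
    obtain ⟨θ, hθ0, hθκ, hθθ₀, hθ1, hθw⟩ : ∃ θ : ℝ, 0 < θ ∧ θ ≤ κ ∧ θ ≤ θ₀ ∧ θ < 1 ∧
        4 * θ ^ 2 < w := by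
      have hm : 0 < min (min κ θ₀) (min (1 / 2) (w / 8)) := by positivity
      refine ⟨_, hm, (min_le_left _ _).trans (min_le_left _ _),
        (min_le_left _ _).trans (min_le_right _ _), ?_, ?_⟩
      · linarith [(min_le_right (min κ θ₀) _).trans (min_le_left (1 / 2 : ℝ) (w / 8))]
      · have h1 := (min_le_right (min κ θ₀) _).trans (min_le_left (1 / 2 : ℝ) (w / 8))
        have h2 := (min_le_right (min κ θ₀) _).trans (min_le_right (1 / 2 : ℝ) (w / 8))
        nlinarith
    refine ⟨θ, ⟨hθ0, hθ1⟩, tendsto_matchingProb V heven hcard _ ?_⟩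
    filter_upwards [hcard.eventually hupper, hεle, hs, hdiam.eventually_ge_atTop 4] with n h1 h2 h3 h4
    obtain ⟨T, hTε, hbad⟩ := h1 (V n) (G n) (hpg n) rfl (ε n) (hε n).1 (hε n).2 h2
    refine ⟨_, fun η hη hF => ?_, hbad⟩
    have hD0 : (0 : ℝ) < (G n).diam := by exact_mod_cast (by omega : 0 < (G n).diam)
    have hε1 := (hε n).1
    obtain ⟨t₁, hmix, ht₁⟩ : ∃ t₁ : ℕ, mixedAt (starMatrix (G n) η (ε n)) (starPi (G n) (ε n))
        (1 - θ) t₁ ∧ t₁ * (1 / ((G n).diam : ℝ) ^ 2 + ε n) ≤ K₃ := by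
      rcases le_or_gt (((B * (G n).diam ^ 2 : ℕ) : ℝ) * ε n) 1 with h | h
      · refine ⟨B * (G n).diam ^ 2, fun x => (mixedAt_of_diffusive hΔ (hreg n) hη hε1 h hC₁
          (hdiff (V n) (G n) (hpg n) (by omega)) x).trans
          (by linarith), ?_⟩
        rw [mul_add]
        have e1 : ((B * (G n).diam ^ 2 : ℕ) : ℝ) * (1 / ((G n).diam : ℝ) ^ 2) = B := by
          push_cast; field_simp
        have : 0 ≤ K * B + K := by positivity
        linarith
      · refine ⟨T, fun x => ?_, ?_⟩
        · have := hF 1 x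
          rw [pow_one, mul_one] at this
          linarith
        · have e1 : 1 / ((G n).diam : ℝ) ^ 2 ≤ B * ε n := by
            rw [div_le_iff₀ (by positivity)]
            push_cast at h
            linarith
          calc (T : ℝ) * (1 / ((G n).diam : ℝ) ^ 2 + ε n) ≤ T * (B * ε n + ε n) := by gcongr
            _ = T * ε n * B + T * ε n := by ring
            _ ≤ K * B + K := by gcongr
            _ ≤ K₃ := by rw [hK₃]; linarith [Nat.cast_nonneg (α := ℝ) B]
    have hτ₁ := tmix_le hmix le_rfl
    have hτ := mixedAt_tmix (exists_mixedAt_of_geometric hκ0 hF hθ0)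
    by_contra! hcon
    have hlt : tmix (starMatrix (G n) η (ε n)) (starPi (G n) (ε n)) θ ≤ 2 * t₁ := by omega
    have := hlower (V n) (G n) (hpg n) h4 (ε n) hε1 h3 η hη θ (2 * K₃) _ hτ (by
        calc _ ≤ ((2 * t₁ : ℕ) : ℝ) * (1 / ((G n).diam : ℝ) ^ 2 + ε n) := by gcongr
          _ ≤ 2 * K₃ := by push_cast; linarith)
    linarith
  · intro hεD
    obtain ⟨m, hm⟩ := exists_pow_lt_of_lt_one (by norm_num : (0 : ℝ) < 1 / 4)
      (by linarith : 1 - κ < 1)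
    set w : ℝ := c₁ * Real.exp (-(2 * 1 / c₁)) with hw
    have hw0 : 0 < w := by positivity
    obtain ⟨M, hM⟩ := exists_pow_lt_of_lt_one (by positivity : 0 < w / 4)
      (by norm_num : (1 / 2 : ℝ) < 1)
    refine ⟨1 / (2 * (M + 1)), max (K * m) (1 / (2 * (M + 1))), by positivity, le_max_right _ _,
      tendsto_matchingProb V heven hcard _ ?_⟩
    filter_upwards [hcard.eventually hupper, hεle, hs, hdiam.eventually_ge_atTop 4,
      hεD.eventually_ge_atTop 1] with n h1 h2 h3 h4 h5
    obtain ⟨T, hTε, hbad⟩ := h1 (V n) (G n) (hpg n) rfl (ε n) (hε n).1 (hε n).2 h2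
    refine ⟨_, fun η hη hF => ?_, hbad⟩
    have hD0 : (0 : ℝ) < (G n).diam := by exact_mod_cast (by omega : 0 < (G n).diam)
    have hε1 := (hε n).1
    have hτ := mixedAt_tmix (exists_mixedAt_of_geometric hκ0 hF (by norm_num : (0 : ℝ) < 1 / 4))
    have hτle := tmix_le (hF m) hm.le
    set τ := tmix (starMatrix (G n) η (ε n)) (starPi (G n) (ε n)) (1 / 4)
    constructor
    · rw [div_le_iff₀ hε1]
      by_contra! hcon
      have hmix : mixedAt (starMatrix (G n) η (ε n)) (starPi (G n) (ε n)) ((1 / 2) ^ (M + 1))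
          (τ * (M + 1)) := by
        intro x
        simp only [starPi_eq (hreg n) hε1]
        refine tv_le_half_pow (starMatrix_symStoch hΔ (hreg n) hη hε1) (fun x => ?_) (M + 1) x
        simpa only [starPi_eq (hreg n) hε1] using hτ x
      have e1 : 1 / ((G n).diam : ℝ) ^ 2 ≤ ε n := by rwa [div_le_iff₀ (by positivity)]
      have := hlower (V n) (G n) (hpg n) h4 (ε n) hε1 h3 η hη _ 1 _ hmix (by
          calc ((τ * (M + 1) : ℕ) : ℝ) * (1 / ((G n).diam : ℝ) ^ 2 + ε n)
              ≤ ((τ * (M + 1) : ℕ) : ℝ) * (ε n + ε n) := by gcongr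
            _ = τ * ε n * (2 * (M + 1)) := by push_cast; ring
            _ ≤ 1 / (2 * (M + 1)) * (2 * (M + 1)) := by gcongr
            _ = 1 := by field_simp)
      have e2 : ((1 / 2 : ℝ) ^ (M + 1)) ^ 2 ≤ (1 / 2) ^ M := by
        rw [← pow_mul]
        exact pow_le_pow_of_le_one (by norm_num) (by norm_num) (by omega)
      linarith
    · rw [le_div_iff₀ hε1]
      calc (τ : ℝ) * ε n ≤ ((T * m : ℕ) : ℝ) * ε n := by gcongr
        _ = T * ε n * m := by push_cast; ring
        _ ≤ K * m := by gcongr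
        _ ≤ _ := le_max_left _ _
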